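/- Let n > 8, let S̃_n be Schur's double cover of S_n with projection π, and let g ∈ S̃_n with k = k(g) the order of π(g). Assume that 3 is NOT a solitary part of the cycle type of π(g) and that 5 is NOT a solitary part of the cycle type of π(g). Then for every irreducible spin representation (ρ, V) of S̃_n, the minimal polynomial of ρ(g) equals X^k − ε_g; in particular ρ(g) has exactly k distinct eigenvalues. -/

import Mathlib

/-!
Schur's double cover `S̃_N` of the symmetric group, presented by generators
`z, t_1, …, t_{N-1}` and relations `z² = 1`, `t_i² = z`, `(t_i t_{i+1})³ = z`,
`(t_i t_j)² = z` for `|i − j| ≥ 2`.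

Generators are indexed by `Option (Fin (N-1))`: `none` is the central element `z`
and `some i` is `t_{i+1}` (so `some i` for `i = 0, …, N-2` are `t_1, …, t_{N-1}`).
-/

abbrev SchurGen (N : ℕ) := Option (Fin (N - 1))

namespace Schur

/-- The relator `z` as an element of the free group. -/
def zf (N : ℕ) : FreeGroup (SchurGen N) := FreeGroup.of none

/-- The generator `t_{i+1}` as an element of the free group. -/
def tf (N : ℕ) (i : Fin (N - 1)) : FreeGroup (SchurGen N) := FreeGroup.of (some i)

/-- The defining relators of Schur's double cover. -/
def rels (N : ℕ) : Set (FreeGroup (SchurGen N)) :=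
  { r | r = zf N ^ 2 ∨
        (∃ i, r = tf N i ^ 2 * (zf N)⁻¹) ∨
        (∃ i j : Fin (N - 1), (i : ℕ) + 1 = (j : ℕ) ∧
          r = (tf N i * tf N j) ^ 3 * (zf N)⁻¹) ∨
        (∃ i j : Fin (N - 1), ((i : ℕ) + 2 ≤ (j : ℕ) ∨ (j : ℕ) + 2 ≤ (i : ℕ)) ∧
          r = (tf N i * tf N j) ^ 2 * (zf N)⁻¹) }

/-- Schur's double cover `S̃_N` of the symmetric group `S_N`. -/
abbrev Cover (N : ℕ) := PresentedGroup (rels N)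

/-- The central element `z` of `S̃_N`. -/
def z (N : ℕ) : Cover N := PresentedGroup.of none

/-- The generator `t_{i+1}` of `S̃_N` (0-indexed). -/
def t (N : ℕ) (i : Fin (N - 1)) : Cover N := PresentedGroup.of (some i)

/-- The generator `t_i` of `S̃_N`, 1-indexed: meaningful for `1 ≤ i ≤ N-1`
(junk value `1` outside this range). -/
def T (N i : ℕ) : Cover N := if h : i - 1 < N - 1 then t N ⟨i - 1, h⟩ else 1

/-- The product `t_a t_{a+1} ⋯ t_{a+n-1}` (`n` consecutive generators, 1-indexed). -/
def P (N a n : ℕ) : Cover N := ((List.range n).map fun j => T N (a + j)).prod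

end Schur


/-- The adjacent transposition `(i, i+1)` of `{1, …, n}`: in 0-indexed terms, for
`i : Fin (n-1)` this is the swap of `i` and `i+1` in `Fin n`.  It is the image of the
generator `t_{i+1}` under the canonical projection `S̃_n → S_n`. -/
def Schur.adj (n : ℕ) (i : Fin (n - 1)) : Equiv.Perm (Fin n) :=
  Equiv.swap ⟨i.1, by have := i.2; omega⟩ ⟨i.1 + 1, by have := i.2; omega⟩

/-- `d` is a *solitary part* of the cycle type of a permutation `σ` if exactly one cycle
of `σ` has length divisible by `d` and this cycle has length `d` (fixed points count as
cycles of length 1; for `d = 3, 5` these never have length divisible by `d`, so Mathlib's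
`cycleType`, which omits fixed points, captures the condition). -/
def Schur.SolitaryPart (d : ℕ) {α : Type*} [Fintype α] [DecidableEq α]
    (σ : Equiv.Perm α) : Prop :=
  σ.cycleType.filter (fun l => d ∣ l) = {d}

open Equiv Module

/-- Two elements agree up to sign. -/
def SignEq {A : Type*} [AddCommGroup A] [Module ℂ A] (a b : A) : Prop :=
  ∃ s : ℂ, s * s = 1 ∧ a = s • b

namespace SignEq

section
variable {A : Type*} [AddCommGroup A] [Module ℂ A] {a b c : A}

theorem refl (a : A) : SignEq a a := ⟨1, by simp, by simp⟩

theorem symm (h : SignEq a b) : SignEq b a := by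
  obtain ⟨s, hs, rfl⟩ := h
  exact ⟨s, hs, by rw [smul_smul, hs, one_smul]⟩

theorem trans (h : SignEq a b) (h' : SignEq b c) : SignEq a c := by
  obtain ⟨s, hs, rfl⟩ := h
  obtain ⟨t, ht, rfl⟩ := h'
  exact ⟨s * t, by linear_combination t * t * hs + ht, by rw [smul_smul]⟩

theorem neg (a : A) : SignEq (-a) a := ⟨-1, by simp, by simp⟩

theorem of_or (h : a = b ∨ a = -b) : SignEq a b := by
  rcases h with rfl | rfl
  exacts [refl _, neg _]

theorem or (h : SignEq a b) : a = b ∨ a = -b := by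
  obtain ⟨s, hs, rfl⟩ := h
  rcases mul_self_eq_one_iff.1 hs with rfl | rfl <;> simp

end

variable {A : Type*} [Ring A] [Algebra ℂ A] {a b c d : A}

theorem mul (h : SignEq a b) (h' : SignEq c d) : SignEq (a * c) (b * d) := by
  obtain ⟨s, hs, rfl⟩ := h
  obtain ⟨t, ht, rfl⟩ := h'
  exact ⟨s * t, by linear_combination t * t * hs + ht, by rw [smul_mul_smul_comm]⟩

/-- Elements of odd order which agree up to sign are equal. -/
theorem eq_of_pow (h : SignEq a b) {k : ℕ} (hk : Odd k) (ha : a ^ k = 1) (hb : b ^ k = 1) :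
    a = b := by
  rcases h.or with rfl | rfl
  · rfl
  · rw [hk.neg_pow, hb] at ha
    have h1 : (1 : A) = 0 := by
      have : (2 : ℂ) • (1 : A) = 0 := by
        rw [two_smul]; nth_rewrite 1 [← ha]; simp
      simpa using this
    calc -b = -b * 1 := by simp
      _ = b * 1 := by rw [h1]; simp
      _ = b := by simp

end SignEq

/-- A spin representation of the symmetric group on `α`: a projective representation with signs,
with the lifts of elements of odd order normalised to have the same odd order. -/
structure SpinRep (α : Type) [DecidableEq α] [Fintype α] (V : Type) [AddCommGroup V]
    [Module ℂ V] where
  op : Perm α → End ℂ V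
  op_one : op 1 = 1
  op_mul : ∀ σ τ, SignEq (op (σ * τ)) (op σ * op τ)
  op_pow_orderOf : ∀ σ, Odd (orderOf σ) → op σ ^ orderOf σ = 1
  op_swap_sq : ∀ a b, a ≠ b → op (swap a b) * op (swap a b) = -1
  op_swap_anti : ∀ a b c d, a ≠ b → c ≠ d → a ≠ c → a ≠ d → b ≠ c → b ≠ d →
    op (swap a b) * op (swap c d) = -(op (swap c d) * op (swap a b))

namespace SpinRep

variable {α : Type} [DecidableEq α] [Fintype α] {V : Type} [AddCommGroup V] [Module ℂ V]
variable (R : SpinRep α V)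

theorem op_mul' (σ τ : Perm α) : SignEq (R.op σ * R.op τ) (R.op (σ * τ)) := (R.op_mul σ τ).symm

theorem op_pow (σ : Perm α) (n : ℕ) : SignEq (R.op (σ ^ n)) (R.op σ ^ n) := by
  induction n with
  | zero => simp only [pow_zero, R.op_one]; exact SignEq.refl _
  | succ n ih =>
    rw [pow_succ, pow_succ]
    exact (R.op_mul _ _).trans (ih.mul (SignEq.refl _))

theorem op_mul_inv (σ : Perm α) : SignEq (R.op σ * R.op σ⁻¹) 1 := by
  simpa [R.op_one] using R.op_mul' σ σ⁻¹

theorem isUnit_op (σ : Perm α) : IsUnit (R.op σ) := by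
  obtain ⟨s, hs, h⟩ := R.op_mul_inv σ
  obtain ⟨t, ht, h'⟩ := R.op_mul_inv σ⁻¹
  rw [inv_inv] at h'
  rw [isUnit_iff_exists_and_exists]
  refine ⟨⟨s • R.op σ⁻¹, ?_⟩, ⟨t • R.op σ⁻¹, ?_⟩⟩
  · rw [mul_smul_comm, h, smul_smul, hs, one_smul]
  · rw [smul_mul_assoc, h', smul_smul, ht, one_smul]

theorem op_injective (σ : Perm α) : Function.Injective (R.op σ) := by
  obtain ⟨u, hu⟩ := R.isUnit_op σ
  rw [← hu]
  intro x y hxy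
  have := congrArg (↑u⁻¹ : End ℂ V) hxy
  rwa [← End.mul_apply, ← End.mul_apply, u.inv_mul] at this

theorem op_pow_eq_one {σ : Perm α} {k : ℕ} (hk : Odd k) (h : σ ^ k = 1) : R.op σ ^ k = 1 := by
  obtain ⟨m, rfl⟩ := orderOf_dvd_of_pow_eq_one h
  rw [pow_mul, R.op_pow_orderOf _ (Nat.Odd.of_mul_left hk), one_pow]

theorem op_eq_of_signEq {σ : Perm α} {k : ℕ} (hk : Odd k) (h : σ ^ k = 1) {A : End ℂ V}
    (hA : A ^ k = 1) (h' : SignEq (R.op σ) A) : R.op σ = A :=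
  h'.eq_of_pow hk (R.op_pow_eq_one hk h) hA

theorem op_pow_of_odd {σ : Perm α} {k : ℕ} (hk : Odd k) (h : σ ^ k = 1) (n : ℕ) :
    R.op (σ ^ n) = R.op σ ^ n := by
  refine R.op_eq_of_signEq hk ?_ ?_ (R.op_pow σ n)
  · rw [← pow_mul, mul_comm, pow_mul, h, one_pow]
  · rw [← pow_mul, mul_comm, pow_mul, R.op_pow_eq_one hk h, one_pow]

theorem op_conj {σ : Perm α} {k : ℕ} (hk : Odd k) (h : σ ^ k = 1) (τ : Perm α) :
    R.op τ * R.op σ = R.op (τ * σ * τ⁻¹) * R.op τ := by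
  have h2 : (τ * σ * τ⁻¹) ^ k = 1 := by rw [conj_pow, h]; simp
  obtain ⟨u, hu⟩ := R.isUnit_op τ
  have h1 : SignEq (R.op (τ * σ * τ⁻¹)) (↑u * R.op σ * (↑u⁻¹ : End ℂ V)) := by
    have h3 : SignEq (R.op (τ * σ * τ⁻¹) * R.op τ) (R.op τ * R.op σ) := by
      refine (R.op_mul' _ _).trans ?_
      simpa using R.op_mul τ σ
    simpa [← hu, mul_assoc] using h3.mul (SignEq.refl (↑u⁻¹ : End ℂ V))
  have h4 : ((u : End ℂ V) * R.op σ * (↑u⁻¹ : End ℂ V)) ^ k = 1 := by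
    rw [Units.conj_pow, R.op_pow_eq_one hk h]; simp
  rw [R.op_eq_of_signEq hk h2 h4 h1, ← hu]
  simp [mul_assoc]

theorem op_comm_of_odd {σ τ : Perm α} {k : ℕ} (hk : Odd k) (h : σ ^ k = 1) (hc : Commute σ τ) :
    Commute (R.op σ) (R.op τ) := by
  have := R.op_conj hk h τ
  rw [← hc.eq, mul_inv_cancel_right] at this
  exact this.symm

theorem op_mul_of_odd {σ τ : Perm α} {k : ℕ} (hk : Odd k) (h : σ ^ k = 1) (h' : τ ^ k = 1)
    (hc : Commute σ τ) : R.op (σ * τ) = R.op σ * R.op τ := by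
  refine R.op_eq_of_signEq hk (by rw [hc.mul_pow, h, h', one_mul]) ?_ (R.op_mul σ τ)
  rw [(R.op_comm_of_odd hk h hc).mul_pow, R.op_pow_eq_one hk h, R.op_pow_eq_one hk h', one_mul]

theorem _root_.Equiv.Perm.viaEmbedding_swap {α β : Type*} [DecidableEq α] [DecidableEq β]
    (e : β ↪ α) (a b : β) : (swap a b).viaEmbedding e = swap (e a) (e b) := by
  ext x
  by_cases hx : x ∈ Set.range e
  · obtain ⟨y, rfl⟩ := hx
    rw [Equiv.Perm.viaEmbedding_apply, e.injective.swap_apply]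
  · rw [Equiv.Perm.viaEmbedding_apply_of_notMem _ _ _ hx, swap_apply_of_ne_of_ne]
    · rintro rfl; exact hx ⟨_, rfl⟩
    · rintro rfl; exact hx ⟨_, rfl⟩

/-- Pulling back along an embedding of finite sets. -/
@[simps]
noncomputable def comap {β : Type} [DecidableEq β] [Fintype β] (e : β ↪ α) : SpinRep β V where
  op σ := R.op (σ.viaEmbedding e)
  op_one := by
    rw [← Equiv.Perm.viaEmbeddingHom_apply, map_one, R.op_one]
  op_mul σ τ := by
    simp only [← Equiv.Perm.viaEmbeddingHom_apply, map_mul]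
    exact R.op_mul _ _
  op_pow_orderOf σ h := by
    have := orderOf_injective _ (Equiv.Perm.viaEmbeddingHom_injective e) σ
    rw [← this] at h ⊢
    exact R.op_pow_orderOf _ h
  op_swap_sq a b h := by
    rw [Equiv.Perm.viaEmbedding_swap]
    exact R.op_swap_sq _ _ (by simpa)
  op_swap_anti a b c d h1 h2 h3 h4 h5 h6 := by
    simp only [Equiv.Perm.viaEmbedding_swap]
    apply R.op_swap_anti <;> simpa

/-- Restricting to an invariant subspace. -/
@[simps]
def restrict (U : Submodule ℂ V) (hU : ∀ σ, ∀ v ∈ U, R.op σ v ∈ U) : SpinRep α U where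
  op σ := (R.op σ).restrict (hU σ)
  op_one := by ext v; simp [R.op_one]
  op_mul σ τ := by
    obtain ⟨s, hs, h⟩ := R.op_mul σ τ
    exact ⟨s, hs, by ext v; simp [h]⟩
  op_pow_orderOf σ h := by
    ext v
    rw [Module.End.pow_restrict]
    simp [R.op_pow_orderOf σ h]
  op_swap_sq a b h := by
    ext v
    simpa using congrArg (· (v : V)) (R.op_swap_sq a b h)
  op_swap_anti a b c d h1 h2 h3 h4 h5 h6 := by
    ext v
    simpa using congrArg (· (v : V)) (R.op_swap_anti a b c d h1 h2 h3 h4 h5 h6)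

end SpinRep

theorem Equiv.Perm.sign_viaEmbedding {α β : Type*} [DecidableEq α] [DecidableEq β] [Fintype α]
    [Fintype β] (e : β ↪ α) (σ : Perm β) : Perm.sign (σ.viaEmbedding e) = Perm.sign σ := by
  classical
  unfold Perm.viaEmbedding
  convert Perm.sign_extendDomain σ (Equiv.ofInjective e.1 e.2)

theorem Equiv.Perm.cycleType_viaEmbedding {α β : Type*} [DecidableEq α] [DecidableEq β] [Fintype α]
    [Fintype β] (e : β ↪ α) (σ : Perm β) : (σ.viaEmbedding e).cycleType = σ.cycleType := by
  classical
  unfold Perm.viaEmbedding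
  convert Perm.cycleType_extendDomain (Equiv.ofInjective e.1 e.2)

theorem Equiv.Perm.viaEmbedding_mul {α β : Type*} (e : β ↪ α) (σ τ : Perm β) :
    (σ * τ).viaEmbedding e = σ.viaEmbedding e * τ.viaEmbedding e := by
  simp only [← Perm.viaEmbeddingHom_apply, map_mul]

theorem Equiv.Perm.viaEmbedding_inv {α β : Type*} (e : β ↪ α) (σ : Perm β) :
    (σ⁻¹).viaEmbedding e = (σ.viaEmbedding e)⁻¹ := by
  simp only [← Perm.viaEmbeddingHom_apply, map_inv]

theorem Equiv.Perm.viaEmbedding_one {α β : Type*} (e : β ↪ α) :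
    (1 : Perm β).viaEmbedding e = 1 := by
  simp only [← Perm.viaEmbeddingHom_apply, map_one]

theorem Equiv.Perm.viaEmbedding_pow {α β : Type*} (e : β ↪ α) (σ : Perm β) (n : ℕ) :
    (σ ^ n).viaEmbedding e = σ.viaEmbedding e ^ n := by
  simp only [← Perm.viaEmbeddingHom_apply, map_pow]

theorem Equiv.Perm.orderOf_viaEmbedding {α β : Type*} (e : β ↪ α) (σ : Perm β) :
    orderOf (σ.viaEmbedding e) = orderOf σ := by
  rw [← Perm.viaEmbeddingHom_apply]
  exact orderOf_injective _ (Perm.viaEmbeddingHom_injective e) σ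

theorem Equiv.Perm.viaEmbedding_commute {α β γ : Type*} (e : β ↪ α) (f : γ ↪ α)
    (h : ∀ b c, e b ≠ f c) (σ : Perm β) (τ : Perm γ) :
    Commute (σ.viaEmbedding e) (τ.viaEmbedding f) := by
  apply Perm.Disjoint.commute
  intro x
  by_cases hx : x ∈ Set.range e
  · right
    obtain ⟨b, rfl⟩ := hx
    apply Perm.viaEmbedding_apply_of_notMem
    rintro ⟨c, hc⟩
    exact h b c hc.symm
  · left
    exact Perm.viaEmbedding_apply_of_notMem _ _ _ hx

/-- The sign by which lifts of disjoint permutations of signs `a`, `b` commute. -/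
def twist (a b : ℤˣ) : ℂ := if a = -1 ∧ b = -1 then -1 else 1

theorem twist_one_left (b : ℤˣ) : twist 1 b = 1 := by
  simp [twist, show ¬ ((1 : ℤˣ) = -1) by decide]

theorem twist_one_right (b : ℤˣ) : twist b 1 = 1 := by
  simp [twist, show ¬ ((1 : ℤˣ) = -1) by decide]

theorem twist_neg : twist (-1) (-1) = -1 := by
  simp [twist]

theorem twist_mul_left (a b c : ℤˣ) : twist (a * b) c = twist a c * twist b c := by
  rcases Int.units_eq_one_or a with rfl | rfl <;> rcases Int.units_eq_one_or b with rfl | rfl <;>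
  rcases Int.units_eq_one_or c with rfl | rfl <;>
  simp [twist_one_left, twist_one_right, twist_neg]

theorem twist_mul_right (a b c : ℤˣ) : twist c (a * b) = twist c a * twist c b := by
  rcases Int.units_eq_one_or a with rfl | rfl <;> rcases Int.units_eq_one_or b with rfl | rfl <;>
  rcases Int.units_eq_one_or c with rfl | rfl <;>
  simp [twist_one_left, twist_one_right, twist_neg]

namespace SpinRep

variable {α : Type} [DecidableEq α] [Fintype α] {V : Type} [AddCommGroup V] [Module ℂ V]
variable (R : SpinRep α V)
variable {β : Type} [DecidableEq β] [Fintype β] {γ : Type} [DecidableEq γ] [Fintype γ]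

/-- Lifts of permutations supported on disjoint sets commute up to the twist by their signs. -/
theorem op_disjoint (e : β ↪ α) (f : γ ↪ α) (h : ∀ b c, e b ≠ f c) (σ : Perm β) (τ : Perm γ) :
    R.op (σ.viaEmbedding e) * R.op (τ.viaEmbedding f) =
      twist (Perm.sign σ) (Perm.sign τ) •
        (R.op (τ.viaEmbedding f) * R.op (σ.viaEmbedding e)) := by
  induction σ using Perm.swap_induction_on with
  | one => simp [Perm.viaEmbedding_one, R.op_one, twist_one_left]
  | swap_mul σ a b hab ih =>
    rw [Perm.viaEmbedding_mul]
    obtain ⟨s, -, hs⟩ := R.op_mul ((swap a b).viaEmbedding e) (σ.viaEmbedding e)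
    have key : R.op ((swap a b).viaEmbedding e) * R.op (τ.viaEmbedding f) =
        twist (-1) (Perm.sign τ) •
        (R.op (τ.viaEmbedding f) * R.op ((swap a b).viaEmbedding e)) := by
      clear ih hs
      induction τ using Perm.swap_induction_on with
      | one => simp [Perm.viaEmbedding_one, R.op_one, twist_one_right]
      | swap_mul τ c d hcd ih =>
        rw [Perm.viaEmbedding_mul]
        obtain ⟨t, -, ht⟩ := R.op_mul ((swap c d).viaEmbedding f) (τ.viaEmbedding f)
        have h0 : R.op ((swap a b).viaEmbedding e) * R.op ((swap c d).viaEmbedding f) =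
            -(R.op ((swap c d).viaEmbedding f) * R.op ((swap a b).viaEmbedding e)) := by
          simp only [Perm.viaEmbedding_swap]
          exact R.op_swap_anti _ _ _ _ (by simpa) (by simpa) (h _ _) (h _ _) (h _ _) (h _ _)
        rw [ht, Perm.sign_mul, Perm.sign_swap hcd, twist_mul_right, twist_neg]
        simp only [mul_smul_comm, smul_mul_assoc]
        rw [← mul_assoc, h0, neg_mul, mul_assoc, ih, mul_smul_comm, mul_assoc]
        module
    rw [hs, Perm.sign_mul, Perm.sign_swap hab, twist_mul_left]
    simp only [mul_smul_comm, smul_mul_assoc]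
    rw [mul_assoc, ih, mul_smul_comm, ← mul_assoc, key, smul_mul_assoc, mul_assoc]
    module

theorem op_disjoint_commute (e : β ↪ α) (f : γ ↪ α) (h : ∀ b c, e b ≠ f c) {σ : Perm β}
    (τ : Perm γ) (hσ : Perm.sign σ = 1) :
    Commute (R.op (σ.viaEmbedding e)) (R.op (τ.viaEmbedding f)) := by
  have := R.op_disjoint e f h σ τ
  rwa [hσ, twist_one_left, one_smul] at this

theorem op_disjoint_anti (e : β ↪ α) (f : γ ↪ α) (h : ∀ b c, e b ≠ f c) {σ : Perm β}
    {τ : Perm γ} (hσ : Perm.sign σ = -1) (hτ : Perm.sign τ = -1) :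
    R.op (σ.viaEmbedding e) * R.op (τ.viaEmbedding f) =
      -(R.op (τ.viaEmbedding f) * R.op (σ.viaEmbedding e)) := by
  have := R.op_disjoint e f h σ τ
  rwa [hσ, hτ, twist_neg, neg_one_smul] at this

/-- The spin representation of a smaller symmetric group on an eigenspace of an operator commuting
with it. -/
noncomputable def onEigenspace (A : End ℂ V) (h : ∀ σ, Commute A (R.op σ)) (a : ℂ) :
    SpinRep α (A.eigenspace a) :=
  R.restrict _ fun σ v hv => by
    rw [End.mem_eigenspace_iff] at hv ⊢
    rw [← End.mul_apply, (h σ).eq, End.mul_apply, hv, map_smul]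

@[simp]
theorem onEigenspace_apply (A : End ℂ V) (h : ∀ σ, Commute A (R.op σ)) (a : ℂ) (σ : Perm α)
    (v : A.eigenspace a) : (((R.onEigenspace A h a).op σ v : A.eigenspace a) : V) = R.op σ v := rfl

end SpinRep

section parts

variable {α : Type} [DecidableEq α] [Fintype α] {β : Type} [DecidableEq β] [Fintype β]

/-- All cycle lengths of a permutation, including fixed points. -/
def Equiv.Perm.parts (σ : Perm α) : Multiset ℕ :=
  σ.cycleType + Multiset.replicate (Fintype.card α - σ.support.card) 1

theorem Equiv.Perm.sum_parts (σ : Perm α) : σ.parts.sum = Fintype.card α := by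
  have := Finset.card_le_univ σ.support
  simp [Perm.parts, Perm.sum_cycleType]; omega

theorem Equiv.Perm.pos_of_mem_parts {σ : Perm α} {m : ℕ} (h : m ∈ σ.parts) : 0 < m := by
  simp only [Perm.parts, Multiset.mem_add] at h
  rcases h with h | h
  · have := Perm.two_le_of_mem_cycleType h; omega
  · rw [Multiset.eq_of_mem_replicate h]; norm_num

theorem Equiv.Perm.cycleType_eq_filter (σ : Perm α) : σ.cycleType = σ.parts.filter (2 ≤ ·) := by
  rw [Perm.parts, Multiset.filter_add, Multiset.filter_eq_self.2, Multiset.filter_eq_nil.2, add_zero]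
  · intro a ha
    rw [Multiset.eq_of_mem_replicate ha]; norm_num
  · intro a ha; exact Perm.two_le_of_mem_cycleType ha

theorem Equiv.Perm.filter_dvd_parts (σ : Perm α) {d : ℕ} (hd : 2 ≤ d) :
    σ.cycleType.filter (d ∣ ·) = σ.parts.filter (d ∣ ·) := by
  have h : (Multiset.replicate (Fintype.card α - σ.support.card) 1).filter (d ∣ ·) = 0 := by
    rw [Multiset.filter_eq_nil]
    intro a ha
    rw [Multiset.eq_of_mem_replicate ha, Nat.dvd_one]; omega
  rw [Perm.parts, Multiset.filter_add, h, add_zero]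

theorem Equiv.Perm.orderOf_eq_lcm_parts (σ : Perm α) : orderOf σ = σ.parts.lcm := by
  rw [Perm.parts, Multiset.lcm_add, Perm.lcm_cycleType]
  have : (Multiset.replicate (Fintype.card α - σ.support.card) 1).lcm ∣ 1 :=
    Multiset.lcm_dvd.2 fun b hb => by rw [Multiset.eq_of_mem_replicate hb]
  rw [Nat.dvd_one.1 this]; simp

theorem Equiv.Perm.sign_eq_parts (σ : Perm α) :
    Perm.sign σ = (-1) ^ (σ.parts.sum + σ.parts.card) := by
  rw [Perm.sign_of_cycleType, Perm.parts]
  simp only [Multiset.sum_add, Multiset.card_add, Multiset.sum_replicate, Multiset.card_replicate,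
    smul_eq_mul, mul_one]
  generalize σ.cycleType.sum = a
  generalize σ.cycleType.card = b
  generalize Fintype.card α - σ.support.card = c
  rw [show a + c + (b + c) = a + b + 2 * c by ring, pow_add _ (a + b), pow_mul]; simp

theorem Equiv.Perm.exists_equiv_of_parts_eq {σ : Perm α} {τ : Perm β} (h : σ.parts = τ.parts) :
    ∃ e : α ≃ β, σ.viaEmbedding e.toEmbedding = τ := by
  have hc : Fintype.card α = Fintype.card β := by rw [← σ.sum_parts, ← τ.sum_parts, h]
  let e := Fintype.equivOfCardEq hc
  have h1 : (σ.viaEmbedding e.toEmbedding).cycleType = τ.cycleType := by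
    rw [Perm.cycleType_viaEmbedding, Perm.cycleType_eq_filter, h, Perm.cycleType_eq_filter]
  obtain ⟨c, hc⟩ := isConj_iff.1 (Perm.isConj_iff_cycleType_eq.2 h1)
  refine ⟨e.trans c, ?_⟩
  rw [← hc]
  ext x
  obtain ⟨y, rfl⟩ := (e.trans c).surjective x
  have := Perm.viaEmbedding_apply σ (e.trans c).toEmbedding y
  simp only [Equiv.trans_apply, Function.Embedding.coeFn_mk] at this ⊢
  rw [this]
  have := Perm.viaEmbedding_apply σ e.toEmbedding y
  simp only [Equiv.coe_toEmbedding] at this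
  simp [this]

theorem Equiv.Perm.parts_viaEmbedding (e : β ↪ α) (σ : Perm β) :
    (σ.viaEmbedding e).parts =
      σ.parts + Multiset.replicate (Fintype.card α - Fintype.card β) 1 := by
  have h1 := Fintype.card_le_of_embedding e
  have h2 := Finset.card_le_univ σ.support
  rw [Perm.parts, Perm.parts, Perm.cycleType_viaEmbedding, ← Perm.sum_cycleType,
    Perm.cycleType_viaEmbedding, Perm.sum_cycleType, add_assoc, ← Multiset.replicate_add]
  congr 2
  omega

theorem Equiv.Perm.parts_mul {σ τ : Perm α} (h : σ.Disjoint τ) :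
    (σ * τ).parts = σ.cycleType + τ.cycleType +
      Multiset.replicate (Fintype.card α - σ.support.card - τ.support.card) 1 := by
  rw [Perm.parts, h.cycleType_mul, h.card_support_mul, Nat.sub_sub]

omit [DecidableEq α] [Fintype α] [DecidableEq β] [Fintype β] in
theorem Equiv.Perm.sumCongr_eq (σ : Perm α) (τ : Perm β) : sumCongr σ τ =
    σ.viaEmbedding Function.Embedding.inl * τ.viaEmbedding Function.Embedding.inr := by
  ext x
  rcases x with x | x
  · rw [Perm.mul_apply, Perm.viaEmbedding_apply_of_notMem τ _ _ (by simp)]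
    exact (Perm.viaEmbedding_apply σ (Function.Embedding.inl : α ↪ α ⊕ β) x).symm
  · have := Perm.viaEmbedding_apply τ (Function.Embedding.inr : β ↪ α ⊕ β) x
    simp only [Function.Embedding.inr_apply] at this
    rw [Perm.mul_apply, this, Perm.viaEmbedding_apply_of_notMem σ _ _ (by simp)]
    rfl

theorem Equiv.Perm.parts_sumCongr (σ : Perm α) (τ : Perm β) :
    Perm.parts (sumCongr σ τ) = σ.parts + τ.parts := by
  rw [Perm.sumCongr_eq, Perm.parts_mul]
  · simp only [Perm.parts, Perm.cycleType_viaEmbedding, ← Perm.sum_cycleType, Fintype.card_sum]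
    simp only [Perm.sum_cycleType]
    have h1 := Finset.card_le_univ σ.support
    have h2 := Finset.card_le_univ τ.support
    rw [show Fintype.card α + Fintype.card β - σ.support.card - τ.support.card =
      (Fintype.card α - σ.support.card) + (Fintype.card β - τ.support.card) by omega,
      Multiset.replicate_add]
    abel
  · intro x
    rcases x with x | x
    · right; exact Perm.viaEmbedding_apply_of_notMem τ _ _ (by simp)
    · left; exact Perm.viaEmbedding_apply_of_notMem σ _ _ (by simp)

/-- The standard cycle of length `m`. -/
def rot (m : ℕ) : Perm (ZMod m) := Equiv.addRight 1

@[simp] theorem rot_apply (m : ℕ) (x : ZMod m) : rot m x = x + 1 := rfl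

theorem parts_rot (m : ℕ) [NeZero m] : (rot m).parts = {m} := by
  rcases m with _ | _ | m
  · exact absurd rfl (NeZero.ne 0)
  · have : (rot 1) = 1 := Subsingleton.elim (α := Perm (Fin 1)) _ _
    simp [this, Perm.parts]
  · have h : rot (m + 1 + 1) = (finRotate (m + 2) : Perm (Fin (m + 2))) := by
      refine Equiv.ext fun x => ?_
      exact (finRotate_apply (n := m + 1 + 1) x).symm
    have h1 : (rot (m + 1 + 1)).cycleType = {m + 2} := by
      rw [h]; exact cycleType_finRotate (n := m)
    rw [Perm.parts, h1, ← Perm.sum_cycleType, h1]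
    simp [ZMod.card]

theorem Equiv.Perm.exists_parts_eq (M : Multiset ℕ) (h : ∀ m ∈ M, 0 < m) :
    ∃ (k : ℕ) (σ : Perm (Fin k)), σ.parts = M := by
  induction M using Multiset.induction_on with
  | empty => exact ⟨0, 1, by simp [Perm.parts]⟩
  | cons m M ih =>
    obtain ⟨k, σ, hσ⟩ := ih fun x hx => h x (Multiset.mem_cons_of_mem hx)
    have : NeZero m := ⟨(h m (Multiset.mem_cons_self m M)).ne'⟩
    let e := Fintype.equivFin (ZMod m ⊕ Fin k)
    refine ⟨_, (Perm.viaEmbedding (sumCongr (rot m) σ) e.toEmbedding), ?_⟩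
    rw [Perm.parts_viaEmbedding, Perm.parts_sumCongr, parts_rot, hσ]
    simp only [Fintype.card_fin, Nat.sub_self, Multiset.replicate_zero, add_zero,
      Multiset.singleton_add]

end parts

section spec

variable {V : Type} [AddCommGroup V] [Module ℂ V]

/-- All `k`-th roots of the scalar `A ^ k` are eigenvalues of `A`. -/
def FullSpec (A : End ℂ V) (k : ℕ) : Prop :=
  ∀ a : ℂ, A ^ k = a ^ k • (1 : End ℂ V) → A.HasEigenvalue a

/-- `A` is not scalar on any nonzero eigenspace of `A * A`. -/
def NonHomog (A : End ℂ V) : Prop :=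
  ∀ m l : ℂ, (A * A).HasEigenvalue m → ∃ v, (A * A) v = m • v ∧ A v ≠ l • v

theorem Module.End.hasEigenvalue_iff_exists {A : End ℂ V} {a : ℂ} :
    A.HasEigenvalue a ↔ ∃ v, v ≠ 0 ∧ A v = a • v := by
  constructor
  · intro h
    obtain ⟨v, hv⟩ := h.exists_hasEigenvector
    exact ⟨v, hv.2, hv.apply_eq_smul⟩
  · rintro ⟨v, hv, h⟩
    exact End.hasEigenvalue_of_hasEigenvector ⟨End.mem_eigenspace_iff.2 h, hv⟩

theorem FullSpec.signEq {A B : End ℂ V} {k : ℕ} (h : FullSpec A k) (hs : SignEq B A) :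
    FullSpec B k := by
  obtain ⟨s, hs, rfl⟩ := hs
  intro a ha
  have h1 : A ^ k = (s * a) ^ k • (1 : End ℂ V) := by
    rw [mul_pow, mul_smul, ← ha, smul_pow, smul_smul, ← mul_pow, hs, one_pow, one_smul]
  obtain ⟨v, hv, hav⟩ := End.hasEigenvalue_iff_exists.1 (h _ h1)
  refine End.hasEigenvalue_iff_exists.2 ⟨v, hv, ?_⟩
  rw [LinearMap.smul_apply, hav, smul_smul, ← mul_assoc, hs, one_mul]

theorem NonHomog.signEq {A B : End ℂ V} (h : NonHomog A) (hs : SignEq B A) : NonHomog B := by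
  obtain ⟨s, hs, rfl⟩ := hs
  intro m l hm
  rw [smul_mul_smul_comm, hs, one_smul] at hm ⊢
  obtain ⟨v, hv, hv'⟩ := h m (s * l) hm
  refine ⟨v, hv, fun h' => hv' ?_⟩
  rw [LinearMap.smul_apply] at h'
  rw [mul_smul, ← h', smul_smul, hs, one_smul]

/-- An operator anticommuting with `A` and invertible on eigenspaces of `A * A` shows that `A` is
not homogeneous. -/
theorem NonHomog.of_anti {A B : End ℂ V} (hA : IsUnit A) (hB : Function.Injective B)
    (h : A * B = -(B * A)) : NonHomog A := by
  intro m l hm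
  by_contra! hc
  obtain ⟨v, hv, hmv⟩ := End.hasEigenvalue_iff_exists.1 hm
  have h1 := hc v hmv
  have h2 : (A * A) (B v) = m • B v := by
    rw [← End.mul_apply, mul_assoc, h, mul_neg, ← mul_assoc, h, neg_mul, neg_neg, mul_assoc,
      End.mul_apply, hmv, map_smul]
  have h3 := hc _ h2
  rw [← End.mul_apply, h, LinearMap.neg_apply, End.mul_apply, h1, map_smul] at h3
  have h4 : (2 * l) • B v = 0 := by
    rw [two_mul, add_smul]; nth_rewrite 1 [← h3]; simp
  rcases smul_eq_zero.1 h4 with h5 | h5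
  · have : l = 0 := by simpa using h5
    rw [this, zero_smul] at h1
    obtain ⟨u, rfl⟩ := hA
    apply hv
    have := congrArg (↑u⁻¹ : End ℂ V) h1
    rwa [← End.mul_apply, u.inv_mul, map_zero] at this
  · exact hv (hB (by rw [h5, map_zero]))

theorem NonHomog.of_fullSpec [Nontrivial V] {A : End ℂ V} {k : ℕ} (hk : Even k) (hk0 : k ≠ 0)
    {c : ℂ} (hc : c ≠ 0) (hA : A ^ k = c • (1 : End ℂ V)) (h : FullSpec A k) : NonHomog A := by
  intro m l hm
  by_contra! hl
  obtain ⟨v, hv, hmv⟩ := End.hasEigenvalue_iff_exists.1 hm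
  obtain ⟨j, rfl⟩ := hk
  obtain ⟨a, ha⟩ := IsAlgClosed.exists_eq_mul_self m
  have h1 : ∀ n : ℕ, ((A * A) ^ n) v = m ^ n • v := by
    intro n
    induction n with
    | zero => simp
    | succ n ih => rw [pow_succ', End.mul_apply, ih, map_smul, hmv, smul_smul, pow_succ]
  have h2 : m ^ j = c := by
    have := h1 j
    rw [← pow_two, ← pow_mul, mul_comm, mul_two, hA] at this
    exact (smul_left_injective ℂ hv this).symm
  have key : ∀ b : ℂ, b * b = m → A.HasEigenvalue b := by
    intro b hb
    apply h
    rw [hA, ← mul_two, mul_comm, pow_mul, pow_two, hb, h2]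
  have key2 : ∀ b : ℂ, b * b = m → b = l := by
    intro b hb
    obtain ⟨w, hw, hbw⟩ := End.hasEigenvalue_iff_exists.1 (key b hb)
    have := hl w (by rw [End.mul_apply, hbw, map_smul, hbw, smul_smul, hb])
    rw [hbw] at this
    exact smul_left_injective ℂ hw this
  have h3 := key2 a ha.symm
  have h4 := key2 (-a) (by rw [neg_mul_neg, ha])
  have h5 : a = 0 := by linear_combination (h3 - h4) / 2
  rw [ha, h5] at h2
  apply hc
  rw [← h2, mul_zero, zero_pow]
  rintro rfl; simp at hk0

theorem FullSpec.of_sq {A : End ℂ V} {k : ℕ} (h : FullSpec (A * A) k) (h' : NonHomog A) :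
    FullSpec A (2 * k) := by
  intro a ha
  by_contra hne
  have h1 : (A * A).HasEigenvalue (a * a) := by
    apply h
    rw [← pow_two, ← pow_two, ← pow_mul, ← pow_mul, ha]
  obtain ⟨v, hv, hav⟩ := h' _ (-a) h1
  apply hne
  refine End.hasEigenvalue_iff_exists.2 ⟨A v + a • v, ?_, ?_⟩
  · intro h0
    exact hav (by rw [neg_smul]; exact eq_neg_of_add_eq_zero_left h0)
  · rw [map_add, map_smul, ← End.mul_apply, hv, smul_add, smul_smul, add_comm]

end spec

section good

variable {α : Type} [DecidableEq α] [Fintype α] {β : Type} [DecidableEq β] [Fintype β]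

/-- In every spin representation, `σ` has as many eigenvalues as its order permits. -/
def Good (σ : Perm α) : Prop :=
  ∀ (V : Type) [AddCommGroup V] [Module ℂ V] [FiniteDimensional ℂ V] [Nontrivial V]
    (R : SpinRep α V), FullSpec (R.op σ) (orderOf σ)

/-- In every spin representation, `σ` is not scalar on eigenspaces of its square. -/
def NonHom (σ : Perm α) : Prop :=
  ∀ (V : Type) [AddCommGroup V] [Module ℂ V] [FiniteDimensional ℂ V] [Nontrivial V]
    (R : SpinRep α V), NonHomog (R.op σ)

theorem Good.of_parts {σ : Perm α} {τ : Perm β} (h : Good σ) (hp : τ.parts = σ.parts) :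
    Good τ := by
  obtain ⟨e, he⟩ := Perm.exists_equiv_of_parts_eq hp.symm
  intro V _ _ _ _ R
  have := h V (R.comap e.toEmbedding)
  rwa [SpinRep.comap_op, he, Perm.orderOf_eq_lcm_parts, ← hp, ← Perm.orderOf_eq_lcm_parts] at this

theorem NonHom.of_parts {σ : Perm α} {τ : Perm β} (h : NonHom σ) (hp : τ.parts = σ.parts) :
    NonHom τ := by
  obtain ⟨e, he⟩ := Perm.exists_equiv_of_parts_eq hp.symm
  intro V _ _ _ _ R
  have := h V (R.comap e.toEmbedding)
  rwa [SpinRep.comap_op, he] at this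

variable {V : Type} [AddCommGroup V] [Module ℂ V] [FiniteDimensional ℂ V]

/-- A weight space argument: on a nonzero subspace stable under a smaller symmetric group, a good
permutation attains all possible eigenvalues. -/
theorem Good.exists_mem {σ : Perm β} (h : Good σ) (R : SpinRep α V) (e : β ↪ α)
    (W : Submodule ℂ V) (hW : W ≠ ⊥)
    (hs : ∀ τ : Perm β, ∀ v ∈ W, R.op (τ.viaEmbedding e) v ∈ W) (a : ℂ)
    (ha : ∀ v ∈ W, (R.op (σ.viaEmbedding e) ^ orderOf σ) v = a ^ orderOf σ • v) :
    ∃ v ∈ W, v ≠ 0 ∧ R.op (σ.viaEmbedding e) v = a • v := by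
  have : Nontrivial W := (Submodule.nontrivial_iff_ne_bot).2 hW
  have hs' : ∀ τ : Perm β, ∀ v ∈ W, (R.comap e).op τ v ∈ W := hs
  have := h W ((R.comap e).restrict W hs') a ?_
  · obtain ⟨v, hv, hav⟩ := End.hasEigenvalue_iff_exists.1 this
    exact ⟨v, v.2, by simpa using hv, by simpa using congrArg (Submodule.subtype W) hav⟩
  · ext v
    rw [SpinRep.restrict_op, Module.End.pow_restrict]
    simpa using ha v v.2

theorem Good.exists_mem_of_odd {σ : Perm β} (h : Good σ) (hk : Odd (orderOf σ)) (R : SpinRep α V)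
    (e : β ↪ α) (W : Submodule ℂ V) (hW : W ≠ ⊥)
    (hs : ∀ τ : Perm β, ∀ v ∈ W, R.op (τ.viaEmbedding e) v ∈ W) (a : ℂ)
    (ha : a ^ orderOf σ = 1) :
    ∃ v ∈ W, v ≠ 0 ∧ R.op (σ.viaEmbedding e) v = a • v := by
  refine h.exists_mem R e W hW hs a fun v _ => ?_
  have : R.op (σ.viaEmbedding e) ^ orderOf σ = 1 := by
    rw [← Perm.orderOf_viaEmbedding e] at hk ⊢
    exact R.op_pow_orderOf _ hk
  rw [this, ha]; simp

theorem good_of_odd {σ : Perm α} (hk : Odd (orderOf σ))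
    (h : ∀ (V : Type) [AddCommGroup V] [Module ℂ V] [FiniteDimensional ℂ V] [Nontrivial V]
      (R : SpinRep α V) (a : ℂ), a ^ orderOf σ = 1 → ∃ v, v ≠ 0 ∧ R.op σ v = a • v) : Good σ := by
  intro V _ _ _ _ R a ha
  refine End.hasEigenvalue_iff_exists.2 (h V R a ?_)
  rw [R.op_pow_orderOf σ hk] at ha
  obtain ⟨v, hv⟩ := exists_ne (0 : V)
  have := congrArg (· v) ha
  simp only [End.one_apply, LinearMap.smul_apply] at this
  exact (smul_left_injective ℂ hv (by simpa using this)).symm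

end good

section

variable {V : Type} [AddCommGroup V] [Module ℂ V] [FiniteDimensional ℂ V]

theorem Module.End.exists_eigenvector_mem (B : End ℂ V) (W : Submodule ℂ V) (hW : W ≠ ⊥)
    (hs : ∀ v ∈ W, B v ∈ W) : ∃ (b : ℂ) (v : V), v ∈ W ∧ v ≠ 0 ∧ B v = b • v := by
  have : Nontrivial W := (Submodule.nontrivial_iff_ne_bot).2 hW
  obtain ⟨b, hb⟩ := End.exists_eigenvalue (B.restrict hs)
  obtain ⟨v, hv, hbv⟩ := End.hasEigenvalue_iff_exists.1 hb
  exact ⟨b, v, v.2, by simpa using hv, by simpa using congrArg (Submodule.subtype W) hbv⟩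

omit [FiniteDimensional ℂ V] in
theorem Module.End.eigenspace_ne_bot {B : End ℂ V} {b : ℂ} {v : V} (hv : v ≠ 0)
    (h : B v = b • v) : B.eigenspace b ≠ ⊥ :=
  fun h' => hv (by
    have : v ∈ B.eigenspace b := End.mem_eigenspace_iff.2 h
    rwa [h', Submodule.mem_bot] at this)

omit [FiniteDimensional ℂ V] in
theorem Module.End.eigenspace_stable {A B : End ℂ V} (h : Commute A B) (b : ℂ) (v : V)
    (hv : v ∈ B.eigenspace b) : A v ∈ B.eigenspace b := by
  rw [End.mem_eigenspace_iff] at hv ⊢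
  rw [← End.mul_apply, ← h.eq, End.mul_apply, hv, map_smul]

theorem exists_mul_eq_of_pow_lcm {k l : ℕ} {a : ℂ} (hk : k ≠ 0) (hl : l ≠ 0)
    (ha : a ^ (k.lcm l) = 1) : ∃ b c : ℂ, b ^ k = 1 ∧ c ^ l = 1 ∧ a = b * c := by
  have h0 : k.lcm l ≠ 0 := Nat.lcm_ne_zero hk hl
  have ha0 : a ≠ 0 := by
    rintro rfl; rw [zero_pow h0] at ha; exact zero_ne_one ha
  obtain ⟨x, hx⟩ := Nat.dvd_lcm_left k l
  obtain ⟨y, hy⟩ := Nat.dvd_lcm_right k l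
  have hc : Nat.Coprime x y := by
    have h1 : k.lcm l ∣ k.lcm l / Nat.gcd x y := by
      apply Nat.lcm_dvd
      · obtain ⟨u, hu⟩ := Nat.gcd_dvd_left x y
        refine ⟨u, ?_⟩
        rw [hx]
        have hg : 0 < Nat.gcd x y := Nat.gcd_pos_of_pos_left _ (by
          rcases x.eq_zero_or_pos with h | h
          · rw [h, mul_zero] at hx; exact absurd hx h0
          · exact h)
        apply Nat.div_eq_of_eq_mul_left hg
        nth_rewrite 1 [hu]; ring
      · obtain ⟨u, hu⟩ := Nat.gcd_dvd_right x y
        refine ⟨u, ?_⟩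
        rw [hy]
        have hg : 0 < Nat.gcd x y := Nat.gcd_pos_of_pos_right _ (by
          rcases y.eq_zero_or_pos with h | h
          · rw [h, mul_zero] at hy; exact absurd hy h0
          · exact h)
        apply Nat.div_eq_of_eq_mul_left hg
        nth_rewrite 1 [hu]; ring
    have h2 : Nat.gcd x y ∣ k.lcm l := (Nat.gcd_dvd_left x y).trans ⟨k, by rw [hx]; ring⟩
    have h3 := Nat.le_of_dvd (Nat.div_pos (Nat.le_of_dvd (Nat.pos_of_ne_zero h0) h2)
      (Nat.pos_of_dvd_of_pos h2 (Nat.pos_of_ne_zero h0))) h1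
    have h4 : Nat.gcd x y ≠ 0 := by
      intro h; rw [h] at h2; exact h0 (Nat.eq_zero_of_zero_dvd h2)
    by_contra hne
    have h5 : 1 < Nat.gcd x y := by
      have : Nat.gcd x y ≠ 1 := hne
      omega
    exact absurd h3 (not_le.2 (Nat.div_lt_self (Nat.pos_of_ne_zero h0) h5))
  have hbez := Nat.gcd_eq_gcd_ab x y
  rw [hc.gcd_eq_one] at hbez
  refine ⟨(a ^ x) ^ (Nat.gcdA x y), (a ^ y) ^ (Nat.gcdB x y), ?_, ?_, ?_⟩
  · rw [← zpow_natCast, zpow_comm, zpow_natCast, ← pow_mul, mul_comm x k, ← hx, ha, one_zpow]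
  · rw [← zpow_natCast, zpow_comm, zpow_natCast, ← pow_mul, mul_comm y l, ← hy, ha, one_zpow]
  · rw [← zpow_natCast, ← zpow_natCast, ← zpow_mul, ← zpow_mul, ← zpow_add₀ ha0, ← hbez]
    simp

end

section

variable {β : Type} [DecidableEq β] [Fintype β] {γ : Type} [DecidableEq γ] [Fintype γ]

theorem Equiv.Perm.orderOf_sumCongr (σ : Perm β) (τ : Perm γ) :
    orderOf (Perm.sumCongr σ τ) = (orderOf σ).lcm (orderOf τ) := by
  simp only [Perm.orderOf_eq_lcm_parts, Perm.parts_sumCongr, Multiset.lcm_add]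
  rfl

theorem Equiv.Perm.sign_eq_one_of_odd {σ : Perm β} (h : Odd (orderOf σ)) : Perm.sign σ = 1 := by
  have h1 : Perm.sign σ ^ orderOf σ = 1 := by rw [← map_pow, pow_orderOf_eq_one, map_one]
  rcases Int.units_eq_one_or (Perm.sign σ) with h2 | h2
  · exact h2
  · rw [h2, h.neg_one_pow] at h1; exact absurd h1 (by decide)

variable {V : Type} [AddCommGroup V] [Module ℂ V]

theorem SpinRep.op_sumCongr (R : SpinRep (β ⊕ γ) V) (σ : Perm β) (τ : Perm γ) :
    SignEq (R.op (Perm.sumCongr σ τ)) (R.op (σ.viaEmbedding Function.Embedding.inl) *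
      R.op (τ.viaEmbedding Function.Embedding.inr)) := by
  rw [Perm.sumCongr_eq]; exact R.op_mul _ _

theorem SpinRep.op_sumCongr_of_odd (R : SpinRep (β ⊕ γ) V) {σ : Perm β} {τ : Perm γ}
    (hσ : Odd (orderOf σ)) (hτ : Odd (orderOf τ)) :
    R.op (Perm.sumCongr σ τ) = R.op (σ.viaEmbedding Function.Embedding.inl) *
      R.op (τ.viaEmbedding Function.Embedding.inr) := by
  rw [Perm.sumCongr_eq]
  refine R.op_mul_of_odd (hσ.mul hτ) ?_ ?_ (Perm.viaEmbedding_commute _ _ (by simp) _ _)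
  · rw [pow_mul, ← Perm.viaEmbedding_pow, pow_orderOf_eq_one, Perm.viaEmbedding_one, one_pow]
  · rw [mul_comm, pow_mul, ← Perm.viaEmbedding_pow, pow_orderOf_eq_one, Perm.viaEmbedding_one,
      one_pow]

/-- If `τ` has an eigenvalue `c` and all the possible eigenvalues of `σ` occur, then so do their
products with `c`. -/
theorem exists_eigenvector_sumCongr [FiniteDimensional ℂ V] (R : SpinRep (β ⊕ γ) V) {σ : Perm β}
    {τ : Perm γ} (h : Good σ) (hσ : Odd (orderOf σ)) (hτ : Odd (orderOf τ)) {b c : ℂ} {w : V}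
    (hw : w ≠ 0) (hcw : R.op (τ.viaEmbedding Function.Embedding.inr) w = c • w)
    (hb : b ^ orderOf σ = 1) : ∃ v, v ≠ 0 ∧ R.op (Perm.sumCongr σ τ) v = (b * c) • v := by
  obtain ⟨v, hv, hv0, hbv⟩ := h.exists_mem_of_odd hσ R Function.Embedding.inl
    ((R.op (τ.viaEmbedding Function.Embedding.inr)).eigenspace c)
    (End.eigenspace_ne_bot hw hcw)
    (fun ρ v hv => End.eigenspace_stable (R.op_disjoint_commute _ _ (by simp) _
      (Perm.sign_eq_one_of_odd hτ)).symm c v hv) b hb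
  refine ⟨v, hv0, ?_⟩
  rw [R.op_sumCongr_of_odd hσ hτ, End.mul_apply, End.mem_eigenspace_iff.1 hv, map_smul, hbv,
    smul_smul, mul_comm]

theorem Good.sumCongr {σ : Perm β} {τ : Perm γ} (h : Good σ) (h' : Good τ) (hσ : Odd (orderOf σ))
    (hτ : Odd (orderOf τ)) : Good (Perm.sumCongr σ τ : Perm (β ⊕ γ)) := by
  have ho : Odd (orderOf (Perm.sumCongr σ τ : Perm (β ⊕ γ))) := by
    rw [Perm.orderOf_sumCongr]
    exact (hσ.mul hτ).of_dvd_nat (Nat.lcm_dvd_mul _ _)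
  refine good_of_odd ho fun V _ _ _ _ R a ha => ?_
  rw [Perm.orderOf_sumCongr] at ha
  obtain ⟨b, c, hb, hc, rfl⟩ := exists_mul_eq_of_pow_lcm hσ.pos.ne' hτ.pos.ne' ha
  obtain ⟨w, -, hw, hcw⟩ := h'.exists_mem_of_odd hτ R Function.Embedding.inr ⊤ top_ne_bot
    (fun _ _ _ => trivial) c hc
  exact exists_eigenvector_sumCongr R h hσ hτ hw hcw hb

theorem Good.sumCongr_of_dvd {σ : Perm β} {τ : Perm γ} (h : Good σ) (hσ : Odd (orderOf σ))
    (hd : orderOf τ ∣ orderOf σ) : Good (Perm.sumCongr σ τ : Perm (β ⊕ γ)) := by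
  have hτ : Odd (orderOf τ) := hσ.of_dvd_nat hd
  have ho : orderOf (Perm.sumCongr σ τ : Perm (β ⊕ γ)) = orderOf σ := by
    rw [Perm.orderOf_sumCongr]; exact Nat.lcm_eq_left hd
  refine good_of_odd (ho ▸ hσ) fun V _ _ _ _ R a ha => ?_
  rw [ho] at ha
  set B := R.op (τ.viaEmbedding Function.Embedding.inr) with hB
  obtain ⟨c, w, -, hw, hcw⟩ := B.exists_eigenvector_mem ⊤ top_ne_bot (fun _ _ => trivial)
  have hc : c ^ orderOf σ = 1 := by
    have h1 : B ^ orderOf σ = 1 := R.op_pow_eq_one hσ (by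
      rw [← Perm.viaEmbedding_pow, orderOf_dvd_iff_pow_eq_one.1 hd, Perm.viaEmbedding_one])
    have h2 : ∀ n : ℕ, (B ^ n) w = c ^ n • w := by
      intro n
      induction n with
      | zero => simp
      | succ n ih => rw [pow_succ', End.mul_apply, ih, map_smul, hcw, smul_smul, pow_succ]
    have h3 := h2 (orderOf σ)
    rw [h1] at h3
    exact (smul_left_injective ℂ hw (by simpa using h3)).symm
  have hc0 : c ≠ 0 := by
    rintro rfl; rw [zero_pow hσ.pos.ne'] at hc; exact zero_ne_one hc
  obtain ⟨v, hv, hv'⟩ := exists_eigenvector_sumCongr (b := a / c) R h hσ hτ hw hcw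
    (by rw [div_pow, ha, hc, div_one])
  exact ⟨v, hv, by rw [hv', div_mul_cancel₀ _ hc0]⟩

theorem NonHom.exists_mem {α : Type} [DecidableEq α] [Fintype α] [FiniteDimensional ℂ V]
    {σ : Perm β} (h : NonHom σ) (R : SpinRep α V) (e : β ↪ α)
    (W : Submodule ℂ V) (hs : ∀ τ : Perm β, ∀ v ∈ W, R.op (τ.viaEmbedding e) v ∈ W) {m : ℂ}
    (l : ℂ) {w : V} (hw : w ∈ W) (hw0 : w ≠ 0)
    (hm : R.op (σ.viaEmbedding e) (R.op (σ.viaEmbedding e) w) = m • w) :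
    ∃ v ∈ W, R.op (σ.viaEmbedding e) (R.op (σ.viaEmbedding e) v) = m • v ∧
      R.op (σ.viaEmbedding e) v ≠ l • v := by
  have : Nontrivial W := ⟨⟨⟨w, hw⟩, 0, by simpa using hw0⟩⟩
  have hs' : ∀ τ : Perm β, ∀ v ∈ W, (R.comap e).op τ v ∈ W := hs
  obtain ⟨v, hv, hv'⟩ := h W ((R.comap e).restrict W hs') m l
    (End.hasEigenvalue_iff_exists.2 ⟨⟨w, hw⟩, by simpa using hw0, Subtype.ext hm⟩)
  refine ⟨v, v.2, congrArg (Submodule.subtype W) hv, fun h => hv' (Subtype.ext h)⟩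

theorem NonHomog.mul_of_commute {A B : End ℂ V} [FiniteDimensional ℂ V] (hc : Commute A B)
    (hB : Function.Injective B)
    (h : ∀ (b m l : ℂ) (w : V), w ≠ 0 → B w = b • w → A (A w) = m • w →
      ∃ v, B v = b • v ∧ A (A v) = m • v ∧ A v ≠ l • v) : NonHomog (A * B) := by
  intro m l hm
  obtain ⟨b, w, hw, hw0, hbw⟩ := B.exists_eigenvector_mem ((A * B * (A * B)).eigenspace m) hm
    (fun v hv => End.eigenspace_stable (by
      have : Commute B (A * B) := hc.symm.mul_right (Commute.refl B)
      exact this.mul_right this) m v hv)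
  have hb : b ≠ 0 := by
    rintro rfl
    exact hw0 (hB (by rw [hbw, zero_smul, map_zero]))
  have hcA : ∀ v, B (A v) = A (B v) := fun v => by rw [← End.mul_apply, ← hc.eq, End.mul_apply]
  have hw1 : A (A w) = (m / (b * b)) • w := by
    have := End.mem_eigenspace_iff.1 hw
    simp only [End.mul_apply, hcA, hbw, map_smul, smul_smul] at this
    rw [div_eq_inv_mul, mul_smul, ← this, smul_smul, inv_mul_cancel₀ (mul_ne_zero hb hb), one_smul]
  obtain ⟨v, hv1, hv2, hv3⟩ := h b _ (l / b) w hw0 hbw hw1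
  refine ⟨v, ?_, ?_⟩
  · simp only [End.mul_apply, hcA, hv1, map_smul, smul_smul, hv2]
    rw [← mul_assoc, mul_div_cancel₀ _ (mul_ne_zero hb hb)]
  · intro h
    rw [End.mul_apply, hv1, map_smul] at h
    exact hv3 (by rw [div_eq_inv_mul, mul_smul, ← h, smul_smul, inv_mul_cancel₀ hb, one_smul])

theorem NonHom.sumCongr {σ : Perm β} {τ : Perm γ} (h : NonHom σ) (hτ : Perm.sign τ = 1) :
    NonHom (Perm.sumCongr σ τ : Perm (β ⊕ γ)) := by
  intro V _ _ _ _ R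
  refine NonHomog.signEq ?_ (R.op_sumCongr σ τ)
  have hc (ρ : Perm β) := R.op_disjoint_commute (σ := τ) Function.Embedding.inr
    Function.Embedding.inl (by simp) ρ hτ
  refine NonHomog.mul_of_commute (hc σ).symm (R.op_injective _) fun b m l w hw hbw hmw => ?_
  obtain ⟨v, hv, h1, h2⟩ := h.exists_mem R Function.Embedding.inl
    ((R.op (τ.viaEmbedding Function.Embedding.inr)).eigenspace b)
    (fun ρ v hv => End.eigenspace_stable (hc ρ).symm b v hv) l
    (End.mem_eigenspace_iff.2 hbw) hw hmw
  exact ⟨v, End.mem_eigenspace_iff.1 hv, h1, h2⟩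

theorem nonHom_sumCongr_of_odd_odd {σ : Perm β} {τ : Perm γ} (hσ : Perm.sign σ = -1)
    (hτ : Perm.sign τ = -1) : NonHom (Perm.sumCongr σ τ : Perm (β ⊕ γ)) := by
  intro V _ _ _ _ R
  refine NonHomog.signEq ?_ (R.op_sumCongr σ τ)
  refine NonHomog.of_anti ((R.isUnit_op _).mul (R.isUnit_op _)) (R.op_injective
    (σ.viaEmbedding Function.Embedding.inl)) ?_
  have h := R.op_disjoint_anti (σ := σ) (τ := τ) Function.Embedding.inl Function.Embedding.inr
    (by simp) hσ hτ
  rw [mul_assoc, ← neg_eq_iff_eq_neg.2 h, mul_neg]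

/-- Passing from the square of an element to the element. -/
theorem Good.of_sq {σ : Perm β} (h : Good (σ ^ 2)) (h' : NonHom σ) (hk : Even (orderOf σ)) :
    Good σ := by
  intro V _ _ _ _ R
  obtain ⟨j, hj⟩ := hk
  have h1 : orderOf (σ ^ 2) = j := by
    rw [orderOf_pow, hj, ← two_mul]; simp
  have h2 : FullSpec (R.op (σ ^ 2)) j := h1 ▸ h V R
  rw [hj, ← two_mul]
  refine FullSpec.of_sq (h2.signEq ?_) (h' V R)
  rw [← pow_two]; exact (R.op_pow σ 2).symm

end

theorem sign_sumComm (β : Type) [DecidableEq β] [Fintype β] :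
    Perm.sign (Equiv.sumComm β β) = (-1) ^ Fintype.card β := by
  let e : β ⊕ β ≃ β × Bool := (Equiv.boolProdEquivSum β).symm.trans (Equiv.prodComm _ _)
  rw [← Perm.sign_permCongr e]
  have : e.permCongr (Equiv.sumComm β β) =
      Equiv.prodCongrRight (fun _ : β => (Equiv.swap true false : Perm Bool)) := by
    ext ⟨x, b⟩ <;> cases b <;> simp [e, Equiv.permCongr_apply]
  rw [this, Perm.sign_prodCongrRight]
  simp

/-- An involution interchanging `x` and `y` reverses the product of their lifts. -/
theorem SpinRep.op_mul_op_of_swap {α : Type} [DecidableEq α] [Fintype α] {V : Type}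
    [AddCommGroup V] [Module ℂ V] [Nontrivial V] (R : SpinRep α V) {f x y : Perm α}
    (hfx : f * x = y * f) (hff : f * f = 1) :
    R.op f * (R.op x * R.op y) = R.op y * R.op x * R.op f := by
  have hfy : f * y = x * f := by
    calc f * y = f * (y * f) * f := by rw [mul_assoc, mul_assoc, hff, mul_one]
      _ = f * f * x * f := by simp only [← hfx, mul_assoc]
      _ = x * f := by rw [hff, one_mul]
  have h1 : SignEq (R.op f * R.op x) (R.op y * R.op f) :=
    (R.op_mul' f x).trans (hfx ▸ R.op_mul y f)
  have h2 : SignEq (R.op f * R.op y) (R.op x * R.op f) :=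
    (R.op_mul' f y).trans (hfy ▸ R.op_mul x f)
  have h3 : SignEq (R.op f * R.op f) 1 := by
    have := R.op_mul' f f
    rwa [hff, R.op_one] at this
  obtain ⟨s, hs, h1⟩ := h1
  obtain ⟨t, ht, h2⟩ := h2
  obtain ⟨u, hu, h3⟩ := h3
  have hst : t * s = 1 := by
    have h4 : R.op f * R.op f * R.op x = (t * s) • (R.op x * (R.op f * R.op f)) := by
      rw [mul_assoc, h1, mul_smul_comm, ← mul_assoc, h2, smul_mul_assoc, smul_smul, mul_assoc,
        mul_comm]
    rw [h3, smul_mul_assoc, one_mul, mul_smul_comm, mul_one, smul_comm] at h4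
    have hu0 : u ≠ 0 := by rintro rfl; simp at hu
    have h5 := smul_right_injective _ hu0 h4
    obtain ⟨v, hv⟩ := exists_ne (0 : V)
    have h6 : R.op x v ≠ 0 := fun h => hv (R.op_injective x (by rw [h, map_zero]))
    have h7 := congrArg (· v) h5
    exact (smul_left_injective ℂ h6 (by simpa using h7)).symm
  rw [← mul_assoc, h1, smul_mul_assoc, mul_assoc, h2, mul_smul_comm, smul_smul, mul_comm s, hst,
    one_smul, mul_assoc]

section

variable {β : Type} [DecidableEq β] [Fintype β] {γ : Type} [DecidableEq γ] [Fintype γ]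

theorem nonHom_of_repeated {σ : Perm β} {τ : Perm γ} (hτ : Perm.sign τ = -1)
    (hσ : Perm.sign σ = -(-1) ^ Fintype.card β) :
    NonHom (Perm.sumCongr (Perm.sumCongr σ σ) τ : Perm ((β ⊕ β) ⊕ γ)) := by
  intro V _ _ _ _ R
  refine NonHomog.signEq ?_ (R.op_sumCongr _ τ)
  let i : β ↪ (β ⊕ β) ⊕ γ := Function.Embedding.inl.trans Function.Embedding.inl
  let j : β ↪ (β ⊕ β) ⊕ γ := Function.Embedding.inr.trans Function.Embedding.inl
  let k : γ ↪ (β ⊕ β) ⊕ γ := Function.Embedding.inr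
  let f : Perm ((β ⊕ β) ⊕ γ) :=
    Perm.viaEmbedding (Equiv.sumComm β β) Function.Embedding.inl
  have hij : ∀ x y, i x ≠ j y := by simp [i, j]
  set x := σ.viaEmbedding i with hx
  set y := σ.viaEmbedding j with hy
  set w := τ.viaEmbedding k with hw
  have hxy : (Perm.sumCongr σ σ).viaEmbedding Function.Embedding.inl = x * y := by
    ext a
    rcases a with (a | a) | a
    · rw [Perm.mul_apply, Perm.viaEmbedding_apply_of_notMem σ j _ (by simp [j])]
      exact (Perm.viaEmbedding_apply (Perm.sumCongr σ σ) _ (Sum.inl a)).trans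
        (Perm.viaEmbedding_apply σ i a).symm
    · have h1 : y (Sum.inl (Sum.inr a)) = j (σ a) := Perm.viaEmbedding_apply σ j a
      rw [Perm.mul_apply, h1, Perm.viaEmbedding_apply_of_notMem σ i _ (by simp [i, j])]
      exact (Perm.viaEmbedding_apply (Perm.sumCongr σ σ) _ (Sum.inr a))
    · rw [Perm.mul_apply, Perm.viaEmbedding_apply_of_notMem _ _ _ (by simp),
        Perm.viaEmbedding_apply_of_notMem σ j _ (by simp [j]),
        Perm.viaEmbedding_apply_of_notMem σ i _ (by simp [i])]
  have hfi : ∀ a, f (i a) = j a := fun a => Perm.viaEmbedding_apply _ _ (Sum.inl a)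
  have hfj : ∀ a, f (j a) = i a := fun a => Perm.viaEmbedding_apply _ _ (Sum.inr a)
  have hfk : ∀ a, f (k a) = k a := fun a => Perm.viaEmbedding_apply_of_notMem _ _ _ (by simp [k])
  have hfx : f * x = y * f := by
    ext a
    simp only [Perm.mul_apply]
    rcases a with (a | a) | a
    · change f (x (i a)) = y (f (i a))
      rw [hx, hy, Perm.viaEmbedding_apply, hfi, hfi, Perm.viaEmbedding_apply]
    · change f (x (j a)) = y (f (j a))
      rw [hx, hy, Perm.viaEmbedding_apply_of_notMem σ i _ (by simp [i, j]), hfj,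
        Perm.viaEmbedding_apply_of_notMem σ j _ (by simp [i, j])]
    · change f (x (k a)) = y (f (k a))
      rw [hx, hy, Perm.viaEmbedding_apply_of_notMem σ i _ (by simp [i, k]), hfk,
        Perm.viaEmbedding_apply_of_notMem σ j _ (by simp [k, j])]
  have hff : f * f = 1 := by
    rw [← Perm.viaEmbedding_mul]
    convert Perm.viaEmbedding_one _
    ext a; rcases a with a | a <;> rfl
  have hfxy := R.op_mul_op_of_swap hfx hff
  have hxyc := R.op_disjoint i j hij σ σ
  have hfw : R.op f * R.op w = twist ((-1) ^ Fintype.card β) (-1) • (R.op w * R.op f) := by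
    rw [← sign_sumComm, ← hτ]
    exact R.op_disjoint _ _ (by simp [k]) _ _
  refine NonHomog.of_anti ((R.isUnit_op _).mul (R.isUnit_op _)) (R.op_injective f) ?_
  obtain ⟨r, hr, h8⟩ := R.op_mul x y
  have h9 : R.op y * R.op x = twist (Perm.sign σ) (Perm.sign σ) • (R.op x * R.op y) := by
    rw [hxyc, smul_smul]
    have : ∀ a : ℤˣ, twist a a * twist a a = 1 := by
      intro a
      rcases Int.units_eq_one_or a with rfl | rfl <;> simp [twist_one_left, twist_neg]
    rw [this, one_smul]
  have h10 : twist ((-1) ^ Fintype.card β) (-1) * twist (Perm.sign σ) (Perm.sign σ) = -1 := by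
    rw [hσ]
    rcases neg_one_pow_eq_or ℤˣ (Fintype.card β) with h | h <;> rw [h] <;>
    simp [twist_one_left, twist_neg]
  change R.op ((Perm.sumCongr σ σ).viaEmbedding Function.Embedding.inl) * R.op w * R.op f = 
    -(R.op f * (R.op ((Perm.sumCongr σ σ).viaEmbedding Function.Embedding.inl) * R.op w))
  rw [hxy, h8]
  simp only [smul_mul_assoc, mul_smul_comm]
  rw [← smul_neg, ← mul_assoc, hfxy, mul_assoc _ (R.op f), hfw, mul_smul_comm, h9, smul_mul_assoc,
    smul_smul, h10, neg_one_smul, neg_neg, mul_assoc (R.op x * R.op y)]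

/-- A permutation of odd sign with two cycles of the same length. -/
theorem nonHom_of_two_le_count {σ : Perm β} {l : ℕ} (h : 2 ≤ σ.parts.count l)
    (hσ : Perm.sign σ = -1) : NonHom σ := by
  obtain ⟨M, hM⟩ := Multiset.le_iff_exists_add.1 (Multiset.le_count_iff_replicate_le.1 h)
  obtain ⟨k, τ, hτ⟩ := Perm.exists_parts_eq M fun m hm => Perm.pos_of_mem_parts (σ := σ) (by
    rw [hM]; exact Multiset.mem_add.2 (Or.inr hm))
  have hl : l ∈ σ.parts := Multiset.one_le_count_iff_mem.1 (by omega)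
  have : NeZero l := ⟨(Perm.pos_of_mem_parts hl).ne'⟩
  have hs : Perm.sign (rot l) = -(-1) ^ l := by
    rw [Perm.sign_eq_parts, parts_rot]; simp [pow_succ]
  have ht : Perm.sign τ = -1 := by
    rw [Perm.sign_eq_parts, hM] at hσ
    rw [Perm.sign_eq_parts, hτ]
    simp only [Multiset.sum_add, Multiset.sum_replicate, Multiset.card_add,
      Multiset.card_replicate, smul_eq_mul] at hσ
    rw [show 2 * l + M.sum + (2 + M.card) = M.sum + M.card + 2 * (l + 1) by ring,
      pow_add _ (M.sum + M.card), pow_mul _ 2] at hσ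
    simpa using hσ
  refine (nonHom_of_repeated (σ := rot l) ht (by rw [ZMod.card, hs])).of_parts ?_
  rw [Perm.parts_sumCongr, Perm.parts_sumCongr, parts_rot, hτ, hM]
  rfl

end

namespace SpinRep

variable {α : Type} [DecidableEq α] [Fintype α] {V : Type} [AddCommGroup V] [Module ℂ V]

/-- The product of two disjoint transpositions is not a scalar. -/
theorem op_swap_mul_swap_ne_one [Nontrivial V] (R : SpinRep α V) {a b c d : α} (hab : a ≠ b)
    (hcd : c ≠ d) (hac : a ≠ c) (had : a ≠ d) (hbc : b ≠ c) (hbd : b ≠ d) :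
    ¬ SignEq (R.op (swap a b * swap c d)) 1 := by
  intro h
  have h1 : SignEq (R.op (swap a b) * R.op (swap c d)) 1 := (R.op_mul' _ _).trans h
  obtain ⟨s, hs, h1⟩ := h1
  have h2 := R.op_swap_anti a b c d hab hcd hac had hbc hbd
  have h3 : R.op (swap c d) * R.op (swap a b) = s • (1 : End ℂ V) := by
    have h4 : R.op (swap a b) * R.op (swap a b) * R.op (swap c d) * R.op (swap a b) =
        s • (R.op (swap a b) * R.op (swap a b)) := by
      rw [mul_assoc (R.op (swap a b)), h1]; simp
    rw [R.op_swap_sq a b hab] at h4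
    simpa [mul_assoc] using h4
  rw [h3, h1] at h2
  have hs0 : s ≠ 0 := by rintro rfl; simp at hs
  have h5 : (2 * s) • (1 : End ℂ V) = 0 := by rw [two_mul, add_smul, ← sub_neg_eq_add, ← h2, sub_self]
  rw [smul_eq_zero] at h5
  rcases h5 with h5 | h5
  · exact hs0 (by simpa using h5)
  · exact one_ne_zero h5

theorem _root_.Equiv.Perm.swap_mul_swap_pow_three {x y z : α} (hxy : x ≠ y) (hxz : x ≠ z)
    (hyz : y ≠ z) : (swap x y * swap y z) ^ 3 = 1 := by
  have := Perm.isThreeCycle_swap_mul_swap_same hxy.symm hyz hxz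
  rw [← this.orderOf, swap_comm x y, pow_orderOf_eq_one]

theorem op_threeCycle_ne_one [Nontrivial V] (R : SpinRep α V) {a b c d : α} (hab : a ≠ b)
    (hac : a ≠ c) (hbc : b ≠ c) (had : a ≠ d) (hbd : b ≠ d) (hcd : c ≠ d) :
    R.op (swap a b * swap b c) ≠ 1 := by
  intro h
  have hr : R.op (swap a b * swap b d) = 1 := by
    have h1 := R.op_conj (by decide : Odd 3) (Perm.swap_mul_swap_pow_three hab hac hbc) (swap c d)
    rw [h, mul_one] at h1
    have h2 : swap c d * (swap a b * swap b c) * (swap c d)⁻¹ = swap a b * swap b d := by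
      rw [mul_inv_eq_iff_eq_mul]
      have h3 : swap c d * swap a b = swap a b * swap c d :=
        (Perm.Disjoint.commute (by
          rw [Perm.disjoint_iff_disjoint_support, Perm.support_swap hcd, Perm.support_swap hab]
          simp [*, Ne.symm])).eq
      rw [← mul_assoc, h3, mul_assoc, mul_assoc]
      congr 1
      ext x
      simp only [Perm.mul_apply, swap_apply_def]
      grind
    rw [h2] at h1
    obtain ⟨u, hu⟩ := R.isUnit_op (swap c d)
    rw [← hu] at h1
    simpa using (congrArg (· * (↑u⁻¹ : End ℂ V)) h1).symm
  have h3 : (swap a b * swap b c) * (swap a b * swap b d) = swap a c * swap b d := by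
    ext x
    simp only [Perm.mul_apply, swap_apply_def]
    grind
  refine R.op_swap_mul_swap_ne_one hac hbd hab had hbc.symm hcd ?_
  rw [← h3]
  refine (R.op_mul _ _).trans ?_
  rw [h, hr, one_mul]
  exact SignEq.refl 1

/-- A 3-cycle has all the nontrivial cube roots of unity as eigenvalues. -/
theorem exists_eigenvector_threeCycle [Nontrivial V] (R : SpinRep α V) {a b c d : α} (hab : a ≠ b)
    (hac : a ≠ c) (hbc : b ≠ c) (had : a ≠ d) (hbd : b ≠ d) (hcd : c ≠ d) {r : ℂ} (hr : r ^ 3 = 1)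
    (hr1 : r ≠ 1) : ∃ v, v ≠ 0 ∧ R.op (swap a b * swap b c) v = r • v := by
  set x := swap a b * swap b c with hx
  have hx3 : x ^ 3 = 1 := Perm.swap_mul_swap_pow_three hab hac hbc
  have hX : R.op x ^ 3 = 1 := R.op_pow_eq_one (by decide) hx3
  have hr2 : r * r + r + 1 = 0 := by
    have : (r - 1) * (r * r + r + 1) = 0 := by linear_combination hr
    exact (mul_eq_zero.1 this).resolve_left (sub_ne_zero.2 hr1)
  have h1 := R.op_threeCycle_ne_one hab hac hbc had hbd hcd
  obtain ⟨v, hv⟩ : ∃ v, R.op x v ≠ v := by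
    by_contra! h
    exact h1 (LinearMap.ext h)
  set X := R.op x
  have hX' (u : V) : X (X (X u)) = u := by
    simpa [pow_succ] using congrArg (· u) hX
  by_cases h2 : X (X v - v) = (r * r) • (X v - v)
  · refine ⟨R.op (swap a b) (X v - v), fun h => hv ?_, ?_⟩
    · rw [← sub_eq_zero]
      exact R.op_injective _ (by rw [h, map_zero])
    · have h3 : swap a b * x * (swap a b)⁻¹ = x ^ 2 := by
        have h4 : x ^ 2 = x⁻¹ := by
          rw [eq_inv_iff_mul_eq_one, ← pow_succ, hx3]
        rw [h4, hx, mul_inv_rev, swap_inv, swap_inv, ← mul_assoc, swap_mul_self, one_mul]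
      have h5 := R.op_conj (by decide : Odd 3) hx3 (swap a b)
      rw [h3, R.op_pow_of_odd (by decide : Odd 3) hx3] at h5
      have h6 := congrArg (· (X v - v)) h5
      simp only [End.mul_apply, pow_two] at h6
      have h7 : R.op (swap a b) (X (X v - v)) = (r * r) • R.op (swap a b) (X v - v) := by
        rw [h2, map_smul]
      rw [h7] at h6
      have h8 := congrArg X h6
      rw [hX', map_smul] at h8
      have h9 := congrArg (r • ·) h8
      simp only [smul_smul] at h9
      rw [show r * (r * r) = 1 by linear_combination hr, one_smul] at h9
      exact h9
  · refine ⟨X (X v - v) - (r * r) • (X v - v), sub_ne_zero.2 h2, ?_⟩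
    simp only [map_sub, map_smul, hX', smul_sub, smul_smul]
    rw [show r * r = -1 - r by linear_combination hr2]
    have : r * (-1 - r) = 1 := by linear_combination -hr2
    rw [this]
    module

/-- Two disjoint 3-cycles have all pairs of nontrivial cube roots of unity as joint eigenvalues. -/
theorem exists_eigenvector_two_threeCycles [Nontrivial V] (R : SpinRep (Fin 7) V) {r s : ℂ}
    (hr : r ^ 3 = 1) (hr1 : r ≠ 1) (hs : s ^ 3 = 1) (hs1 : s ≠ 1) :
    ∃ v, v ≠ 0 ∧ R.op (swap 0 1 * swap 1 2) v = r • v ∧ R.op (swap 3 4 * swap 4 5) v = s • v := by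
  obtain ⟨w, hw, hsw⟩ := R.exists_eigenvector_threeCycle (a := 3) (b := 4) (c := 5) (d := 6)
    (by decide) (by decide) (by decide) (by decide) (by decide) (by decide) hs hs1
  have := Submodule.nontrivial_iff_ne_bot.2 (End.eigenspace_ne_bot hw hsw)
  let e : Fin 4 ↪ Fin 7 := ⟨![0, 1, 2, 6], by decide⟩
  let f : Fin 3 ↪ Fin 7 := ⟨![3, 4, 5], by decide⟩
  have hf : swap (3 : Fin 7) 4 * swap 4 5 = (swap 0 1 * swap 1 2 : Perm (Fin 3)).viaEmbedding f := by
    rw [Perm.viaEmbedding_mul, Perm.viaEmbedding_swap, Perm.viaEmbedding_swap]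
    rfl
  have he : swap (0 : Fin 7) 1 * swap 1 2 = (swap 0 1 * swap 1 2 : Perm (Fin 4)).viaEmbedding e := by
    rw [Perm.viaEmbedding_mul, Perm.viaEmbedding_swap, Perm.viaEmbedding_swap]
    rfl
  have hc (σ : Perm (Fin 4)) : Commute (R.op (swap 3 4 * swap 4 5)) ((R.comap e).op σ) := by
    rw [hf]
    exact R.op_disjoint_commute f e (by decide) σ (by decide)
  obtain ⟨v, hv, hrv⟩ := ((R.comap e).onEigenspace _ hc s).exists_eigenvector_threeCycle
    (a := 0) (b := 1) (c := 2) (d := 3)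
    (by decide) (by decide) (by decide) (by decide) (by decide) (by decide) hr hr1
  refine ⟨v, by simpa using hv, ?_, End.mem_eigenspace_iff.1 v.2⟩
  have := congrArg Subtype.val hrv
  rw [onEigenspace_apply, comap_op, ← he] at this
  exact this

end SpinRep

section cyclic

variable {V : Type} [AddCommGroup V] [Module ℂ V]

theorem Module.End.pow_apply_of_eigen {A : End ℂ V} {b : ℂ} {v : V} (h : A v = b • v) (n : ℕ) :
    (A ^ n) v = b ^ n • v := by
  induction n with
  | zero => simp
  | succ n ih => rw [pow_succ', End.mul_apply, ih, map_smul, h, smul_smul, pow_succ]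

/-- The unnormalised projection onto the `a`-eigenspace of `A`. -/
noncomputable def cyclicSum (A : End ℂ V) (a : ℂ) (e : ℕ) : End ℂ V :=
  ∑ j ∈ Finset.range e, a⁻¹ ^ j • A ^ j

theorem apply_cyclicSum {A : End ℂ V} {a : ℂ} (ha : a ≠ 0) {e : ℕ} {v : V}
    (h : (A ^ e) v = a ^ e • v) : A (cyclicSum A a e v) = a • cyclicSum A a e v := by
  have h1 : cyclicSum A a e v = ∑ j ∈ Finset.range e, a⁻¹ ^ j • (A ^ j) v := by
    simp [cyclicSum, LinearMap.sum_apply]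
  have h2 : A (cyclicSum A a e v) =
      a • ∑ j ∈ Finset.range e, a⁻¹ ^ (j + 1) • (A ^ (j + 1)) v := by
    rw [h1, map_sum, Finset.smul_sum]
    refine Finset.sum_congr rfl fun j _ => ?_
    rw [map_smul, smul_smul, pow_succ, mul_comm (a⁻¹ ^ j), ← mul_assoc, mul_inv_cancel₀ ha,
      one_mul, pow_succ' A, End.mul_apply]
  have h3 := Finset.sum_range_succ (fun j => a⁻¹ ^ j • (A ^ j) v) e
  rw [Finset.sum_range_succ'] at h3
  rw [h2, h1]
  congr 1
  have h4 : a⁻¹ ^ e • (A ^ e) v = v := by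
    rw [h, smul_smul, ← mul_pow, inv_mul_cancel₀ ha, one_pow, one_smul]
  rw [h4] at h3
  simpa using h3

theorem cyclicSum_ne_zero {A X : End ℂ V} {a w : ℂ} {e : ℕ} (he : 0 < e) {v : V} (hv : v ≠ 0)
    (hX : X v = w • v)
    (hj : ∀ j, 0 < j → j < e → ∃ b, b ≠ w ∧ X ((A ^ j) v) = b • (A ^ j) v) :
    cyclicSum A a e v ≠ 0 := by
  intro h
  obtain ⟨e, rfl⟩ := Nat.exists_eq_succ_of_ne_zero he.ne'
  rw [cyclicSum, Finset.sum_range_succ'] at h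
  simp only [pow_zero, one_smul, LinearMap.add_apply, End.one_apply, LinearMap.sum_apply,
    LinearMap.smul_apply] at h
  have hd := X.eigenspaces_iSupIndep w
  refine hv (Submodule.disjoint_def.1 hd v (End.mem_eigenspace_iff.2 hX) ?_)
  rw [eq_neg_of_add_eq_zero_right h]
  refine Submodule.neg_mem _ (Submodule.sum_mem _ fun j hj' => Submodule.smul_mem _ _ ?_)
  obtain ⟨b, hb, hbX⟩ := hj (j + 1) (by omega) (by have := Finset.mem_range.1 hj'; omega)
  exact Submodule.mem_iSup_of_mem b (Submodule.mem_iSup_of_mem hb (End.mem_eigenspace_iff.2 hbX))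

theorem cyclicSum_commute {A B : End ℂ V} (h : Commute A B) (a : ℂ) (e : ℕ) :
    Commute (cyclicSum A a e) B :=
  Commute.sum_left _ _ _ fun _ _ => (h.pow_left _).smul_left _

end cyclic

section letters

variable {β : Type} [DecidableEq β] [Fintype β]

/-- `a` is an eigenvalue of the `n`-th power of `σ` in every spin representation. -/
def Letter (σ : Perm β) (n : ℕ) (a : ℂ) : Prop :=
  ∀ (V : Type) [AddCommGroup V] [Module ℂ V] [FiniteDimensional ℂ V] [Nontrivial V]
    (R : SpinRep β V), ∃ v, v ≠ 0 ∧ (R.op σ ^ n) v = a • v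

theorem Good.letter {σ : Perm β} (h : Good σ) (ho : Odd (orderOf σ)) {a : ℂ}
    (ha : a ^ orderOf σ = 1) : Letter σ 1 a := by
  intro V _ _ _ _ R
  obtain ⟨v, hv⟩ := End.hasEigenvalue_iff_exists.1 (h V R a (by
    rw [ha, one_smul, R.op_pow_orderOf _ ho]))
  exact ⟨v, by simpa using hv⟩

variable {α : Type} [DecidableEq α] [Fintype α]
variable {V : Type} [AddCommGroup V] [Module ℂ V] [FiniteDimensional ℂ V]

theorem Letter.exists_mem {σ : Perm β} {n : ℕ} {a : ℂ} (h : Letter σ n a) (R : SpinRep α V)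
    (e : β ↪ α) (W : Submodule ℂ V) (hW : W ≠ ⊥)
    (hs : ∀ τ : Perm β, ∀ v ∈ W, R.op (τ.viaEmbedding e) v ∈ W) :
    ∃ v ∈ W, v ≠ 0 ∧ (R.op (σ.viaEmbedding e) ^ n) v = a • v := by
  have := Submodule.nontrivial_iff_ne_bot.2 hW
  obtain ⟨v, hv, hav⟩ := h W ((R.comap e).restrict W hs)
  refine ⟨v, v.2, by simpa using hv, ?_⟩
  have h1 (m : ℕ) (u : W) : (((((R.comap e).restrict W hs).op σ ^ m) u : W) : V) =
      (R.op (σ.viaEmbedding e) ^ m) u := by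
    induction m with
    | zero => rfl
    | succ m ih => rw [pow_succ', pow_succ', End.mul_apply, End.mul_apply, ← ih]; rfl
  rw [← h1, hav]
  rfl

theorem Letter.exists_forall {σ : Perm β} {n : ℕ} (hσ : Perm.sign (σ ^ n) = 1) (R : SpinRep α V)
    {ι : Type} [Fintype ι] (E : ι → β ↪ α) (hE : ∀ i j, i ≠ j → ∀ x y, E i x ≠ E j y)
    {a : ι → ℂ} (ha : ∀ i, Letter σ n (a i)) (W : Submodule ℂ V) (hW : W ≠ ⊥)
    (hs : ∀ i, ∀ τ : Perm β, ∀ v ∈ W, R.op (τ.viaEmbedding (E i)) v ∈ W) :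
    ∃ v ∈ W, v ≠ 0 ∧ ∀ i, (R.op (σ.viaEmbedding (E i)) ^ n) v = a i • v := by
  classical
  suffices ∀ s : Finset ι, ∃ v ∈ W, v ≠ 0 ∧
      ∀ i ∈ s, (R.op (σ.viaEmbedding (E i)) ^ n) v = a i • v by
    obtain ⟨v, hv, hv0, h⟩ := this Finset.univ
    exact ⟨v, hv, hv0, fun i => h i (Finset.mem_univ i)⟩
  intro s
  induction s using Finset.induction_on with
  | empty =>
    obtain ⟨v, hv, hv0⟩ := Submodule.exists_mem_ne_zero_of_ne_bot hW
    exact ⟨v, hv, hv0, by simp⟩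
  | insert j s hj ih =>
    obtain ⟨w, hw, hw0, hws⟩ := ih
    let W' : Submodule ℂ V :=
      W ⊓ ⨅ i ∈ s, (R.op (σ.viaEmbedding (E i)) ^ n).eigenspace (a i)
    have hmem (v : V) : v ∈ W' ↔
        v ∈ W ∧ ∀ i ∈ s, (R.op (σ.viaEmbedding (E i)) ^ n) v = a i • v := by
      simp only [W', Submodule.mem_inf, Submodule.mem_iInf, End.mem_eigenspace_iff]
    obtain ⟨v, hv, hv0, hvj⟩ := (ha j).exists_mem R (E j) W'
      (Submodule.ne_bot_iff _ |>.2 ⟨w, (hmem w).2 ⟨hw, hws⟩, hw0⟩) (by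
        intro τ v hv
        rw [hmem] at hv ⊢
        refine ⟨hs j τ v hv.1, fun i hi => ?_⟩
        have hij : i ≠ j := fun h => hj (h ▸ hi)
        have hc := R.op_disjoint_commute (E i) (E j) (hE i j hij) τ hσ
        obtain ⟨t, ht, hp⟩ := (R.op_pow (σ.viaEmbedding (E i)) n).symm
        rw [← Perm.viaEmbedding_pow] at hp
        have hc' : Commute (R.op (σ.viaEmbedding (E i)) ^ n) (R.op (τ.viaEmbedding (E j))) := by
          rw [hp]; exact hc.smul_left t
        rw [← End.mul_apply, hc'.eq, End.mul_apply, hv.2 i hi, map_smul])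
    rw [hmem] at hv
    refine ⟨v, hv.1, hv0, fun i hi => ?_⟩
    rcases Finset.mem_insert.1 hi with rfl | hi
    · exact hvj
    · exact hv.2 i hi

end letters

section prime

variable {V : Type} [AddCommGroup V] [Module ℂ V]

theorem exists_eigenvector_ne_one_of_pow_eq_one [FiniteDimensional ℂ V] {X : End ℂ V} {p : ℕ}
    (hp : p ≠ 0) (hX : X ^ p = 1) (h1 : X ≠ 1) : ∃ (b : ℂ) (v : V), b ≠ 1 ∧ v ≠ 0 ∧ X v = b • v := by
  have hW : LinearMap.range (X - 1) ≠ ⊥ := by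
    rwa [Ne, LinearMap.range_eq_bot, sub_eq_zero]
  obtain ⟨b, v, ⟨y, hy⟩, hv0, hv⟩ := End.exists_eigenvector_mem X _ hW (by
    rintro _ ⟨y, rfl⟩
    exact ⟨X y, by simp⟩)
  refine ⟨b, v, ?_, hv0, hv⟩
  rintro rfl
  rw [one_smul] at hv
  have hXy : X y = y + v := by rw [← hy]; simp
  have h2 (n : ℕ) : (X ^ n) y = y + n • v := by
    induction n with
    | zero => simp
    | succ n ih => rw [pow_succ', End.mul_apply, ih, map_add, map_nsmul, hv, hXy]; module
  have h3 := h2 p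
  rw [hX, End.one_apply] at h3
  have h4 : (p : ℂ) • v = 0 := by simpa [Nat.cast_smul_eq_nsmul] using h3
  exact hv0 ((smul_eq_zero.1 h4).resolve_left (by exact_mod_cast hp))

/-- Multiplication by a unit as a permutation of `ZMod m`. -/
def dil {m : ℕ} (u : (ZMod m)ˣ) : Perm (ZMod m) := Units.mulLeft u

@[simp] theorem dil_apply {m : ℕ} (u : (ZMod m)ˣ) (x : ZMod m) : dil u x = u * x := rfl

theorem rot_pow_apply (m n : ℕ) (x : ZMod m) : (rot m ^ n) x = x + n := by
  induction n with
  | zero => simp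
  | succ n ih => rw [pow_succ', Perm.mul_apply, ih, rot_apply]; push_cast; ring

theorem rot_pow_self (m : ℕ) : rot m ^ m = 1 := by
  ext x : 1
  simp [rot_pow_apply]

theorem dil_inv_mul_rot {m : ℕ} (u : (ZMod m)ˣ) {k : ℕ} (hk : (u : ZMod m) = k) :
    (dil u⁻¹) * rot m ^ k * (dil u⁻¹)⁻¹ = rot m := by
  rw [mul_inv_eq_iff_eq_mul]
  ext x : 1
  simp only [Perm.mul_apply, dil_apply, rot_pow_apply, rot_apply, ← hk, mul_add]
  simp

theorem letter_rot_prime {p : ℕ} [Fact p.Prime] (hp : 5 ≤ p) {a : ℂ} (ha : a ^ p = 1)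
    (ha1 : a ≠ 1) : Letter (rot p) 1 a := by
  intro V _ _ _ _ R
  have hodd : Odd p := (Fact.out : p.Prime).odd_of_ne_two (by omega)
  have hX := R.op_pow_eq_one hodd (rot_pow_self p)
  have hne : ∀ k : ℕ, 0 < k → k < 5 → (k : ZMod p) ≠ 0 := by
    intro k h0 hk h
    rw [ZMod.natCast_eq_zero_iff] at h
    exact absurd (Nat.le_of_dvd h0 h) (by omega)
  have h1 : R.op (rot p) ≠ 1 := by
    intro h
    have n1 := hne 1 (by norm_num) (by norm_num)
    have n2 := hne 2 (by norm_num) (by norm_num)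
    have n3 := hne 3 (by norm_num) (by norm_num)
    push_cast at n1 n2 n3
    have d1 : (-1 : ZMod p) ≠ 0 := neg_ne_zero.2 n1
    have d2 : (-1 : ZMod p) ≠ 1 := fun h => n2 (by linear_combination -h)
    have d3 : (-1 : ZMod p) ≠ 2 := fun h => n3 (by linear_combination -h)
    have d4 : (1 : ZMod p) ≠ 2 := fun h => n1 (by linear_combination -h)
    refine R.op_threeCycle_ne_one (a := -1) (b := 0) (c := 1) (d := 2) d1 d2 n1.symm d3 n2.symm d4 ?_
    have h2 := R.op_conj hodd (rot_pow_self p) (swap 0 1)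
    rw [h, mul_one] at h2
    have h3 : R.op (swap 0 1 * rot p * (swap 0 1)⁻¹) = 1 := by
      obtain ⟨u, hu⟩ := R.isUnit_op (swap 0 1)
      rw [← hu] at h2
      simpa using (congrArg (· * (↑u⁻¹ : End ℂ V)) h2).symm
    have h4 : swap (-1) 0 * swap 0 1 = (rot p)⁻¹ * (swap 0 1 * rot p * (swap 0 1)⁻¹) := by
      have : swap (-1) 0 = (rot p)⁻¹ * swap 0 1 * rot p := by
        rw [mul_assoc, eq_inv_mul_iff_mul_eq, Equiv.mul_swap_eq_swap_mul]
        simp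
      rw [this, swap_inv]
      simp only [mul_assoc]
    refine R.op_eq_of_signEq (by decide : Odd 3)
      (Perm.swap_mul_swap_pow_three d1 d2 n1.symm) (one_pow _) ?_
    rw [h4]
    refine (R.op_mul _ _).trans ?_
    have h5 := R.op_mul_inv (rot p)
    rw [h, one_mul] at h5
    rwa [h3, mul_one]
  obtain ⟨b, v, hb, hv, hbv⟩ := exists_eigenvector_ne_one_of_pow_eq_one (Fact.out : p.Prime).ne_zero
    hX h1
  have hbp : b ^ p = 1 := by
    have := End.pow_apply_of_eigen hbv p
    rw [hX, End.one_apply] at this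
    exact (smul_left_injective ℂ hv (by simpa using this)).symm
  have hprim : IsPrimitiveRoot b p := by
    have := orderOf_eq_prime hbp hb
    rw [← this]; exact IsPrimitiveRoot.orderOf b
  have : NeZero p := ⟨(Fact.out : p.Prime).ne_zero⟩
  obtain ⟨k, hk, rfl⟩ := hprim.eq_pow_of_pow_eq_one ha
  have hk0 : (k : ZMod p) ≠ 0 := by
    intro h
    rw [ZMod.natCast_eq_zero_iff] at h
    obtain ⟨j, rfl⟩ := h
    exact ha1 (by rw [pow_mul, hbp, one_pow])
  let u : (ZMod p)ˣ := Units.mk0 _ hk0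
  have h2 := R.op_conj hodd (σ := rot p ^ k)
    (by rw [← pow_mul, mul_comm, pow_mul, rot_pow_self, one_pow]) (dil u⁻¹)
  rw [dil_inv_mul_rot u rfl, R.op_pow_of_odd hodd (rot_pow_self p)] at h2
  refine ⟨R.op (dil u⁻¹) v, fun h => hv (R.op_injective _ (by rw [h, map_zero])), ?_⟩
  rw [pow_one, ← End.mul_apply, ← h2, End.mul_apply, End.pow_apply_of_eigen hbv, map_smul]

end prime

theorem Equiv.Perm.viaEmbedding_subtypePerm_support {α : Type} [DecidableEq α] [Fintype α]
    (σ : Perm α) : (σ.subtypePerm (p := (· ∈ σ.support)) fun _ => Perm.apply_mem_support).viaEmbedding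
      (Function.Embedding.subtype (· ∈ σ.support)) = σ := by
  ext x
  by_cases hx : x ∈ σ.support
  · exact Perm.viaEmbedding_apply (ι := Function.Embedding.subtype (· ∈ σ.support)) _ ⟨x, hx⟩
  · rw [Perm.viaEmbedding_apply_of_notMem _ _ _ (by simpa using hx)]
    exact (Perm.notMem_support.1 hx).symm

theorem SpinRep.op_disjoint_perm {α : Type} [DecidableEq α] [Fintype α] {V : Type}
    [AddCommGroup V] [Module ℂ V] (R : SpinRep α V) {σ τ : Perm α} (h : σ.Disjoint τ) :
    R.op σ * R.op τ = twist (Perm.sign σ) (Perm.sign τ) • (R.op τ * R.op σ) := by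
  have h1 := R.op_disjoint (Function.Embedding.subtype (· ∈ σ.support))
    (Function.Embedding.subtype (· ∈ τ.support)) (by
      rintro ⟨x, hx⟩ ⟨y, hy⟩ rfl
      exact Finset.disjoint_left.1 (Perm.disjoint_iff_disjoint_support.1 h) hx hy)
    (σ.subtypePerm fun _ => Perm.apply_mem_support) (τ.subtypePerm fun _ => Perm.apply_mem_support)
  rw [← Perm.sign_viaEmbedding (Function.Embedding.subtype (· ∈ σ.support)),
    ← Perm.sign_viaEmbedding (Function.Embedding.subtype (· ∈ τ.support)),
    Perm.viaEmbedding_subtypePerm_support, Perm.viaEmbedding_subtypePerm_support] at h1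
  exact h1

section wheel

variable (e d : ℕ)

/-- The inclusion of the `i`-th block. -/
def blk (i : ZMod e) : ZMod d ↪ ZMod e × ZMod d := ⟨fun t => (i, t), fun _ _ h => (Prod.mk.inj h).2⟩

@[simp] theorem blk_apply (i : ZMod e) (t : ZMod d) : blk e d i t = (i, t) := rfl

/-- A cycle of length `e * d` whose `e`-th power shifts every block. -/
def wheel : Perm (ZMod e × ZMod d) where
  toFun x := (x.1 + 1, if x.1 = -1 then x.2 + 1 else x.2)
  invFun x := (x.1 - 1, if x.1 = 0 then x.2 - 1 else x.2)
  left_inv x := by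
    ext
    · simp
    · by_cases h : x.1 = -1
      · simp [h]
      · have : x.1 + 1 ≠ 0 := fun h' => h (eq_neg_of_add_eq_zero_left h')
        simp [h, this]
  right_inv x := by
    ext
    · simp
    · by_cases h : x.1 = 0
      · simp [h]
      · have : x.1 - 1 ≠ -1 := fun h' => h (by linear_combination h')
        simp [h, this]

theorem wheel_apply (x : ZMod e × ZMod d) :
    wheel e d x = (x.1 + 1, if x.1 = -1 then x.2 + 1 else x.2) := rfl

/-- The shift of the block `i`. -/
noncomputable def shift (i : ZMod e) : Perm (ZMod e × ZMod d) := (rot d).viaEmbedding (blk e d i)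

theorem shift_apply (i : ZMod e) (x : ZMod e × ZMod d) :
    shift e d i x = (x.1, if x.1 = i then x.2 + 1 else x.2) := by
  obtain ⟨j, t⟩ := x
  by_cases h : j = i
  · subst h
    simpa [shift] using Perm.viaEmbedding_apply (rot d) (blk e d j) t
  · rw [shift, Perm.viaEmbedding_apply_of_notMem]
    · simp [h]
    · rintro ⟨t', ht'⟩
      exact h (Prod.mk.inj ht').1.symm

theorem wheel_mul_shift (i : ZMod e) :
    wheel e d * shift e d i = shift e d (i + 1) * wheel e d := by
  ext x : 1
  simp only [Perm.mul_apply, shift_apply, wheel_apply, add_left_inj]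
  ext
  · rfl
  · simp only
    split_ifs <;> rfl

/-- The simultaneous shift of a set of blocks. -/
def shifts (S : Finset (ZMod e)) : Perm (ZMod e × ZMod d) where
  toFun x := (x.1, if x.1 ∈ S then x.2 + 1 else x.2)
  invFun x := (x.1, if x.1 ∈ S then x.2 - 1 else x.2)
  left_inv x := by ext <;> by_cases h : x.1 ∈ S <;> simp [h]
  right_inv x := by ext <;> by_cases h : x.1 ∈ S <;> simp [h]

theorem shifts_apply (S : Finset (ZMod e)) (x : ZMod e × ZMod d) :
    shifts e d S x = (x.1, if x.1 ∈ S then x.2 + 1 else x.2) := rfl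

theorem shifts_empty : shifts e d ∅ = 1 := by
  ext x : 1; simp [shifts_apply]

theorem shifts_insert {i : ZMod e} {S : Finset (ZMod e)} (h : i ∉ S) :
    shifts e d (insert i S) = shift e d i * shifts e d S := by
  ext x : 1
  simp only [Perm.mul_apply, shift_apply, shifts_apply, Finset.mem_insert]
  ext
  · rfl
  · by_cases h1 : x.1 = i
    · simp [h1, h]
    · simp [h1]

theorem shift_commute_shifts (i : ZMod e) (S : Finset (ZMod e)) :
    Commute (shift e d i) (shifts e d S) := by
  ext x : 1
  simp only [Perm.mul_apply, shift_apply, shifts_apply]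
  ext
  · rfl
  · simp only; split_ifs <;> rfl

theorem wheel_pow_zero [NeZero e] {k : ℕ} (hk : k < e) (t : ZMod d) :
    (wheel e d ^ k) (0, t) = ((k : ZMod e), t) := by
  induction k with
  | zero => simp
  | succ k ih =>
    rw [pow_succ', Perm.mul_apply, ih (by omega), wheel_apply, if_neg]
    · simp
    · intro h
      have h1 : ((k + 1 : ℕ) : ZMod e) = 0 := by
        push_cast; linear_combination h
      rw [ZMod.natCast_eq_zero_iff] at h1
      exact absurd (Nat.le_of_dvd (by omega) h1) (by omega)

theorem wheel_pow_self [NeZero e] : wheel e d ^ e = shifts e d Finset.univ := by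
  have h0 (t : ZMod d) : (wheel e d ^ e) (0, t) = (0, t + 1) := by
    obtain ⟨k, rfl⟩ := Nat.exists_eq_succ_of_ne_zero (NeZero.ne e)
    rw [pow_succ', Perm.mul_apply, wheel_pow_zero _ _ (Nat.lt_succ_self k), wheel_apply, if_pos]
    · have := ZMod.natCast_self (k + 1)
      push_cast at this
      rw [this]
    · have := ZMod.natCast_self (k + 1)
      push_cast at this
      exact eq_neg_of_add_eq_zero_left this
  ext x : 1
  obtain ⟨i, t⟩ := x
  have h1 : (i, t) = (wheel e d ^ i.val) (0, t) := by
    rw [wheel_pow_zero _ _ (ZMod.val_lt i), ZMod.natCast_zmod_val]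
  rw [h1, ← Perm.mul_apply, (Commute.refl (wheel e d)).pow_pow, Perm.mul_apply, h0,
    wheel_pow_zero _ _ (ZMod.val_lt i), wheel_pow_zero _ _ (ZMod.val_lt i), shifts_apply]
  simp

theorem shifts_univ_pow [NeZero e] (n : ℕ) (x : ZMod e × ZMod d) :
    (shifts e d Finset.univ ^ n) x = (x.1, x.2 + n) := by
  induction n with
  | zero => simp
  | succ n ih => 
    rw [pow_succ', Perm.mul_apply, ih, shifts_apply]
    simp [add_assoc]

theorem parts_wheel [NeZero e] [NeZero d] (he : 2 ≤ e) : (wheel e d).parts = {e * d} := by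
  have hne (x : ZMod e × ZMod d) : wheel e d x ≠ x := by
    intro h
    have h1 := congrArg Prod.fst h
    have h2 : (1 : ZMod e) = 0 := by simpa [wheel_apply] using h1
    have h3 := (ZMod.natCast_eq_zero_iff 1 e).1 (by simpa using h2)
    exact absurd (Nat.le_of_dvd one_pos h3) (by omega)
  have hsupp : (wheel e d).support = Finset.univ := by
    ext x; simp [hne x]
  have hcyc : (wheel e d).IsCycle := by
    refine ⟨(0, 0), hne _, fun y _ => ⟨((e * y.2.val + y.1.val : ℕ) : ℤ), ?_⟩⟩
    rw [zpow_natCast, add_comm, pow_add, Perm.mul_apply, pow_mul, wheel_pow_self,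
      shifts_univ_pow, zero_add, wheel_pow_zero _ _ (ZMod.val_lt _), ZMod.natCast_zmod_val,
      ZMod.natCast_zmod_val]
  have hcard : Fintype.card (ZMod e × ZMod d) = e * d := by
    rw [Fintype.card_prod, ZMod.card, ZMod.card]
  rw [Perm.parts, hcyc.cycleType, hsupp, Finset.card_univ, hcard]
  simp

theorem orderOf_wheel [NeZero e] [NeZero d] (he : 2 ≤ e) : orderOf (wheel e d) = e * d := by
  rw [Perm.orderOf_eq_lcm_parts, parts_wheel e d he]; simp

end wheel

section wheelRep

variable {e d : ℕ} [NeZero e] [NeZero d] {V : Type} [AddCommGroup V] [Module ℂ V]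
  (R : SpinRep (ZMod e × ZMod d) V)

/-- The `n`-th powers of the lifts of the block shifts act on `v` through the scalars `w`. -/
def SpinRep.HasWeight (n : ℕ) (w : ZMod e → ℂ) (v : V) : Prop :=
  ∀ i, (R.op (shift e d i) ^ n) v = w i • v

theorem SpinRep.op_shifts_pow (n : ℕ) (S : Finset (ZMod e)) : ∃ s : ℂ, s * s = 1 ∧
    ∀ w v, R.HasWeight n w v → R.op (shifts e d S ^ n) v = (s * ∏ i ∈ S, w i) • v := by
  induction S using Finset.induction_on with
  | empty => exact ⟨1, by simp, fun w v _ => by simp [shifts_empty, R.op_one]⟩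
  | insert i S hi ih =>
    obtain ⟨s, hs, h⟩ := ih
    obtain ⟨t, ht, h1⟩ : SignEq (R.op (shifts e d (insert i S) ^ n))
        (R.op (shifts e d S ^ n) * R.op (shift e d i) ^ n) := by
      rw [shifts_insert e d hi, ((shift_commute_shifts e d i S)).mul_pow,
        ((shift_commute_shifts e d i S).pow_pow n n).eq]
      exact (R.op_mul _ _).trans ((SignEq.refl _).mul (R.op_pow _ _))
    refine ⟨s * t, by linear_combination t * t * hs + ht, fun w v hw => ?_⟩
    rw [h1, LinearMap.smul_apply, End.mul_apply, hw i, map_smul, h w v hw, Finset.prod_insert hi,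
      smul_smul, smul_smul]
    congr 1
    ring

theorem SpinRep.op_wheel_pow (n : ℕ) : ∃ s : ℂ, s * s = 1 ∧
    ∀ w v, R.HasWeight n w v → (R.op (wheel e d) ^ (e * n)) v = (s * ∏ i, w i) • v := by
  obtain ⟨s, hs, h⟩ := R.op_shifts_pow n Finset.univ
  obtain ⟨t, ht, h1⟩ := (R.op_pow (wheel e d) (e * n)).symm
  rw [pow_mul (wheel e d), wheel_pow_self] at h1
  refine ⟨s * t, by linear_combination t * t * hs + ht, fun w v hw => ?_⟩
  rw [h1, LinearMap.smul_apply, h w v hw, smul_smul]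
  congr 1
  ring

theorem SpinRep.op_wheel_mul_shift_sq (i : ZMod e) :
    R.op (wheel e d) * R.op (shift e d i) ^ 2 =
      R.op (shift e d (i + 1)) ^ 2 * R.op (wheel e d) := by
  obtain ⟨s, hs, h⟩ : SignEq (R.op (wheel e d) * R.op (shift e d i))
      (R.op (shift e d (i + 1)) * R.op (wheel e d)) := by
    have := R.op_mul' (wheel e d) (shift e d i)
    rw [wheel_mul_shift] at this
    exact this.trans (R.op_mul _ _)
  rw [pow_two, ← mul_assoc, h, smul_mul_assoc, mul_assoc, h, mul_smul_comm, smul_smul, hs, one_smul,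
    pow_two, mul_assoc]

theorem SpinRep.op_wheel_mul_shift (hd : Odd d) (i : ZMod e) :
    R.op (wheel e d) * R.op (shift e d i) = R.op (shift e d (i + 1)) * R.op (wheel e d) := by
  have hp : shift e d i ^ d = 1 := by
    rw [shift, ← Perm.viaEmbedding_pow, rot_pow_self, Perm.viaEmbedding_one]
  have := R.op_conj hd hp (wheel e d)
  rwa [wheel_mul_shift, mul_inv_cancel_right] at this

/-- If the powers of the lifts of the shifts are permuted by the wheel, so are the weights. -/
theorem SpinRep.HasWeight.wheel_pow {n : ℕ} (hn : ∀ i, R.op (wheel e d) * R.op (shift e d i) ^ n =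
    R.op (shift e d (i + 1)) ^ n * R.op (wheel e d)) {w : ZMod e → ℂ} {v : V}
    (h : R.HasWeight n w v) (j : ℕ) :
    R.HasWeight n (fun i => w (i - j)) ((R.op (wheel e d) ^ j) v) := by
  induction j with
  | zero => simpa using h
  | succ j ih =>
    intro i
    have h1 := hn (i - 1)
    rw [sub_add_cancel] at h1
    rw [pow_succ', End.mul_apply, ← End.mul_apply, ← h1, End.mul_apply, ih (i - 1), map_smul]
    congr 2
    push_cast; ring_nf

theorem SpinRep.HasWeight.exists_wheel_eigenvector {n : ℕ}
    (hn : ∀ i, R.op (wheel e d) * R.op (shift e d i) ^ n =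
      R.op (shift e d (i + 1)) ^ n * R.op (wheel e d)) {w : ZMod e → ℂ} {v : V} (hv : v ≠ 0)
    (h : R.HasWeight n w v) {i₀ : ZMod e} (hi : ∀ i, i ≠ i₀ → w i ≠ w i₀) {a : ℂ} :
    cyclicSum (R.op (wheel e d)) a e v ≠ 0 := by
  refine cyclicSum_ne_zero (X := R.op (shift e d i₀) ^ n) (w := w i₀)
    (Nat.pos_of_ne_zero (NeZero.ne e)) hv (h i₀) fun j hj hje => ?_
  refine ⟨w (i₀ - j), hi _ ?_, h.wheel_pow R hn j i₀⟩
  intro h1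
  have h2 : ((j : ℕ) : ZMod e) = 0 := by linear_combination -h1
  rw [ZMod.natCast_eq_zero_iff] at h2
  exact absurd (Nat.le_of_dvd hj h2) (by omega)

theorem SpinRep.exists_hasWeight [FiniteDimensional ℂ V] [Nontrivial V] {n : ℕ}
    (hσ : Perm.sign (rot d ^ n) = 1) {w : ZMod e → ℂ} (hw : ∀ i, Letter (rot d) n (w i)) :
    ∃ v, v ≠ 0 ∧ R.HasWeight n w v := by
  obtain ⟨v, -, hv, h⟩ := Letter.exists_forall hσ R (blk e d)
    (by intro i j hij x y h; exact hij (Prod.mk.inj h).1) hw ⊤ top_ne_bot (by simp)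
  exact ⟨v, hv, h⟩

end wheelRep

/-- The set of `d`-th roots of unity of which every nontrivial element occurs as an eigenvalue of a
`d`-cycle. -/
def Lettered (d : ℕ) [NeZero d] : Prop := ∀ a : ℂ, a ^ d = 1 → a ≠ 1 → Letter (rot d) 1 a

section words

variable {e d : ℕ}

theorem exists_root_notMem (hd : d ≠ 0) (S : Finset ℂ) (hS : S.card < d) :
    ∃ a : ℂ, a ^ d = 1 ∧ a ∉ S := by
  have h := (Complex.isPrimitiveRoot_exp d hd).card_nthRootsFinset
  obtain ⟨a, ha, haS⟩ := Finset.exists_mem_notMem_of_card_lt_card (h ▸ hS)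
  exact ⟨a, (Polynomial.mem_nthRootsFinset (Nat.pos_of_ne_zero hd) _).1 ha, haS⟩

theorem prod_zmod_word [NeZero e] (he : 2 ≤ e) (b c r : ℂ) :
    ∏ i : ZMod e, (if i = 0 then b else if i = 1 then c else r) = b * c * r ^ (e - 2) := by
  have h1 : (1 : ZMod e) ≠ 0 := by
    intro h
    have h3 := (ZMod.natCast_eq_zero_iff 1 e).1 (by simpa using h)
    exact absurd (Nat.le_of_dvd one_pos h3) (by omega)
  rw [← Finset.mul_prod_erase Finset.univ _ (Finset.mem_univ (0 : ZMod e)),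
    ← Finset.mul_prod_erase (Finset.univ.erase (0 : ZMod e)) _
      (Finset.mem_erase.2 ⟨h1, Finset.mem_univ _⟩), if_pos rfl, if_neg h1, if_pos rfl, ← mul_assoc]
  congr 1
  rw [Finset.prod_congr rfl (g := fun _ => r), Finset.prod_const, Finset.card_erase_of_mem,
    Finset.card_erase_of_mem, Finset.card_univ, ZMod.card, Nat.sub_sub]
  · exact Finset.mem_univ _
  · exact Finset.mem_erase.2 ⟨h1, Finset.mem_univ _⟩
  · intro i hi
    simp only [Finset.mem_erase] at hi
    rw [if_neg hi.2.1, if_neg hi.1]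

/-- There is a word of nontrivial roots of unity with a given product in which the first letter
occurs only once. -/
theorem exists_word [NeZero e] (he : 2 ≤ e) (hd : Odd d) (hd5 : 5 ≤ d) {z : ℂ} (hz : z ^ d = 1) :
    ∃ w : ZMod e → ℂ, (∀ i, w i ^ d = 1 ∧ w i ≠ 1) ∧ (∀ i, i ≠ 0 → w i ≠ w 0) ∧ ∏ i, w i = z := by
  have hd0 : d ≠ 0 := by omega
  obtain ⟨r, hr, hr1⟩ := exists_root_notMem hd0 {1} (by simp; omega)
  have hr0 : r ≠ 0 := by rintro rfl; simp [hd0] at hr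
  set κ := z * (r ^ (e - 2))⁻¹ with hκ
  have hκd : κ ^ d = 1 := by
    rw [hκ, mul_pow, hz, inv_pow, ← pow_mul, mul_comm (e - 2), pow_mul, hr]; simp
  obtain ⟨b, hb, hbS⟩ := exists_root_notMem hd0 {1, κ, r, κ ^ ((d + 1) / 2)}
    (lt_of_le_of_lt Finset.card_le_four (by omega))
  have hb0 : b ≠ 0 := by rintro rfl; simp [hd0] at hb
  simp only [Finset.mem_insert, Finset.mem_singleton, not_or] at hbS
  obtain ⟨hb1, hbκ, hbr, hbs⟩ := hbS
  have hc : ∀ i : ZMod e, i ≠ 0 → (if i = 0 then b else if i = 1 then κ / b else r) =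
      if i = 1 then κ / b else r := fun i hi => if_neg hi
  have hcb : κ / b ≠ b := by
    intro h
    rw [div_eq_iff hb0] at h
    apply hbs
    rw [h, ← pow_two, ← pow_mul, Nat.mul_div_cancel' (by obtain ⟨k, rfl⟩ := hd; exact ⟨k + 1, by ring⟩),
      pow_succ, hb, one_mul]
  refine ⟨fun i => if i = 0 then b else if i = 1 then κ / b else r, fun i => ?_, fun i hi => ?_, ?_⟩
  · dsimp only
    split_ifs
    · exact ⟨hb, hb1⟩
    · refine ⟨by rw [div_pow, hκd, hb, div_one], fun h => hbκ ?_⟩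
      rw [div_eq_one_iff_eq hb0] at h
      exact h.symm
    · exact ⟨hr, by simpa using hr1⟩
  · dsimp only
    rw [if_neg hi, if_pos rfl]
    split_ifs
    · exact hcb
    · exact fun h => hbr h.symm
  · rw [prod_zmod_word he, mul_div_cancel₀ _ hb0, hκ, mul_assoc, inv_mul_cancel₀ (pow_ne_zero _ hr0),
      mul_one]

end words

theorem sign_rot_of_odd {d : ℕ} [NeZero d] (hd : Odd d) : Perm.sign (rot d) = 1 := by
  rw [Perm.sign_eq_parts, parts_rot]
  simpa using hd.add_one.neg_one_pow

theorem Lettered.good_wheel {d e : ℕ} [NeZero e] [NeZero d] (h : Lettered d) (he : 2 ≤ e)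
    (hd : Odd d) (hd5 : 5 ≤ d) : Good (wheel e d) := by
  intro V _ _ _ _ R a ha
  rw [orderOf_wheel e d he] at ha
  obtain ⟨s, hs, hpow⟩ := R.op_wheel_pow 1
  rw [mul_one] at hpow
  have hsign : Perm.sign (rot d ^ 1) = 1 := by rw [pow_one, sign_rot_of_odd hd]
  have hsd : s ^ d = s := by
    obtain ⟨k, rfl⟩ := hd
    rw [pow_succ, pow_mul, pow_two, hs, one_pow, one_mul]
  have ham : a ^ (e * d) = s := by
    obtain ⟨w, hw, -, hprod⟩ := exists_word he hd hd5 (one_pow d)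
    obtain ⟨v, hv, hvw⟩ := R.exists_hasWeight hsign fun i => h _ (hw i).1 (hw i).2
    have h1 := hpow w v hvw
    rw [hprod, mul_one] at h1
    have h2 := End.pow_apply_of_eigen h1 d
    rw [← pow_mul, ha, hsd] at h2
    exact smul_left_injective ℂ hv (by simpa using h2)
  obtain ⟨w, hw, hw0, hprod⟩ := exists_word (z := s * a ^ e) he hd hd5 (by
    rw [mul_pow, hsd, ← pow_mul, ham, hs])
  obtain ⟨v, hv, hvw⟩ := R.exists_hasWeight hsign fun i => h _ (hw i).1 (hw i).2
  have h1 := hpow w v hvw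
  rw [hprod, ← mul_assoc, hs, one_mul] at h1
  have ha0 : a ≠ 0 := by
    rintro rfl
    rw [zero_pow (mul_ne_zero (NeZero.ne e) (NeZero.ne d))] at ham
    rw [← ham] at hs; simp at hs
  exact End.hasEigenvalue_iff_exists.2 ⟨_, hvw.exists_wheel_eigenvector R
    (fun i => by simpa using R.op_wheel_mul_shift hd i) hv hw0, apply_cyclicSum ha0 h1⟩

theorem Lettered.good_rot {d e m : ℕ} [NeZero m] [NeZero d] (h : Lettered d) (he : 2 ≤ e)
    (hd : Odd d) (hd5 : 5 ≤ d) (hm : m = e * d) : Good (rot m) := by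
  have : NeZero e := ⟨by omega⟩
  refine (h.good_wheel he hd hd5).of_parts ?_
  rw [parts_rot, parts_wheel e d he, hm]

theorem lettered_prime {p : ℕ} [NeZero p] (hp : p.Prime) (hp5 : 5 ≤ p) : Lettered p :=
  have : Fact p.Prime := ⟨hp⟩
  fun _ ha ha1 => letter_rot_prime hp5 ha ha1

theorem Good.lettered {d : ℕ} [NeZero d] (h : Good (rot d)) (hd : Odd d) : Lettered d := by
  have ho : orderOf (rot d) = d := by rw [Perm.orderOf_eq_lcm_parts, parts_rot]; simp
  intro a ha _
  exact h.letter (by rwa [ho]) (by rwa [ho])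

theorem SpinRep.op_rot_four_sq_mul_self {V : Type} [AddCommGroup V] [Module ℂ V]
    (R : SpinRep (ZMod 4) V) : R.op (rot 4) ^ 2 * R.op (rot 4) ^ 2 = -1 ∧
      R.op (rot 4) ^ 2 * R.op (swap 0 2) = -(R.op (swap 0 2) * R.op (rot 4) ^ 2) := by
  have hr : rot 4 ^ 2 = swap 0 2 * swap 1 3 := by decide
  have h02 := R.op_swap_sq 0 2 (by decide)
  have h13 := R.op_swap_sq 1 3 (by decide)
  have hanti := R.op_swap_anti 0 2 1 3 (by decide) (by decide) (by decide) (by decide) (by decide)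
    (by decide)
  obtain ⟨s, hs, h⟩ : SignEq (R.op (rot 4) ^ 2) (R.op (swap 0 2) * R.op (swap 1 3)) := by
    refine (R.op_pow _ _).symm.trans ?_
    rw [hr]; exact R.op_mul _ _
  have h3 : R.op (swap 1 3) * R.op (swap 0 2) = -(R.op (swap 0 2) * R.op (swap 1 3)) := by
    rw [hanti, neg_neg]
  rw [h]
  constructor
  · rw [smul_mul_smul_comm, hs, one_smul, mul_assoc, ← mul_assoc (R.op (swap 1 3)), h3, neg_mul,
      mul_assoc, h13, mul_neg, mul_neg, mul_neg, neg_neg, mul_one, h02]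
  · rw [smul_mul_assoc, mul_smul_comm, mul_assoc, h3, mul_neg, smul_neg]

theorem letter_rot_four {a : ℂ} (ha : a * a = -1) : Letter (rot 4) 2 a := by
  intro V _ _ _ _ R
  obtain ⟨h1, h2⟩ := R.op_rot_four_sq_mul_self
  obtain ⟨b, hb⟩ := End.exists_eigenvalue (R.op (rot 4) ^ 2)
  obtain ⟨v, hv, hbv⟩ := End.hasEigenvalue_iff_exists.1 hb
  have hb2 : b * b = -1 := by
    have := congrArg (· v) h1
    simp only [End.mul_apply, hbv, map_smul, smul_smul, LinearMap.neg_apply, End.one_apply] at this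
    exact smul_left_injective ℂ hv (by simpa using this)
  rcases mul_self_eq_mul_self_iff.1 (ha.trans hb2.symm) with rfl | rfl
  · exact ⟨v, hv, hbv⟩
  · refine ⟨R.op (swap 0 2) v, fun h => hv (R.op_injective _ (by rw [h, map_zero])), ?_⟩
    rw [← End.mul_apply, h2, LinearMap.neg_apply, End.mul_apply, hbv, map_smul, neg_smul]

section

variable (e d : ℕ)

/-- The exchange of two blocks. -/
def blockSwap (i j : ZMod e) : Perm (ZMod e × ZMod d) := Equiv.prodCongr (swap i j) (Equiv.refl _)

theorem blockSwap_apply (i j : ZMod e) (x : ZMod e × ZMod d) :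
    blockSwap e d i j x = (swap i j x.1, x.2) := rfl

theorem sign_blockSwap [NeZero e] [NeZero d] {i j : ZMod e} (h : i ≠ j) :
    Perm.sign (blockSwap e d i j) = (-1) ^ d := by
  have : blockSwap e d i j = Equiv.prodCongrLeft (fun _ => swap i j) := by
    ext x : 1; rfl
  rw [this, Perm.sign_prodCongrLeft]
  simp [Perm.sign_swap h, ZMod.card]

theorem blockSwap_mul_shift (i j k : ZMod e) :
    blockSwap e d i j * shift e d k = shift e d (swap i j k) * blockSwap e d i j := by
  ext x : 1
  simp only [Perm.mul_apply, shift_apply, blockSwap_apply, (swap i j).injective.eq_iff]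

theorem blockSwap_mul_self (i j : ZMod e) : blockSwap e d i j * blockSwap e d i j = 1 := by
  ext x : 1
  simp [blockSwap_apply]

theorem disjoint_blockSwap_shifts {i j : ZMod e} {S : Finset (ZMod e)} (hi : i ∉ S) (hj : j ∉ S) :
    (blockSwap e d i j).Disjoint (shifts e d S) := by
  intro x
  by_cases h : x.1 ∈ S
  · left
    rw [blockSwap_apply, swap_apply_of_ne_of_ne]
    · rintro rfl; exact hi h
    · rintro rfl; exact hj h
  · right
    simp [shifts_apply, h]

variable {e d} [NeZero e] [NeZero d] {V : Type} [AddCommGroup V] [Module ℂ V]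

theorem SpinRep.op_wheel_pow_anti [Nontrivial V] (R : SpinRep (ZMod e × ZMod 4) V) {i j : ZMod e}
    (hij : i ≠ j) : R.op (wheel e 4) ^ e * R.op (blockSwap e 4 i j) =
      -(R.op (blockSwap e 4 i j) * R.op (wheel e 4) ^ e) := by
  set S : Finset (ZMod e) := (Finset.univ.erase i).erase j
  have hjS : j ∉ S := Finset.notMem_erase _ _
  have hiS : i ∉ S := fun h => Finset.notMem_erase _ _ (Finset.mem_of_mem_erase h)
  have hijS : i ∉ insert j S := by simp [hij, hiS]
  have huniv : insert i (insert j S) = (Finset.univ : Finset (ZMod e)) := by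
    rw [Finset.insert_erase (Finset.mem_erase.2 ⟨hij.symm, Finset.mem_univ _⟩),
      Finset.insert_erase (Finset.mem_univ _)]
  have hsgn : Perm.sign (rot 4) = -1 := by decide
  have hxy := R.op_disjoint_anti (blk e 4 i) (blk e 4 j) (fun x y h => hij (Prod.mk.inj h).1)
    hsgn hsgn
  have hf := R.op_mul_op_of_swap (f := blockSwap e 4 i j) (x := shift e 4 i) (y := shift e 4 j)
    (by rw [blockSwap_mul_shift, swap_apply_left]) (blockSwap_mul_self _ _ _ _)
  have hS := R.op_disjoint_perm (disjoint_blockSwap_shifts e 4 hiS hjS)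
  rw [sign_blockSwap _ _ hij, show ((-1 : ℤˣ)) ^ 4 = 1 by decide, twist_one_left, one_smul] at hS
  obtain ⟨s, -, h⟩ : SignEq (R.op (wheel e 4) ^ e)
      (R.op (shift e 4 i) * R.op (shift e 4 j) * R.op (shifts e 4 S)) := by
    refine (R.op_pow _ _).symm.trans ?_
    rw [wheel_pow_self, ← huniv, shifts_insert _ _ hijS, shifts_insert _ _ hjS, ← mul_assoc]
    exact (R.op_mul _ _).trans ((R.op_mul _ _).mul (SignEq.refl _))
  change R.op (shift e 4 i) * R.op (shift e 4 j) = -(R.op (shift e 4 j) * R.op (shift e 4 i)) at hxy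
  rw [h, smul_mul_assoc, mul_smul_comm, ← smul_neg, mul_assoc, ← hS, ← mul_assoc, ← mul_assoc, hf,
    hxy]
  simp only [mul_assoc, neg_mul]

theorem good_wheel_four (he : 3 ≤ e) : Good (wheel e 4) := by
  intro V _ _ _ _ R a ha
  rw [orderOf_wheel e 4 (by omega)] at ha
  obtain ⟨s, hs, hpow⟩ := R.op_wheel_pow 2
  have hsign : Perm.sign (rot 4 ^ 2) = 1 := by decide
  have hk (k : ℕ) (h0 : 0 < k) (hk : k < e) : (k : ZMod e) ≠ 0 := by
    rw [Ne, ZMod.natCast_eq_zero_iff]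
    exact fun h => absurd (Nat.le_of_dvd h0 h) (by omega)
  have h1 := hk 1 (by norm_num) (by omega)
  have h2 := hk 2 (by norm_num) (by omega)
  push_cast at h1 h2
  have h12 : (1 : ZMod e) ≠ 2 := fun h => h1 (by linear_combination -h)
  have hI : Complex.I * Complex.I = -1 := Complex.I_mul_I
  have hI0 : (Complex.I : ℂ) ≠ -Complex.I := fun h => Complex.I_ne_zero (by linear_combination h / 2)
  have hlet (w : ZMod e → ℂ) (hw : ∀ i, w i = Complex.I ∨ w i = -Complex.I) (i) :
      Letter (rot 4) 2 (w i) := by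
    apply letter_rot_four
    rcases hw i with h | h <;> rw [h]
    · exact hI
    · rw [neg_mul_neg, hI]
  set w₁ : ZMod e → ℂ := fun i => if i = 0 then -Complex.I else if i = 1 then Complex.I else
    Complex.I with hw₁
  set w₂ : ZMod e → ℂ := fun i => if i = 0 then -Complex.I else if i = 1 then -Complex.I else
    Complex.I with hw₂
  have hl₁ : ∀ i, w₁ i = Complex.I ∨ w₁ i = -Complex.I := by
    intro i; dsimp only [w₁]; split_ifs <;> simp
  have hl₂ : ∀ i, w₂ i = Complex.I ∨ w₂ i = -Complex.I := by
    intro i; dsimp only [w₂]; split_ifs <;> simp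
  have hp₁ : ∏ i, w₁ i = -Complex.I * Complex.I * Complex.I ^ (e - 2) :=
    prod_zmod_word (by omega) _ _ _
  have hp₂ : ∏ i, w₂ i = -Complex.I * -Complex.I * Complex.I ^ (e - 2) :=
    prod_zmod_word (by omega) _ _ _
  have hconj (i : ZMod e) := R.op_wheel_mul_shift_sq i
  have hae : a ^ (e * 2) = s * ∏ i, w₁ i ∨ a ^ (e * 2) = s * ∏ i, w₂ i := by
    obtain ⟨v, hv, hvw⟩ := R.exists_hasWeight hsign (hlet w₁ hl₁)
    have h3 := End.pow_apply_of_eigen (hpow w₁ v hvw) 2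
    rw [← pow_mul, mul_assoc, show 2 * 2 = 4 from rfl, ha, LinearMap.smul_apply,
      End.one_apply] at h3
    have h4 : a ^ (e * 4) = (s * ∏ i, w₁ i) ^ 2 := smul_left_injective ℂ hv h3
    rw [show e * 4 = e * 2 * 2 by ring, pow_mul, sq_eq_sq_iff_eq_or_eq_neg] at h4
    refine h4.imp id fun h => ?_
    rw [h, hp₁, hp₂]; ring
  have ha0 : a ≠ 0 := by
    rintro rfl
    have hs0 : s ≠ 0 := by rintro rfl; simp at hs
    rw [zero_pow (by omega), hp₁, hp₂] at hae
    rcases hae with h | h <;> revert h <;> simp [hs0, Complex.I_ne_zero]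
  have main (w : ZMod e → ℂ) (hw : ∀ i, w i = Complex.I ∨ w i = -Complex.I) (i j : ZMod e)
      (hij : i ≠ j) (hwij : w i = w j) (hprod : a ^ (e * 2) = s * ∏ i, w i) :
      ∃ v, v ≠ 0 ∧ R.HasWeight 2 w v ∧ (R.op (wheel e 4) ^ e) v = a ^ e • v := by
    obtain ⟨v, hv, hvw⟩ := R.exists_hasWeight hsign (hlet w hw)
    set C := R.op (wheel e 4) ^ e with hC
    have hCC : C (C v) = (a ^ e * a ^ e) • v := by
      have h3 := hpow w v hvw
      rw [← hprod, mul_two, pow_add, pow_add, End.mul_apply] at h3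
      exact h3
    have hCw : R.HasWeight 2 w (C v) := by
      have h3 := hvw.wheel_pow R hconj e
      simpa using h3
    by_cases h : C v + a ^ e • v = 0
    · have hfi : ∀ k, w (swap i j k) = w k := by
        intro k
        by_cases hk : k = i
        · rw [hk, swap_apply_left, hwij]
        · by_cases hk' : k = j
          · rw [hk', swap_apply_right, hwij]
          · rw [swap_apply_of_ne_of_ne hk hk']
      refine ⟨R.op (blockSwap e 4 i j) v, fun h => hv (R.op_injective _ (by rw [h, map_zero])),
        fun k => ?_, ?_⟩
      · obtain ⟨t, ht, h3⟩ : SignEq (R.op (shift e 4 k) * R.op (blockSwap e 4 i j))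
            (R.op (blockSwap e 4 i j) * R.op (shift e 4 (swap i j k))) := by
          have h3 := R.op_mul' (shift e 4 k) (blockSwap e 4 i j)
          have h4 := blockSwap_mul_shift e 4 i j (swap i j k)
          rw [show swap i j (swap i j k) = k by simp [← Perm.mul_apply]] at h4
          rw [← h4] at h3
          exact h3.trans (R.op_mul _ _)
        have h5 : R.op (shift e 4 k) ^ 2 * R.op (blockSwap e 4 i j) =
            R.op (blockSwap e 4 i j) * R.op (shift e 4 (swap i j k)) ^ 2 := by
          rw [pow_two, mul_assoc, h3, mul_smul_comm, ← mul_assoc, h3, smul_mul_assoc, smul_smul, ht,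
            one_smul, mul_assoc, pow_two]
        rw [← End.mul_apply, h5, End.mul_apply, hvw, map_smul, hfi]
      · rw [← End.mul_apply, R.op_wheel_pow_anti hij, LinearMap.neg_apply, End.mul_apply,
          eq_neg_of_add_eq_zero_left h, map_neg, neg_neg, map_smul]
    · refine ⟨_, h, fun k => ?_, ?_⟩
      · rw [map_add, map_smul, hCw k, hvw k]; module
      · rw [map_add, map_smul, hCC]; module
  rcases hae with hae | hae
  · obtain ⟨v, hv, hvw, hCv⟩ := main w₁ hl₁ 1 2 h12 (by simp [w₁, h1, h2]) hae
    refine End.hasEigenvalue_iff_exists.2 ⟨_, hvw.exists_wheel_eigenvector R hconj hv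
      (i₀ := 0) fun i hi => ?_, apply_cyclicSum ha0 hCv⟩
    simpa [w₁, hi] using hI0
  · obtain ⟨v, hv, hvw, hCv⟩ := main w₂ hl₂ 0 1 h1.symm (by simp [w₂, h1]) hae
    refine End.hasEigenvalue_iff_exists.2 ⟨_, cyclicSum_ne_zero
      (X := R.op (shift e 4 0) ^ 2 + (2 : ℂ) • R.op (shift e 4 1) ^ 2) (w := w₂ 0 + 2 * w₂ 1)
      (by omega) hv ?_ fun j hj hje => ⟨w₂ (0 - j) + 2 * w₂ (1 - j), ?_, ?_⟩, apply_cyclicSum ha0 hCv⟩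
    · rw [LinearMap.add_apply, LinearMap.smul_apply, hvw 0, hvw 1]; module
    · have hj0 := hk j hj hje
      have h3 : ((0 : ZMod e) - j = 0) ↔ False := by simpa using hj0
      have h4 : ((1 : ZMod e) - j = 1) ↔ False := by simpa using hj0
      have h5 : ¬ ((0 : ZMod e) - j = 1 ∧ 1 - (j : ZMod e) = 0) := by
        rintro ⟨h5, h6⟩
        exact h2 (by linear_combination h6 - h5)
      have hI' := Complex.I_ne_zero
      simp only [w₂, h3, h4, if_false, if_true, h1]
      intro h
      by_cases h6 : (0 : ZMod e) - j = 1 <;> by_cases h7 : (1 : ZMod e) - j = 0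
      · exact h5 ⟨h6, h7⟩
      all_goals
        simp only [h6, h7, if_true, if_false] at h
        apply hI'
        first
          | linear_combination h / 2
          | linear_combination h / 4
          | linear_combination h / 6
    · have h3 := hvw.wheel_pow R hconj j
      rw [LinearMap.add_apply, LinearMap.smul_apply, h3 0, h3 1]; module

end

theorem Module.End.pow_eq_one_of_eigen {V : Type} [AddCommGroup V] [Module ℂ V] {A : End ℂ V}
    {n : ℕ} (h : A ^ n = 1) {a : ℂ} {v : V} (hv : v ≠ 0) (hav : A v = a • v) : a ^ n = 1 := by
  have := End.pow_apply_of_eigen hav n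
  rw [h, End.one_apply] at this
  exact (smul_left_injective ℂ hv (by simpa using this)).symm

section sixPoints

variable {V : Type} [AddCommGroup V] [Module ℂ V]

theorem Module.End.apply_eq_neg_apply_inv {P B B' U : End ℂ V} (hB : B' * B = 1) (hU : P * U = P)
    (h : B * U * (B * U) = -1) {v : V} (hv : U v = v) : P (B v) = -P (B' v) := by
  have h1 : U * B * U = -B' := by
    rw [← mul_one (-B'), neg_mul_comm, ← h, mul_assoc B, ← mul_assoc, hB, one_mul, mul_assoc]
  have h2 := congrArg (fun A : End ℂ V => P (A v)) h1
  simp only [End.mul_apply, hv, LinearMap.neg_apply, map_neg] at h2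
  rw [← h2, ← End.mul_apply P U, hU]

theorem SpinRep.op_mul_op_sq {α : Type} [DecidableEq α] [Fintype α] (R : SpinRep α V)
    {σ τ : Perm α} {a b c d : α} (h : σ * τ = swap a b * swap c d) (hab : a ≠ b)
    (hcd : c ≠ d) (hac : a ≠ c) (had : a ≠ d) (hbc : b ≠ c) (hbd : b ≠ d) :
    R.op σ * R.op τ * (R.op σ * R.op τ) = -1 := by
  obtain ⟨s, hs, h1⟩ : SignEq (R.op σ * R.op τ) (R.op (swap a b) * R.op (swap c d)) :=
    (R.op_mul' σ τ).trans (h ▸ R.op_mul _ _)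
  have h2 := R.op_swap_anti a b c d hab hcd hac had hbc hbd
  rw [h1, smul_mul_smul_comm, hs, one_smul]
  nth_rw 2 [h2]
  rw [mul_neg, mul_assoc, ← mul_assoc (R.op (swap c d)), R.op_swap_sq c d hcd, ← mul_assoc,
    mul_neg_one, neg_mul, R.op_swap_sq a b hab, neg_neg]

/-- If two disjoint 3-cycles never act nontrivially together on six points, then they have no
common fixed vector. -/
theorem SpinRep.eq_zero_of_threeCycles_fixed (R : SpinRep (Fin 6) V)
    (h : ∀ v, (R.op (swap 0 1 * swap 1 2) - 1) ((R.op (swap 3 4 * swap 4 5) - 1) v) = 0) {v : V}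
    (hx : R.op (swap 0 1 * swap 1 2) v = v) (hy : R.op (swap 3 4 * swap 4 5) v = v) : v = 0 := by
  set x : Perm (Fin 6) := swap 0 1 * swap 1 2 with hxd
  set y : Perm (Fin 6) := swap 3 4 * swap 4 5 with hyd
  set x' : Perm (Fin 6) := swap 0 1 * swap 1 3 with hxd'
  set y' : Perm (Fin 6) := swap 2 4 * swap 4 5 with hyd'
  have h3 : Odd 3 := by decide
  have ex : x ^ 3 = 1 := by decide
  have ey : y ^ 3 = 1 := by decide
  have ex' : x' ^ 3 = 1 := by decide
  have ey' : y' ^ 3 = 1 := by decide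
  have hc : Commute x y := by unfold Commute SemiconjBy; decide
  have hc' : Commute x' y' := by unfold Commute SemiconjBy; decide
  have hX := R.op_pow_eq_one h3 ex
  have hY := R.op_pow_eq_one h3 ey
  have hX' := R.op_pow_eq_one h3 ex'
  have hY' := R.op_pow_eq_one h3 ey'
  have hC := R.op_comm_of_odd h3 ex hc
  have hC' := R.op_comm_of_odd h3 ex' hc'
  have hxy : R.op (x' * y') = R.op x' * R.op y' := R.op_mul_of_odd h3 ex' ey' hc'
  have hxy' : R.op (x' * y' ^ 2) = R.op x' * R.op y' ^ 2 := by
    rw [R.op_mul_of_odd h3 ex' (by rw [← pow_mul, mul_comm, pow_mul, ey', one_pow])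
      (hc'.pow_right 2), R.op_pow_of_odd h3 ey']
  have hU (i j : ℕ) : R.op (x ^ i * y ^ j) = R.op x ^ i * R.op y ^ j := by
    rw [R.op_mul_of_odd h3 (by rw [← pow_mul, mul_comm, pow_mul, ex, one_pow])
      (by rw [← pow_mul, mul_comm, pow_mul, ey, one_pow])
      (hc.pow_pow i j), R.op_pow_of_odd h3 ex, R.op_pow_of_odd h3 ey]
  set P : End ℂ V := (1 + R.op x + R.op x ^ 2) * (1 + R.op y + R.op y ^ 2) with hP
  have hPY : P * R.op y = P := by
    rw [hP, mul_assoc]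
    congr 1
    rw [add_mul, add_mul, one_mul, ← pow_succ, hY, ← pow_two]; abel
  have hPX : P * R.op x = P := by
    rw [hP, mul_assoc, ← ((Commute.one_right (R.op x)).add_right hC |>.add_right
      (hC.pow_right 2)).eq, ← mul_assoc]
    congr 1
    rw [add_mul, add_mul, one_mul, ← pow_succ, hX, ← pow_two]; abel
  have hPU (i j : ℕ) : P * R.op (x ^ i * y ^ j) = P := by
    have h1 (i : ℕ) : P * R.op x ^ i = P := by
      induction i with
      | zero => simp
      | succ i ih => rw [pow_succ, ← mul_assoc, ih, hPX]
    have h2 (i : ℕ) : P * R.op y ^ i = P := by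
      induction i with
      | zero => simp
      | succ i ih => rw [pow_succ, ← mul_assoc, ih, hPY]
    rw [hU, ← mul_assoc, h1, h2]
  have hvU (i j : ℕ) : R.op (x ^ i * y ^ j) v = v := by
    have h1 := End.pow_apply_of_eigen (b := 1) (by rwa [one_smul] : R.op x v = (1 : ℂ) • v) i
    have h2 := End.pow_apply_of_eigen (b := 1) (by rwa [one_smul] : R.op y v = (1 : ℂ) • v) j
    rw [one_pow, one_smul] at h1 h2
    rw [hU, End.mul_apply, h2, h1]
  have k1 := End.apply_eq_neg_apply_inv (P := P) (B := R.op x') (B' := R.op x' ^ 2)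
    (by rw [← pow_succ, hX']) (hPU 1 0)
    (R.op_mul_op_sq (a := 0) (b := 3) (c := 1) (d := 2) (by decide) (by decide) (by decide)
      (by decide) (by decide) (by decide) (by decide)) (hvU 1 0)
  have k2 := End.apply_eq_neg_apply_inv (P := P) (B := R.op y') (B' := R.op y' ^ 2)
    (by rw [← pow_succ, hY']) (hPU 0 1)
    (R.op_mul_op_sq (a := 2) (b := 4) (c := 3) (d := 5) (by decide) (by decide) (by decide)
      (by decide) (by decide) (by decide) (by decide)) (hvU 0 1)
  have k3 := End.apply_eq_neg_apply_inv (P := P) (B := R.op (x' * y'))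
    (B' := R.op x' ^ 2 * R.op y' ^ 2)
    (by rw [hxy, ← hC'.mul_pow, ← pow_succ, hC'.mul_pow, hX', hY', one_mul]) (hPU 2 2)
    (R.op_mul_op_sq (a := 0) (b := 4) (c := 2) (d := 3) (by decide) (by decide) (by decide)
      (by decide) (by decide) (by decide) (by decide)) (hvU 2 2)
  have k4 := End.apply_eq_neg_apply_inv (P := P) (B := R.op (x' * y' ^ 2))
    (B' := R.op x' ^ 2 * R.op y')
    (by rw [hxy', mul_assoc, ← mul_assoc (R.op y'), (hC'.symm.eq), mul_assoc, ← mul_assoc,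
      ← pow_succ, hX', ← pow_succ', hY', one_mul]) (hPU 2 1)
    (R.op_mul_op_sq (a := 0) (b := 5) (c := 2) (d := 3) (by decide) (by decide) (by decide)
      (by decide) (by decide) (by decide) (by decide)) (hvU 2 1)
  have h' (u : V) : R.op x' (R.op y' u) = R.op x' u + R.op y' u - u := by
    obtain ⟨G, hG⟩ := R.isUnit_op (swap 2 3)
    have e1 := R.op_conj h3 ex (swap 2 3)
    have e2 := R.op_conj h3 ey (swap 2 3)
    rw [show swap 2 3 * x * (swap 2 3)⁻¹ = x' by decide, ← hG] at e1
    rw [show swap 2 3 * y * (swap 2 3)⁻¹ = y' by decide, ← hG] at e2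
    have e3 (w : V) : R.op x' (G.val w) = G.val (R.op x w) := (congrArg (· w) e1).symm
    have e4 (w : V) : R.op y' (G.val w) = G.val (R.op y w) := (congrArg (· w) e2).symm
    have e5 := congrArg G.val (h (G.inv u))
    have e6 : G.val (G.inv u) = u := congrArg (· u) G.val_inv
    simp only [LinearMap.sub_apply, End.one_apply, map_sub, ← e3, ← e4, e6, map_zero] at e5
    rw [← sub_eq_zero, ← e5]; abel
  have key : (R.op x' * R.op y' + R.op x' ^ 2 * R.op y' ^ 2 + (R.op x' * R.op y' ^ 2 +
      R.op x' ^ 2 * R.op y')) v = (2 : ℂ) • (R.op x' v + (R.op x' ^ 2) v) +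
        (2 : ℂ) • (R.op y' v + (R.op y' ^ 2) v) - (4 : ℂ) • v := by
    have hc (u : V) : R.op y' (R.op x' u) = R.op x' (R.op y' u) := (congrArg (· u) hC').symm
    simp only [LinearMap.add_apply, End.mul_apply, pow_two, h', map_add, map_sub]
    module
  have key' := congrArg P key
  rw [← hxy, ← hxy'] at key'
  simp only [LinearMap.add_apply, map_add, map_sub, map_smul, k1, k2, k3, k4] at key'
  have hPv : P v = (9 : ℂ) • v := by
    simp only [hP, End.mul_apply, LinearMap.add_apply, End.one_apply, pow_two, map_add, hx, hy]
    module
  rw [hPv] at key'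
  simpa using key'

end sixPoints

section ninePoints

variable {V : Type} [AddCommGroup V] [Module ℂ V] [FiniteDimensional ℂ V] [Nontrivial V]
  (R : SpinRep (ZMod 3 × ZMod 3) V)

theorem shift_three (i : ZMod 3) : shift 3 3 i = swap (i, 0) (i, 1) * swap (i, 1) (i, 2) := by
  ext x : 1
  rw [shift_apply]
  revert i x
  decide

theorem SpinRep.op_shift_three_ne_one (i : ZMod 3) : R.op (shift 3 3 i) ≠ 1 := by
  have h1 : i ≠ i + 1 := by revert i; decide
  rw [shift_three]
  exact R.op_threeCycle_ne_one (d := (i + 1, 0)) (by simp) (by revert i; decide) (by revert i; decide) (by simp)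
    (by simp [h1]) (by simp [h1])

theorem SpinRep.op_translation_ne_one : R.op (Equiv.addRight ((0, 1) : ZMod 3 × ZMod 3)) ≠ 1 := by
  intro h
  have h3 : Odd 3 := by decide
  let f : Perm (ZMod 3 × ZMod 3) := swap (0, 0) (0, 1)
  have e1 := R.op_conj h3 (σ := Equiv.addRight ((0, 1) : ZMod 3 × ZMod 3)) (by decide) f
  obtain ⟨u, hu⟩ := R.isUnit_op f
  rw [h, mul_one, ← hu] at e1
  have e2 : R.op (f * Equiv.addRight ((0, 1) : ZMod 3 × ZMod 3) * f⁻¹) = 1 := by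
    simpa using (congrArg (· * (↑u⁻¹ : End ℂ V)) e1).symm
  have e3 : SignEq (R.op (shift 3 3 0 ^ 2)) 1 := by
    have e4 := R.op_mul (shift 3 3 0 ^ 2) (f * Equiv.addRight ((0, 1) : ZMod 3 × ZMod 3) * f⁻¹)
    rw [e2, mul_one, shift_three, show (swap ((0 : ZMod 3), (0 : ZMod 3)) (0, 1) *
      swap (0, 1) (0, 2)) ^ 2 * (f * Equiv.addRight ((0, 1) : ZMod 3 × ZMod 3) * f⁻¹) =
      Equiv.addRight ((0, 1) : ZMod 3 × ZMod 3) by decide, h, ← shift_three] at e4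
    exact e4.symm
  have e5 : shift 3 3 0 ^ 3 = 1 := by rw [shift_three]; decide
  have e6 := R.op_eq_of_signEq h3 (by rw [← pow_mul, mul_comm, pow_mul, e5, one_pow])
    (one_pow 3) e3
  refine R.op_shift_three_ne_one 0 ?_
  rw [R.op_pow_of_odd h3 e5] at e6
  have e7 := R.op_pow_eq_one h3 e5
  rwa [pow_succ, e6, one_mul] at e7

/-- A linear map of the plane over `ZMod 3`. -/
def planeMap (j : ℕ) : Perm (ZMod 3 × ZMod 3) where
  toFun x := (x.2, x.1 + j * x.2)
  invFun x := (x.2 - j * x.1, x.1)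
  left_inv x := by ext <;> simp
  right_inv x := by ext <;> simp

theorem SpinRep.exists_translation_fixed_ne :
    ∃ v, R.op (Equiv.addRight ((0, 1) : ZMod 3 × ZMod 3)) v = v ∧
      R.op (Equiv.addRight ((1, 0) : ZMod 3 × ZMod 3)) v ≠ v := by
  by_contra! h
  set X := R.op (Equiv.addRight ((0, 1) : ZMod 3 × ZMod 3)) with hX
  set S := R.op (Equiv.addRight ((1, 0) : ZMod 3 × ZMod 3)) with hS
  have h3 : Odd 3 := by decide
  have hX3 : X ^ 3 = 1 := R.op_pow_eq_one h3 (by decide)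
  have hS3 : S ^ 3 = 1 := R.op_pow_eq_one h3 (by decide)
  have hXS : Commute X S := R.op_comm_of_odd h3 (by decide) (by unfold Commute SemiconjBy; decide)
  have key (j : ℕ) (hj : j < 3) (v : V) (hv : S ((X ^ j) v) = v) : X v = v := by
    set g := planeMap j with hg
    have e1 := R.op_conj h3 (σ := Equiv.addRight ((0, 1) : ZMod 3 × ZMod 3)) (by decide) g
    have e2 := R.op_conj h3 (σ := Equiv.addRight ((1, 0) : ZMod 3 × ZMod 3)) (by decide) g
    have e3 : planeMap j * Equiv.addRight ((0, 1) : ZMod 3 × ZMod 3) * (planeMap j)⁻¹ =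
        Equiv.addRight ((1, 0) : ZMod 3 × ZMod 3) * Equiv.addRight ((0, 1) : ZMod 3 × ZMod 3) ^ j := by
      interval_cases j <;> decide
    have e4 : planeMap j * Equiv.addRight ((1, 0) : ZMod 3 × ZMod 3) * (planeMap j)⁻¹ =
        Equiv.addRight ((0, 1) : ZMod 3 × ZMod 3) := by
      interval_cases j <;> decide
    have e5 : R.op (Equiv.addRight ((1, 0) : ZMod 3 × ZMod 3) *
        Equiv.addRight ((0, 1) : ZMod 3 × ZMod 3) ^ j) = S * X ^ j := by
      rw [R.op_mul_of_odd h3 (by decide) (by interval_cases j <;> decide)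
        (by unfold Commute SemiconjBy; interval_cases j <;> decide),
        R.op_pow_of_odd h3 (by decide)]
    rw [hg, e3, e5, ← hg] at e1
    rw [hg, e4, ← hg] at e2
    obtain ⟨G, hG⟩ := R.isUnit_op g
    have e6 : G.val (G.inv v) = v := congrArg (· v) G.val_inv
    have e7 : X (G.inv v) = G.inv v := by
      apply R.op_injective g
      have := congrArg (· (G.inv v)) e1
      simp only [End.mul_apply, ← hG, e6, hv] at this ⊢
      exact this
    have e8 := congrArg (· (G.inv v)) e2
    simp only [End.mul_apply, ← hG, e6] at e8
    rw [hX, ← e8, ← hS, h _ e7, e6]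
  obtain ⟨r, w, hr1, hw, hrw⟩ := exists_eigenvector_ne_one_of_pow_eq_one three_ne_zero hX3
    R.op_translation_ne_one
  obtain ⟨s, v, hvr, hv, hsv⟩ := End.exists_eigenvector_mem S _ (End.eigenspace_ne_bot hw hrw)
    (End.eigenspace_stable hXS.symm r)
  rw [End.mem_eigenspace_iff] at hvr
  have hr := End.pow_eq_one_of_eigen hX3 hv hvr
  have hs := End.pow_eq_one_of_eigen hS3 hv hsv
  obtain ⟨j, hj, hjs⟩ : ∃ j < 3, r ^ j * s = 1 := by
    have hp : IsPrimitiveRoot r 3 := by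
      have := orderOf_eq_prime hr hr1
      rw [← this]; exact IsPrimitiveRoot.orderOf r
    obtain ⟨j, hj, rfl⟩ := hp.eq_pow_of_pow_eq_one hs
    interval_cases j
    · exact ⟨0, by simp⟩
    · exact ⟨2, by norm_num, by rw [← pow_add]; exact hr⟩
    · exact ⟨1, by norm_num, by rw [← pow_add]; exact hr⟩
  have := key j hj v (by rw [End.pow_apply_of_eigen hvr, map_smul, hsv, smul_smul, hjs, one_smul])
  rw [hvr] at this
  exact hr1 (smul_left_injective ℂ hv (by simpa using this))

end ninePoints

/-- Three commuting operators have a common eigenvector in any nonzero invariant subspace. -/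
theorem Module.End.exists_common_eigenvector {V : Type} [AddCommGroup V] [Module ℂ V]
    [FiniteDimensional ℂ V] {A B C : End ℂ V} (hAB : Commute A B) (hAC : Commute A C)
    (hBC : Commute B C) {M : Submodule ℂ V} (hM : M ≠ ⊥) (hA : ∀ v ∈ M, A v ∈ M)
    (hB : ∀ v ∈ M, B v ∈ M) (hC : ∀ v ∈ M, C v ∈ M) :
    ∃ (a b c : ℂ) (v : V), v ∈ M ∧ v ≠ 0 ∧ A v = a • v ∧ B v = b • v ∧ C v = c • v := by
  have step {M : Submodule ℂ V} {X : End ℂ V} {x : ℂ} {u : V} (huM : u ∈ M) (hu : u ≠ 0)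
      (hx : X u = x • u) : M ⊓ X.eigenspace x ≠ ⊥ := fun h => hu (by
    have : u ∈ M ⊓ X.eigenspace x := ⟨huM, End.mem_eigenspace_iff.2 hx⟩
    rwa [h, Submodule.mem_bot] at this)
  obtain ⟨a, u, huM, hu, ha⟩ := End.exists_eigenvector_mem A M hM hA
  obtain ⟨b, w, ⟨hwM, hwa⟩, hw, hb⟩ := End.exists_eigenvector_mem B _ (step huM hu ha)
    fun v hv => ⟨hB v hv.1, End.eigenspace_stable hAB.symm a v hv.2⟩
  obtain ⟨c, v, ⟨⟨hvM, hva⟩, hvb⟩, hv, hc⟩ := End.exists_eigenvector_mem C _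
    (step (M := M ⊓ A.eigenspace a) ⟨hwM, hwa⟩ hw hb)
    fun v hv => ⟨⟨hC v hv.1.1, End.eigenspace_stable hAC.symm a v hv.1.2⟩,
      End.eigenspace_stable hBC.symm b v hv.2⟩
  exact ⟨a, b, c, v, hvM, hv, End.mem_eigenspace_iff.1 hva, End.mem_eigenspace_iff.1 hvb, hc⟩

theorem Module.End.apply_eq_self_of_fixed {V : Type} [AddCommGroup V] [Module ℂ V] {A : End ℂ V}
    {p : ℕ} (hp : p ≠ 0) (h : A ^ p = 1) {y : V} (hy : A (A y - y) = A y - y) : A y = y := by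
  have h1 (n : ℕ) : (A ^ n) y = y + (n : ℂ) • (A y - y) := by
    induction n with
    | zero => simp
    | succ n ih =>
      rw [pow_succ', End.mul_apply, ih, map_add, map_smul, hy]
      push_cast
      module
  have h2 := h1 p
  rw [h, End.one_apply, left_eq_add, smul_eq_zero, Nat.cast_eq_zero] at h2
  exact sub_eq_zero.1 (h2.resolve_left hp)

namespace SpinRep

section nine

variable {V : Type} [AddCommGroup V] [Module ℂ V] (R : SpinRep (ZMod 3 × ZMod 3) V)

theorem apply_conj {α : Type} [DecidableEq α] [Fintype α] (R : SpinRep α V) {σ τ : Perm α} {k : ℕ}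
    (hk : Odd k) (hσ : σ ^ k = 1) (f : Perm α) (h : f * σ * f⁻¹ = τ) {r : ℂ} {v : V}
    (hv : R.op σ v = r • v) : R.op τ (R.op f v) = r • R.op f v := by
  have h1 := congrArg (· v) (R.op_conj hk hσ f)
  simp only [End.mul_apply, h, hv, map_smul] at h1
  exact h1.symm

/-- The scalars `r`, `s`, `t` are the eigenvalues of the three shifts on a common eigenvector. -/
def HasTriple (r s t : ℂ) : Prop :=
  ∃ v, v ≠ 0 ∧ R.op (shift 3 3 0) v = r • v ∧ R.op (shift 3 3 1) v = s • v ∧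
    R.op (shift 3 3 2) v = t • v

theorem shift_three_pow (i : ZMod 3) : shift 3 3 i ^ 3 = 1 := by
  rw [shift_three]; revert i; decide

theorem op_shift_three_sq (i : ZMod 3) : R.op (shift 3 3 i ^ 2) = R.op (shift 3 3 i) ^ 2 :=
  R.op_pow_of_odd (by decide : Odd 3) (shift_three_pow i) 2

theorem shift_three_sq_pow (i : ZMod 3) : (shift 3 3 i ^ 2) ^ 3 = 1 := by
  rw [← pow_mul, mul_comm, pow_mul, shift_three_pow, one_pow]

theorem op_shift_three_commute (i j : ZMod 3) :
    Commute (R.op (shift 3 3 i)) (R.op (shift 3 3 j)) := by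
  refine R.op_comm_of_odd (by decide : Odd 3) (shift_three_pow i) ?_
  unfold Commute SemiconjBy
  rw [shift_three, shift_three]; revert i j; decide

variable {R} {r s t : ℂ}

theorem HasTriple.sq (h : R.HasTriple r s t) : R.HasTriple (r ^ 2) s t := by
  obtain ⟨v, hv, h0, h1, h2⟩ := h
  have h3 : Odd 3 := by decide
  let f : Perm (ZMod 3 × ZMod 3) := swap (0, 0) (0, 1)
  refine ⟨R.op f v, fun h => hv (R.op_injective f (by rw [h, map_zero])),
    R.apply_conj h3 (shift_three_sq_pow 0) f (by rw [shift_three]; decide) ?_,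
    R.apply_conj h3 (shift_three_pow 1) f (by rw [shift_three]; decide) h1,
    R.apply_conj h3 (shift_three_pow 2) f (by rw [shift_three]; decide) h2⟩
  rw [op_shift_three_sq, End.pow_apply_of_eigen h0]

theorem HasTriple.rotate (h : R.HasTriple r s t) : R.HasTriple t r s := by
  obtain ⟨v, hv, h0, h1, h2⟩ := h
  have h3 : Odd 3 := by decide
  let f : Perm (ZMod 3 × ZMod 3) := Equiv.addRight (1, 0)
  exact ⟨R.op f v, fun h => hv (R.op_injective f (by rw [h, map_zero])),
    R.apply_conj h3 (shift_three_pow 2) f (by rw [shift_three, shift_three]; decide) h2,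
    R.apply_conj h3 (shift_three_pow 0) f (by rw [shift_three, shift_three]; decide) h0,
    R.apply_conj h3 (shift_three_pow 1) f (by rw [shift_three, shift_three]; decide) h1⟩

theorem HasTriple.pow_three (h : R.HasTriple r s t) : r ^ 3 = 1 ∧ s ^ 3 = 1 ∧ t ^ 3 = 1 := by
  obtain ⟨v, hv, h0, h1, h2⟩ := h
  have h3 (i : ZMod 3) := R.op_pow_eq_one (by decide : Odd 3) (shift_three_pow i)
  exact ⟨End.pow_eq_one_of_eigen (h3 0) hv h0, End.pow_eq_one_of_eigen (h3 1) hv h1,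
    End.pow_eq_one_of_eigen (h3 2) hv h2⟩

theorem HasTriple.hasEigenvalue (h : R.HasTriple r s t) (hrs : r ≠ s) (hrt : r ≠ t) {a : ℂ}
    (ha : a ^ 3 = r * s * t) : End.HasEigenvalue (R.op (wheel 3 3)) a := by
  obtain ⟨hr3, hs3, ht3⟩ := h.pow_three
  obtain ⟨v, hv, h0, h1, h2⟩ := h
  have hn (i : ZMod 3) : R.op (wheel 3 3) * R.op (shift 3 3 i) ^ 1 =
      R.op (shift 3 3 (i + 1)) ^ 1 * R.op (wheel 3 3) := by
    rw [pow_one, pow_one]; exact R.op_wheel_mul_shift (by decide) i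
  have hw : R.HasWeight 1 (fun i : ZMod 3 => if i = 0 then r else if i = 1 then s else t) v := by
    intro i
    rw [pow_one]
    fin_cases i
    exacts [h0, h1, h2]
  obtain ⟨ε, hε, hpow⟩ := R.op_wheel_pow 1
  have h4 := hpow _ v hw
  rw [prod_zmod_word (by norm_num), mul_one, show 3 - 2 = 1 from rfl, pow_one, ← ha] at h4
  have ha9 : a ^ 9 = 1 := by
    rw [show 9 = 3 * 3 from rfl, pow_mul, ha, mul_pow, mul_pow, hr3, hs3, ht3]; norm_num
  have hε1 : ε = 1 := by
    have h5 := End.pow_apply_of_eigen h4 3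
    have h6 : wheel 3 3 ^ (3 * 3) = 1 := by
      have := pow_orderOf_eq_one (wheel 3 3)
      rwa [orderOf_wheel 3 3 (by norm_num)] at this
    rw [← pow_mul, R.op_pow_eq_one (by decide : Odd (3 * 3)) h6, End.one_apply] at h5
    have h7 : 1 = (ε * a ^ 3) ^ 3 := smul_left_injective ℂ hv (by simpa using h5)
    rcases mul_self_eq_one_iff.1 hε with h8 | h8
    · exact h8
    · rw [h8, mul_pow, ← pow_mul, ha9] at h7
      norm_num at h7
  rw [hε1, one_mul] at h4
  have ha0 : a ≠ 0 := by rintro rfl; norm_num at ha9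
  refine End.hasEigenvalue_iff_exists.2 ⟨_, hw.exists_wheel_eigenvector R hn hv (i₀ := 0) ?_,
    apply_cyclicSum ha0 h4⟩
  intro i hi
  simp only [hi, if_false, if_true]
  split_ifs
  exacts [hrs.symm, hrt.symm]

variable (R) [FiniteDimensional ℂ V]

theorem exists_hasTriple [Nontrivial V] (hr : r ^ 3 = 1) (hr1 : r ≠ 1) (hs : s ^ 3 = 1)
    (hs1 : s ≠ 1) : ∃ t, R.HasTriple r s t := by
  let e : Fin 7 ↪ ZMod 3 × ZMod 3 :=
    ⟨![(0, 0), (0, 1), (0, 2), (1, 0), (1, 1), (1, 2), (2, 0)], by decide⟩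
  obtain ⟨v, hv, h0, h1⟩ := (R.comap e).exists_eigenvector_two_threeCycles hr hr1 hs hs1
  rw [comap_op, Perm.viaEmbedding_mul, Perm.viaEmbedding_swap, Perm.viaEmbedding_swap] at h0 h1
  change R.op (swap ((0 : ZMod 3), (0 : ZMod 3)) (0, 1) * swap (0, 1) (0, 2)) v = _ at h0
  change R.op (swap ((1 : ZMod 3), (0 : ZMod 3)) (1, 1) * swap (1, 1) (1, 2)) v = _ at h1
  rw [← shift_three] at h0 h1
  have hM : (R.op (shift 3 3 0)).eigenspace r ⊓ (R.op (shift 3 3 1)).eigenspace s ≠ ⊥ :=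
    fun h => hv (by
      have : v ∈ (R.op (shift 3 3 0)).eigenspace r ⊓ (R.op (shift 3 3 1)).eigenspace s :=
        ⟨End.mem_eigenspace_iff.2 h0, End.mem_eigenspace_iff.2 h1⟩
      rwa [h, Submodule.mem_bot] at this)
  obtain ⟨t, u, ⟨hu0, hu1⟩, hu, h2⟩ := End.exists_eigenvector_mem (R.op (shift 3 3 2)) _ hM
    fun v hv => ⟨End.eigenspace_stable (op_shift_three_commute R 2 0) r v hv.1,
      End.eigenspace_stable (op_shift_three_commute R 2 1) s v hv.2⟩
  exact ⟨t, u, hu, End.mem_eigenspace_iff.1 hu0, End.mem_eigenspace_iff.1 hu1, h2⟩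

/-- A triple as in `HasTriple` with exactly two entries different from `1` exists. -/
def HasPair : Prop := ∃ r s, r ≠ 1 ∧ s ≠ 1 ∧ R.HasTriple r s 1

variable {R}

/-- If no pairs occur, then the shifts of two blocks have no common fixed vector which is also
fixed by the third one. -/
theorem eq_zero_of_shifts_fixed (hQ : ¬ R.HasPair) {v : V} (h0 : R.op (shift 3 3 0) v = v)
    (h1 : R.op (shift 3 3 1) v = v) (h2 : R.op (shift 3 3 2) v = v) : v = 0 := by
  set A := R.op (shift 3 3 0) with hA
  set B := R.op (shift 3 3 1) with hB
  set C := R.op (shift 3 3 2) with hC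
  have hAB : Commute A B := op_shift_three_commute R 0 1
  have hAC : Commute A C := op_shift_three_commute R 0 2
  have hBC : Commute B C := op_shift_three_commute R 1 2
  have hA3 : A ^ 3 = 1 := R.op_pow_eq_one (by decide : Odd 3) (shift_three_pow 0)
  have hB3 : B ^ 3 = 1 := R.op_pow_eq_one (by decide : Odd 3) (shift_three_pow 1)
  let e : Fin 6 ↪ ZMod 3 × ZMod 3 :=
    ⟨![(0, 0), (0, 1), (0, 2), (1, 0), (1, 1), (1, 2)], by decide⟩
  let f : Fin 3 ↪ ZMod 3 × ZMod 3 := ⟨![(2, 0), (2, 1), (2, 2)], by decide⟩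
  have hf : shift 3 3 2 = (swap 0 1 * swap 1 2 : Perm (Fin 3)).viaEmbedding f := by
    rw [shift_three, Perm.viaEmbedding_mul, Perm.viaEmbedding_swap, Perm.viaEmbedding_swap]
    rfl
  have he0 : (swap 0 1 * swap 1 2 : Perm (Fin 6)).viaEmbedding e = shift 3 3 0 := by
    rw [shift_three, Perm.viaEmbedding_mul, Perm.viaEmbedding_swap, Perm.viaEmbedding_swap]
    rfl
  have he1 : (swap 3 4 * swap 4 5 : Perm (Fin 6)).viaEmbedding e = shift 3 3 1 := by
    rw [shift_three, Perm.viaEmbedding_mul, Perm.viaEmbedding_swap, Perm.viaEmbedding_swap]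
    rfl
  have hc (σ : Perm (Fin 6)) : Commute C ((R.comap e).op σ) := by
    rw [hC, hf]
    exact R.op_disjoint_commute f e (by decide) σ (by decide)
  have hall (u : V) (hu : C u = u) : (A - 1) ((B - 1) u) = 0 := by
    set D := (A - 1) * (B - 1) with hD
    by_contra hne
    have hDA : Commute A D := by
      rw [hD]; exact ((Commute.refl A).sub_right (Commute.one_right A)).mul_right
        (hAB.sub_right (Commute.one_right A))
    have hDB : Commute B D := by
      rw [hD]; exact (hAB.symm.sub_right (Commute.one_right B)).mul_right
        ((Commute.refl B).sub_right (Commute.one_right B))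
    have hDC : Commute C D := by
      rw [hD]; exact (hAC.symm.sub_right (Commute.one_right C)).mul_right
        (hBC.symm.sub_right (Commute.one_right C))
    have hst {X : End ℂ V} (hXD : Commute X D) (hXC : Commute X C) :
        ∀ v ∈ (C.eigenspace 1).map D, X v ∈ (C.eigenspace 1).map D := by
      rintro _ ⟨w, hw, rfl⟩
      exact ⟨X w, End.eigenspace_stable hXC 1 w hw, (congrArg (· w) hXD.eq).symm⟩
    obtain ⟨r, s, t, u, ⟨w, hw, rfl⟩, hu0, hr, hs, ht⟩ := End.exists_common_eigenvector hAB hAC hBC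
      (M := (C.eigenspace 1).map D) (fun h => hne (by
        have : D u ∈ (C.eigenspace 1).map D :=
          ⟨u, End.mem_eigenspace_iff.2 (by rwa [one_smul]), rfl⟩
        rwa [h, Submodule.mem_bot] at this))
      (hst hDA hAC) (hst hDB hBC) (hst hDC (Commute.refl C))
    have hCD : C (D w) = D w := by
      have := End.eigenspace_stable hDC.symm 1 w hw
      rwa [End.mem_eigenspace_iff, one_smul] at this
    refine hQ ⟨r, s, ?_, ?_, D w, hu0, hr, hs, by rw [one_smul]; exact hCD⟩
    · rintro rfl
      rw [one_smul] at hr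
      exact hu0 (sub_eq_zero.2 (End.apply_eq_self_of_fixed three_ne_zero hA3 (y := (B - 1) w) hr))
    · rintro rfl
      have hD' : D w = B ((A - 1) w) - (A - 1) w := by
        simp only [hD, End.mul_apply, LinearMap.sub_apply, End.one_apply, map_sub,
          show A (B w) = B (A w) from congrArg (· w) hAB.eq]
      rw [one_smul, hD'] at hs
      exact hu0 (hD'.trans (sub_eq_zero.2 (End.apply_eq_self_of_fixed three_ne_zero hB3 hs)))
  let R' := (R.comap e).onEigenspace C hc 1
  have hv : v ∈ C.eigenspace 1 := End.mem_eigenspace_iff.2 (by rwa [one_smul])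
  have := R'.eq_zero_of_threeCycles_fixed (v := ⟨v, hv⟩) (fun u => Subtype.ext ?_)
    (Subtype.ext ?_) (Subtype.ext ?_)
  · exact congrArg Subtype.val this
  · have := hall u (by simpa using End.mem_eigenspace_iff.1 u.2)
    simp only [LinearMap.sub_apply, End.one_apply, map_sub] at this
    simp only [R', LinearMap.sub_apply, End.one_apply, Submodule.coe_sub, onEigenspace_apply,
      comap_op, he0, he1, map_sub, Submodule.coe_zero]
    exact this
  · rw [onEigenspace_apply, comap_op, he0]; exact h0
  · rw [onEigenspace_apply, comap_op, he1]; exact h1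

theorem translation_eq_shifts : Equiv.addRight ((0, 1) : ZMod 3 × ZMod 3) =
    shift 3 3 0 * (shift 3 3 1 * shift 3 3 2) := by
  ext x : 1
  simp only [Perm.mul_apply, shift_apply]
  revert x; decide

/-- The scalars `s` and `r` are the eigenvalues of a shift and a translation of the blocks on a
common eigenvector. -/
theorem exists_shift_translation_eigenvector [Nontrivial V] (hQ : ¬ R.HasPair) :
    ∃ (s r : ℂ) (v : V), s ≠ 1 ∧ r ≠ 1 ∧ v ≠ 0 ∧ R.op (shift 3 3 0) v = s • v ∧
      R.op (Equiv.addRight ((1, 0) : ZMod 3 × ZMod 3)) v = r • v := by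
  obtain ⟨v, hXv, hSv⟩ := R.exists_translation_fixed_ne
  set A := R.op (shift 3 3 0) with hA
  set B := R.op (shift 3 3 1) with hB
  set C := R.op (shift 3 3 2) with hC
  set X := R.op (Equiv.addRight ((0, 1) : ZMod 3 × ZMod 3)) with hX
  set S := R.op (Equiv.addRight ((1, 0) : ZMod 3 × ZMod 3)) with hS
  have h3 : Odd 3 := by decide
  have hA3 : A ^ 3 = 1 := R.op_pow_eq_one h3 (shift_three_pow 0)
  have hB3 : B ^ 3 = 1 := R.op_pow_eq_one h3 (shift_three_pow 1)
  have hS3 : S ^ 3 = 1 := R.op_pow_eq_one h3 (by decide)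
  have hAB : Commute A B := op_shift_three_commute R 0 1
  have hAC : Commute A C := op_shift_three_commute R 0 2
  have hBC : Commute B C := op_shift_three_commute R 1 2
  have hXS : Commute X S := R.op_comm_of_odd h3 (by decide) (by unfold Commute SemiconjBy; decide)
  have hXi (i : ZMod 3) : Commute X (R.op (shift 3 3 i)) := R.op_comm_of_odd h3 (by decide) (by
    unfold Commute SemiconjBy; rw [shift_three]; revert i; decide)
  have hABC : X = A * (B * C) := by
    have hc (i j : ZMod 3) : Commute (shift 3 3 i) (shift 3 3 j) := by
      unfold Commute SemiconjBy; rw [shift_three, shift_three]; revert i j; decide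
    rw [hA, hB, hC, ← R.op_mul_of_odd h3 (shift_three_pow 1) (shift_three_pow 2) (hc 1 2),
      ← R.op_mul_of_odd h3 (shift_three_pow 0)
        (by rw [(hc 1 2).mul_pow, shift_three_pow, shift_three_pow, one_mul])
        ((hc 0 1).mul_right (hc 0 2)), hX, translation_eq_shifts]
  have hSA : S * A = B * S := by
    have := R.op_conj h3 (shift_three_pow 0) (Equiv.addRight ((1, 0) : ZMod 3 × ZMod 3))
    rwa [show Equiv.addRight ((1, 0) : ZMod 3 × ZMod 3) * shift 3 3 0 *
      (Equiv.addRight ((1, 0) : ZMod 3 × ZMod 3))⁻¹ = shift 3 3 1 by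
        rw [shift_three, shift_three]; decide] at this
  set W := X.eigenspace 1 with hW
  have memW (w : V) : w ∈ W ↔ X w = w := by rw [hW, End.mem_eigenspace_iff, one_smul]
  have hWA : ∀ w ∈ W, A w = B w := by
    by_contra! hne
    obtain ⟨w, hwW, hw⟩ := hne
    have hst {Y : End ℂ V} (hYA : Commute Y A) (hYB : Commute Y B) (hYX : Commute Y X) :
        ∀ v ∈ W.map (A - B), Y v ∈ W.map (A - B) := by
      rintro _ ⟨u, hu, rfl⟩
      exact ⟨Y u, End.eigenspace_stable hYX 1 u hu, (congrArg (· u) (hYA.sub_right hYB).eq).symm⟩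
    obtain ⟨r, s, t, u, ⟨y, hy, rfl⟩, hu0, hr, hs, ht⟩ := End.exists_common_eigenvector hAB hAC hBC
      (M := W.map (A - B)) (fun h => hw (by
        have : (A - B) w ∈ W.map (A - B) := ⟨w, hwW, rfl⟩
        rw [h, Submodule.mem_bot] at this
        exact sub_eq_zero.1 this))
      (hst (Commute.refl A) hAB (hXi 0).symm) (hst hAB.symm (Commute.refl B) (hXi 1).symm)
      (hst hAC.symm hBC.symm (hXi 2).symm)
    have hT : R.HasTriple r s t := ⟨_, hu0, hr, hs, ht⟩
    obtain ⟨hr3, hs3, ht3⟩ := hT.pow_three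
    have hX1 : X ((A - B) y) = (A - B) y :=
      (memW _).1 (End.eigenspace_stable (((hXi 0).sub_right (hXi 1)).symm) 1 y hy)
    have hrst : r * s * t = 1 := by
      rw [hABC, End.mul_apply, End.mul_apply, ht, map_smul, hs, map_smul, map_smul, hr, smul_smul,
        smul_smul] at hX1
      have := smul_left_injective ℂ hu0 (hX1.trans (one_smul ℂ _).symm)
      linear_combination this
    have hr0 : r ≠ 0 := by rintro rfl; norm_num at hr3
    have hrs : r ≠ s := by
      rintro rfl
      have h5 : (A * A + A * B + B * B) * (A - B) = 0 := by
        have h6 : A * A * A = B * B * B := by rw [← pow_three', ← pow_three', hA3, hB3]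
        have h7 : B * A = A * B := hAB.eq.symm
        have h8 : B * B * A = A * B * B := by rw [mul_assoc, h7, ← mul_assoc, h7]
        have h9 : A * B * A = A * A * B := by rw [mul_assoc, h7, ← mul_assoc]
        simp only [add_mul, mul_sub, h8, h9, h6]
        abel
      have h6 := congrArg (· y) h5
      simp only [End.mul_apply, LinearMap.add_apply, LinearMap.zero_apply] at h6
      simp only [hr, hs, map_smul, smul_smul, ← add_smul] at h6
      have h7 := (smul_eq_zero.1 h6).resolve_right hu0
      exact hr0 (pow_eq_zero_iff two_ne_zero |>.1 (by linear_combination h7 / 3))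
    refine hQ ?_
    by_cases h1 : r = 1
    · subst h1
      exact ⟨s, t, hrs.symm, fun h => hrs (by rw [h] at hrst; linear_combination -hrst),
        hT.rotate.rotate⟩
    by_cases h2 : s = 1
    · subst h2
      exact ⟨t, r, fun h => hrs (by rw [h] at hrst; linear_combination hrst), hrs, hT.rotate⟩
    refine ⟨r, s, h1, h2, ?_⟩
    have h4 : r ^ 2 + r * s + s ^ 2 = 0 := (mul_eq_zero.1 (by linear_combination hr3 - hs3 :
      (r - s) * (r ^ 2 + r * s + s ^ 2) = 0)).resolve_left (sub_ne_zero.2 hrs)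
    have h5 : r ^ 2 + r + 1 = 0 := (mul_eq_zero.1 (by linear_combination hr3 :
      (r - 1) * (r ^ 2 + r + 1) = 0)).resolve_left (sub_ne_zero.2 h1)
    have h6 : s = r ^ 2 := sub_eq_zero.1 ((mul_eq_zero.1 (by linear_combination h4 - s * h5 :
      (s - 1) * (s - r ^ 2) = 0)).resolve_left (sub_ne_zero.2 h2))
    have h7 : t = 1 := by rw [h6] at hrst; linear_combination hrst - t * hr3
    rwa [h7] at hT
  have hWS (w : V) (hw : w ∈ W) : S w ∈ W := End.eigenspace_stable hXS.symm 1 w hw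
  obtain ⟨r, u, ⟨y, hy, rfl⟩, hu0, hr⟩ := End.exists_eigenvector_mem S (W.map (S - 1)) (fun h => hSv (by
    have : (S - 1) v ∈ W.map (S - 1) := ⟨v, (memW v).2 hXv, rfl⟩
    rw [h, Submodule.mem_bot] at this
    exact sub_eq_zero.1 this)) (by
      rintro _ ⟨w, hw, rfl⟩
      exact ⟨S w, hWS w hw, by simp⟩)
  have hr1 : r ≠ 1 := by
    rintro rfl
    rw [one_smul] at hr
    exact hu0 (sub_eq_zero.2 (End.apply_eq_self_of_fixed three_ne_zero hS3 hr))
  have hyW : (S - 1) y ∈ W := W.sub_mem (hWS y hy) hy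
  obtain ⟨s, w, ⟨hwW, hwr⟩, hw0, hs⟩ := End.exists_eigenvector_mem A (W ⊓ S.eigenspace r) (fun h => hu0 (by
    have : (S - 1) y ∈ W ⊓ S.eigenspace r := ⟨hyW, End.mem_eigenspace_iff.2 hr⟩
    rwa [h, Submodule.mem_bot] at this)) (fun w hw => by
      have h4 : A w ∈ W := End.eigenspace_stable (hXi 0).symm 1 w hw.1
      refine ⟨h4, End.mem_eigenspace_iff.2 ?_⟩
      rw [← End.mul_apply, hSA, End.mul_apply, ← hWA _ (hWS w hw.1), End.mem_eigenspace_iff.1 hw.2,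
        map_smul])
  refine ⟨s, r, w, ?_, hr1, hw0, hs, End.mem_eigenspace_iff.1 hwr⟩
  rintro rfl
  rw [one_smul] at hs
  have hBw : B w = w := by rw [← hWA w hwW, hs]
  refine hw0 (eq_zero_of_shifts_fixed hQ hs hBw ?_)
  have := (memW w).1 hwW
  rw [hABC, hBC.eq, ← mul_assoc, hAC.eq, mul_assoc, End.mul_apply, End.mul_apply, hBw, hs] at this
  exact this

omit [FiniteDimensional ℂ V] in
theorem shift_zero_mul_translation : wheel 3 3 = shift 3 3 0 * Equiv.addRight (1, 0) := by
  ext x : 1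
  simp only [Perm.mul_apply, shift_apply, wheel_apply]
  revert x; decide

end nine

end SpinRep

/-- A primitive cube root and its square are all cube roots different from `1`. -/
theorem eq_or_eq_sq_of_pow_three {z t : ℂ} (hz : z ^ 3 = 1) (hz1 : z ≠ 1) (ht : t ^ 3 = 1)
    (ht1 : t ≠ 1) : t = z ∨ t = z ^ 2 := by
  have h5 : z ^ 2 + z + 1 = 0 := (mul_eq_zero.1 (by linear_combination hz :
    (z - 1) * (z ^ 2 + z + 1) = 0)).resolve_left (sub_ne_zero.2 hz1)
  have h6 : t ^ 2 + t + 1 = 0 := (mul_eq_zero.1 (by linear_combination ht :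
    (t - 1) * (t ^ 2 + t + 1) = 0)).resolve_left (sub_ne_zero.2 ht1)
  have : (t - z) * (t - z ^ 2) = 0 := by linear_combination h6 - t * h5 + hz
  exact (mul_eq_zero.1 this).imp sub_eq_zero.1 sub_eq_zero.1

theorem SpinRep.hasEigenvalue_wheel_three {V : Type} [AddCommGroup V] [Module ℂ V]
    [FiniteDimensional ℂ V] [Nontrivial V] (R : SpinRep (ZMod 3 × ZMod 3) V) {a : ℂ}
    (ha : a ^ 9 = 1) : End.HasEigenvalue (R.op (wheel 3 3)) a := by
  have hz : (a ^ 3) ^ 3 = 1 := by rw [← pow_mul, ha]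
  by_cases hz1 : a ^ 3 = 1
  · by_cases hQ : R.HasPair
    · obtain ⟨r, s, hr, hs, h⟩ := hQ
      obtain ⟨hr3, hs3, -⟩ := h.pow_three
      have key {r s : ℂ} (hr : r ≠ 1) (hs : s ≠ 1) (h : R.HasTriple r s 1) (hrs : r * s = 1) :
          End.HasEigenvalue (R.op (wheel 3 3)) a :=
        h.rotate.hasEigenvalue hr.symm hs.symm (by rw [hz1, one_mul, hrs])
      rcases eq_or_eq_sq_of_pow_three hr3 hr hs3 hs with rfl | rfl
      · refine key (fun h1 => hr ?_) hs h.sq (by rw [← pow_succ, hr3])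
        linear_combination hr3 - s * h1
      · exact key hr hs h (by rw [← pow_succ', hr3])
    · obtain ⟨s, r, v, hs, hr, hv, h0, h1⟩ := R.exists_shift_translation_eigenvector hQ
      have h3 : Odd 3 := by decide
      let f : Perm (ZMod 3 × ZMod 3) := Equiv.addRight (1, 0)
      have hf3 : f ^ 3 = 1 := by decide
      have hs3 : s ^ 3 = 1 :=
        End.pow_eq_one_of_eigen (R.op_pow_eq_one h3 (shift_three_pow 0)) hv h0
      have hr3 : r ^ 3 = 1 := End.pow_eq_one_of_eigen (R.op_pow_eq_one h3 hf3) hv h1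
      let U (s r : ℂ) : Prop := ∃ v, v ≠ 0 ∧ R.op (shift 3 3 0) v = s • v ∧ R.op f v = r • v
      have hU1 {s r : ℂ} (h : U s r) : U (s ^ 2) r := by
        obtain ⟨v, hv, h0, h1⟩ := h
        let g : Perm (ZMod 3 × ZMod 3) := (Equiv.refl _).prodCongr (Equiv.neg _)
        refine ⟨R.op g v, fun h => hv (R.op_injective g (by rw [h, map_zero])),
          R.apply_conj h3 (shift_three_sq_pow 0) g (by rw [shift_three]; decide) ?_,
          R.apply_conj h3 hf3 g (by decide) h1⟩
        rw [op_shift_three_sq, End.pow_apply_of_eigen h0]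
      have hU2 {s r : ℂ} (h : U s r) : U s (r ^ 2) := by
        obtain ⟨v, hv, h0, h1⟩ := h
        let g : Perm (ZMod 3 × ZMod 3) := (Equiv.neg _).prodCongr (Equiv.refl _)
        refine ⟨R.op g v, fun h => hv (R.op_injective g (by rw [h, map_zero])),
          R.apply_conj h3 (shift_three_pow 0) g (by rw [shift_three]; decide) h0,
          R.apply_conj (σ := f ^ 2) h3 (by decide) g (by decide) ?_⟩
        rw [R.op_pow_of_odd h3 hf3, End.pow_apply_of_eigen h1]
      have hU {s r : ℂ} (h : U s r) (hs3 : s ^ 3 = 1) (hr3 : r ^ 3 = 1) :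
          End.HasEigenvalue (R.op (wheel 3 3)) (s * r) := by
        obtain ⟨v, hv, h0, h1⟩ := h
        obtain ⟨ε, hε, h2⟩ := R.op_mul (shift 3 3 0) f
        have h4 : R.op (wheel 3 3) v = (ε * (s * r)) • v := by
          rw [show wheel 3 3 = shift 3 3 0 * f from shift_zero_mul_translation, h2,
            LinearMap.smul_apply, End.mul_apply, h1, map_smul, h0, smul_smul, smul_smul]
          ring_nf
        have h5 : wheel 3 3 ^ 9 = 1 := by
          have := pow_orderOf_eq_one (wheel 3 3)
          rwa [orderOf_wheel 3 3 (by norm_num)] at this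
        have h6 := End.pow_eq_one_of_eigen (R.op_pow_eq_one (by decide : Odd 9) h5) hv h4
        rcases mul_self_eq_one_iff.1 hε with h8 | h8
        · rw [h8, one_mul] at h4
          exact End.hasEigenvalue_iff_exists.2 ⟨v, hv, h4⟩
        · rw [h8, show (-1 * (s * r)) ^ 9 = -((s ^ 3) ^ 3 * (r ^ 3) ^ 3) by ring, hs3, hr3] at h6
          norm_num at h6
      have hss : s ^ 2 ≠ 1 := fun h => hs (by linear_combination hs3 - s * h)
      have hUss : U s s := by
        rcases eq_or_eq_sq_of_pow_three hs3 hs hr3 hr with rfl | rfl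
        · exact ⟨v, hv, h0, h1⟩
        · have := hU2 (s := s) ⟨v, hv, h0, h1⟩
          rwa [show (s ^ 2) ^ 2 = s by linear_combination s * hs3] at this
      have hss3 : (s ^ 2) ^ 3 = 1 := by rw [← pow_mul, mul_comm, pow_mul, hs3, one_pow]
      by_cases ha1 : a = 1
      · have := hU (hU2 hUss) hs3 hss3
        rwa [ha1, ← hs3, pow_succ']
      · rcases eq_or_eq_sq_of_pow_three hs3 hs hz1 ha1 with rfl | rfl
        · have := hU (hU1 (hU2 hUss)) hss3 hss3
          rwa [show a ^ 2 * a ^ 2 = a by linear_combination a * hs3] at this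
        · have := hU hUss hs3 hs3
          rwa [← pow_two] at this
  · generalize hz' : a ^ 3 = z at hz hz1
    have hzz : (z ^ 2) ^ 3 = 1 := by rw [← pow_mul, mul_comm, pow_mul, hz, one_pow]
    have hzz1 : z ^ 2 ≠ 1 := fun h => hz1 (by linear_combination hz - z * h)
    have hz2 : z ≠ z ^ 2 := fun h => hzz1 (by linear_combination hz + z * h)
    have h4 : (z ^ 2) ^ 2 = z := by linear_combination z * hz
    obtain ⟨t, h⟩ := R.exists_hasTriple hzz hzz1 hzz hzz1
    have hfin (h : R.HasTriple (z ^ 2) z z) : End.HasEigenvalue (R.op (wheel 3 3)) a :=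
      h.hasEigenvalue hz2.symm hz2.symm (by linear_combination hz' - z * hz)
    have hstep (h : R.HasTriple z (z ^ 2) (z ^ 2)) : End.HasEigenvalue (R.op (wheel 3 3)) a := by
      have := h.rotate.sq
      rw [h4] at this
      exact hfin this.rotate
    obtain ⟨-, -, ht⟩ := h.pow_three
    by_cases ht1 : t = 1
    · subst ht1
      exact h.rotate.hasEigenvalue hzz1.symm hzz1.symm (by linear_combination hz' - z * hz)
    · rcases eq_or_eq_sq_of_pow_three hz hz1 ht ht1 with rfl | rfl
      · exact hstep h.rotate
      · have := h.sq
        rw [h4] at this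
        exact hstep this

theorem good_wheel_three : Good (wheel 3 3) := by
  have h : orderOf (wheel 3 3) = 9 := orderOf_wheel 3 3 (by norm_num)
  refine good_of_odd (by rw [h]; decide) fun V _ _ _ _ R a ha => ?_
  rw [h] at ha
  exact End.hasEigenvalue_iff_exists.1 (R.hasEigenvalue_wheel_three ha)

namespace SpinRep

variable {α : Type} [DecidableEq α] [Fintype α] {V : Type} [AddCommGroup V] [Module ℂ V]

/-- Lifts of 3-cycles have no nonzero fixed vectors. -/
def Basic (R : SpinRep α V) : Prop :=
  ∀ a b c, a ≠ b → b ≠ c → a ≠ c → ∀ v, R.op (swap a b * swap b c) v = v → v = 0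

variable {R : SpinRep α V}

theorem Basic.op_threeCycle (h : R.Basic) {a b c : α} (hab : a ≠ b) (hbc : b ≠ c) (hac : a ≠ c) :
    R.op (swap a b * swap b c) * R.op (swap a b * swap b c) + R.op (swap a b * swap b c) + 1 =
      0 := by
  have h3 := R.op_pow_eq_one (by decide : Odd 3) (Perm.swap_mul_swap_pow_three hab hac hbc)
  set x := R.op (swap a b * swap b c)
  ext v
  refine h a b c hab hbc hac _ ?_
  have h4 : x * (x * x + x + 1) = x * x + x + 1 := by
    rw [mul_add, mul_add, ← pow_three, h3, mul_one]; abel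
  exact congrArg (· v) h4

theorem Basic.exists_anticomm (h : R.Basic) {a b c : α} (hab : a ≠ b) (hac : a ≠ c)
    (hbc : b ≠ c) : ∃ s : ℂ, s * s = 1 ∧ R.op (swap a b) * R.op (swap a c) +
      R.op (swap a c) * R.op (swap a b) = s • 1 := by
  have hx := h.op_threeCycle hab.symm hac hbc
  obtain ⟨s, hs, h1⟩ := R.op_mul' (swap b a) (swap a c)
  rw [swap_comm b a] at h1 hx
  set x := R.op (swap a b * swap a c)
  have hP := R.op_swap_sq a b hab
  have hQ := R.op_swap_sq a c hac
  set P := R.op (swap a b)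
  set Q := R.op (swap a c)
  refine ⟨-s, by rw [neg_mul_neg, hs], ?_⟩
  have h2 : P * Q * (Q * P) = 1 := by
    rw [mul_assoc, ← mul_assoc Q, hQ, neg_one_mul, mul_neg, hP, neg_neg]
  have h3 : P * Q * (P * Q) + s • (P * Q) + 1 = 0 := by
    rw [h1, smul_mul_smul_comm, smul_smul, hs, one_smul, one_smul, hx]
  have h4 := congrArg (· * (Q * P)) h3
  simp only [add_mul, mul_assoc (P * Q) (P * Q), h2, smul_mul_assoc, mul_one, one_mul,
    zero_mul] at h4
  rw [neg_smul, eq_neg_iff_add_eq_zero, ← h4]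
  abel

/-- Normalised lifts of the transpositions moving `o`. -/
structure Star (R : SpinRep α V) (o : α) where
  tau : α → End ℂ V
  tau_base : tau o = 0
  signEq : ∀ k, k ≠ o → SignEq (tau k) (R.op (swap o k))
  anticomm : ∀ j k, j ≠ o → k ≠ o → j ≠ k → tau j * tau k + tau k * tau j = -1

theorem Basic.nonempty_star [Nontrivial V] (h : R.Basic) (o : α) : Nonempty (R.Star o) := by
  by_cases ho : ∃ p, p ≠ o
  swap
  · push Not at ho
    exact ⟨⟨fun _ => 0, rfl, fun k hk => absurd (ho k) hk, fun j _ hj => absurd (ho j) hj⟩⟩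
  obtain ⟨p, hp⟩ := ho
  have h1 (k : α) : ∃ s : ℂ, s * s = 1 ∧ (k ≠ o → k ≠ p →
      R.op (swap o p) * (s • R.op (swap o k)) + s • R.op (swap o k) * R.op (swap o p) = -1) := by
    by_cases hk : k ≠ o ∧ k ≠ p
    · obtain ⟨s, hs, h2⟩ := h.exists_anticomm hp.symm hk.1.symm hk.2.symm
      refine ⟨-s, by rw [neg_mul_neg, hs], fun _ _ => ?_⟩
      rw [mul_smul_comm, smul_mul_assoc, ← smul_add, h2, smul_smul, neg_mul, hs, neg_smul, one_smul]
    · exact ⟨1, by simp, fun h3 h4 => absurd ⟨h3, h4⟩ hk⟩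
  choose s hs h2 using h1
  let tau (k : α) : End ℂ V := if k = o then 0 else if k = p then R.op (swap o p) else
    s k • R.op (swap o k)
  have htp : tau p = R.op (swap o p) := by simp [tau, hp]
  have ht (k : α) (hk : k ≠ o) (hk' : k ≠ p) : tau k = s k • R.op (swap o k) := by
    simp [tau, hk, hk']
  have hsig (k : α) (hk : k ≠ o) : SignEq (tau k) (R.op (swap o k)) := by
    by_cases hk' : k = p
    · rw [hk', htp]; exact SignEq.refl _
    · exact ⟨s k, hs k, ht k hk hk'⟩
  have hpk (k : α) (hk : k ≠ o) (hk' : k ≠ p) : tau p * tau k + tau k * tau p = -1 := by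
    rw [htp, ht k hk hk', h2 k hk hk']
  refine ⟨⟨tau, by simp [tau], hsig, fun j k hj hk hjk => ?_⟩⟩
  by_cases hjp : j = p
  · subst hjp; exact hpk k hk hjk.symm
  by_cases hkp : k = p
  · subst hkp; rw [add_comm]; exact hpk j hj hjk
  obtain ⟨d, hd, h3⟩ : ∃ d : ℂ, d * d = 1 ∧ tau j * tau k + tau k * tau j = d • 1 := by
    obtain ⟨d, hd, h3⟩ := h.exists_anticomm hj.symm hk.symm hjk
    refine ⟨s j * s k * d, by
      linear_combination s j * s j * s k * s k * hd + s j * s j * hs k + hs j, ?_⟩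
    rw [ht j hj hjp, ht k hk hkp, smul_mul_smul_comm, smul_mul_smul_comm, mul_comm (s k),
      ← smul_add, h3, smul_smul]
  have hjj : tau j * tau j = -1 := by
    rw [ht j hj hjp, smul_mul_smul_comm, hs, one_smul, R.op_swap_sq o j hj.symm]
  have h4 : tau j * tau k * tau j = d • tau j + tau k := by
    rw [eq_sub_of_add_eq h3, sub_mul, mul_assoc, hjj, smul_mul_assoc, one_mul, mul_neg_one,
      sub_neg_eq_add]
  have h5 : SignEq (tau j * tau k * tau j) (R.op (swap j k)) := by
    refine (((hsig j hj).mul (hsig k hk)).mul (hsig j hj)).trans ?_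
    have : swap j k = swap o j * swap o k * swap o j := by
      rw [swap_comm o k, Equiv.swap_mul_swap_mul_swap hk hjk.symm]
    rw [this]
    exact (((R.op_mul _ _).trans ((R.op_mul _ _).mul (SignEq.refl _)))).symm
  obtain ⟨r, -, h6⟩ := h5
  have h7 : tau p * (tau j * tau k * tau j) + (tau j * tau k * tau j) * tau p = 0 := by
    rw [h6, htp, mul_smul_comm, smul_mul_assoc, R.op_swap_anti o p j k hp.symm hjk hj.symm hk.symm
      (Ne.symm hjp) (Ne.symm hkp), smul_neg, neg_add_cancel]
  rw [h4, mul_add, add_mul, mul_smul_comm, smul_mul_assoc] at h7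
  have h8 : (d + 1) • (1 : End ℂ V) = 0 := by
    have : d • (tau p * tau j + tau j * tau p) + (tau p * tau k + tau k * tau p) = 0 := by
      rw [← h7, smul_add]; abel
    rw [hpk j hj hjp, hpk k hk hkp] at this
    rw [add_smul, one_smul, ← neg_eq_zero, ← this, smul_neg]; abel
  rw [h3, eq_neg_of_add_eq_zero_left ((smul_eq_zero.1 h8).resolve_right one_ne_zero), neg_smul,
    one_smul]

namespace Star

variable {o : α} (T : R.Star o)

theorem tau_sq {k : α} (hk : k ≠ o) : T.tau k * T.tau k = -1 := by
  obtain ⟨s, hs, h⟩ := T.signEq k hk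
  rw [h, smul_mul_smul_comm, hs, one_smul, R.op_swap_sq o k hk.symm]

/-- The linear combination of the normalised transpositions. -/
noncomputable def phi (b : α → ℂ) : End ℂ V := ∑ k, b k • T.tau k

theorem anticomm_ite {j : α} (hj : j ≠ o) (k : α) : T.tau j * T.tau k + T.tau k * T.tau j =
    (if k = o then 0 else if k = j then -2 else -1 : ℂ) • 1 := by
  split_ifs with h1 h2
  · rw [h1, T.tau_base]; simp
  · rw [h2, T.tau_sq hj, neg_smul, two_smul]; abel
  · rw [T.anticomm j k hj h1 (Ne.symm h2), neg_smul, one_smul]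

theorem tau_mul_phi {j : α} (hj : j ≠ o) {b : α → ℂ} (hb : ∑ k, b k = 0) :
    T.tau j * T.phi b + T.phi b * T.tau j = (b o - b j) • 1 := by
  rw [phi, Finset.mul_sum, Finset.sum_mul, ← Finset.sum_add_distrib]
  have h1 (k : α) : T.tau j * b k • T.tau k + b k • T.tau k * T.tau j =
      (-b k + (if k = o then b k else 0) - (if k = j then b k else 0)) • 1 := by
    rw [mul_smul_comm, smul_mul_assoc, ← smul_add, T.anticomm_ite hj, smul_smul]
    congr 1
    split_ifs with h1 h2 h2
    · exact absurd (h2.symm.trans h1) hj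
    all_goals ring
  simp_rw [h1]
  rw [← Finset.sum_smul, Finset.sum_sub_distrib, Finset.sum_add_distrib, Finset.sum_neg_distrib, hb]
  simp

theorem phi_anticomm {b c : α → ℂ} (hb : ∑ k, b k = 0) (hc : ∑ k, c k = 0) :
    T.phi b * T.phi c + T.phi c * T.phi b = (-∑ k, b k * c k) • 1 := by
  have h2 : T.phi b * T.phi c + T.phi c * T.phi b =
      ∑ k, (b k • T.tau k * T.phi c + T.phi c * b k • T.tau k) := by
    rw [Finset.sum_add_distrib, ← Finset.sum_mul, ← Finset.mul_sum]; rfl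
  have h1 (k : α) : b k • T.tau k * T.phi c + T.phi c * b k • T.tau k =
      (b k * c o - b k * c k) • 1 := by
    by_cases hk : k = o
    · rw [hk, T.tau_base]; simp
    · rw [mul_smul_comm, smul_mul_assoc, ← smul_add, T.tau_mul_phi hk hc, smul_smul, mul_sub]
  simp_rw [h2, h1]
  rw [← Finset.sum_smul, Finset.sum_sub_distrib, ← Finset.sum_mul, hb, zero_mul, zero_sub]

theorem op_swap_mul_phi {j : α} (hj : j ≠ o) {b : α → ℂ} (hb : ∑ k, b k = 0) :
    R.op (swap o j) * T.phi b = -(T.phi (b ∘ swap o j) * R.op (swap o j)) := by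
  have h1 : T.phi (b ∘ swap o j) = T.phi b + (b o - b j) • T.tau j := by
    rw [← sub_eq_iff_eq_add', phi, phi, ← Finset.sum_sub_distrib, Finset.sum_eq_single j]
    · rw [Function.comp_apply, swap_apply_right, sub_smul]
    · intro k _ hk
      by_cases hko : k = o
      · rw [hko, T.tau_base]; simp
      · rw [Function.comp_apply, swap_apply_of_ne_of_ne hko hk, sub_self]
    · simp
  obtain ⟨s, hs, h⟩ := (T.signEq j hj).symm
  rw [h, smul_mul_assoc, mul_smul_comm, ← smul_neg, h1, add_mul, smul_mul_assoc, T.tau_sq hj,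
    eq_sub_of_add_eq (T.tau_mul_phi hj hb)]
  congr 1
  simp only [smul_neg]
  abel

theorem op_mul_phi (g : Perm α) : ∀ b : α → ℂ, ∑ k, b k = 0 →
    R.op g * T.phi b = ((Perm.sign g : ℤ) : ℂ) • (T.phi (b ∘ ⇑g⁻¹) * R.op g) := by
  have hmul {g h : Perm α}
      (hg : ∀ b : α → ℂ, ∑ k, b k = 0 →
        R.op g * T.phi b = ((Perm.sign g : ℤ) : ℂ) • (T.phi (b ∘ ⇑g⁻¹) * R.op g))
      (hh : ∀ b : α → ℂ, ∑ k, b k = 0 →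
        R.op h * T.phi b = ((Perm.sign h : ℤ) : ℂ) • (T.phi (b ∘ ⇑h⁻¹) * R.op h))
      (b : α → ℂ) (hb : ∑ k, b k = 0) :
      R.op (g * h) * T.phi b =
        ((Perm.sign (g * h) : ℤ) : ℂ) • (T.phi (b ∘ ⇑(g * h)⁻¹) * R.op (g * h)) := by
    obtain ⟨s, -, h1⟩ := R.op_mul g h
    have hb' : ∑ k, (b ∘ ⇑h⁻¹) k = 0 := by rw [← hb]; exact Equiv.sum_comp h⁻¹ b
    rw [h1, smul_mul_assoc, mul_assoc, hh b hb, mul_smul_comm, ← mul_assoc, hg _ hb', smul_mul_assoc,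
      mul_smul_comm, smul_smul, smul_smul, smul_smul, mul_assoc, Perm.sign_mul]
    push_cast
    congr 1
    ring
  have hstar {j : α} (hj : j ≠ o) (b : α → ℂ) (hb : ∑ k, b k = 0) : R.op (swap o j) * T.phi b =
      ((Perm.sign (swap o j) : ℤ) : ℂ) • (T.phi (b ∘ ⇑(swap o j)⁻¹) * R.op (swap o j)) := by
    rw [T.op_swap_mul_phi hj hb, Perm.sign_swap hj.symm, swap_inv]; simp
  induction g using Perm.swap_induction_on with
  | one => intro b _; simp [R.op_one]
  | swap_mul g x y hxy ih =>
    refine hmul (fun b hb => ?_) ih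
    by_cases hx : x = o
    · subst hx; exact hstar hxy.symm b hb
    by_cases hy : y = o
    · subst hy; rw [swap_comm]; exact hstar hxy b hb
    have : swap x y = swap o x * (swap o y * swap o x) := by
      rw [← mul_assoc, swap_comm o y, Equiv.swap_mul_swap_mul_swap hy hxy.symm]
    rw [this]
    exact hmul (hstar hx) (hmul (hstar hy) (hstar hx)) b hb

end Star

end SpinRep

section

variable {V : Type} [AddCommGroup V] [Module ℂ V] [FiniteDimensional ℂ V]

theorem End.finrank_eigenspace_le_of_swap {D A : End ℂ V} (hA : Function.Injective A)
    (hAD : A * D = -(D * A)) (r : ℂ) :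
    finrank ℂ (D.eigenspace r) ≤ finrank ℂ (D.eigenspace (-r)) := by
  have h1 (v : V) (hv : v ∈ D.eigenspace r) : A v ∈ D.eigenspace (-r) := by
    rw [End.mem_eigenspace_iff] at hv ⊢
    have := congrArg (· v) hAD
    simp only [End.mul_apply, LinearMap.neg_apply, hv, map_smul] at this
    rw [neg_smul, this, neg_neg]
  refine LinearMap.finrank_le_finrank_of_injective (f := A.restrict h1) fun v w h => ?_
  exact Subtype.ext (hA (congrArg Subtype.val h))

theorem End.finrank_eq_two_mul {D A : End ℂ V} {r : ℂ} (hr : r ≠ 0) (hD : D * D = (r * r) • 1)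
    (hA : Function.Injective A) (hAD : A * D = -(D * A)) :
    finrank ℂ V = 2 * finrank ℂ (D.eigenspace r) := by
  have h1 : IsCompl (D.eigenspace r) (D.eigenspace (-r)) := by
    constructor
    · rw [Submodule.disjoint_def]
      intro v h1 h2
      rw [End.mem_eigenspace_iff] at h1 h2
      rw [h1, neg_smul, eq_neg_iff_add_eq_zero, ← add_smul, smul_eq_zero] at h2
      exact h2.resolve_left (by rw [← two_mul]; simpa using hr)
    · rw [codisjoint_iff, eq_top_iff]
      intro v _
      have h2 : D (D v) = (r * r) • v := congrArg (· v) hD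
      have h3 : v = (2 * r)⁻¹ • (r • v + D v) + (2 * r)⁻¹ • (r • v - D v) := by
        rw [← smul_add, add_add_sub_cancel, ← two_smul ℂ (r • v), smul_smul (2 : ℂ) r, smul_smul,
          inv_mul_cancel₀ (by simpa using hr), one_smul]
      rw [h3]
      refine Submodule.add_mem_sup (Submodule.smul_mem _ _ ?_) (Submodule.smul_mem _ _ ?_)
      · rw [End.mem_eigenspace_iff, map_add, map_smul, h2, smul_add, smul_smul, add_comm]
      · rw [End.mem_eigenspace_iff, map_sub, map_smul, h2, smul_sub, smul_smul, neg_mul, neg_smul,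
          neg_smul, sub_neg_eq_add, neg_add_eq_sub]
  have h2 := End.finrank_eigenspace_le_of_swap hA hAD r
  have h3 := End.finrank_eigenspace_le_of_swap hA hAD (-r)
  rw [neg_neg] at h3
  rw [← Submodule.finrank_add_eq_of_isCompl h1, le_antisymm h3 h2]
  ring

theorem End.isSemisimple_of_pow_eq_one {A : End ℂ V} {N : ℕ} (hN : 0 < N) (hA : A ^ N = 1) :
    A.IsSemisimple := by
  refine End.isSemisimple_of_squarefree_aeval_eq_zero (p := Polynomial.X ^ N - 1) ?_ (by simp [hA])
  refine Polynomial.Separable.squarefree ?_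
  exact Polynomial.separable_X_pow_sub_C 1 (by exact_mod_cast hN.ne') one_ne_zero

theorem End.isInternal_eigenspace {A : End ℂ V} {N : ℕ} (hN : 0 < N) (hA : A ^ N = 1) :
    DirectSum.IsInternal fun ζ : Polynomial.nthRootsFinset N (1 : ℂ) => A.eigenspace (ζ : ℂ) := by
  refine DirectSum.isInternal_submodule_of_iSupIndep_of_iSup_eq_top ?_ ?_
  · exact (End.eigenspaces_iSupIndep A).comp Subtype.val_injective
  · have h1 := (End.isSemisimple_of_pow_eq_one hN hA).isFinitelySemisimple
    have h2 : ⨆ μ : ℂ, A.eigenspace μ = ⊤ := by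
      rw [← End.iSup_maxGenEigenspace_eq_top A]
      exact iSup_congr fun μ => (h1.maxGenEigenspace_eq_eigenspace μ).symm
    rw [eq_top_iff, ← h2]
    refine iSup_le fun μ => ?_
    by_cases hμ : μ ∈ Polynomial.nthRootsFinset N (1 : ℂ)
    · exact le_iSup (fun ζ : Polynomial.nthRootsFinset N (1 : ℂ) => A.eigenspace (ζ : ℂ)) ⟨μ, hμ⟩
    · intro v hv
      by_cases hv0 : v = 0
      · rw [hv0]; exact Submodule.zero_mem _
      · exact absurd ((Polynomial.mem_nthRootsFinset hN _).2
          (End.pow_eq_one_of_eigen hA hv0 (End.mem_eigenspace_iff.1 hv))) hμ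

theorem End.trace_pow_eq_sum {A : End ℂ V} {N : ℕ} (hN : 0 < N) (hA : A ^ N = 1) (j : ℕ) :
    LinearMap.trace ℂ V (A ^ j) =
      ∑ ζ ∈ Polynomial.nthRootsFinset N (1 : ℂ), ζ ^ j * finrank ℂ (A.eigenspace ζ) := by
  have h1 (ζ : ℂ) (v : V) (hv : v ∈ A.eigenspace ζ) : (A ^ j) v = ζ ^ j • v :=
    End.pow_apply_of_eigen (End.mem_eigenspace_iff.1 hv) j
  have h2 (ζ : ℂ) : Set.MapsTo (A ^ j) (A.eigenspace ζ) (A.eigenspace ζ) := fun v hv => by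
    rw [h1 ζ v hv]; exact Submodule.smul_mem _ _ hv
  rw [LinearMap.trace_eq_sum_trace_restrict (End.isInternal_eigenspace hN hA) fun ζ => h2 ζ,
    ← Finset.sum_coe_sort (Polynomial.nthRootsFinset N (1 : ℂ))]
  refine Finset.sum_congr rfl fun ζ _ => ?_
  have h3 : (A ^ j).restrict (h2 ζ) = (ζ : ℂ) ^ j • (1 : End ℂ (A.eigenspace (ζ : ℂ))) :=
    LinearMap.ext fun v => Subtype.ext (h1 ζ v v.2)
  rw [h3, map_smul, LinearMap.trace_one, smul_eq_mul]

theorem End.finrank_eq_sum_eigenspace {A : End ℂ V} {N : ℕ} (hN : 0 < N) (hA : A ^ N = 1) :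
    finrank ℂ V = ∑ ζ ∈ Polynomial.nthRootsFinset N (1 : ℂ), finrank ℂ (A.eigenspace ζ) := by
  have := End.trace_pow_eq_sum hN hA 0
  simp only [pow_zero, LinearMap.trace_one, one_mul] at this
  exact_mod_cast this

end

theorem End.two_pow_dvd_finrank (r : ℕ) : ∀ {V : Type} [AddCommGroup V] [Module ℂ V]
    [FiniteDimensional ℂ V] (A : ℕ → End ℂ V) (c : ℕ → ℂ), (∀ i < 2 * r, c i ≠ 0) →
    (∀ i < 2 * r, A i * A i = c i • 1) →
    (∀ i < 2 * r, ∀ j < 2 * r, i ≠ j → A i * A j = -(A j * A i)) → 2 ^ r ∣ finrank ℂ V := by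
  induction r with
  | zero => simp
  | succ r ih =>
    intro V _ _ _ A c hc hA hAA
    obtain ⟨s, hs⟩ := IsAlgClosed.exists_eq_mul_self (-(c 0 * c 1))
    have h01 := hAA 0 (by omega) 1 (by omega) (by omega)
    have hD : A 0 * A 1 * (A 0 * A 1) = (s * s) • 1 := by
      rw [← hs, mul_assoc, ← mul_assoc (A 1), ← neg_eq_iff_eq_neg.2 h01, neg_mul, mul_assoc,
        hA 1 (by omega), mul_smul_comm, mul_one, mul_neg, mul_smul_comm, hA 0 (by omega), smul_smul,
        neg_smul, mul_comm]
    have hs0 : s ≠ 0 := by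
      rintro rfl
      have := mul_ne_zero (hc 0 (by omega)) (hc 1 (by omega))
      simp_all
    have hinj : Function.Injective (A 0) := by
      intro v w h
      have h1 (v : V) : A 0 (A 0 v) = c 0 • v := congrArg (· v) (hA 0 (by omega))
      have h2 := congrArg (A 0) h
      rw [h1, h1] at h2
      exact smul_right_injective _ (hc 0 (by omega)) h2
    have hanti : A 0 * (A 0 * A 1) = -(A 0 * A 1 * A 0) := by
      rw [mul_assoc, ← neg_eq_iff_eq_neg.2 h01, mul_neg, neg_neg]
    rw [End.finrank_eq_two_mul hs0 hD hinj hanti, pow_succ']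
    refine mul_dvd_mul_left 2 ?_
    have hcomm (i : ℕ) (hi : i < 2 * r) : Commute (A 0 * A 1) (A (i + 2)) := by
      rw [Commute, SemiconjBy, mul_assoc, hAA 1 (by omega) (i + 2) (by omega) (by omega), mul_neg,
        ← mul_assoc, hAA 0 (by omega) (i + 2) (by omega) (by omega), neg_mul, neg_neg, mul_assoc]
    have hstab (i : ℕ) (hi : i < 2 * r) (v : V) (hv : v ∈ (A 0 * A 1).eigenspace s) :
        A (i + 2) v ∈ (A 0 * A 1).eigenspace s := by
      rw [End.mem_eigenspace_iff] at hv ⊢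
      rw [← End.mul_apply, (hcomm i hi).eq, End.mul_apply, hv, map_smul]
    let B (i : ℕ) : End ℂ ((A 0 * A 1).eigenspace s) :=
      if hi : i < 2 * r then (A (i + 2)).restrict (hstab i hi) else 0
    have hB (i : ℕ) (hi : i < 2 * r) (v) : (B i v : V) = A (i + 2) v := by simp [B, hi]
    refine ih B (fun i => c (i + 2)) (fun i hi => hc _ (by omega)) (fun i hi => ?_)
      fun i hi j hj hij => ?_
    · ext v
      have := congrArg (· (v : V)) (hA (i + 2) (by omega))
      simpa [hB i hi] using this
    · ext v
      have := congrArg (· (v : V)) (hAA (i + 2) (by omega) (j + 2) (by omega) (by omega))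
      simpa [hB i hi, hB j hj] using this

/-- The Helmert vectors, an orthogonal family of vectors with zero sum. -/
def helmert (i x : ℕ) : ℂ := if x = i + 1 then i + 1 else if x < i + 1 then -1 else 0

theorem sum_helmert {i n : ℕ} (h : i + 1 < n) : ∑ x ∈ Finset.range n, helmert i x = 0 := by
  have h1 (m : ℕ) : ∑ x ∈ Finset.range m, helmert i x = if m ≤ i + 1 then -(m : ℂ) else 0 := by
    induction m with
    | zero => simp
    | succ m ih =>
      rw [Finset.sum_range_succ, ih, helmert]
      rcases lt_trichotomy m (i + 1) with h | h | h
      · rw [if_pos h.le, if_neg h.ne, if_pos h, if_pos (by omega)]; push_cast; ring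
      · rw [if_pos h.le, if_pos h, if_neg (by omega), h]; push_cast; ring
      · rw [if_neg (by omega), if_neg (by omega), if_neg (by omega), if_neg (by omega)]; ring
  rw [h1, if_neg (by omega)]

theorem sum_helmert_mul {i j n : ℕ} (hij : i < j) (h : j + 1 < n) :
    ∑ x ∈ Finset.range n, helmert i x * helmert j x = 0 := by
  have h1 (x : ℕ) : helmert i x * helmert j x = -helmert i x := by
    unfold helmert
    split_ifs <;> first | omega | ring
  simp_rw [h1, Finset.sum_neg_distrib, sum_helmert (show i + 1 < n by omega), neg_zero]

theorem sum_helmert_sq {i n : ℕ} (h : i + 1 < n) :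
    ∑ x ∈ Finset.range n, helmert i x * helmert i x = ((i + 1) * (i + 2) : ℂ) := by
  have h1 (x : ℕ) : helmert i x * helmert i x =
      -helmert i x + if x = i + 1 then ((i + 1) * (i + 2) : ℂ) else 0 := by
    unfold helmert
    split_ifs <;> ring
  simp_rw [h1, Finset.sum_add_distrib, Finset.sum_neg_distrib, sum_helmert h]
  simp [h]

namespace SpinRep

variable {α β : Type} [DecidableEq α] [Fintype α] [DecidableEq β] [Fintype β]
  {V : Type} [AddCommGroup V] [Module ℂ V]

theorem Basic.comap {R : SpinRep α V} (h : R.Basic) (e : β ↪ α) : (R.comap e).Basic := by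
  intro a b c hab hbc hac v hv
  rw [comap_op, Perm.viaEmbedding_mul, Perm.viaEmbedding_swap, Perm.viaEmbedding_swap] at hv
  exact h _ _ _ (e.injective.ne hab) (e.injective.ne hbc) (e.injective.ne hac) v hv

variable [FiniteDimensional ℂ V]

theorem Basic.two_pow_dvd_finrank {R : SpinRep α V} (h : R.Basic) {r : ℕ}
    (hr : 2 * r + 1 ≤ Fintype.card α) : 2 ^ r ∣ finrank ℂ V := by
  rcases subsingleton_or_nontrivial V with hV | hV
  · rw [finrank_zero_of_subsingleton]; exact dvd_zero _
  obtain ⟨e⟩ : Nonempty (Fin (2 * r + 1) ↪ α) :=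
    Function.Embedding.nonempty_of_card_le (by simpa using hr)
  obtain ⟨T⟩ := (h.comap e).nonempty_star 0
  have hs {i : ℕ} (hi : i < 2 * r) : ∑ x : Fin (2 * r + 1), helmert i x = 0 := by
    rw [Fin.sum_univ_eq_sum_range (helmert i), sum_helmert (by omega)]
  refine End.two_pow_dvd_finrank r (fun i => T.phi fun x => helmert i x)
    (fun i => -((i + 1) * (i + 2)) / 2) (fun i _ => ?_) (fun i hi => ?_) ?_
  · have : (((i + 1) * (i + 2) : ℕ) : ℂ) ≠ 0 :=
      Nat.cast_ne_zero.2 (Nat.mul_ne_zero (by omega) (by omega))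
    push_cast at this
    exact div_ne_zero (neg_ne_zero.2 this) two_ne_zero
  · have h1 := T.phi_anticomm (hs hi) (hs hi)
    rw [Fin.sum_univ_eq_sum_range (fun x => helmert i x * helmert i x), sum_helmert_sq (by omega),
      ← two_smul ℂ] at h1
    rw [div_eq_inv_mul, mul_smul, ← h1, smul_smul]
    simp
  · have h2 : ∀ i j, i < j → j < 2 * r →
        T.phi (fun x => helmert i x) * T.phi (fun x => helmert j x) +
          T.phi (fun x => helmert j x) * T.phi (fun x => helmert i x) = 0 := by
      intro i j hij hj
      rw [T.phi_anticomm (hs (hij.trans hj)) (hs hj),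
        Fin.sum_univ_eq_sum_range (fun x => helmert i x * helmert j x),
        sum_helmert_mul hij (by omega)]
      simp
    intro i hi j hj hij
    rw [eq_neg_iff_add_eq_zero]
    rcases hij.lt_or_gt with h3 | h3
    · exact h2 i j h3 hj
    · rw [add_comm]; exact h2 j i h3 hi

end SpinRep

namespace SpinRep

variable {α : Type} [DecidableEq α] [Fintype α] {V : Type} [AddCommGroup V] [Module ℂ V]

theorem exists_fixed_of_not_basic {R : SpinRep α V} (h : ¬R.Basic) {a b c : α} (hab : a ≠ b)
    (hbc : b ≠ c) (hac : a ≠ c) : ∃ v, v ≠ 0 ∧ R.op (swap a b * swap b c) v = v := by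
  rw [Basic] at h
  push Not at h
  obtain ⟨a', b', c', hab', hbc', hac', v, hv, hv0⟩ := h
  have h1 : IsConj (swap a' b' * swap b' c') (swap a b * swap b c) := by
    rw [Perm.isConj_iff_cycleType_eq, swap_comm a', swap_comm a,
      (Perm.isThreeCycle_swap_mul_swap_same hab'.symm hbc' hac').cycleType,
      (Perm.isThreeCycle_swap_mul_swap_same hab.symm hbc hac).cycleType]
  obtain ⟨f, hf⟩ := isConj_iff.1 h1
  refine ⟨R.op f v, fun h2 => hv0 (R.op_injective f (by rw [h2, map_zero])), ?_⟩
  have := R.apply_conj (by decide : Odd 3) (Perm.swap_mul_swap_pow_three hab' hac' hbc') f hf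
    (r := 1) (v := v) (by rw [one_smul, hv])
  rwa [one_smul] at this

variable [FiniteDimensional ℂ V]

theorem two_pow_dvd_finrank (k : ℕ) : ∀ {α : Type} [DecidableEq α] [Fintype α] {V : Type}
    [AddCommGroup V] [Module ℂ V] [FiniteDimensional ℂ V], SpinRep α V →
    4 * k ≤ Fintype.card α → 2 ^ k ∣ finrank ℂ V := by
  induction k with
  | zero => simp
  | succ k ih =>
    intro α _ _ V _ _ _ R hk
    obtain ⟨e⟩ : Nonempty (Fin 4 ⊕ Fin (4 * k) ↪ α) :=
      Function.Embedding.nonempty_of_card_le (by simp; omega)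
    have hne {i j : Fin 4} (h : i ≠ j) : e (.inl i) ≠ e (.inl j) :=
      e.injective.ne (Sum.inl_injective.ne h)
    have hP := R.op_swap_sq (e (.inl 0)) (e (.inl 1)) (hne (by decide))
    have hQ := R.op_swap_sq (e (.inl 2)) (e (.inl 3)) (hne (by decide))
    have hPQ := R.op_swap_anti (e (.inl 0)) (e (.inl 1)) (e (.inl 2)) (e (.inl 3))
      (hne (by decide)) (hne (by decide)) (hne (by decide)) (hne (by decide)) (hne (by decide))
      (hne (by decide))
    have hcomm (τ : Perm (Fin (4 * k))) :
        Commute (R.op (swap (e (.inl 0)) (e (.inl 1))) * R.op (swap (e (.inl 2)) (e (.inl 3))))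
          ((R.comap (Function.Embedding.inr.trans e)).op τ) := by
      obtain ⟨s, -, hs⟩ := R.op_mul' (swap (e (.inl 0)) (e (.inl 1)))
        (swap (e (.inl 2)) (e (.inl 3)))
      rw [hs, comap_op]
      refine Commute.smul_left ?_ s
      have h1 := R.op_disjoint_commute (Function.Embedding.inl.trans e)
        (Function.Embedding.inr.trans e) (fun b c => e.injective.ne Sum.inl_ne_inr)
        (σ := swap 0 1 * swap 2 3) τ (by decide)
      rwa [Perm.viaEmbedding_mul, Perm.viaEmbedding_swap, Perm.viaEmbedding_swap] at h1
    have hinj := R.op_injective (swap (e (.inl 0)) (e (.inl 1)))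
    set P := R.op (swap (e (.inl 0)) (e (.inl 1)))
    set Q := R.op (swap (e (.inl 2)) (e (.inl 3)))
    rw [End.finrank_eq_two_mul (D := P * Q) (A := P) (r := Complex.I) Complex.I_ne_zero
      (by rw [Complex.I_mul_I, mul_assoc, ← mul_assoc Q, ← neg_eq_iff_eq_neg.2 hPQ, neg_mul,
        mul_assoc, hQ, mul_neg, mul_neg, mul_one, mul_neg, neg_neg, hP, neg_smul, one_smul]) hinj
      (by rw [mul_assoc, ← neg_eq_iff_eq_neg.2 hPQ, mul_neg, neg_neg]), pow_succ']
    exact mul_dvd_mul_left 2 (ih (onEigenspace _ _ hcomm Complex.I) (by simp))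

theorem three_mul_le_finrank {R : SpinRep α V} (h : ¬R.Basic) {m f : ℕ} (hm : 0 < m)
    (hα : m + 3 ≤ Fintype.card α)
    (hf : ∀ {W : Type} [AddCommGroup W] [Module ℂ W] [FiniteDimensional ℂ W] [Nontrivial W],
      SpinRep (Fin m) W → f ≤ finrank ℂ W) : 3 * f ≤ finrank ℂ V := by
  obtain ⟨e⟩ : Nonempty (Fin 3 ⊕ Fin m ↪ α) :=
    Function.Embedding.nonempty_of_card_le (by simp; omega)
  have hne {i j : Fin 3} (h : i ≠ j) : e (.inl i) ≠ e (.inl j) :=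
    e.injective.ne (Sum.inl_injective.ne h)
  have h01 := hne (show 0 ≠ 1 by decide)
  have h12 := hne (show 1 ≠ 2 by decide)
  have h02 := hne (show 0 ≠ 2 by decide)
  have hn3 (i : Fin 3) : e (.inl i) ≠ e (.inr ⟨0, hm⟩) := e.injective.ne Sum.inl_ne_inr
  have hx3 := R.op_pow_eq_one (by decide : Odd 3) (Perm.swap_mul_swap_pow_three h01 h02 h12)
  have hcomm (τ : Perm (Fin m)) :
      Commute (R.op (swap (e (.inl 0)) (e (.inl 1)) * swap (e (.inl 1)) (e (.inl 2))))
        ((R.comap (Function.Embedding.inr.trans e)).op τ) := by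
    have h1 := R.op_disjoint_commute (Function.Embedding.inl.trans e)
      (Function.Embedding.inr.trans e) (fun b c => e.injective.ne Sum.inl_ne_inr)
      (σ := swap 0 1 * swap 1 2) τ (by decide)
    rwa [Perm.viaEmbedding_mul, Perm.viaEmbedding_swap, Perm.viaEmbedding_swap] at h1
  have hne {r : ℂ} (hr : r ^ 3 = 1) :
      ∃ v, v ≠ 0 ∧ R.op (swap (e (.inl 0)) (e (.inl 1)) * swap (e (.inl 1)) (e (.inl 2))) v =
        r • v := by
    by_cases hr1 : r = 1
    · rw [hr1]
      simpa using exists_fixed_of_not_basic h h01 h12 h02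
    · have : Nontrivial V := by
        obtain ⟨v, hv, -⟩ := exists_fixed_of_not_basic h h01 h12 h02
        exact nontrivial_of_ne v 0 hv
      exact R.exists_eigenvector_threeCycle h01 h02 h12 (hn3 0) (hn3 1) (hn3 2) hr hr1
  rw [End.finrank_eq_sum_eigenspace (by decide : 0 < 3) hx3]
  have hcard := (Complex.isPrimitiveRoot_exp 3 (by decide)).card_nthRootsFinset
  calc 3 * f = ∑ ζ ∈ Polynomial.nthRootsFinset 3 (1 : ℂ), f := by
        rw [Finset.sum_const, hcard, smul_eq_mul]
    _ ≤ _ := Finset.sum_le_sum fun ζ hζ => by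
        obtain ⟨v, hv, hv'⟩ := hne ((Polynomial.mem_nthRootsFinset (by decide) _).1 hζ)
        have : Nontrivial ((R.op (swap (e (.inl 0)) (e (.inl 1)) *
            swap (e (.inl 1)) (e (.inl 2)))).eigenspace ζ) :=
          Submodule.nontrivial_iff_ne_bot.2
            ((Submodule.ne_bot_iff _).2 ⟨v, End.mem_eigenspace_iff.2 hv', hv⟩)
        exact hf (onEigenspace _ _ hcomm ζ)

theorem two_pow_card_le (n : ℕ) : ∀ {α : Type} [DecidableEq α] [Fintype α] {V : Type}
    [AddCommGroup V] [Module ℂ V] [FiniteDimensional ℂ V] [Nontrivial V], SpinRep α V →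
    Fintype.card α = n → 2 ^ n ≤ 8 * finrank ℂ V ^ 2 := by
  induction n using Nat.strong_induction_on with
  | _ n ih =>
    intro α _ _ V _ _ _ _ R hα
    have hd : 0 < finrank ℂ V := finrank_pos
    rcases Nat.lt_or_ge n 4 with hn | hn
    · calc 2 ^ n ≤ 2 ^ 3 := Nat.pow_le_pow_right (by decide) (by omega)
        _ ≤ 8 * finrank ℂ V ^ 2 := by nlinarith
    by_cases hR : R.Basic
    · have h1 := Nat.le_of_dvd hd (hR.two_pow_dvd_finrank (r := (n - 1) / 2) (by omega))
      calc 2 ^ n ≤ 2 ^ (3 + 2 * ((n - 1) / 2)) := Nat.pow_le_pow_right (by decide) (by omega)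
        _ = 8 * (2 ^ ((n - 1) / 2)) ^ 2 := by rw [pow_add, ← pow_mul, mul_comm 2]; norm_num
        _ ≤ _ := Nat.mul_le_mul_left 8 (Nat.pow_le_pow_left h1 2)
    · obtain ⟨m, rfl⟩ : ∃ m, n = m + 3 := ⟨n - 3, by omega⟩
      by_contra! hlt
      have h1 := three_mul_le_finrank hR (m := m) (f := finrank ℂ V / 3 + 1) (by omega) (by omega)
        fun {W} _ _ _ _ R' => by
          by_contra! h2
          have h3 := ih m (by omega) R' (by simp)
          rw [pow_add] at hlt
          have h4 : 3 * finrank ℂ W ≤ finrank ℂ V := by omega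
          nlinarith [Nat.mul_le_mul h4 h4]
      omega

theorem two_pow_le_of_not_basic [Nontrivial V] {R : SpinRep α V} (h : ¬R.Basic) {n : ℕ}
    (hα : Fintype.card α = n + 6) (hn : 0 < n) : 9 * 2 ^ n ≤ finrank ℂ V ^ 2 := by
  by_contra! hlt
  have h1 := three_mul_le_finrank h (m := n + 3) (f := finrank ℂ V / 3 + 1) (by omega) (by omega)
    fun {W} _ _ _ _ R' => by
      by_contra! h2
      have h3 := two_pow_card_le (n + 3) R' (by simp)
      rw [pow_add] at h3
      have h4 : 3 * finrank ℂ W ≤ finrank ℂ V := by omega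
      nlinarith [Nat.mul_le_mul h4 h4]
  omega

end SpinRep

namespace SpinRep

variable {α : Type} [DecidableEq α] [Fintype α] {V : Type} [AddCommGroup V] [Module ℂ V]
  (R : SpinRep α V)

/-- The automorphism attached to a permutation. -/
noncomputable def unit (σ : Perm α) : (End ℂ V)ˣ := (R.isUnit_op σ).unit

@[simp]
theorem coe_unit (σ : Perm α) : (R.unit σ : End ℂ V) = R.op σ := (R.isUnit_op σ).unit_spec

theorem coe_unit_inv (σ : Perm α) :
    SignEq ((R.unit σ)⁻¹ : (End ℂ V)ˣ).val (R.op σ⁻¹) := by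
  obtain ⟨s, hs, h⟩ := R.op_mul_inv σ
  refine ⟨s, hs, Units.inv_eq_of_mul_eq_one_right ?_⟩
  rw [coe_unit, mul_smul_comm, h, smul_smul, hs, one_smul]

/-- The sum of the conjugates of an endomorphism. -/
noncomputable def avg (E : End ℂ V) : End ℂ V :=
  ∑ σ, R.op σ * E * ((R.unit σ)⁻¹ : (End ℂ V)ˣ).val

theorem op_mul_avg (E : End ℂ V) (τ : Perm α) : R.op τ * R.avg E = R.avg E * R.op τ := by
  have h1 (σ : Perm α) : R.op τ * (R.op σ * E * ((R.unit σ)⁻¹ : (End ℂ V)ˣ).val) =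
      R.op (τ * σ) * E * ((R.unit (τ * σ))⁻¹ : (End ℂ V)ˣ).val * R.op τ := by
    obtain ⟨s, hs, h⟩ := R.op_mul τ σ
    have h2 : ((R.unit (τ * σ))⁻¹ : (End ℂ V)ˣ).val =
        s • (((R.unit σ)⁻¹ : (End ℂ V)ˣ).val * ((R.unit τ)⁻¹ : (End ℂ V)ˣ).val) := by
      refine Units.inv_eq_of_mul_eq_one_right ?_
      rw [coe_unit, h, smul_mul_smul_comm, hs, one_smul, ← coe_unit, ← coe_unit, mul_assoc,
        Units.mul_inv_cancel_left, Units.mul_inv]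
    rw [h2, h, smul_mul_assoc, smul_mul_smul_comm, hs, one_smul, ← R.coe_unit τ]
    simp only [mul_assoc]
    rw [Units.inv_mul, mul_one]
  rw [avg, Finset.mul_sum, Finset.sum_mul]
  simp_rw [h1]
  exact (Group.mulLeft_bijective τ).sum_comp
    fun σ => R.op σ * E * ((R.unit σ)⁻¹ : (End ℂ V)ˣ).val * R.op τ

/-- Irreducibility. -/
def Irred : Prop := ∀ U : Submodule ℂ V, (∀ σ, ∀ v ∈ U, R.op σ v ∈ U) → U = ⊥ ∨ U = ⊤

theorem exists_isCompl (W : Submodule ℂ V) (hW : ∀ σ, ∀ v ∈ W, R.op σ v ∈ W) :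
    ∃ W' : Submodule ℂ V, (∀ σ, ∀ v ∈ W', R.op σ v ∈ W') ∧ IsCompl W W' := by
  obtain ⟨C, hC⟩ := Submodule.exists_isCompl W
  let p : End ℂ V := W.subtype.comp (W.projectionOnto C hC)
  have hp (v : V) : p v ∈ W := (W.projectionOnto C hC v).2
  have hpw {w : V} (hw : w ∈ W) : p w = w := by
    simp only [p, LinearMap.comp_apply]
    rw [Submodule.projectionOnto_apply_left hC ⟨w, hw⟩]; rfl
  have hinv (σ : Perm α) {w : V} (hw : w ∈ W) : ((R.unit σ)⁻¹ : (End ℂ V)ˣ).val w ∈ W := by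
    obtain ⟨s, -, h⟩ := R.coe_unit_inv σ
    rw [h]
    exact W.smul_mem _ (hW _ _ hw)
  have h1 (v : V) : R.avg p v ∈ W := by
    rw [avg, LinearMap.sum_apply]
    exact W.sum_mem fun σ _ => hW _ _ (hp _)
  have h2 {w : V} (hw : w ∈ W) : R.avg p w = (Fintype.card (Perm α) : ℂ) • w := by
    rw [avg, LinearMap.sum_apply]
    have (σ : Perm α) : (R.op σ * p * ((R.unit σ)⁻¹ : (End ℂ V)ˣ).val) w = w := by
      rw [End.mul_apply, End.mul_apply, hpw (hinv σ hw), ← coe_unit, ← End.mul_apply, Units.mul_inv,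
        End.one_apply]
    simp [this, Nat.cast_smul_eq_nsmul]
  have hN : (Fintype.card (Perm α) : ℂ) ≠ 0 := by exact_mod_cast Fintype.card_ne_zero
  refine ⟨LinearMap.ker (R.avg p), fun σ v hv => ?_, ?_, ?_⟩
  · rw [LinearMap.mem_ker] at hv ⊢
    rw [← End.mul_apply, ← op_mul_avg, End.mul_apply, hv, map_zero]
  · rw [Submodule.disjoint_def]
    intro v hv hv'
    rw [LinearMap.mem_ker, h2 hv] at hv'
    exact (smul_eq_zero.1 hv').resolve_left hN
  · rw [codisjoint_iff, eq_top_iff]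
    intro v _
    rw [← add_sub_cancel ((Fintype.card (Perm α) : ℂ)⁻¹ • R.avg p v) v]
    refine Submodule.add_mem_sup (W.smul_mem _ (h1 v)) ?_
    rw [LinearMap.mem_ker, map_sub, map_smul, h2 (h1 v), smul_smul, inv_mul_cancel₀ hN, one_smul,
      sub_self]

variable [FiniteDimensional ℂ V]

theorem restrict_irred {U : Submodule ℂ V} (hU : ∀ σ, ∀ v ∈ U, R.op σ v ∈ U)
    (h : ∀ W : Submodule ℂ V, (∀ σ, ∀ v ∈ W, R.op σ v ∈ W) → W < U → W = ⊥) :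
    (R.restrict U hU).Irred := by
  intro W hW
  have h1 : W.map U.subtype ≤ U := Submodule.map_subtype_le U W
  rcases h1.lt_or_eq with h2 | h2
  · left
    have h3 := h _ (fun σ v hv => ?_) h2
    · rw [eq_bot_iff]
      intro w hw
      exact Subtype.ext (h3.le (Submodule.mem_map_of_mem hw))
    · obtain ⟨w, hw, rfl⟩ := hv
      exact ⟨_, hW σ w hw, rfl⟩
  · right
    rw [eq_top_iff]
    intro u _
    have h3 : (u : V) ∈ W.map U.subtype := h2.symm ▸ u.2
    obtain ⟨w, hw, hwu⟩ := h3
    rwa [← Subtype.ext hwu]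

theorem exists_irred [Nontrivial V] : ∃ (U : Submodule ℂ V) (hU : ∀ σ, ∀ v ∈ U, R.op σ v ∈ U),
    Nontrivial U ∧ (R.restrict U hU).Irred := by
  obtain ⟨U, ⟨hU, hU0⟩, hmin⟩ := wellFounded_lt.has_min
    {U : Submodule ℂ V | (∀ σ, ∀ v ∈ U, R.op σ v ∈ U) ∧ U ≠ ⊥}
    ⟨⊤, fun _ _ _ => Submodule.mem_top, top_ne_bot⟩
  refine ⟨U, hU, Submodule.nontrivial_iff_ne_bot.2 hU0, R.restrict_irred hU fun W hW hlt => ?_⟩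
  by_contra h0
  exact hmin W ⟨hW, h0⟩ hlt

variable {R}

theorem exists_irred_of_not_basic (h : ¬R.Basic) :
    ∃ (U : Submodule ℂ V) (hU : ∀ σ, ∀ v ∈ U, R.op σ v ∈ U),
      ¬(R.restrict U hU).Basic ∧ (R.restrict U hU).Irred := by
  rw [Basic] at h
  push Not at h
  obtain ⟨a, b, c, hab, hbc, hac, v, hv, hv0⟩ := h
  obtain ⟨U, ⟨hU, u, hu, hu0, hux⟩, hmin⟩ := wellFounded_lt.has_min
    {U : Submodule ℂ V | (∀ σ, ∀ v ∈ U, R.op σ v ∈ U) ∧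
      ∃ v ∈ U, v ≠ 0 ∧ R.op (swap a b * swap b c) v = v}
    ⟨⊤, fun _ _ _ => Submodule.mem_top, v, Submodule.mem_top, hv0, hv⟩
  refine ⟨U, hU, fun h => ?_, R.restrict_irred hU fun W hW hlt => ?_⟩
  · have := h a b c hab hbc hac ⟨u, hu⟩ (Subtype.ext hux)
    exact hu0 (congrArg Subtype.val this)
  · obtain ⟨W', hW', hc⟩ := R.exists_isCompl W hW
    by_contra hW0
    have hu' : u ∈ W ⊔ W' := by rw [hc.sup_eq_top]; exact Submodule.mem_top
    obtain ⟨w, hw, w', hw', rfl⟩ := Submodule.mem_sup.1 hu'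
    set x := swap a b * swap b c
    have h1 : R.op x w - w = w' - R.op x w' := by
      rw [sub_eq_sub_iff_add_eq_add, ← map_add, hux, add_comm]
    have h2 : R.op x w - w = 0 := (Submodule.disjoint_def.1 hc.disjoint) _
      (W.sub_mem (hW _ _ hw) hw) (h1 ▸ W'.sub_mem hw' (hW' _ _ hw'))
    rw [h2, eq_comm, sub_eq_zero] at h1
    have h3 : w = 0 := by
      by_contra h3
      exact hmin W ⟨hW, w, hw, h3, sub_eq_zero.1 h2⟩ hlt
    rw [h3, zero_add] at hu hu0
    refine hmin (W' ⊓ U) ⟨fun σ v hv => ⟨hW' σ v hv.1, hU σ v hv.2⟩, w', ⟨hw', hu⟩, hu0, h1.symm⟩ ?_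
    refine lt_of_le_of_ne inf_le_right fun h4 => hW0 ?_
    rw [eq_bot_iff, ← hc.inf_eq_bot]
    exact le_inf le_rfl (hlt.le.trans (inf_eq_right.1 h4))

theorem Irred.avg_eq [Nontrivial V] (h : R.Irred) (E : End ℂ V) :
    R.avg E = (Fintype.card (Perm α) * LinearMap.trace ℂ V E / finrank ℂ V) • 1 := by
  obtain ⟨c, hc⟩ := End.exists_eigenvalue (R.avg E)
  have h1 : (R.avg E).eigenspace c = ⊤ := by
    refine (h _ fun σ v hv => ?_).resolve_left hc
    exact End.eigenspace_stable (R.op_mul_avg E σ) c v hv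
  have h2 : R.avg E = c • 1 := by
    ext v
    have : v ∈ (R.avg E).eigenspace c := h1 ▸ Submodule.mem_top
    exact End.mem_eigenspace_iff.1 this
  have h3 := congrArg (LinearMap.trace ℂ V) h2
  have h4 (σ : Perm α) :
      LinearMap.trace ℂ V (R.op σ * E * ((R.unit σ)⁻¹ : (End ℂ V)ˣ).val) = LinearMap.trace ℂ V E := by
    rw [← coe_unit, LinearMap.trace_conj]
  rw [avg, map_sum, map_smul, LinearMap.trace_one] at h3
  simp_rw [h4] at h3
  rw [Finset.sum_const, Finset.card_univ, nsmul_eq_mul, smul_eq_mul] at h3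
  have hd : (finrank ℂ V : ℂ) ≠ 0 := by exact_mod_cast (finrank_pos (R := ℂ) (M := V)).ne'
  rw [h2, h3, mul_div_cancel_right₀ _ hd]

theorem Irred.sum_trace [Nontrivial V] (h : R.Irred) :
    ∑ σ, LinearMap.trace ℂ V (R.op σ) * LinearMap.trace ℂ V ((R.unit σ)⁻¹ : (End ℂ V)ˣ).val =
      Fintype.card (Perm α) := by
  let b := Module.finBasis ℂ V
  have htr (A : End ℂ V) : LinearMap.trace ℂ V A = ∑ i, b.repr (A (b i)) i := by
    rw [LinearMap.trace_eq_matrix_trace ℂ b, Matrix.trace]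
    simp [LinearMap.toMatrix_apply]
  have h1 (i j) : ∑ σ, b.repr (R.op σ (b i)) i *
      b.repr (((R.unit σ)⁻¹ : (End ℂ V)ˣ).val (b j)) j =
      if i = j then (Fintype.card (Perm α) / finrank ℂ V : ℂ) else 0 := by
    have h2 := congrArg (fun A : End ℂ V => b.repr (A (b j)) i)
      (h.avg_eq ((b.coord j).smulRight (b i)))
    simp only [avg, LinearMap.sum_apply, End.mul_apply, LinearMap.smulRight_apply,
      LinearMap.trace_smulRight, map_sum, map_smul, LinearMap.smul_apply, End.one_apply,
      Finsupp.smul_apply, Finsupp.finsetSum_apply, Basis.coord_apply, Basis.repr_self, smul_eq_mul,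
      Finsupp.single_apply] at h2
    simp_rw [mul_comm (b.repr (R.op _ _) i)]
    rw [h2]
    rcases eq_or_ne i j with rfl | h3
    · simp
    · rw [if_neg h3, if_neg h3, if_neg h3.symm, mul_zero]
  simp_rw [htr, Finset.sum_mul_sum]
  rw [Finset.sum_comm]
  have h2 (i) : ∑ σ, ∑ j, b.repr (R.op σ (b i)) i *
      b.repr (((R.unit σ)⁻¹ : (End ℂ V)ˣ).val (b j)) j =
      Fintype.card (Perm α) / finrank ℂ V := by
    rw [Finset.sum_comm, Finset.sum_congr rfl fun j _ => h1 i j]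
    simp
  rw [Finset.sum_congr rfl fun i _ => h2 i]
  have hd : (finrank ℂ V : ℂ) ≠ 0 := by exact_mod_cast (finrank_pos (R := ℂ) (M := V)).ne'
  simp [mul_div_cancel₀, hd]

end SpinRep

theorem End.trace_inv_eq_conj {V : Type} [AddCommGroup V] [Module ℂ V] [FiniteDimensional ℂ V]
    (u : (End ℂ V)ˣ) {N : ℕ} (hN : 0 < N) (h : (u : End ℂ V) ^ N = 1) :
    LinearMap.trace ℂ V (u⁻¹ : (End ℂ V)ˣ).val =
      (starRingEnd ℂ) (LinearMap.trace ℂ V (u : End ℂ V)) := by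
  obtain ⟨N, rfl⟩ : ∃ M, N = M + 1 := ⟨N - 1, by omega⟩
  have h1 : (u⁻¹ : (End ℂ V)ˣ).val = (u : End ℂ V) ^ N :=
    Units.inv_eq_of_mul_eq_one_right (by rw [← pow_succ', h])
  have h2 := End.trace_pow_eq_sum hN h 1
  rw [pow_one] at h2
  rw [h1, h2, End.trace_pow_eq_sum hN h N, map_sum]
  refine Finset.sum_congr rfl fun ζ hζ => ?_
  rw [Polynomial.mem_nthRootsFinset hN] at hζ
  rw [pow_one, map_mul, Complex.conj_natCast,
    ← Complex.inv_eq_conj (Complex.norm_eq_one_of_pow_eq_one hζ N.succ_ne_zero)]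
  congr 1
  exact (inv_eq_of_mul_eq_one_right (by rw [← pow_succ', hζ])).symm

/-- The order of the centralizer of a permutation. -/
noncomputable def Perm.zee {α : Type} [DecidableEq α] [Fintype α] (σ : Perm α) : ℕ :=
  (Fintype.card α - σ.cycleType.sum).factorial * σ.cycleType.prod *
    ∏ n ∈ σ.cycleType.toFinset, (σ.cycleType.count n).factorial

namespace SpinRep

variable {α : Type} [DecidableEq α] [Fintype α] {V : Type} [AddCommGroup V] [Module ℂ V]
  (R : SpinRep α V)

/-- The squared absolute value of the character. -/
noncomputable def chiSq (σ : Perm α) : ℝ := Complex.normSq (LinearMap.trace ℂ V (R.op σ))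

theorem chiSq_nonneg (σ : Perm α) : 0 ≤ R.chiSq σ := Complex.normSq_nonneg _

theorem chiSq_eq_of_isConj {σ τ : Perm α} (h : IsConj σ τ) : R.chiSq τ = R.chiSq σ := by
  obtain ⟨f, rfl⟩ := isConj_iff.1 h
  have h1 : SignEq (R.op (f * σ * f⁻¹)) (R.op f * R.op σ * ((R.unit f)⁻¹ : (End ℂ V)ˣ).val) :=
    ((R.op_mul _ _).trans ((R.op_mul _ _).mul (SignEq.refl _))).trans
      ((SignEq.refl _).mul (R.coe_unit_inv f).symm)
  obtain ⟨s, hs, h2⟩ := h1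
  rw [chiSq, chiSq, h2, map_smul, ← R.coe_unit f, LinearMap.trace_conj, smul_eq_mul,
    Complex.normSq_mul]
  have h3 := congrArg Complex.normSq hs
  rw [Complex.normSq_mul, map_one] at h3
  have h4 : Complex.normSq s = 1 := by nlinarith [Complex.normSq_nonneg s]
  rw [h4, one_mul]

theorem exists_op_pow_eq_one (σ : Perm α) : ∃ N, 0 < N ∧ R.op σ ^ N = 1 := by
  obtain ⟨s, hs, h⟩ := (R.op_pow σ (orderOf σ)).symm
  rw [pow_orderOf_eq_one, R.op_one] at h
  refine ⟨orderOf σ * 2, Nat.mul_pos (orderOf_pos σ) two_pos, ?_⟩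
  rw [pow_mul, h, sq, smul_mul_smul_comm, hs, one_smul, one_mul]

variable [FiniteDimensional ℂ V] {R}

theorem Irred.sum_chiSq [Nontrivial V] (h : R.Irred) :
    ∑ σ, R.chiSq σ = (Fintype.card α).factorial := by
  have h1 := h.sum_trace
  have h2 (σ : Perm α) : LinearMap.trace ℂ V (R.op σ) *
      LinearMap.trace ℂ V ((R.unit σ)⁻¹ : (End ℂ V)ˣ).val = (R.chiSq σ : ℂ) := by
    obtain ⟨N, hN, hσ⟩ := R.exists_op_pow_eq_one σ
    rw [End.trace_inv_eq_conj _ hN (by rw [coe_unit, hσ]), coe_unit, Complex.mul_conj, chiSq]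
  simp_rw [h2] at h1
  rw [Fintype.card_perm] at h1
  exact_mod_cast h1

theorem Irred.chiSq_div_add_le [Nontrivial V] (h : R.Irred) {σ τ : Perm α} (hστ : ¬IsConj σ τ) :
    R.chiSq σ / Perm.zee σ + R.chiSq τ / Perm.zee τ ≤ 1 := by
  classical
  let C (σ : Perm α) : Finset (Perm α) := Finset.univ.filter fun ρ => IsConj σ ρ
  have h1 (σ : Perm α) :
      ∑ ρ ∈ C σ, R.chiSq ρ = (Fintype.card α).factorial * (R.chiSq σ / Perm.zee σ) := by
    have h2 := Perm.card_isConj_mul_eq σ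
    rw [Nat.card_eq_card_toFinset, ← Perm.zee] at h2
    have h3 : {ρ : Perm α | IsConj σ ρ}.toFinset = C σ := by ext; simp [C]
    rw [h3] at h2
    have h4 : (Perm.zee σ : ℝ) ≠ 0 := by
      intro h0
      rw [Nat.cast_eq_zero.1 h0, mul_zero] at h2
      exact (Nat.factorial_ne_zero _) h2.symm
    rw [Finset.sum_congr rfl fun ρ hρ =>
      R.chiSq_eq_of_isConj ((Finset.mem_filter.1 hρ).2), Finset.sum_const, nsmul_eq_mul, ← h2]
    push_cast
    field_simp
    exact mul_comm _ _
  have hd : Disjoint (C σ) (C τ) := by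
    rw [Finset.disjoint_left]
    intro ρ h2 h3
    exact hστ ((Finset.mem_filter.1 h2).2.trans (Finset.mem_filter.1 h3).2.symm)
  have h5 : ∑ ρ ∈ C σ ∪ C τ, R.chiSq ρ ≤ ∑ ρ, R.chiSq ρ :=
    Finset.sum_le_sum_of_subset_of_nonneg (Finset.subset_univ _) fun ρ _ _ => R.chiSq_nonneg ρ
  rw [Finset.sum_union hd, h1, h1, h.sum_chiSq, ← mul_add] at h5
  have h6 : (0 : ℝ) < (Fintype.card α).factorial := by exact_mod_cast Nat.factorial_pos _
  nlinarith

/-- The strict column bound for nonidentity permutations. -/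
theorem Irred.chiSq_lt [Nontrivial V] (h : R.Irred) {σ : Perm α} (hσ : σ ≠ 1) :
    R.chiSq σ < Perm.zee σ := by
  have h1 : ¬IsConj σ 1 := fun h => hσ (isConj_one_left.1 h)
  have h2 := h.chiSq_div_add_le h1
  have h3 : 0 < R.chiSq 1 / (Perm.zee (1 : Perm α) : ℝ) := by
    have hd : (finrank ℂ V : ℂ) ≠ 0 := by exact_mod_cast (finrank_pos (R := ℂ) (M := V)).ne'
    refine div_pos ?_ ?_
    · rw [chiSq, R.op_one, LinearMap.trace_one]
      exact Complex.normSq_pos.2 hd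
    · simp [Perm.zee, Nat.factorial_pos]
  have h4 : R.chiSq σ / Perm.zee σ < 1 := by linarith
  by_contra! h5
  rcases (Perm.zee σ).eq_zero_or_pos with h0 | h0
  · have h6 := Perm.card_isConj_mul_eq σ
    rw [← Perm.zee, h0, mul_zero] at h6
    exact (Nat.factorial_ne_zero _) h6.symm
  · exact absurd h4 (not_lt.2 ((one_le_div (by exact_mod_cast h0)).2 h5))

end SpinRep

theorem sum_nthRootsFinset {N : ℕ} (hN : 0 < N) {ω : ℂ} (hω : IsPrimitiveRoot ω N) (f : ℂ → ℂ) :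
    ∑ ζ ∈ Polynomial.nthRootsFinset N (1 : ℂ), f ζ = ∑ i ∈ Finset.range N, f (ω ^ i) := by
  refine (Finset.sum_bij (fun i _ => ω ^ i) (fun i _ => ?_) (fun i hi j hj hij => ?_)
    (fun ζ hζ => ?_) fun _ _ => rfl).symm
  · rw [Polynomial.mem_nthRootsFinset hN, ← pow_mul, mul_comm, pow_mul, hω.pow_eq_one, one_pow]
  · exact hω.pow_inj (Finset.mem_range.1 hi) (Finset.mem_range.1 hj) hij
  · have : NeZero N := ⟨hN.ne'⟩
    obtain ⟨i, hi, h⟩ := hω.eq_pow_of_pow_eq_one ((Polynomial.mem_nthRootsFinset hN _).1 hζ)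
    exact ⟨i, Finset.mem_range.2 hi, h⟩

theorem sum_nthRootsFinset_prime {p : ℕ} (hp : p.Prime) :
    ∑ ζ ∈ Polynomial.nthRootsFinset p (1 : ℂ), ζ = 0 := by
  obtain ⟨ω, hω⟩ : ∃ ω : ℂ, IsPrimitiveRoot ω p := ⟨_, Complex.isPrimitiveRoot_exp p hp.ne_zero⟩
  rw [sum_nthRootsFinset hp.pos hω]
  exact hω.geom_sum_eq_zero hp.one_lt

theorem End.trace_mul_eq_sum {V : Type} [AddCommGroup V] [Module ℂ V] [FiniteDimensional ℂ V]
    {A B : End ℂ V} {N : ℕ} (hN : 0 < N) (hA : A ^ N = 1)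
    (hB : ∀ ζ, Set.MapsTo B (A.eigenspace ζ) (A.eigenspace ζ)) (j : ℕ) :
    LinearMap.trace ℂ V (A ^ j * B) = ∑ ζ ∈ Polynomial.nthRootsFinset N (1 : ℂ),
      ζ ^ j * LinearMap.trace ℂ (A.eigenspace ζ) (B.restrict (hB ζ)) := by
  have h1 (ζ : ℂ) (v : V) (hv : v ∈ A.eigenspace ζ) : (A ^ j * B) v = ζ ^ j • B v :=
    End.pow_apply_of_eigen (End.mem_eigenspace_iff.1 (hB ζ hv)) j
  have h2 (ζ : ℂ) : Set.MapsTo (A ^ j * B) (A.eigenspace ζ) (A.eigenspace ζ) := fun v hv => by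
    rw [h1 ζ v hv]; exact Submodule.smul_mem _ _ (hB ζ hv)
  rw [LinearMap.trace_eq_sum_trace_restrict (End.isInternal_eigenspace hN hA) fun ζ => h2 ζ,
    ← Finset.sum_coe_sort (Polynomial.nthRootsFinset N (1 : ℂ))]
  refine Finset.sum_congr rfl fun ζ _ => ?_
  have h3 : (A ^ j * B).restrict (h2 ζ) = (ζ : ℂ) ^ j • B.restrict (hB ζ) :=
    LinearMap.ext fun v => Subtype.ext (h1 ζ v v.2)
  rw [h3, map_smul, smul_eq_mul]

namespace SpinRep

variable {α : Type} [DecidableEq α] [Fintype α] {V : Type} [AddCommGroup V] [Module ℂ V]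
  [FiniteDimensional ℂ V] (R : SpinRep α V)

theorem trace_eq_of_mul_eq (f : Perm α) {A B : End ℂ V} (hAB : R.op f * A = B * R.op f) :
    LinearMap.trace ℂ V B = LinearMap.trace ℂ V A := by
  obtain ⟨u, hu⟩ := R.isUnit_op f
  have : B = u * A * (u⁻¹ : (End ℂ V)ˣ).val := by
    rw [hu, hAB, mul_assoc, ← hu, Units.mul_inv, mul_one]
  rw [this, LinearMap.trace_conj]

/-- The eigenvalue multiplicities of a rational element of odd prime order. -/
theorem exists_finrank_eigenspace {p : ℕ} (hp : p.Prime) (hodd : Odd p) {σ : Perm α}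
    (hσ : σ ^ p = 1) (hc : ∀ k, ¬p ∣ k → IsConj (σ ^ k) σ) :
    ∃ b : ℕ, (∀ ζ : ℂ, ζ ^ p = 1 → ζ ≠ 1 → finrank ℂ ((R.op σ).eigenspace ζ) = b) ∧
      finrank ℂ V = finrank ℂ ((R.op σ).eigenspace 1) + (p - 1) * b ∧
      LinearMap.trace ℂ V (R.op σ) = finrank ℂ ((R.op σ).eigenspace 1) - b := by
  have hX := R.op_pow_eq_one hodd hσ
  have hle (ζ ξ : ℂ) (hζ : ζ ^ p = 1) (hζ1 : ζ ≠ 1) (hξ : ξ ^ p = 1) (hξ1 : ξ ≠ 1) :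
      finrank ℂ ((R.op σ).eigenspace ζ) ≤ finrank ℂ ((R.op σ).eigenspace ξ) := by
    have : Fact p.Prime := ⟨hp⟩
    have : NeZero p := ⟨hp.ne_zero⟩
    have hprim : IsPrimitiveRoot ζ p := by
      rw [← orderOf_eq_prime hζ hζ1]; exact IsPrimitiveRoot.orderOf ζ
    obtain ⟨k, -, rfl⟩ := hprim.eq_pow_of_pow_eq_one hξ
    obtain ⟨f, hf⟩ := isConj_iff.1 (hc k fun ⟨j, hj⟩ => hξ1 (by rw [hj, pow_mul, hζ, one_pow]))
    have h1 := R.op_conj hodd (σ := σ ^ k) (by rw [← pow_mul, mul_comm, pow_mul, hσ, one_pow]) f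
    rw [hf, R.op_pow_of_odd hodd hσ] at h1
    have h2 (v : V) (hv : v ∈ (R.op σ).eigenspace ζ) :
        R.op f v ∈ (R.op σ).eigenspace (ζ ^ k) := by
      rw [End.mem_eigenspace_iff] at hv ⊢
      rw [← End.mul_apply, ← h1, End.mul_apply, End.pow_apply_of_eigen hv, map_smul]
    refine LinearMap.finrank_le_finrank_of_injective (f := (R.op f).restrict h2) fun v w h => ?_
    exact Subtype.ext (R.op_injective f (congrArg Subtype.val h))
  have hω := Complex.isPrimitiveRoot_exp p hp.ne_zero
  have hω1 := hω.ne_one hp.one_lt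
  refine ⟨finrank ℂ ((R.op σ).eigenspace (Complex.exp (2 * Real.pi * Complex.I / p))),
    fun ζ hζ hζ1 => (hle _ _ hζ hζ1 hω.pow_eq_one hω1).antisymm
      (hle _ _ hω.pow_eq_one hω1 hζ hζ1), ?_, ?_⟩
  all_goals
    set b := finrank ℂ ((R.op σ).eigenspace (Complex.exp (2 * Real.pi * Complex.I / p)))
    have hb (ζ : ℂ) (hζ : ζ ∈ (Polynomial.nthRootsFinset p (1 : ℂ)).erase 1) :
        finrank ℂ ((R.op σ).eigenspace ζ) = b := by
      rw [Finset.mem_erase, Polynomial.mem_nthRootsFinset hp.pos] at hζ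
      exact (hle _ _ hζ.2 hζ.1 hω.pow_eq_one hω1).antisymm (hle _ _ hω.pow_eq_one hω1 hζ.2 hζ.1)
    have h1 : (1 : ℂ) ∈ Polynomial.nthRootsFinset p (1 : ℂ) := by
      rw [Polynomial.mem_nthRootsFinset hp.pos, one_pow]
  · rw [End.finrank_eq_sum_eigenspace hp.pos hX, ← Finset.add_sum_erase _ _ h1,
      Finset.sum_congr rfl hb, Finset.sum_const, Finset.card_erase_of_mem h1,
      hω.card_nthRootsFinset, smul_eq_mul]
  · have h2 := End.trace_pow_eq_sum hp.pos hX 1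
    rw [pow_one] at h2
    rw [h2, ← Finset.add_sum_erase _ _ h1, Finset.sum_congr rfl fun ζ hζ => by rw [hb ζ hζ]]
    simp only [pow_one]
    rw [← Finset.sum_mul]
    have h3 := sum_nthRootsFinset_prime hp
    rw [← Finset.add_sum_erase _ _ h1] at h3
    rw [eq_neg_of_add_eq_zero_right h3]
    ring

theorem _root_.Equiv.Perm.isConj_threeCycle_pow {a b c : α} (hab : a ≠ b) (hbc : b ≠ c)
    (hac : a ≠ c) {k : ℕ} (hk : ¬3 ∣ k) :
    IsConj ((swap a b * swap b c) ^ k) (swap a b * swap b c) := by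
  set σ := swap a b * swap b c with hσ
  have h3 : σ ^ 3 = 1 := Perm.swap_mul_swap_pow_three hab hac hbc
  rw [← Nat.div_add_mod k 3, pow_add, pow_mul, h3, one_pow, one_mul]
  have h : k % 3 = 1 ∨ k % 3 = 2 := by omega
  rcases h with h | h <;> rw [h]
  · rw [pow_one]
  · refine isConj_iff.2 ⟨swap a b, ?_⟩
    have h1 : σ ^ 2 = σ⁻¹ := eq_inv_of_mul_eq_one_left (by rw [← pow_succ, h3])
    rw [h1, hσ, mul_inv_rev, swap_inv, swap_inv]
    rw [mul_assoc, mul_assoc, swap_mul_self, mul_one]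

/-- Multiplicities of a 3-cycle in the presence of a fixed point. -/
theorem exists_finrank_threeCycle {a b c d : α} (hab : a ≠ b) (hac : a ≠ c) (hbc : b ≠ c)
    (had : a ≠ d) (hbd : b ≠ d) (hcd : c ≠ d) :
    ∃ m : ℕ, (finrank ℂ V ≠ 0 → m ≠ 0) ∧
      finrank ℂ V = finrank ℂ ((R.op (swap a b * swap b c)).eigenspace 1) + 2 * m ∧
      LinearMap.trace ℂ V (R.op (swap a b * swap b c)) = finrank ℂ V - 3 * m := by
  obtain ⟨m, h1, h2, h3⟩ := R.exists_finrank_eigenspace Nat.prime_three (by decide)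
    (Perm.swap_mul_swap_pow_three hab hac hbc)
    fun k hk => Perm.isConj_threeCycle_pow hab hbc hac hk
  refine ⟨m, fun hV hm => ?_, h2, ?_⟩
  · have : Nontrivial V := finrank_pos_iff.1 (Nat.pos_of_ne_zero hV)
    have hω := Complex.isPrimitiveRoot_exp 3 (by decide)
    have hω1 := hω.ne_one (by decide)
    obtain ⟨v, hv, hv'⟩ := R.exists_eigenvector_threeCycle hab hac hbc had hbd hcd
      hω.pow_eq_one hω1
    have := h1 _ hω.pow_eq_one hω1
    rw [hm, Submodule.finrank_eq_zero] at this
    exact hv ((Submodule.eq_bot_iff _).1 this v (End.mem_eigenspace_iff.2 hv'))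
  · rw [h3, h2]
    push_cast
    ring

end SpinRep

namespace SpinRep

variable {V : Type} [AddCommGroup V] [Module ℂ V] [FiniteDimensional ℂ V]

/-- Joint multiplicities of two disjoint 3-cycles on seven points. -/
theorem exists_finrank_two_threeCycles {R : SpinRep (Fin 7) V} (h : ¬R.Basic) :
    ∃ P q c : ℕ, q ≠ 0 ∧ c ≠ 0 ∧ 2 ∣ q ∧ finrank ℂ V = P + 4 * q + 4 * c ∧
      LinearMap.trace ℂ V (R.op (swap 0 1 * swap 1 2 * (swap 3 4 * swap 4 5))) =
        P - 2 * q + c := by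
  set x : Perm (Fin 7) := swap 0 1 * swap 1 2 with hx
  set y : Perm (Fin 7) := swap 3 4 * swap 4 5 with hy
  have hx3 : x ^ 3 = 1 := Perm.swap_mul_swap_pow_three (by decide) (by decide) (by decide)
  have hy3 : y ^ 3 = 1 := Perm.swap_mul_swap_pow_three (by decide) (by decide) (by decide)
  have hA := R.op_pow_eq_one (by decide : Odd 3) hx3
  obtain ⟨b, hb, hd, htA⟩ := R.exists_finrank_eigenspace Nat.prime_three (by decide) hx3
    fun k hk => Perm.isConj_threeCycle_pow (by decide) (by decide) (by decide) hk
  let e : Fin 3 ↪ Fin 7 := ⟨![0, 1, 2], by decide⟩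
  let f : Fin 4 ↪ Fin 7 := ⟨![3, 4, 5, 6], by decide⟩
  have he : x = (swap 0 1 * swap 1 2 : Perm (Fin 3)).viaEmbedding e := by
    rw [Perm.viaEmbedding_mul, Perm.viaEmbedding_swap, Perm.viaEmbedding_swap]
    rfl
  have hf : y = (swap 0 1 * swap 1 2 : Perm (Fin 4)).viaEmbedding f := by
    rw [Perm.viaEmbedding_mul, Perm.viaEmbedding_swap, Perm.viaEmbedding_swap]
    rfl
  have hc (σ : Perm (Fin 4)) : Commute (R.op x) ((R.comap f).op σ) := by
    rw [he]
    exact R.op_disjoint_commute e f (by decide) σ (by decide)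
  have hB (ζ : ℂ) : Set.MapsTo (R.op y) ((R.op x).eigenspace ζ) ((R.op x).eigenspace ζ) := by
    rw [hf]
    exact fun v hv => End.eigenspace_stable (hc _).symm ζ v hv
  have ht (ζ : ℂ) : ∃ m : ℕ, (finrank ℂ ((R.op x).eigenspace ζ) ≠ 0 → m ≠ 0) ∧
      (∃ P, finrank ℂ ((R.op x).eigenspace ζ) = P + 2 * m) ∧
      LinearMap.trace ℂ _ ((R.op y).restrict (hB ζ)) =
        finrank ℂ ((R.op x).eigenspace ζ) - 3 * m := by
    obtain ⟨m, h1, h2, h3⟩ := ((R.comap f).onEigenspace _ hc ζ).exists_finrank_threeCycle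
      (a := 0) (b := 1) (c := 2) (d := 3)
      (by decide) (by decide) (by decide) (by decide) (by decide) (by decide)
    refine ⟨m, h1, ⟨_, h2⟩, ?_⟩
    rw [← h3]
    congr 1
    refine LinearMap.ext fun v => Subtype.ext ?_
    rw [onEigenspace_apply, comap_op, ← hf]
    rfl
  have heven (ζ : ℂ) : 2 ∣ finrank ℂ ((R.op x).eigenspace ζ) := by
    simpa using two_pow_dvd_finrank 1 ((R.comap f).onEigenspace _ hc ζ) (by simp)
  choose m hm0 hmP hmt using ht
  obtain ⟨ω, hω⟩ : ∃ ω : ℂ, IsPrimitiveRoot ω 3 := ⟨_, Complex.isPrimitiveRoot_exp 3 (by decide)⟩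
  have hω1 := hω.ne_one (by decide)
  have hω3 := hω.pow_eq_one
  have hω0 : ω ≠ 0 := hω.ne_zero (by decide)
  have hω2 : ω ^ 2 ≠ 1 := hω.pow_ne_one_of_pos_of_lt (by decide) (by decide)
  have hs : 1 + ω + ω ^ 2 = 0 := by
    have := hω.geom_sum_eq_zero (by decide)
    simpa [Finset.sum_range_succ] using this
  have htr (j : ℕ) : LinearMap.trace ℂ V (R.op x ^ j * R.op y) =
      (finrank ℂ ((R.op x).eigenspace 1) - 3 * m 1) + ω ^ j * (b - 3 * m ω) +
        (ω ^ 2) ^ j * (b - 3 * m (ω ^ 2)) := by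
    obtain ⟨D, hD⟩ : ∃ D : ℂ → ℕ, ∀ ζ, finrank ℂ ((R.op x).eigenspace ζ) = D ζ :=
      ⟨_, fun _ => rfl⟩
    rw [End.trace_mul_eq_sum (by decide) hA hB j,
      Finset.sum_congr rfl fun ζ _ => by rw [hmt, hD],
      sum_nthRootsFinset (by decide) hω fun ζ => ζ ^ j * (D ζ - 3 * m ζ), hD 1,
      ← hb ω hω3 hω1, hD]
    have hD2 := hb (ω ^ 2) (by rw [← pow_mul, mul_comm, pow_mul, hω3, one_pow]) hω2
    rw [← hb ω hω3 hω1, hD, hD] at hD2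
    simp only [Finset.sum_range_succ, Finset.sum_range_zero, pow_zero, pow_one, one_pow, hD2]
    ring
  have hsym : R.op (swap 0 1) * (R.op x ^ 1 * R.op y) =
      (R.op x ^ 2 * R.op y) * R.op (swap 0 1) := by
    have h1 := R.op_conj (by decide : Odd 3) hx3 (swap 0 1)
    have h2 := R.op_conj (by decide : Odd 3) hy3 (swap 0 1)
    rw [show swap 0 1 * x * (swap 0 1)⁻¹ = x ^ 2 by decide,
      R.op_pow_of_odd (by decide : Odd 3) hx3] at h1
    rw [show swap 0 1 * y * (swap 0 1)⁻¹ = y by decide] at h2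
    rw [pow_one, ← mul_assoc, h1, mul_assoc, h2, mul_assoc]
  have h1 := R.trace_eq_of_mul_eq _ hsym
  rw [htr, htr] at h1
  have hcc : (m ω : ℂ) = m (ω ^ 2) := by
    have h2 : ω - ω ^ 2 ≠ 0 := by
      intro h2
      have : ω * (1 - ω) = 0 := by linear_combination h2
      rcases mul_eq_zero.1 this with h3 | h3
      · exact hω0 h3
      · exact hω1 (by linear_combination -h3)
    have h3 : (ω - ω ^ 2) * ((m ω : ℂ) - m (ω ^ 2)) = 0 := by
      linear_combination (1 / 3) * h1 - (1 / 3) * ω * (b - 3 * m (ω ^ 2)) * hω3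
    exact sub_eq_zero.1 ((mul_eq_zero.1 h3).resolve_left h2)
  have hswap : R.op (swap 0 3 * swap 1 4 * swap 2 5) * R.op x =
      R.op y * R.op (swap 0 3 * swap 1 4 * swap 2 5) := by
    rw [R.op_conj (by decide : Odd 3) hx3, show swap 0 3 * swap 1 4 * swap 2 5 * x *
      (swap 0 3 * swap 1 4 * swap 2 5)⁻¹ = y by decide]
  have h2 := R.trace_eq_of_mul_eq _ hswap
  have h3 := htr 0
  rw [pow_zero, one_mul, h2, htA, ← hcc] at h3
  have hbq : b = m 1 + 2 * m ω := by
    have : (b : ℂ) = m 1 + 2 * m ω := by linear_combination -(1 / 3) * h3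
    exact_mod_cast this
  obtain ⟨P, hP⟩ := hmP 1
  obtain ⟨v, hv, hvx⟩ := exists_fixed_of_not_basic h (a := 0) (b := 1) (c := 2) (by decide)
    (by decide) (by decide)
  have : Nontrivial V := nontrivial_of_ne v 0 hv
  have hE1 : finrank ℂ ((R.op x).eigenspace 1) ≠ 0 := by
    rw [Ne, Submodule.finrank_eq_zero]
    exact fun h => hv ((Submodule.eq_bot_iff _).1 h v
      (End.mem_eigenspace_iff.2 (by rw [hvx, one_smul])))
  have hEω : finrank ℂ ((R.op x).eigenspace ω) ≠ 0 := by
    obtain ⟨w, hw, hwx⟩ := R.exists_eigenvector_threeCycle (a := 0) (b := 1) (c := 2) (d := 3)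
      (by decide) (by decide) (by decide) (by decide) (by decide) (by decide) hω3 hω1
    rw [Ne, Submodule.finrank_eq_zero]
    exact fun h => hw ((Submodule.eq_bot_iff _).1 h w (End.mem_eigenspace_iff.2 hwx))
  have heω := heven ω
  rw [hb ω hω3 hω1] at heω
  refine ⟨P, m 1, m ω, hm0 1 hE1, hm0 ω hEω, by omega, by omega, ?_⟩
  have h4 := htr 1
  rw [pow_one, ← R.op_mul_of_odd (by decide : Odd 3) hx3 hy3 (show x * y = y * x by decide)] at h4
  rw [h4, ← hcc, hP, hbq]
  push_cast
  linear_combination (m 1 - m ω : ℂ) * hs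

end SpinRep

namespace SpinRep

variable {V : Type} [AddCommGroup V] [Module ℂ V] [FiniteDimensional ℂ V]

theorem _root_.Equiv.Perm.cycleType_two_threeCycles :
    (swap 0 1 * swap 1 2 * (swap 3 4 * swap 4 5) : Perm (Fin 7)).cycleType = {3, 3} := by
  have h (a b c : Fin 7) (hab : a ≠ b) (hbc : b ≠ c) (hac : a ≠ c) :
      (swap a b * swap b c).cycleType = {3} := by
    rw [swap_comm a b]
    exact Perm.IsThreeCycle.cycleType (Perm.isThreeCycle_swap_mul_swap_same hab.symm hbc hac)
  rw [Perm.Disjoint.cycleType_mul (fun x => by revert x; decide),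
    h _ _ _ (by decide) (by decide) (by decide), h _ _ _ (by decide) (by decide) (by decide)]
  rfl

theorem Irred.finrank_sevenCycle_ne [Nontrivial V] {R : SpinRep (Fin 7) V} (hR : R.Irred)
    (hb : ¬R.Basic) {σ : Perm (Fin 7)} (hσ : σ.cycleType = {7}) {b : ℕ}
    (htr : LinearMap.trace ℂ V (R.op σ) = -b) (hd : finrank ℂ V = 6 * b) : False := by
  obtain ⟨P, q, c, hq, hc, hq2, h1, h2⟩ := exists_finrank_two_threeCycles hb
  have hτ := Perm.cycleType_two_threeCycles
  generalize (swap 0 1 * swap 1 2 * (swap 3 4 * swap 4 5) : Perm (Fin 7)) = τ at h2 hτ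
  have hστ : ¬IsConj σ τ := by
    rw [Perm.isConj_iff_cycleType_eq, hσ, hτ]
    decide
  have hσ1 : σ ≠ 1 := by rintro rfl; simp at hσ
  have hzσ : Perm.zee σ = 7 := by simp [Perm.zee, hσ]
  have hzτ : Perm.zee τ = 18 := by
    simp [Perm.zee, hτ, Multiset.toFinset_cons]
  have hχσ : R.chiSq σ = (b : ℝ) ^ 2 := by
    rw [chiSq, htr, Complex.normSq_neg, Complex.normSq_natCast, sq]
  have h3 := hR.chiSq_lt hσ1
  rw [hχσ, hzσ] at h3
  have hb2 : b ≤ 2 := by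
    have h4 : b ^ 2 < 7 := by exact_mod_cast h3
    nlinarith
  have hb' : b = 2 := by omega
  have hP : P = 0 := by omega
  have hq' : q = 2 := by omega
  have hc' : c = 1 := by omega
  have h4 := hR.chiSq_div_add_le hστ
  have hχτ : R.chiSq τ = 9 := by
    rw [chiSq, h2, hP, hq', hc']
    norm_num
  rw [hχσ, hχτ, hzσ, hzτ, hb'] at h4
  norm_num at h4

theorem two_pow_bound_of_basic {r : ℕ} (hr : 6 ≤ r) : (2 * r) ^ 2 * (2 * r + 1) < (2 ^ r) ^ 2 := by
  induction r, hr using Nat.le_induction with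
  | base => norm_num
  | succ r hr ih =>
    rw [pow_succ 2 r, mul_pow]
    nlinarith [Nat.mul_le_mul hr hr, Nat.mul_le_mul (Nat.mul_le_mul hr hr) hr]

theorem two_pow_bound_of_not_basic {n : ℕ} (hn : 11 ≤ n) :
    (n + 5) ^ 2 * (n + 6) < 9 * 2 ^ n := by
  induction n, hn using Nat.le_induction with
  | base => norm_num
  | succ n hn ih =>
    rw [pow_succ 2 n]
    nlinarith [Nat.mul_le_mul hn hn, Nat.mul_le_mul (Nat.mul_le_mul hn hn) hn]

section prime

variable {p : ℕ} [Fact p.Prime]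

theorem isConj_rot_pow {k : ℕ} (hk : ¬p ∣ k) : IsConj (rot p ^ k) (rot p) := by
  have hk0 : (k : ZMod p) ≠ 0 := fun h => hk ((ZMod.natCast_eq_zero_iff _ _).1 h)
  exact isConj_iff.2 ⟨dil (Units.mk0 _ hk0)⁻¹, dil_inv_mul_rot (Units.mk0 _ hk0) rfl⟩

theorem cycleType_rot : (rot p).cycleType = {p} := by
  have : NeZero p := ⟨(Fact.out : p.Prime).ne_zero⟩
  rw [Perm.cycleType_eq_filter, parts_rot, Multiset.filter_singleton,
    if_pos (Fact.out : p.Prime).two_le]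

theorem Irred.exists_fixed_rot [Nontrivial V] {R : SpinRep (ZMod p) V} (hR : R.Irred)
    (hp : 7 ≤ p) : ∃ v, v ≠ 0 ∧ R.op (rot p) v = v := by
  have hpp : p.Prime := Fact.out
  have hodd : Odd p := hpp.odd_of_ne_two (by omega)
  obtain ⟨b, -, hd, htr⟩ := R.exists_finrank_eigenspace hpp hodd (rot_pow_self p)
    fun k hk => isConj_rot_pow hk
  by_contra! hne
  have hE : finrank ℂ ((R.op (rot p)).eigenspace 1) = 0 := by
    rw [Submodule.finrank_eq_zero, Submodule.eq_bot_iff]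
    intro v hv
    by_contra hv0
    exact hne v hv0 (by simpa using End.mem_eigenspace_iff.1 hv)
  rw [hE, Nat.cast_zero, zero_sub] at htr
  rw [hE, zero_add] at hd
  have hd0 : 0 < finrank ℂ V := finrank_pos
  have hσ1 : rot p ≠ 1 := by
    intro h
    have h1 := cycleType_rot (p := p)
    rw [h] at h1
    simp at h1
  have hb : b ^ 2 < p := by
    have h1 := hR.chiSq_lt hσ1
    rw [chiSq, htr, Complex.normSq_neg, Complex.normSq_natCast] at h1
    have h2 : Perm.zee (rot p) = p := by simp [Perm.zee, cycleType_rot, ZMod.card]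
    rw [h2] at h1
    rw [sq]
    exact_mod_cast h1
  have hb1 : 0 < b := by
    rcases b.eq_zero_or_pos with h | h
    · rw [hd, h] at hd0; simp at hd0
    · exact h
  have hdsq : finrank ℂ V ^ 2 < (p - 1) ^ 2 * p := by
    rw [hd, mul_pow]
    exact Nat.mul_lt_mul_of_pos_left hb (by positivity [Nat.sub_pos_of_lt hpp.one_lt])
  by_cases hB : R.Basic
  · obtain ⟨r, hr⟩ := hodd
    have h1 := hB.two_pow_dvd_finrank (r := r) (by rw [ZMod.card, hr])
    rcases Nat.lt_or_ge r 6 with h6 | h6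
    · have h3 : r = 3 ∨ r = 4 ∨ r = 5 := by omega
      rcases h3 with rfl | rfl | rfl
      · subst hr
        have : b ≤ 2 := by nlinarith
        norm_num at h1 hd
        omega
      · subst hr
        norm_num at hpp
      · subst hr
        have : b ≤ 3 := by nlinarith
        norm_num at h1 hd
        omega
    · have h2 := two_pow_bound_of_basic h6
      have h3 := Nat.pow_le_pow_left (Nat.le_of_dvd hd0 h1) 2
      rw [hr, Nat.add_sub_cancel] at hdsq
      omega
  · have h4 := fun k hk => two_pow_dvd_finrank k R (by rw [ZMod.card]; exact hk)
    rcases Nat.lt_or_ge p 17 with h17 | h17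
    · have h3 : p = 7 ∨ p = 11 ∨ p = 13 := by
        interval_cases p <;> revert hpp <;> decide
      rcases h3 with rfl | rfl | rfl
      · exact Irred.finrank_sevenCycle_ne (R := R) hR hB (cycleType_rot (p := 7)) htr hd
      · have h1 := h4 2 (by decide)
        have h2 := three_mul_le_finrank hB (m := 8) (f := 8) (by decide) (by rw [ZMod.card])
          fun {W} _ _ _ _ R' => by
            have h5 := two_pow_dvd_finrank 2 R' (by decide)
            have h6 := two_pow_card_le 8 R' (by decide)
            have h7 : ¬finrank ℂ W ≤ 5 := fun h => by nlinarith
            omega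
        have : b ≤ 3 := by nlinarith
        omega
      · have h1 := h4 3 (by decide)
        have h2 := two_pow_le_of_not_basic hB (n := 7) (by rw [ZMod.card]) (by decide)
        have : b ≤ 3 := by nlinarith
        have h3 : b = 2 := by omega
        rw [hd, h3] at h2
        norm_num at h2
    · obtain ⟨n, rfl⟩ : ∃ n, p = n + 6 := ⟨p - 6, by omega⟩
      have h1 := two_pow_le_of_not_basic hB (n := n) (ZMod.card _) (by omega)
      have h2 := two_pow_bound_of_not_basic (n := n) (by omega)
      rw [show n + 6 - 1 = n + 5 by omega] at hdsq
      omega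

end prime

end SpinRep

theorem letter_rot_prime_one {p : ℕ} [Fact p.Prime] (hp : 7 ≤ p) : Letter (rot p) 1 1 := by
  intro V _ _ _ _ R
  obtain ⟨U, hU, _, hirr⟩ := R.exists_irred
  obtain ⟨v, hv, h⟩ := hirr.exists_fixed_rot hp
  exact ⟨v, by simpa using hv, by simpa using congrArg Subtype.val h⟩

theorem good_rot_prime {p : ℕ} [Fact p.Prime] (hp : 7 ≤ p) : Good (rot p) := by
  have : NeZero p := ⟨(Fact.out : p.Prime).ne_zero⟩
  have hodd : Odd p := (Fact.out : p.Prime).odd_of_ne_two (by omega)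
  have ho : orderOf (rot p) = p := by rw [Perm.orderOf_eq_lcm_parts, parts_rot]; simp
  refine good_of_odd (by rwa [ho]) fun V _ _ _ _ R a ha => ?_
  rw [ho] at ha
  obtain ⟨v, hv, h⟩ : ∃ v, v ≠ 0 ∧ (R.op (rot p) ^ 1) v = a • v := by
    by_cases ha1 : a = 1
    · rw [ha1]; exact letter_rot_prime_one hp V R
    · exact letter_rot_prime (by omega) ha ha1 V R
  exact ⟨v, hv, by rwa [pow_one] at h⟩

theorem good_rot_nine : Good (rot 9) :=
  good_wheel_three.of_parts (by rw [parts_rot, parts_wheel 3 3 (by norm_num)])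

theorem exists_lettered_dvd {j : ℕ} (hj : Odd j) (hj5 : 5 ≤ j) : ∃ (d : ℕ) (_ : NeZero d),
    Odd d ∧ 5 ≤ d ∧ d ∣ j ∧ (d.Prime ∨ d = 9) ∧ Lettered d := by
  by_cases h9 : 9 ∣ j
  · exact ⟨9, inferInstance, by decide, by norm_num, h9, Or.inr rfl,
      good_rot_nine.lettered (by decide)⟩
  · obtain ⟨p, hp, hpj, hp5⟩ : ∃ p, p.Prime ∧ p ∣ j ∧ 5 ≤ p := by
      by_contra! hc
      have h3 : ∀ {p : ℕ}, p.Prime → p ∣ j → p = 3 := by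
        intro p hp hpj
        have h1 := hc p hp hpj
        have h2 := hj.of_dvd_nat hpj
        have := hp.two_le
        interval_cases p
        · exact absurd h2 (by decide)
        · rfl
        · exact absurd h2 (by decide)
      have h4 := Nat.eq_prime_pow_of_unique_prime_dvd (by omega : j ≠ 0) h3
      generalize j.primeFactorsList.length = k at h4
      rcases k with _ | _ | k
      · norm_num at h4; omega
      · norm_num at h4; omega
      · exact h9 ⟨3 ^ k, by rw [h4, pow_add]; ring⟩
    exact ⟨p, ⟨hp.ne_zero⟩, hj.of_dvd_nat hpj, hp5, hpj, Or.inl hp,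
      haveI : NeZero p := ⟨hp.ne_zero⟩; lettered_prime hp hp5⟩

theorem good_rot_of_odd {q : ℕ} [NeZero q] (hq : Odd q) (hq7 : 7 ≤ q) : Good (rot q) := by
  obtain ⟨d, _, hd, hd5, ⟨e, he⟩, hd', h⟩ := exists_lettered_dvd hq (by omega)
  rcases e with _ | _ | e
  · omega
  · obtain rfl : q = d := by omega
    rcases hd' with hp | rfl
    · have : Fact q.Prime := ⟨hp⟩
      exact good_rot_prime hq7
    · exact good_rot_nine
  · exact h.good_rot (by omega : 2 ≤ e + 1 + 1) hd hd5 (by rw [he, mul_comm])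

theorem good_rot_of_even {m : ℕ} [NeZero m] (hm : Even m) (hm10 : 10 ≤ m) : Good (rot m) := by
  obtain ⟨j, rfl⟩ := hm
  rcases Nat.even_or_odd j with ⟨e, rfl⟩ | hj
  · have : NeZero e := ⟨by omega⟩
    refine (good_wheel_four (e := e) (by omega)).of_parts ?_
    rw [parts_rot, parts_wheel e 4 (by omega)]
    congr 1; ring
  · obtain ⟨d, _, hd, hd5, ⟨e, he⟩, -, h⟩ := exists_lettered_dvd hj (by omega)
    refine h.good_rot (e := 2 * e) ?_ hd hd5 (by rw [he]; ring)
    rcases e with _ | e <;> omega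

/-- All permutations whose cycle lengths (with fixed points) are `M` are good. -/
def GoodParts (M : Multiset ℕ) : Prop :=
  ∀ (α : Type) [DecidableEq α] [Fintype α] (σ : Perm α), σ.parts = M → Good σ

section parts

variable {α β : Type} [DecidableEq α] [Fintype α] [DecidableEq β] [Fintype β] {M N : Multiset ℕ}

theorem Good.goodParts {σ : Perm α} (h : Good σ) (hM : σ.parts = M) : GoodParts M :=
  fun _ _ _ _ hτ => h.of_parts (hτ.trans hM.symm)

theorem odd_lcm (h : ∀ m ∈ M, Odd m) : Odd M.lcm := by
  have h1 : Odd M.prod := by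
    induction M using Multiset.induction_on with
    | empty => simp
    | cons a M ih =>
      rw [Multiset.prod_cons]
      exact (h a (Multiset.mem_cons_self a M)).mul (ih fun m hm => h m (Multiset.mem_cons_of_mem hm))
  exact h1.of_dvd_nat (Multiset.lcm_dvd.2 fun _ => Multiset.dvd_prod)

theorem exists_parts_add {τ : Perm α} (hτ : τ.parts = M + N) :
    ∃ (k l : ℕ) (σ₁ : Perm (Fin k)) (σ₂ : Perm (Fin l)), σ₁.parts = M ∧ σ₂.parts = N ∧
      τ.parts = Perm.parts (Perm.sumCongr σ₁ σ₂) := by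
  obtain ⟨k, σ₁, h1⟩ := Perm.exists_parts_eq M fun m hm =>
    τ.pos_of_mem_parts (hτ ▸ Multiset.mem_add.2 (Or.inl hm))
  obtain ⟨l, σ₂, h2⟩ := Perm.exists_parts_eq N fun m hm =>
    τ.pos_of_mem_parts (hτ ▸ Multiset.mem_add.2 (Or.inr hm))
  exact ⟨k, l, σ₁, σ₂, h1, h2, by rw [Perm.parts_sumCongr, h1, h2, hτ]⟩

theorem GoodParts.add (hM : GoodParts M) (hN : GoodParts N) (oM : ∀ m ∈ M, Odd m)
    (oN : ∀ m ∈ N, Odd m) : GoodParts (M + N) := by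
  intro α _ _ τ hτ
  obtain ⟨k, l, σ₁, σ₂, h1, h2, h⟩ := exists_parts_add hτ
  refine ((hM _ σ₁ h1).sumCongr (hN _ σ₂ h2) ?_ ?_).of_parts h
  · rw [Perm.orderOf_eq_lcm_parts, h1]; exact odd_lcm oM
  · rw [Perm.orderOf_eq_lcm_parts, h2]; exact odd_lcm oN

theorem GoodParts.of_le (hN : GoodParts N) (hle : N ≤ M) (oN : ∀ m ∈ N, Odd m)
    (hd : ∀ m ∈ M - N, m ∣ N.lcm) : GoodParts M := by
  intro α _ _ τ hτ
  obtain ⟨k, l, σ₁, σ₂, h1, h2, h⟩ :=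
    exists_parts_add (hτ.trans (add_tsub_cancel_of_le hle).symm)
  refine ((hN _ σ₁ h1).sumCongr_of_dvd ?_ ?_).of_parts h
  · rw [Perm.orderOf_eq_lcm_parts, h1]; exact odd_lcm oN
  · rw [Perm.orderOf_eq_lcm_parts, Perm.orderOf_eq_lcm_parts, h1, h2]
    exact Multiset.lcm_dvd.2 hd

theorem goodParts_zero : GoodParts 0 := by
  intro α _ _ σ hσ
  have ho : orderOf σ = 1 := by rw [Perm.orderOf_eq_lcm_parts, hσ, Multiset.lcm_zero]
  refine good_of_odd (by rw [ho]; exact odd_one) fun V _ _ _ _ R a ha => ?_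
  rw [ho, pow_one] at ha
  obtain ⟨v, hv⟩ := exists_ne (0 : V)
  refine ⟨v, hv, ?_⟩
  rw [ha, orderOf_eq_one_iff.1 ho, R.op_one]; simp

theorem goodParts_of_seven_le (h : ∀ m ∈ M, Odd m ∧ 7 ≤ m) : GoodParts M := by
  induction M using Multiset.induction_on with
  | empty => exact goodParts_zero
  | cons q M ih =>
    have hq := h q (Multiset.mem_cons_self q M)
    have h' := fun m hm => h m (Multiset.mem_cons_of_mem hm)
    have : NeZero q := ⟨by omega⟩
    rw [← Multiset.singleton_add]
    refine ((good_rot_of_odd hq.1 hq.2).goodParts (parts_rot q)).add (ih h') ?_ fun m hm => (h' m hm).1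
    simpa using hq.1

theorem goodParts_five_five : GoodParts {5, 5} := by
  have ho : orderOf (rot 5) = 5 := by rw [Perm.orderOf_eq_lcm_parts, parts_rot]; simp
  have hodd : Odd (orderOf (rot 5)) := by rw [ho]; decide
  have : Good (Perm.sumCongr (rot 5) (rot 5) : Perm (ZMod 5 ⊕ ZMod 5)) := by
    have hos : orderOf (Perm.sumCongr (rot 5) (rot 5) : Perm (ZMod 5 ⊕ ZMod 5)) = 5 := by
      rw [Perm.orderOf_sumCongr, ho, Nat.lcm_self]
    refine good_of_odd (by rw [hos]; decide) fun V _ _ _ _ R a ha => ?_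
    rw [hos] at ha
    obtain ⟨w, hw, -, hprod⟩ := exists_word (e := 2) (d := 5) le_rfl (by decide) le_rfl ha
    have hl (i : ZMod 2) := lettered_prime (p := 5) (by norm_num) le_rfl _ (hw i).1 (hw i).2
    let E : ZMod 2 → ZMod 5 ↪ ZMod 5 ⊕ ZMod 5 :=
      fun i => if i = 0 then Function.Embedding.inl else Function.Embedding.inr
    obtain ⟨v, -, hv, hvw⟩ := Letter.exists_forall (σ := rot 5) (n := 1)
      (by rw [pow_one, sign_rot_of_odd (by decide)]) R E
      (by
        intro i j hij x y
        have h2 : ∀ i j : ZMod 2, i ≠ j → i ≠ 0 → j = 0 := by decide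
        by_cases hi : i = 0
        · have hj : j ≠ 0 := fun hj => hij (hi.trans hj.symm)
          simp [E, hi, hj]
        · simp [E, hi, h2 i j hij hi]) hl ⊤ top_ne_bot (by simp)
    refine ⟨v, hv, ?_⟩
    have h0 := hvw 0
    have h1 := hvw 1
    simp only [E, pow_one, if_true] at h0
    simp only [E, pow_one, one_ne_zero, if_false] at h1
    rw [R.op_sumCongr_of_odd hodd hodd, End.mul_apply, h1, map_smul, h0, smul_smul, ← hprod]
    congr 1
    exact (mul_comm _ _).trans (Fin.prod_univ_two w).symm
  exact this.goodParts (by rw [Perm.parts_sumCongr, parts_rot]; rfl)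

theorem eq_one_or_five {m : ℕ} (h : Odd m) (h3 : m ≠ 3) (h7 : ¬ 7 ≤ m) : m = 1 ∨ m = 5 := by
  obtain ⟨k, rfl⟩ := h; omega

theorem goodParts_of_three_notMem (hM : ∀ m ∈ M, Odd m) (h3 : 3 ∉ M)
    (h5 : M.filter (5 ∣ ·) ≠ {5}) : GoodParts M := by
  set B := M.filter (7 ≤ ·) with hB
  have hBM : B ≤ M := Multiset.filter_le _ _
  have hBo : ∀ m ∈ B, Odd m := fun m hm => hM m (Multiset.mem_of_le hBM hm)
  have hgB : GoodParts B := goodParts_of_seven_le fun m hm => by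
    rw [hB, Multiset.mem_filter] at hm
    exact ⟨hM m hm.1, hm.2⟩
  have hsub : M - B = M.filter (¬ 7 ≤ ·) := by
    rw [hB, tsub_eq_iff_eq_add_of_le (Multiset.filter_le _ _), add_comm, Multiset.filter_add_not]
  have hsmall {m : ℕ} (hm : m ∈ M - B) : m = 1 ∨ m = 5 := by
    rw [hsub, Multiset.mem_filter] at hm
    exact eq_one_or_five (hM m hm.1) (fun h => h3 (h ▸ hm.1)) hm.2
  by_cases hmem : 5 ∈ M
  · have h5F : 5 ∈ M.filter (5 ∣ ·) := Multiset.mem_filter.2 ⟨hmem, dvd_rfl⟩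
    obtain ⟨F, hF⟩ := Multiset.exists_cons_of_mem h5F
    have hF0 : F ≠ 0 := by rintro rfl; exact h5 hF
    obtain ⟨x, hx⟩ := Multiset.exists_mem_of_ne_zero hF0
    have hxM : x ∈ M ∧ 5 ∣ x := by
      rw [← Multiset.mem_filter (p := (5 ∣ ·)), hF]; exact Multiset.mem_cons_of_mem hx
    by_cases hx5 : x = 5
    · subst hx5
      have hle : ({5, 5} : Multiset ℕ) ≤ M - B := by
        rw [hsub, Multiset.le_filter]
        refine ⟨le_trans ?_ (Multiset.filter_le (5 ∣ ·) M), by simp⟩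
        rw [hF]
        exact Multiset.cons_le_cons 5 (Multiset.singleton_le.2 hx)
      have h55 : ∀ m ∈ ({5, 5} : Multiset ℕ), Odd m := by
        intro m hm
        obtain rfl : m = 5 := by simpa using hm
        decide
      refine (hgB.add goodParts_five_five hBo h55).of_le (add_le_of_le_tsub_left_of_le hBM hle)
        (fun m hm => (Multiset.mem_add.1 hm).elim (hBo m) (h55 m)) fun m hm => ?_
      rw [← tsub_tsub] at hm
      rcases hsmall (Multiset.mem_of_le tsub_le_self hm) with rfl | rfl
      · exact one_dvd _
      · exact Multiset.dvd_lcm (by simp)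
    · refine hgB.of_le hBM hBo fun m hm => ?_
      have hxB : x ∈ B := by
        rw [hB, Multiset.mem_filter]
        refine ⟨hxM.1, ?_⟩
        have := hM x hxM.1
        obtain ⟨⟨k, hk⟩, ⟨l, hl⟩⟩ := And.intro this hxM.2
        omega
      rcases hsmall hm with rfl | rfl
      · exact one_dvd _
      · exact hxM.2.trans (Multiset.dvd_lcm hxB)
  · refine hgB.of_le hBM hBo fun m hm => ?_
    rcases hsmall hm with rfl | rfl
    · exact one_dvd _
    · exact absurd (Multiset.mem_of_le tsub_le_self hm) hmem

theorem exists_mul_of_pow_three {b : ℂ} (hb : b ^ 3 = 1) :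
    ∃ r s : ℂ, r ^ 3 = 1 ∧ r ≠ 1 ∧ s ^ 3 = 1 ∧ s ≠ 1 ∧ b = r * s := by
  by_cases h1 : b = 1
  · obtain ⟨r, hr, hr1⟩ := exists_root_notMem (d := 3) (by norm_num) {1} (by simp)
    rw [Finset.mem_singleton] at hr1
    refine ⟨r, r ^ 2, hr, hr1, by rw [← pow_mul, mul_comm, pow_mul, hr, one_pow], fun h => hr1 ?_,
      by rw [h1, ← hr]; ring⟩
    rw [pow_succ, h, one_mul] at hr
    exact hr
  · have h2 : b ^ 2 ≠ 1 := fun h => h1 (by rw [pow_succ, h, one_mul] at hb; exact hb)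
    have h3 : (b ^ 2) ^ 3 = 1 := by rw [← pow_mul, mul_comm, pow_mul, hb, one_pow]
    exact ⟨b ^ 2, b ^ 2, h3, h2, h3, h2, by linear_combination -b * hb⟩

theorem GoodParts.three_three_add (hN : GoodParts N) (oN : ∀ m ∈ N, Odd m) (hN0 : N ≠ 0) :
    GoodParts ({3, 3} + N) := by
  intro α _ _ τ hτ
  obtain ⟨k, l, -, σ₂, -, h2, -⟩ := exists_parts_add hτ
  have hl : 0 < l := by
    obtain ⟨x, hx⟩ := Multiset.exists_mem_of_ne_zero hN0
    have h3 := σ₂.pos_of_mem_parts (h2 ▸ hx)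
    have h4 := Multiset.single_le_sum (fun _ _ => Nat.zero_le _) x hx
    rw [← h2, σ₂.sum_parts, Fintype.card_fin] at h4
    omega
  set x : Perm (Fin 6) := swap 0 1 * swap 1 2 with hx
  set y : Perm (Fin 6) := swap 3 4 * swap 4 5 with hy
  have hx3 : x ^ 3 = 1 := by decide
  have hy3 : y ^ 3 = 1 := by decide
  have hxy : Commute x y := by unfold Commute SemiconjBy; decide
  have hct (a b c : Fin 6) (hab : a ≠ b) (hbc : b ≠ c) (hac : a ≠ c) :
      (swap a b * swap b c).cycleType = {3} := by
    rw [swap_comm a b]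
    exact Perm.IsThreeCycle.cycleType (Perm.isThreeCycle_swap_mul_swap_same hab.symm hbc hac)
  have hp : (x * y).parts = {3, 3} := by
    have hd : x.Disjoint y := fun i => by revert i; decide
    have hs : x.support.card = 3 ∧ y.support.card = 3 := by decide
    rw [Perm.parts_mul hd, hs.1, hs.2, hct _ _ _ (by decide) (by decide) (by decide),
      hct _ _ _ (by decide) (by decide) (by decide)]
    rfl
  have ho : orderOf (x * y) = 3 := by rw [Perm.orderOf_eq_lcm_parts, hp]; decide
  have hodd : Odd (orderOf (x * y)) := by rw [ho]; decide
  have hodd₂ : Odd (orderOf σ₂) := by rw [Perm.orderOf_eq_lcm_parts, h2]; exact odd_lcm oN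
  refine Good.of_parts (σ := Perm.sumCongr (x * y) σ₂) ?_
    (by rw [Perm.parts_sumCongr, hp, h2, hτ])
  have hos := Perm.orderOf_sumCongr (x * y) σ₂
  refine good_of_odd (hos ▸ (hodd.mul hodd₂).of_dvd_nat (Nat.lcm_dvd_mul _ _))
    fun V _ _ _ _ R a ha => ?_
  rw [hos, ho] at ha
  obtain ⟨b, c, hb, hc, rfl⟩ := exists_mul_eq_of_pow_lcm (by norm_num) (orderOf_pos σ₂).ne' ha
  obtain ⟨r, s, hr, hr1, hs, hs1, rfl⟩ := exists_mul_of_pow_three hb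
  set X := R.op (x.viaEmbedding Function.Embedding.inl) with hX
  set Y := R.op (y.viaEmbedding Function.Embedding.inl) with hY
  let e : Fin 7 ↪ Fin 6 ⊕ Fin l := ⟨![Sum.inl 0, Sum.inl 1, Sum.inl 2, Sum.inl 3, Sum.inl 4,
    Sum.inl 5, Sum.inr ⟨0, hl⟩], by
      intro i j hij
      fin_cases i <;> fin_cases j <;> simp at hij ⊢⟩
  obtain ⟨v, hv, hrv, hsv⟩ := (R.comap e).exists_eigenvector_two_threeCycles hr hr1 hs hs1
  rw [SpinRep.comap_op, Perm.viaEmbedding_mul, Perm.viaEmbedding_swap, Perm.viaEmbedding_swap]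
    at hrv hsv
  have hrv' : X v = r • v := by
    rw [hX, hx, Perm.viaEmbedding_mul, Perm.viaEmbedding_swap, Perm.viaEmbedding_swap]; exact hrv
  have hsv' : Y v = s • v := by
    rw [hY, hy, Perm.viaEmbedding_mul, Perm.viaEmbedding_swap, Perm.viaEmbedding_swap]; exact hsv
  have hcomm {u : Perm (Fin 6)} (hu : u ^ 3 = 1) (ρ : Perm (Fin l)) :
      Commute (R.op (ρ.viaEmbedding Function.Embedding.inr))
        (R.op (u.viaEmbedding Function.Embedding.inl)) :=
    (R.op_disjoint_commute _ _ (by simp) ρ (by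
      have h1 : orderOf u ∣ 3 := orderOf_dvd_of_pow_eq_one hu
      exact Perm.sign_eq_one_of_odd ((by decide : Odd 3).of_dvd_nat h1))).symm
  obtain ⟨u, hu, hu0, hcu⟩ := (hN _ σ₂ h2).exists_mem_of_odd hodd₂ R Function.Embedding.inr
    (X.eigenspace r ⊓ Y.eigenspace s)
    (fun h => hv ((Submodule.eq_bot_iff _).1 h v ⟨End.mem_eigenspace_iff.2 hrv',
      End.mem_eigenspace_iff.2 hsv'⟩))
    (fun ρ w hw => ⟨End.eigenspace_stable (hcomm hx3 ρ) _ _ hw.1,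
      End.eigenspace_stable (hcomm hy3 ρ) _ _ hw.2⟩) c hc
  have hrs := And.intro (End.mem_eigenspace_iff.1 hu.1) (End.mem_eigenspace_iff.1 hu.2)
  refine ⟨u, hu0, ?_⟩
  rw [R.op_sumCongr_of_odd hodd hodd₂, End.mul_apply, hcu, map_smul, Perm.viaEmbedding_mul,
    R.op_mul_of_odd (k := 3) (by decide) (by rw [← Perm.viaEmbedding_pow, hx3, Perm.viaEmbedding_one])
      (by rw [← Perm.viaEmbedding_pow, hy3, Perm.viaEmbedding_one])
      (by unfold Commute SemiconjBy; rw [← Perm.viaEmbedding_mul, hxy.eq, Perm.viaEmbedding_mul]),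
    End.mul_apply, hrs.2, map_smul, hrs.1, smul_smul, smul_smul]
  congr 1; ring

theorem goodParts_three_three_three : GoodParts {3, 3, 3} := by
  have h3 : Odd 3 := by decide
  have hd01 : (shift 3 3 0).Disjoint (shift 3 3 1) := fun i => by
    rw [shift_three, shift_three]; revert i; decide
  have hd2 : (shift 3 3 0 * shift 3 3 1).Disjoint (shift 3 3 2) := fun i => by
    rw [shift_three, shift_three, shift_three]; revert i; decide
  have hct (i : ZMod 3) : (shift 3 3 i).cycleType = {3} := by
    rw [shift, Perm.cycleType_viaEmbedding, Perm.cycleType_eq_filter, parts_rot]; rfl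
  have hp : (shift 3 3 0 * shift 3 3 1 * shift 3 3 2).parts = {3, 3, 3} := by
    have h1 := Perm.sum_cycleType (shift 3 3 0 * shift 3 3 1)
    have h2 (i : ZMod 3) := Perm.sum_cycleType (shift 3 3 i)
    rw [hd01.cycleType_mul] at h1
    simp only [hct] at h1 h2
    rw [Perm.parts_mul hd2, hd01.cycleType_mul, hct, hct, hct, ← h1, ← h2]
    rfl
  have ho : orderOf (shift 3 3 0 * shift 3 3 1 * shift 3 3 2) = 3 := by
    rw [Perm.orderOf_eq_lcm_parts, hp]; decide
  refine Good.goodParts (good_of_odd (by rw [ho]; exact h3) fun V _ _ _ _ R a ha => ?_) hp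
  rw [ho] at ha
  have hc (i j : ZMod 3) : Commute (shift 3 3 i) (shift 3 3 j) := by
    unfold Commute SemiconjBy
    rw [shift_three, shift_three]; revert i j; decide
  have key {r s t : ℂ} (h : R.HasTriple r s t) (ha : a = r * s * t) :
      ∃ v, v ≠ 0 ∧ R.op (shift 3 3 0 * shift 3 3 1 * shift 3 3 2) v = a • v := by
    obtain ⟨v, hv, h0, h1, h2⟩ := h
    refine ⟨v, hv, ?_⟩
    rw [R.op_mul_of_odd (k := 3) h3 (by rw [(hc 0 1).mul_pow]; simp [SpinRep.shift_three_pow])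
      (SpinRep.shift_three_pow 2) ((hc 0 2).mul_left (hc 1 2)), R.op_mul_of_odd (k := 3) h3
      (SpinRep.shift_three_pow 0) (SpinRep.shift_three_pow 1) (hc 0 1), End.mul_apply,
      End.mul_apply, h2, map_smul, map_smul, h1, map_smul, h0, smul_smul, smul_smul, ha]
    congr 1; ring
  obtain ⟨r, s, hr, hr1, hs, hs1, rfl⟩ := exists_mul_of_pow_three ha
  obtain ⟨t, h⟩ := R.exists_hasTriple hr hr1 hs hs1
  by_cases ht1 : t = 1
  · exact key h (by rw [ht1, mul_one])
  · have flip {x y s t : ℂ} (h : R.HasTriple x s t) (hx1 : x ≠ 1) (hy : y ^ 3 = 1) (hy1 : y ≠ 1) :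
        R.HasTriple y s t := by
      rcases eq_or_eq_sq_of_pow_three h.pow_three.1 hx1 hy hy1 with rfl | rfl
      · exact h
      · exact h.sq
    have all {x y z : ℂ} (hx : x ^ 3 = 1) (hx1 : x ≠ 1) (hy : y ^ 3 = 1) (hy1 : y ≠ 1)
        (hz : z ^ 3 = 1) (hz1 : z ≠ 1) : R.HasTriple x y z :=
      (flip (flip (flip h hr1 hx hx1).rotate ht1 hz hz1).rotate hs1 hy hy1).rotate
    by_cases ha1 : r * s = 1
    · exact key (all hr hr1 hr hr1 hr hr1) (by rw [ha1, ← hr]; ring)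
    · have hr2 : (r ^ 2) ^ 3 = 1 := by rw [← pow_mul, mul_comm, pow_mul, hr, one_pow]
      refine key (all ha ha1 hr hr1 hr2 fun h => hr1 ?_) (by linear_combination -(r * s) * hr)
      rw [pow_succ, h, one_mul] at hr
      exact hr

/-- Permutations with odd cycle lengths. -/
theorem goodParts_of_odd (hM : ∀ m ∈ M, Odd m) (h3 : M.filter (3 ∣ ·) ≠ {3})
    (h5 : M.filter (5 ∣ ·) ≠ {5}) (h7 : 3 ∉ M ∨ 7 ≤ M.sum) : GoodParts M := by
  by_cases hmem : 3 ∈ M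
  swap
  · exact goodParts_of_three_notMem hM hmem h5
  have hsum := h7.resolve_left (not_not.2 hmem)
  set N := M.filter (· ≠ 3) with hN
  have hNM : N ≤ M := Multiset.filter_le _ _
  have hNo : ∀ m ∈ N, Odd m := fun m hm => hM m (Multiset.mem_of_le hNM hm)
  have hgN : GoodParts N := by
    refine goodParts_of_three_notMem hNo (by simp [hN]) ?_
    rwa [hN, Multiset.filter_filter, Multiset.filter_congr (q := (5 ∣ ·))]
    intro x _
    refine ⟨And.left, fun h => ⟨h, ?_⟩⟩
    rintro rfl
    norm_num at h
  have hsub : M - N = Multiset.replicate (M.count 3) 3 := by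
    rw [hN, tsub_eq_iff_eq_add_of_le (Multiset.filter_le _ _), ← Multiset.filter_eq' M 3, add_comm]
    exact (Multiset.filter_add_not _ _).symm.trans (add_comm _ _)
  by_cases hx : ∃ x ∈ N, 3 ∣ x
  · obtain ⟨x, hxN, hx3⟩ := hx
    refine hgN.of_le hNM hNo fun m hm => ?_
    rw [hsub] at hm
    rw [Multiset.eq_of_mem_replicate hm]
    exact hx3.trans (Multiset.dvd_lcm hxN)
  · have hfil : M.filter (3 ∣ ·) = M - N := by
      rw [← add_tsub_cancel_of_le hNM, Multiset.filter_add, hsub, Multiset.filter_eq_nil.2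
        fun x hxN h => hx ⟨x, hxN, h⟩, zero_add, Multiset.filter_eq_self.2]
      · simp
      · intro a ha
        rw [Multiset.eq_of_mem_replicate ha]
    have hpos : 1 ≤ M.count 3 := Multiset.one_le_count_iff_mem.2 hmem
    have hc : 2 ≤ M.count 3 := by
      rw [hfil, hsub] at h3
      by_contra hlt
      obtain hc : M.count 3 = 1 := by omega
      exact h3 (by rw [hc]; rfl)
    by_cases hN0 : N = 0
    · have hM3 : M = Multiset.replicate (M.count 3) 3 := by
        rw [← hsub, hN0, tsub_zero]
      rw [hM3, Multiset.sum_replicate, smul_eq_mul] at hsum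
      refine goodParts_three_three_three.of_le (Multiset.le_count_iff_replicate_le (n := 3).1 (by omega))
        (fun m hm => ?_) fun m hm => ?_
      · obtain rfl : m = 3 := by simpa using hm
        decide
      · rw [hM3] at hm
        rw [Multiset.eq_of_mem_replicate (Multiset.mem_of_le tsub_le_self hm)]
        exact Multiset.dvd_lcm (by simp)
    · have hle : ({3, 3} : Multiset ℕ) ≤ M - N := by
        rw [hsub]
        exact (Multiset.replicate_le_replicate (k := 2) 3).2 hc
      refine (hgN.three_three_add hNo hN0).of_le
        (add_le_of_le_tsub_right_of_le hNM hle) (fun m hm => ?_) fun m hm => ?_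
      · rcases Multiset.mem_add.1 hm with h | h
        · obtain rfl : m = 3 := by simpa using h
          decide
        · exact hNo m h
      · rw [add_comm, ← tsub_tsub, hsub] at hm
        rw [Multiset.eq_of_mem_replicate (Multiset.mem_of_le tsub_le_self hm)]
        exact Multiset.dvd_lcm (by simp)

end parts

/-- The cycle lengths of the square of a cycle of length `l`. -/
def sqParts (l : ℕ) : Multiset ℕ := if Even l then {l / 2, l / 2} else {l}

theorem parts_rot_sq (l : ℕ) [NeZero l] : (rot l ^ 2).parts = sqParts l := by
  rw [sqParts]
  split_ifs with h
  · obtain ⟨d, rfl⟩ := h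
    have hd0 : d ≠ 0 := by rintro rfl; exact NeZero.ne (0 + 0) rfl
    have : NeZero d := ⟨hd0⟩
    obtain ⟨e, he⟩ := Perm.exists_equiv_of_parts_eq (σ := wheel 2 d) (τ := rot (d + d)) (by
      rw [parts_wheel 2 d le_rfl, parts_rot, two_mul])
    rw [← he, ← Perm.viaEmbedding_pow, Perm.parts_viaEmbedding, wheel_pow_self]
    let f : ZMod d ⊕ ZMod d ↪ ZMod 2 × ZMod d :=
      ⟨Sum.elim (fun t => (0, t)) (fun t => (1, t)), by
        rintro (x | x) (y | y) h <;> simp_all⟩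
    have hf : (Perm.sumCongr (rot d) (rot d)).viaEmbedding f = shifts 2 d Finset.univ := by
      ext x : 1
      have h2 : x.1 = 0 ∨ x.1 = 1 := by have : ∀ i : ZMod 2, i = 0 ∨ i = 1 := by decide
                                        exact this _
      obtain ⟨i, t⟩ := x
      rcases h2 with h | h
      · obtain rfl : i = 0 := h
        exact (Perm.viaEmbedding_apply _ f (Sum.inl t)).trans (by
          simp [shifts_apply, f]
          rfl)
      · obtain rfl : i = 1 := h
        exact (Perm.viaEmbedding_apply _ f (Sum.inr t)).trans (by
          simp [shifts_apply, f]
          rfl)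
    have hcard : Fintype.card (ZMod (d + d)) = d + d := ZMod.card _
    rw [← hf, Perm.parts_viaEmbedding, Perm.parts_sumCongr, parts_rot]
    simp only [hcard, Fintype.card_sum, Fintype.card_prod, ZMod.card, two_mul, tsub_self,
      Multiset.replicate_zero, add_zero]
    rw [show (d + d) / 2 = d by omega]
    rfl
  · rw [Nat.not_even_iff_odd] at h
    obtain ⟨u, hu⟩ : IsUnit ((2 : ℕ) : ZMod l) :=
      (ZMod.isUnit_iff_coprime 2 l).2 (Nat.coprime_two_left.2 h)
    rw [← parts_rot l]
    conv_rhs => rw [← dil_inv_mul_rot u hu]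
    simp only [Perm.parts, Perm.cycleType_conj, Perm.card_support_conj]

section

variable {α : Type} [DecidableEq α] [Fintype α]

theorem Equiv.Perm.parts_sq (σ : Perm α) : (σ ^ 2).parts = σ.parts.bind sqParts := by
  generalize hM : σ.parts = M
  induction M using Multiset.induction_on generalizing α with
  | empty =>
    have : Fintype.card α = 0 := by rw [← σ.sum_parts, hM, Multiset.sum_zero]
    have := Fintype.card_eq_zero_iff.1 this
    rw [Subsingleton.elim (σ ^ 2) σ, hM, Multiset.zero_bind]
  | cons l M ih =>
    rw [← Multiset.singleton_add] at hM
    obtain ⟨k, m, σ₁, σ₂, h1, h2, h⟩ := exists_parts_add hM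
    have : NeZero l := ⟨(σ₁.pos_of_mem_parts (by rw [h1]; simp)).ne'⟩
    obtain ⟨e, he⟩ := Perm.exists_equiv_of_parts_eq h.symm
    obtain ⟨f, hf⟩ := Perm.exists_equiv_of_parts_eq ((parts_rot l).trans h1.symm)
    have hs : Perm.sumCongr σ₁ σ₂ ^ 2 = Perm.sumCongr (σ₁ ^ 2) (σ₂ ^ 2) := by
      simp only [sq, Perm.sumCongr_mul]
    rw [← he, ← Perm.viaEmbedding_pow, Perm.parts_viaEmbedding, Fintype.card_congr e, tsub_self,
      Multiset.replicate_zero, add_zero, hs, Perm.parts_sumCongr, ih _ h2, ← hf,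
      ← Perm.viaEmbedding_pow, Perm.parts_viaEmbedding, Fintype.card_congr f, tsub_self,
      Multiset.replicate_zero, add_zero, parts_rot_sq, Multiset.cons_bind]

theorem filter_dvd_parts_sq {σ : Perm α} {d : ℕ} (hd : Odd d) (h : σ.parts.filter (d ∣ ·) ≠ {d}) :
    (σ ^ 2).parts.filter (d ∣ ·) ≠ {d} := by
  have hc (l : ℕ) (hl : l ∈ σ.parts) : (sqParts l).filter (d ∣ ·) =
      if d ∣ l then sqParts l else 0 := by
    rw [sqParts]
    split_ifs with h1 h2 h2
    · obtain ⟨k, rfl⟩ := h1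
      have h3 : d ∣ k := (Nat.coprime_two_right.2 hd).dvd_of_dvd_mul_left (two_mul k ▸ h2)
      rw [show (k + k) / 2 = k by omega, Multiset.filter_eq_self.2]
      intro a ha
      simp only [Multiset.insert_eq_cons, Multiset.mem_cons, Multiset.mem_singleton, or_self] at ha
      rwa [ha]
    · obtain ⟨k, rfl⟩ := h1
      rw [show (k + k) / 2 = k by omega, Multiset.filter_eq_nil.2]
      intro a ha hda
      simp only [Multiset.insert_eq_cons, Multiset.mem_cons, Multiset.mem_singleton, or_self] at ha
      exact h2 (dvd_add (ha ▸ hda) (ha ▸ hda))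
    · simpa [Multiset.filter_singleton] using h2
    · simpa [Multiset.filter_singleton] using h2
  have key : (σ ^ 2).parts.filter (d ∣ ·) = (σ.parts.filter (d ∣ ·)).bind sqParts := by
    rw [Perm.parts_sq]
    generalize σ.parts = M at hc
    induction M using Multiset.induction_on with
    | empty => simp
    | cons l M ih =>
      rw [Multiset.cons_bind, Multiset.filter_add, ih fun m hm => hc m (Multiset.mem_cons_of_mem hm),
        hc l (Multiset.mem_cons_self l M), Multiset.filter_cons, Multiset.add_bind]
      split_ifs <;> simp
  rw [key]
  intro hF
  have hcard (l : ℕ) : 1 ≤ (sqParts l).card := by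
    rw [sqParts]; split_ifs <;> simp
  generalize σ.parts.filter (d ∣ ·) = F at h hF
  induction F using Multiset.induction_on with
  | empty => simp at hF
  | cons l F _ =>
    have h1 := congrArg Multiset.card hF
    rw [Multiset.cons_bind, Multiset.card_add, Multiset.card_singleton] at h1
    rcases Multiset.empty_or_exists_mem F with rfl | ⟨m, hm⟩
    · rw [Multiset.cons_bind, Multiset.zero_bind, add_zero, sqParts] at hF
      split_ifs at hF with h2
      · simpa using congrArg Multiset.card hF
      · rw [Multiset.singleton_inj.1 hF] at h
        exact h rfl
    · obtain ⟨F, rfl⟩ := Multiset.exists_cons_of_mem hm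
      rw [Multiset.cons_bind, Multiset.card_add] at h1
      have := hcard l
      have := hcard m
      omega

/-- Even permutations. -/
theorem good_of_sign_eq_one {σ : Perm α} (hs : Perm.sign σ = 1)
    (h3 : σ.parts.filter (3 ∣ ·) ≠ {3}) (h5 : σ.parts.filter (5 ∣ ·) ≠ {5})
    (h7 : (∀ b, 3 * 2 ^ b ∉ σ.parts) ∨ 7 ≤ Fintype.card α) : Good σ := by
  induction hN : orderOf σ using Nat.strong_induction_on generalizing σ with
  | _ N ih =>
  subst hN
  rcases Nat.even_or_odd (orderOf σ) with he | ho
  · refine Good.of_sq ?_ ?_ he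
    · refine ih _ ?_ (by rw [map_pow, hs, one_pow]) (filter_dvd_parts_sq (by decide) h3)
        (filter_dvd_parts_sq (by decide) h5) (h7.imp_left fun h b hb => ?_) rfl
      · have := orderOf_pos σ
        rw [orderOf_pow, Nat.gcd_eq_right he.two_dvd]
        omega
      · rw [Perm.parts_sq, Multiset.mem_bind] at hb
        obtain ⟨l, hl, hb⟩ := hb
        rw [sqParts] at hb
        split_ifs at hb with hl2
        · simp only [Multiset.insert_eq_cons, Multiset.mem_cons, Multiset.mem_singleton,
            or_self] at hb
          refine h (b + 1) ?_
          rw [pow_succ, ← mul_assoc, hb, Nat.div_mul_cancel hl2.two_dvd]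
          exact hl
        · rw [Multiset.mem_singleton] at hb
          exact h b (hb ▸ hl)
    · obtain ⟨l, hl, hle⟩ : ∃ l ∈ σ.parts, Even l := by
        by_contra! hc
        rw [Perm.orderOf_eq_lcm_parts] at he
        exact Nat.not_odd_iff_even.2 he (odd_lcm fun m hm => Nat.not_even_iff_odd.1 (hc m hm))
      obtain ⟨N, hN⟩ := Multiset.exists_cons_of_mem hl
      rw [← Multiset.singleton_add] at hN
      obtain ⟨k, m, σ₁, σ₂, h1, h2, h⟩ := exists_parts_add hN
      have hs1 : Perm.sign σ₁ = -1 := by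
        rw [Perm.sign_eq_parts, h1, Multiset.sum_singleton, Multiset.card_singleton]
        exact hle.add_one.neg_one_pow
      have hs2 : Perm.sign σ₁ * Perm.sign σ₂ = 1 := by
        rw [← Perm.sign_sumCongr, Perm.sign_eq_parts, ← h, ← Perm.sign_eq_parts, hs]
      refine (nonHom_sumCongr_of_odd_odd hs1 ?_).of_parts h
      rw [hs1, neg_one_mul] at hs2
      rw [← neg_neg (Perm.sign σ₂), hs2]
  · refine goodParts_of_odd (fun m hm => ho.of_dvd_nat ?_) h3 h5 ?_ _ _ rfl
    · rw [Perm.orderOf_eq_lcm_parts]; exact Multiset.dvd_lcm hm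
    · exact h7.imp (fun h => h 0) fun h => by rwa [σ.sum_parts]

/-- Odd permutations. -/
theorem NonHom.good {σ : Perm α} (h : NonHom σ) (hs : Perm.sign σ = -1)
    (h3 : σ.parts.filter (3 ∣ ·) ≠ {3}) (h5 : σ.parts.filter (5 ∣ ·) ≠ {5})
    (h7 : 7 ≤ Fintype.card α) : Good σ := by
  refine Good.of_sq (good_of_sign_eq_one (by rw [map_pow, hs]; rfl)
    (filter_dvd_parts_sq (by decide) h3) (filter_dvd_parts_sq (by decide) h5) (Or.inr h7)) h ?_
  by_contra ho
  rw [Perm.sign_eq_one_of_odd (Nat.not_even_iff_odd.1 ho)] at hs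
  exact absurd hs (by decide)

end

section

variable {β γ : Type} [DecidableEq β] [Fintype β] [DecidableEq γ] [Fintype γ]
variable {V : Type} [AddCommGroup V] [Module ℂ V]

/-- In a basic spin representation, a permutation preserving a nontrivial subset anticommutes with
an invertible operator as soon as it is odd. -/
theorem SpinRep.Basic.nonHomog_sumCongr [Nontrivial V] {R : SpinRep (β ⊕ γ) V} (h : R.Basic)
    [Nonempty β] [Nonempty γ] {σ : Perm β} {τ : Perm γ}
    (hs : Perm.sign (Perm.sumCongr σ τ) = -1) : NonHomog (R.op (Perm.sumCongr σ τ)) := by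
  obtain ⟨T⟩ := h.nonempty_star (Sum.inl (Classical.arbitrary β))
  set b : β ⊕ γ → ℂ := Sum.elim (fun _ => Fintype.card γ) (fun _ => -Fintype.card β) with hb
  have hb0 : ∑ k, b k = 0 := by
    simp [hb]; ring
  have hbg : b ∘ ⇑(Perm.sumCongr σ τ)⁻¹ = b := by
    ext (x | x) <;> simp [hb, Perm.sumCongr_inv]
  have h1 := T.op_mul_phi (Perm.sumCongr σ τ) b hb0
  rw [hbg, hs] at h1
  refine NonHomog.of_anti (R.isUnit_op _) (B := T.phi b) ?_ (by simpa using h1)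
  have h2 := T.phi_anticomm hb0 hb0
  set c := -∑ k, b k * b k with hc
  have hc0 : c ≠ 0 := by
    have h3 : (c : ℂ) = ((-(Fintype.card β * Fintype.card γ * (Fintype.card γ + Fintype.card β) : ℕ)
        : ℤ) : ℂ) := by
      simp [hc, hb]; ring
    rw [h3, Ne, Int.cast_eq_zero, neg_eq_zero, Int.natCast_eq_zero]
    have := Fintype.card_pos (α := β)
    have := Fintype.card_pos (α := γ)
    positivity
  rw [injective_iff_map_eq_zero]
  intro v hv
  have h3 := congrArg (· v) h2
  simp only [LinearMap.add_apply, End.mul_apply, hv, map_zero, add_zero, LinearMap.smul_apply,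
    End.one_apply] at h3
  exact (smul_eq_zero.1 h3.symm).resolve_left hc0

theorem Good.nonHom {σ : Perm β} (h : Good σ) (he : Even (orderOf σ)) : NonHom σ := by
  intro V _ _ _ _ R
  obtain ⟨s, hs, h1⟩ := (R.op_pow σ (orderOf σ)).symm
  rw [pow_orderOf_eq_one, R.op_one] at h1
  exact NonHomog.of_fullSpec he (orderOf_pos σ).ne' (by rintro rfl; simp at hs) h1 (h V R)

/-- On a nonzero subspace stable under a smaller symmetric group, a good permutation attains all
its eigenvalues. -/
theorem Good.exists_mem_of_eigen {σ : Perm β} (h : Good σ) [FiniteDimensional ℂ V]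
    (R : SpinRep γ V) (e : β ↪ γ) (W : Submodule ℂ V) (hW : W ≠ ⊥)
    (hs : ∀ τ : Perm β, ∀ v ∈ W, R.op (τ.viaEmbedding e) v ∈ W) {b : ℂ} {w : V} (hw : w ≠ 0)
    (hb : R.op (σ.viaEmbedding e) w = b • w) :
    ∃ v ∈ W, v ≠ 0 ∧ R.op (σ.viaEmbedding e) v = b • v := by
  refine h.exists_mem R e W hW hs b fun v _ => ?_
  obtain ⟨s, -, h1⟩ := (R.op_pow (σ.viaEmbedding e) (orderOf σ)).symm
  rw [← Perm.viaEmbedding_pow, pow_orderOf_eq_one, Perm.viaEmbedding_one, R.op_one] at h1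
  have h2 := End.pow_apply_of_eigen hb (orderOf σ)
  rw [h1] at h2 ⊢
  rw [← smul_left_injective ℂ hw h2]
  rfl

theorem nonHom_rot_of_even {m : ℕ} [NeZero m] (hm : Even m) (hm10 : 10 ≤ m) : NonHom (rot m) :=
  (good_rot_of_even hm hm10).nonHom (by
    rw [Perm.orderOf_eq_lcm_parts, parts_rot]; simpa)

end

section six

variable {γ : Type} [DecidableEq γ] [Fintype γ]

theorem shift_two_three (i : ZMod 2) :
    shift 2 3 i = swap (i, 0) (i, 1) * swap (i, 1) (i, 2) := by
  ext x : 1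
  rw [shift_apply]
  revert i x
  decide

theorem SpinRep.nonHomog_six [Nonempty γ] {V : Type} [AddCommGroup V] [Module ℂ V]
    [FiniteDimensional ℂ V] [Nontrivial V] (R : SpinRep ((ZMod 2 × ZMod 3) ⊕ γ) V)
    (hR : ¬ R.Basic) {τ : Perm γ} (hτ : Good τ) (hs : Perm.sign τ = 1) :
    NonHomog (R.op (Perm.sumCongr (wheel 2 3) τ)) := by
  let e : (ZMod 2 × ZMod 3) ↪ (ZMod 2 × ZMod 3) ⊕ γ := Function.Embedding.inl
  let f : γ ↪ (ZMod 2 × ZMod 3) ⊕ γ := Function.Embedding.inr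
  have h3 : Odd 3 := by decide
  have hS3 (i : ZMod 2) : shift 2 3 i ^ 3 = 1 := by rw [shift_two_three]; revert i; decide
  have hS3e (i : ZMod 2) : (shift 2 3 i).viaEmbedding e ^ 3 = 1 := by
    rw [← Perm.viaEmbedding_pow, hS3, Perm.viaEmbedding_one]
  set X := R.op ((shift 2 3 0).viaEmbedding e) with hX
  set Y := R.op ((shift 2 3 1).viaEmbedding e) with hY
  have hXY : Commute X Y := R.op_comm_of_odd h3 (hS3e 0) (by
    rw [Commute, SemiconjBy, ← Perm.viaEmbedding_mul, ← Perm.viaEmbedding_mul, shift_two_three,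
      shift_two_three]
    congr 1
    decide)
  have hX3 : X ^ 3 = 1 := R.op_pow_eq_one h3 (hS3e 0)
  have hY3 : Y ^ 3 = 1 := R.op_pow_eq_one h3 (hS3e 1)
  refine NonHomog.signEq ?_ (R.op_sumCongr _ τ)
  refine NonHomog.mul_of_commute (R.op_disjoint_commute f e (by simp [e, f]) _ hs).symm
    (R.op_injective _) fun b m l w hw hbw hmw => ?_
  have hA2 : SignEq (R.op ((wheel 2 3).viaEmbedding e) * R.op ((wheel 2 3).viaEmbedding e))
      (X * Y) := by
    have h1 : wheel 2 3 * wheel 2 3 = shift 2 3 0 * shift 2 3 1 := by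
      rw [shift_two_three, shift_two_three]; decide
    have h2 := R.op_mul' ((wheel 2 3).viaEmbedding e) ((wheel 2 3).viaEmbedding e)
    rw [← Perm.viaEmbedding_mul, h1, Perm.viaEmbedding_mul] at h2
    exact h2.trans (R.op_mul _ _)
  obtain ⟨s, hs1, hA2⟩ := hA2
  have hg3 : (s * m) ^ 3 = 1 := by
    refine End.pow_eq_one_of_eigen (A := X * Y) (by rw [hXY.mul_pow, hX3, hY3, one_mul]) hw ?_
    have h1 : (X * Y) w = s • m • w := by
      have h2 := congrArg (· w) hA2
      simp only [End.mul_apply, LinearMap.smul_apply] at h2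
      rw [← hmw]
      change _ = s • (R.op ((wheel 2 3).viaEmbedding e)) ((R.op ((wheel 2 3).viaEmbedding e)) w)
      rw [h2, smul_smul, hs1, one_smul, End.mul_apply]
    rw [h1, smul_smul]
  let g : γ := Classical.arbitrary γ
  obtain ⟨p, q, v₀, hv₀, hpq, hne, hp, hq⟩ : ∃ (p q : ℂ) (v : V), v ≠ 0 ∧ p * q = s * m ∧ p ≠ q ∧
      X v = p • v ∧ Y v = q • v := by
    by_cases hg : s * m = 1
    · obtain ⟨z, hz⟩ : ∃ z : ℂ, IsPrimitiveRoot z 3 := ⟨_, Complex.isPrimitiveRoot_exp 3 (by decide)⟩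
      have hz3 := hz.pow_eq_one
      have hz1 := hz.ne_one (by decide)
      have hz31 : (z ^ 2) ^ 3 = 1 := by rw [← pow_mul, mul_comm, pow_mul, hz3, one_pow]
      have hz21 : z ^ 2 ≠ 1 := fun h => hz1 (by linear_combination hz3 - z * h)
      let e₇ : Fin 7 ↪ (ZMod 2 × ZMod 3) ⊕ γ := ⟨![Sum.inl (0, 0), Sum.inl (0, 1), Sum.inl (0, 2),
        Sum.inl (1, 0), Sum.inl (1, 1), Sum.inl (1, 2), Sum.inr g], by
          intro i j hij
          fin_cases i <;> fin_cases j <;> first | rfl | (simp at hij; done) | (revert hij; simp; decide)⟩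
      obtain ⟨v, hv, h0, h1⟩ :=
        (R.comap e₇).exists_eigenvector_two_threeCycles hz3 hz1 hz31 hz21
      refine ⟨z, z ^ 2, v, hv, by rw [hg, ← pow_succ', hz3],
        fun h => hz1 (mul_left_cancel₀ (hz.ne_zero (by decide)) (by rw [← pow_two, ← h, mul_one])), ?_, ?_⟩
      · rw [hX, shift_two_three, Perm.viaEmbedding_mul, Perm.viaEmbedding_swap,
          Perm.viaEmbedding_swap]
        rw [SpinRep.comap_op, Perm.viaEmbedding_mul, Perm.viaEmbedding_swap,
          Perm.viaEmbedding_swap] at h0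
        exact h0
      · rw [hY, shift_two_three, Perm.viaEmbedding_mul, Perm.viaEmbedding_swap,
          Perm.viaEmbedding_swap]
        rw [SpinRep.comap_op, Perm.viaEmbedding_mul, Perm.viaEmbedding_swap,
          Perm.viaEmbedding_swap] at h1
        exact h1
    · obtain ⟨u, hu, hu1⟩ := SpinRep.exists_fixed_of_not_basic hR (a := e (0, 0)) (b := e (0, 1))
        (c := e (0, 2)) (by simp [e]) (by simp [e]; decide) (by simp [e]; decide)
      rw [← Perm.viaEmbedding_swap, ← Perm.viaEmbedding_swap, ← Perm.viaEmbedding_mul,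
        ← shift_two_three, ← hX] at hu1
      let e₄ : Fin 4 ↪ (ZMod 2 × ZMod 3) ⊕ γ := ⟨![Sum.inl (1, 0), Sum.inl (1, 1), Sum.inl (1, 2),
        Sum.inr g], by
          intro i j hij
          fin_cases i <;> fin_cases j <;> first | rfl | (simp at hij; done) | (revert hij; simp; decide)⟩
      let e₃ : Fin 3 ↪ (ZMod 2 × ZMod 3) ⊕ γ := ⟨![Sum.inl (0, 0), Sum.inl (0, 1), Sum.inl (0, 2)],
        by
          intro i j hij
          fin_cases i <;> fin_cases j <;> first | rfl | (simp at hij; done) | (revert hij; simp; decide)⟩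
      have hXe : X = R.op ((swap 0 1 * swap 1 2 : Perm (Fin 3)).viaEmbedding e₃) := by
        rw [hX, shift_two_three, Perm.viaEmbedding_mul, Perm.viaEmbedding_swap,
          Perm.viaEmbedding_swap, Perm.viaEmbedding_mul, Perm.viaEmbedding_swap,
          Perm.viaEmbedding_swap]
        rfl
      have hst (ρ : Perm (Fin 4)) : ∀ v ∈ X.eigenspace 1, (R.comap e₄).op ρ v ∈ X.eigenspace 1 :=
        fun v hv => End.eigenspace_stable (by
          rw [hXe]
          exact (R.op_disjoint_commute e₃ e₄ (by
            intro i j hij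
            obtain ⟨x, hx⟩ : ∃ x, e₃ i = Sum.inl (0, x) := by fin_cases i <;> exact ⟨_, rfl⟩
            obtain ⟨y, hy⟩ | hy : (∃ y, e₄ j = Sum.inl (1, y)) ∨ e₄ j = Sum.inr g := by
              fin_cases j <;> first | exact Or.inl ⟨_, rfl⟩ | exact Or.inr rfl
            · rw [hx, hy, Sum.inl.injEq, Prod.mk.injEq] at hij
              exact absurd hij.1 (by decide)
            · rw [hx, hy] at hij
              cases hij) ρ (by decide)).symm) 1 v hv
      have : Nontrivial (X.eigenspace 1) :=
        Submodule.nontrivial_iff_ne_bot.2 (End.eigenspace_ne_bot hu (by rw [hu1, one_smul]))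
      obtain ⟨v, hv, h1⟩ := ((R.comap e₄).restrict _ hst).exists_eigenvector_threeCycle
        (a := 0) (b := 1) (c := 2) (d := 3) (by decide) (by decide) (by decide) (by decide)
        (by decide) (by decide) hg3 hg
      have h2 := congrArg (Submodule.subtype _) h1
      refine ⟨1, s * m, v, by simpa using hv, one_mul _, Ne.symm hg,
        End.mem_eigenspace_iff.1 v.2, ?_⟩
      rw [hY, shift_two_three, Perm.viaEmbedding_mul, Perm.viaEmbedding_swap,
        Perm.viaEmbedding_swap]
      simp only [SpinRep.restrict_op, SpinRep.comap_op, Perm.viaEmbedding_mul,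
        Perm.viaEmbedding_swap] at h2
      exact h2
  have hcomm (i : ZMod 2) (ρ : Perm γ) : Commute (R.op (ρ.viaEmbedding f))
      (R.op ((shift 2 3 i).viaEmbedding e)) :=
    (R.op_disjoint_commute e f (by simp [e, f]) ρ (by
      rw [shift_two_three]; revert i; decide)).symm
  obtain ⟨v, ⟨hvX, hvY⟩, hv, hbv⟩ := hτ.exists_mem_of_eigen R f (X.eigenspace p ⊓ Y.eigenspace q)
    (fun h => hv₀ ((Submodule.eq_bot_iff _).1 h v₀ ⟨End.mem_eigenspace_iff.2 hp,
      End.mem_eigenspace_iff.2 hq⟩))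
    (fun ρ v hv => ⟨End.eigenspace_stable (hcomm 0 ρ) _ _ hv.1,
      End.eigenspace_stable (hcomm 1 ρ) _ _ hv.2⟩) hw hbw
  have hvX' : X v = p • v := End.mem_eigenspace_iff.1 hvX
  have hvY' : Y v = q • v := End.mem_eigenspace_iff.1 hvY
  refine ⟨v, hbv, ?_, fun hl => ?_⟩
  · have h2 := congrArg (· v) hA2
    simp only [End.mul_apply, LinearMap.smul_apply, hvX', hvY', map_smul, smul_smul] at h2
    change R.op ((wheel 2 3).viaEmbedding e) (R.op ((wheel 2 3).viaEmbedding e) v) = _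
    rw [h2]
    congr 1
    linear_combination s * hpq + m * hs1
  · change R.op ((wheel 2 3).viaEmbedding e) v = _ at hl
    have h1 := R.apply_conj h3 (hS3e 0) ((wheel 2 3).viaEmbedding e)
      (τ := (shift 2 3 1).viaEmbedding e) (by
        rw [← Perm.viaEmbedding_mul, wheel_mul_shift, ← Perm.viaEmbedding_inv,
          ← Perm.viaEmbedding_mul, mul_inv_cancel_right]
        rfl) hvX'
    rw [hl, map_smul, ← hY, hvY', smul_smul, smul_smul] at h1
    have h2 : l * q = p * l := smul_left_injective ℂ hv h1
    have hl0 : l ≠ 0 := by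
      rintro rfl
      rw [zero_smul] at hl
      exact hv (R.op_injective _ (by rw [hl, map_zero]))
    exact hne (mul_left_cancel₀ hl0 (by rw [h2, mul_comm]))

end six

theorem SpinRep.exists_hasTriple_ne {V : Type} [AddCommGroup V] [Module ℂ V]
    [FiniteDimensional ℂ V] [Nontrivial V] (R : SpinRep (ZMod 3 × ZMod 3) V) {b : ℂ}
    (hb : b ^ 3 = 1) (hb1 : b ≠ 1) : ∃ r s t, r ≠ s ∧ r * (s * t) = b ∧ R.HasTriple r s t := by
  have h0 : b ≠ 0 := fun h => by simp [h] at hb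
  have hb2 : b ^ 2 ≠ b := fun h => hb1 (mul_left_cancel₀ h0 (by rw [← pow_two, h, mul_one]))
  have hb21 : b ^ 2 ≠ 1 := fun h => hb1 (by linear_combination hb - b * h)
  obtain ⟨t, h⟩ := R.exists_hasTriple hb hb1 hb hb1
  by_cases ht : t = 1
  · subst ht
    exact ⟨1, b ^ 2, b ^ 2, hb21.symm, by linear_combination b * hb, h.sq.rotate.rotate.sq.rotate.rotate⟩
  · obtain rfl | rfl := eq_or_eq_sq_of_pow_three hb hb1 h.pow_three.2.2 ht
    · exact ⟨_, _, _, hb2, by linear_combination t * hb, h.sq⟩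
    · exact ⟨_, _, _, hb2, by linear_combination b * hb, h.rotate⟩

theorem nonHom_blockSwap_mul_translation :
    NonHom (blockSwap 3 3 0 1 * Equiv.addRight ((0, 1) : ZMod 3 × ZMod 3)) := by
  intro V _ _ _ _ R
  have h3 : Odd 3 := by decide
  have hX3 : Equiv.addRight ((0, 1) : ZMod 3 × ZMod 3) ^ 3 = 1 := by decide
  have hS3 : Equiv.addRight ((1, 0) : ZMod 3 × ZMod 3) ^ 3 = 1 := by decide
  refine NonHomog.signEq ?_ (R.op_mul _ _)
  have hcomm (τ : Perm (ZMod 3 × ZMod 3)) (h : Commute (Equiv.addRight (0, 1)) τ) :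
      Commute (R.op τ) (R.op (Equiv.addRight (0, 1))) := (R.op_comm_of_odd h3 hX3 h).symm
  have hAB := hcomm (blockSwap 3 3 0 1) (by unfold Commute SemiconjBy; decide)
  set A := R.op (blockSwap 3 3 0 1) with hA
  set B := R.op (Equiv.addRight ((0, 1) : ZMod 3 × ZMod 3)) with hB
  refine NonHomog.mul_of_commute hAB (R.op_injective _) fun b m l w hw hbw hmw => ?_
  have hb3 : b ^ 3 = 1 := End.pow_eq_one_of_eigen (R.op_pow_eq_one h3 hX3) hw hbw
  obtain ⟨s, hs, hA2⟩ : SignEq (A * A) 1 := by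
    have := R.op_mul' (blockSwap 3 3 0 1) (blockSwap 3 3 0 1)
    rwa [blockSwap_mul_self, R.op_one] at this
  have hA2' (v : V) : A (A v) = s • v := by
    rw [← End.mul_apply, hA2]; rfl
  obtain rfl : s = m := by
    rw [hA2'] at hmw
    exact smul_left_injective ℂ hw hmw
  by_contra! hcon
  replace hcon (v : V) (hv : B v = b • v) : A v = l • v := hcon v hv (hA2' v)
  have hl0 : l ≠ 0 := by
    rintro rfl
    have := hcon w hbw
    rw [zero_smul, ← map_zero A] at this
    exact hw (R.op_injective _ this)
  by_cases hb : b = 1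
  · subst hb
    obtain ⟨v, hv, hne⟩ := R.exists_translation_fixed_ne
    set S := R.op (Equiv.addRight ((1, 0) : ZMod 3 × ZMod 3)) with hS
    have hSB : Commute S B := hcomm _ (by unfold Commute SemiconjBy; decide)
    have hSv : B (S v) = (1 : ℂ) • S v := by
      rw [← End.mul_apply, ← hSB.eq, End.mul_apply, hv, one_smul]
    have hAS : A * S = S ^ 2 * A := by
      rw [hA, hS, ← R.op_pow_of_odd h3 hS3, R.op_conj h3 hS3]
      congr 2
      decide
    have h1 : l • S v = l • S (S v) := by
      have := congrArg (· v) hAS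
      simp only [pow_two, End.mul_apply] at this
      rwa [hcon _ hSv, hcon v (by rw [hv, one_smul]), map_smul, map_smul] at this
    refine hne ?_
    have h2 : S v = S (S v) := smul_right_injective V hl0 h1
    exact (R.op_injective _ h2).symm
  · obtain ⟨r, s, t, hrs, hrst, v, hv, hr, hs, ht⟩ := R.exists_hasTriple_ne hb3 hb
    have hBv : B v = b • v := by
      have h1 : B = R.op (shift 3 3 0) * (R.op (shift 3 3 1) * R.op (shift 3 3 2)) := by
        rw [hB, SpinRep.translation_eq_shifts,
          R.op_mul_of_odd h3 (SpinRep.shift_three_pow 0) (by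
            rw [(show Commute (shift 3 3 1) (shift 3 3 2) by
              unfold Commute SemiconjBy; rw [shift_three, shift_three]; decide).mul_pow,
              SpinRep.shift_three_pow, SpinRep.shift_three_pow, one_mul])
            (by unfold Commute SemiconjBy; rw [shift_three, shift_three, shift_three]; decide),
          R.op_mul_of_odd h3 (SpinRep.shift_three_pow 1) (SpinRep.shift_three_pow 2)
            (by unfold Commute SemiconjBy; rw [shift_three, shift_three]; decide)]
      rw [h1, End.mul_apply, End.mul_apply, ht, map_smul, hs, map_smul, map_smul, hr, smul_smul,
        smul_smul, ← hrst]
      congr 1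
      ring
    have h1 := R.apply_conj h3 (SpinRep.shift_three_pow 0) (blockSwap 3 3 0 1) (τ := shift 3 3 1) (by
      rw [blockSwap_mul_shift, mul_inv_cancel_right]; rfl) hr
    rw [← hA, hcon v hBv, map_smul, hs, smul_comm r] at h1
    exact hrs (smul_left_injective ℂ hv (smul_right_injective V hl0 h1)).symm

theorem nonHom_of_parts_six_three {α : Type} [DecidableEq α] [Fintype α] {σ : Perm α}
    (h : σ.parts = {6, 3}) : NonHom σ := by
  let e : ZMod 6 ⊕ ZMod 3 ↪ ZMod 3 × ZMod 3 :=
    ⟨Sum.elim ![(0, 0), (1, 1), (0, 2), (1, 0), (0, 1), (1, 2)] ![(2, 0), (2, 1), (2, 2)], by decide⟩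
  refine nonHom_blockSwap_mul_translation.of_parts ?_
  let f := Equiv.ofBijective e ((Fintype.bijective_iff_injective_and_card _).2 ⟨e.injective, rfl⟩)
  have h1 : (Perm.sumCongr (rot 6) (rot 3)).viaEmbedding f.toEmbedding =
      blockSwap 3 3 0 1 * Equiv.addRight ((0, 1) : ZMod 3 × ZMod 3) := by
    ext y : 1
    obtain ⟨x, rfl⟩ := f.surjective y
    refine (Perm.viaEmbedding_apply _ f.toEmbedding x).trans ?_
    change e (Perm.sumCongr (rot 6) (rot 3) x) =
      (blockSwap 3 3 0 1 * Equiv.addRight ((0, 1) : ZMod 3 × ZMod 3)) (e x)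
    revert x
    decide
  rw [h, ← h1, Perm.parts_viaEmbedding, Perm.parts_sumCongr, parts_rot, parts_rot]
  rfl

section wheels
variable {V : Type} [AddCommGroup V] [Module ℂ V]

/-- If an odd permutation divides `σ` up to a disjoint odd factor, then `op σ` has trace zero. -/
theorem SpinRep.trace_eq_zero_of_disjoint [FiniteDimensional ℂ V] {α : Type} [DecidableEq α] [Fintype α]
    (R : SpinRep α V) {f h : Perm α} (hfh : f.Disjoint h) (hf : Perm.sign f = -1)
    (hh : Perm.sign h = -1) (k : ℕ) {A : End ℂ V} (hA : SignEq A (R.op (f ^ k * h))) :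
    LinearMap.trace ℂ V A = 0 := by
  obtain ⟨s, -, hs⟩ := (hA.trans (R.op_mul _ _)).trans ((R.op_pow f k).mul (SignEq.refl (R.op h)))
  have h1 : R.op f * R.op h = -(R.op h * R.op f) := by
    rw [R.op_disjoint_perm hfh, hf, hh]
    simp [twist]
  have h2 := R.trace_eq_of_mul_eq f (A := A) (B := -A) (by
    rw [hs, mul_smul_comm, neg_mul, smul_mul_assoc, ← mul_assoc, ← pow_succ', pow_succ, mul_assoc,
      h1, mul_neg, mul_assoc, smul_neg])
  rw [map_neg] at h2
  linear_combination -(1 / 2 : ℂ) * h2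

variable [FiniteDimensional ℂ V] [Nontrivial V]

theorem SpinRep.Irred.exists_apply_ne_of_trace {h : ℕ} [NeZero (2 * h)]
    {R : SpinRep (ZMod (2 * h)) V} (hR : R.Irred) (h2 : 2 ≤ h)
    (ht : ∀ j, 0 < j → j < h → LinearMap.trace ℂ V (R.op (rot (2 * h)) ^ (2 * j)) = 0)
    (hu : ∀ j < h, (2 * j + 1).Coprime (2 * h)) (hd : 2 * h ^ 3 ≤ finrank ℂ V ^ 2) {a : ℂ}
    (ha : R.op (rot (2 * h)) ^ (2 * h) = a ^ h • 1) (l : ℂ) :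
    ∃ v, R.op (rot (2 * h)) (R.op (rot (2 * h)) v) = a • v ∧ R.op (rot (2 * h)) v ≠ l • v := by
  by_contra! hcon
  set A := R.op (rot (2 * h)) with hA
  have ha1 : ‖a‖ = 1 := by
    obtain ⟨s, hs, h1⟩ : SignEq (A ^ (2 * h)) 1 := by
      have := (R.op_pow (rot (2 * h)) (2 * h)).symm
      rwa [rot_pow_self, R.op_one] at this
    obtain ⟨v, hv⟩ := exists_ne (0 : V)
    have h3 : a ^ h = s := by
      rw [ha] at h1
      have := congrArg (· v) h1
      simp only [LinearMap.smul_apply, End.one_apply] at this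
      exact smul_left_injective ℂ hv this
    have h4 : a ^ (h + h) = 1 := by rw [pow_add, h3, hs]
    exact Complex.norm_eq_one_of_pow_eq_one h4 (by omega)
  have ha0 : a ≠ 0 := fun h => by simp [h] at ha1
  set P := cyclicSum (A * A) a h with hP
  have hAP : A * P = l • P := by
    ext v
    refine hcon _ ?_
    rw [← End.mul_apply]
    refine apply_cyclicSum ha0 ?_
    rw [← pow_two, ← pow_mul, ha]
    rfl
  have hP2 : P = ∑ j ∈ Finset.range h, a⁻¹ ^ j • A ^ (2 * j) := by
    simp only [hP, cyclicSum, ← pow_two, ← pow_mul]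
  have htP : LinearMap.trace ℂ V P = finrank ℂ V := by
    rw [hP2, map_sum, Finset.sum_eq_single_of_mem 0 (Finset.mem_range.2 (by omega))]
    · simp
    · intro j hj hj0
      rw [map_smul, ht j (by omega) (Finset.mem_range.1 hj), smul_zero]
  have hd0 : (finrank ℂ V : ℂ) ≠ 0 := Nat.cast_ne_zero.2 (Module.finrank_pos (R := ℂ) (M := V)).ne'
  have hl1 : ‖l‖ = 1 := by
    have h1 : A * A * P = a • P := by
      ext v
      refine apply_cyclicSum (A := A * A) ha0 ?_
      rw [← pow_two, ← pow_mul, ha]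
      rfl
    rw [mul_assoc, hAP, mul_smul_comm, hAP, smul_smul] at h1
    have h3 : LinearMap.trace ℂ V ((l * l) • P) = LinearMap.trace ℂ V (a • P) := by rw [h1]
    rw [map_smul, map_smul, htP] at h3
    have h4 : ‖l‖ * ‖l‖ = 1 := by
      rw [← norm_mul, mul_right_cancel₀ hd0 h3, ha1]
    nlinarith [norm_nonneg l]
  have htA : LinearMap.trace ℂ V (A * P) =
      ∑ j ∈ Finset.range h, a⁻¹ ^ j * LinearMap.trace ℂ V (A ^ (2 * j + 1)) := by
    simp only [hP2, Finset.mul_sum, map_sum, mul_smul_comm, ← pow_succ', map_smul, smul_eq_mul]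
  have hσ1 : rot (2 * h) ≠ 1 := by
    intro h1
    have h3 := parts_rot (2 * h)
    rw [h1] at h3
    have h4 := congrArg Multiset.sum (Perm.cycleType_eq_filter (1 : Perm (ZMod (2 * h))))
    rw [h3, Multiset.filter_singleton, if_pos (by omega)] at h4
    simp at h4
    omega
  have hz : Perm.zee (rot (2 * h)) = 2 * h := by
    have h3 : (rot (2 * h)).cycleType = {2 * h} := by
      rw [Perm.cycleType_eq_filter, parts_rot, Multiset.filter_singleton, if_pos (by omega)]
    simp [Perm.zee, h3, ZMod.card]
  have hj (j : ℕ) (hj : j ∈ Finset.range h) :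
      ‖LinearMap.trace ℂ V (A ^ (2 * j + 1))‖ ^ 2 < 2 * h := by
    have h1 := hR.chiSq_lt hσ1
    rw [hz] at h1
    push_cast at h1
    refine lt_of_eq_of_lt ?_ h1
    have h3 : IsConj (rot (2 * h) ^ (2 * j + 1)) (rot (2 * h)) :=
      isConj_iff.2 ⟨_, dil_inv_mul_rot (ZMod.unitOfCoprime _ (hu j (Finset.mem_range.1 hj)))
        (ZMod.coe_unitOfCoprime _ _)⟩
    rw [R.chiSq_eq_of_isConj h3, SpinRep.chiSq, Complex.normSq_eq_norm_sq]
    obtain ⟨s, hs, h4⟩ := (R.op_pow (rot (2 * h)) (2 * j + 1)).symm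
    rw [h4, map_smul, norm_smul]
    have h5 : ‖s‖ = 1 := Complex.norm_eq_one_of_pow_eq_one (n := 2) (by rw [pow_two, hs]) (by decide)
    rw [h5, one_mul]
  have hlt : (finrank ℂ V : ℝ) < h * √(2 * h) := by
    calc (finrank ℂ V : ℝ) = ‖LinearMap.trace ℂ V (A * P)‖ := by
          rw [hAP, map_smul, htP, norm_smul, hl1, one_mul, Complex.norm_natCast]
      _ ≤ ∑ j ∈ Finset.range h, ‖LinearMap.trace ℂ V (A ^ (2 * j + 1))‖ := by
          rw [htA]
          refine (norm_sum_le _ _).trans (Finset.sum_le_sum fun j _ => ?_)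
          rw [norm_mul, norm_pow, norm_inv, ha1, inv_one, one_pow, one_mul]
      _ < ∑ j ∈ Finset.range h, √(2 * h) :=
          Finset.sum_lt_sum_of_nonempty ⟨0, Finset.mem_range.2 (by omega)⟩ fun j hj' =>
            Real.lt_sqrt_of_sq_lt (hj j hj')
      _ = h * √(2 * h) := by simp
  have h6 : (finrank ℂ V : ℝ) ^ 2 < 2 * h ^ 3 := by
    calc (finrank ℂ V : ℝ) ^ 2 < ((h : ℝ) * √(2 * h)) ^ 2 := by gcongr
      _ = 2 * (h : ℝ) ^ 3 := by rw [mul_pow, Real.sq_sqrt (by positivity)]; ring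
  exact absurd (by exact_mod_cast h6 : finrank ℂ V ^ 2 < 2 * h ^ 3) (by omega)

theorem SpinRep.four_le_finrank_of_not_basic {α : Type} [DecidableEq α] [Fintype α]
    {R : SpinRep α V} (hR : ¬R.Basic) (hα : 4 ≤ Fintype.card α) : 4 ≤ finrank ℂ V := by
  have h1 := three_mul_le_finrank hR (m := 1) (f := 1) (by decide) (by omega)
    fun _ => Module.finrank_pos
  have h2 := two_pow_dvd_finrank 1 R (by omega)
  omega

theorem SpinRep.twelve_le_finrank_of_not_basic {α : Type} [DecidableEq α] [Fintype α]
    {R : SpinRep α V} (hR : ¬R.Basic) (hα : 8 ≤ Fintype.card α) : 12 ≤ finrank ℂ V :=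
  three_mul_le_finrank hR (m := 5) (f := 4) (by decide) (by omega) fun {W} _ _ _ _ R' => by
    by_cases h : R'.Basic
    · exact Nat.le_of_dvd Module.finrank_pos (h.two_pow_dvd_finrank (r := 2) (by simp))
    · exact four_le_finrank_of_not_basic h (by simp)

theorem SpinRep.Irred.exists_apply_ne_four {R : SpinRep (ZMod 4) V} (hR : R.Irred)
    (hB : ¬R.Basic) {a : ℂ} (ha : R.op (rot 4) ^ 4 = a ^ 2 • 1) (l : ℂ) :
    ∃ v, R.op (rot 4) (R.op (rot 4) v) = a • v ∧ R.op (rot 4) v ≠ l • v := by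
  refine exists_apply_ne_of_trace (h := 2) hR le_rfl (fun j hj hj2 => ?_) (by decide) ?_ ha l
  · obtain rfl : j = 1 := by omega
    refine R.trace_eq_zero_of_disjoint (f := swap 0 2) (h := swap 1 3) (by
      unfold Perm.Disjoint; decide) (by decide) (by decide) 1 ((R.op_pow _ _).symm.trans ?_)
    exact SignEq.of_or (.inl (congrArg R.op (by decide)))
  · have := SpinRep.four_le_finrank_of_not_basic hB (by rw [ZMod.card])
    nlinarith

theorem SpinRep.Irred.exists_apply_ne_eight {R : SpinRep (ZMod 8) V} (hR : R.Irred)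
    (hB : ¬R.Basic) {a : ℂ} (ha : R.op (rot 8) ^ 8 = a ^ 4 • 1) (l : ℂ) :
    ∃ v, R.op (rot 8) (R.op (rot 8) v) = a • v ∧ R.op (rot 8) v ≠ l • v := by
  refine exists_apply_ne_of_trace (h := 4) hR (by decide) (fun j hj hj2 => ?_) (by decide) ?_ ha l
  · have h1 : j = 1 ∨ j = 2 ∨ j = 3 := by omega
    obtain rfl | rfl | rfl := h1
    · refine R.trace_eq_zero_of_disjoint (f := swap 0 2 * swap 2 4 * swap 4 6)
        (h := swap 1 3 * swap 3 5 * swap 5 7) (by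
        unfold Perm.Disjoint; decide) (by decide) (by decide) 1 ((R.op_pow _ _).symm.trans ?_)
      exact SignEq.of_or (.inl (congrArg R.op (by decide)))
    · refine R.trace_eq_zero_of_disjoint (f := swap 0 4)
        (h := swap 1 5 * swap 2 6 * swap 3 7) (by
        unfold Perm.Disjoint; decide) (by decide) (by decide) 1 ((R.op_pow _ _).symm.trans ?_)
      exact SignEq.of_or (.inl (congrArg R.op (by decide)))
    · refine R.trace_eq_zero_of_disjoint (f := swap 0 2 * swap 2 4 * swap 4 6)
        (h := (swap 1 3 * swap 3 5 * swap 5 7) ^ 3) (by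
        unfold Perm.Disjoint; decide) (by decide) (by decide) 3 ((R.op_pow _ _).symm.trans ?_)
      exact SignEq.of_or (.inl (congrArg R.op (by decide)))
  · have := SpinRep.twelve_le_finrank_of_not_basic hB (by rw [ZMod.card])
    nlinarith

end wheels

variable {γ : Type} [DecidableEq γ] [Fintype γ]

/-- Nonscalarity passes from irreducible nonbasic representations on one side to all
representations. -/
theorem nonHom_sumCongr_rot_of_irred {h : ℕ} [NeZero (2 * h)] (h2 : 2 ≤ h)
    (hirr : ∀ {V : Type} [AddCommGroup V] [Module ℂ V] [FiniteDimensional ℂ V] [Nontrivial V]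
      {R : SpinRep (ZMod (2 * h)) V}, R.Irred → ¬R.Basic → ∀ {a : ℂ},
      R.op (rot (2 * h)) ^ (2 * h) = a ^ h • 1 → ∀ l : ℂ,
      ∃ v, R.op (rot (2 * h)) (R.op (rot (2 * h)) v) = a • v ∧ R.op (rot (2 * h)) v ≠ l • v)
    [Nonempty γ] {τ : Perm γ} (hτ : Good τ) (hs : Perm.sign τ = 1)
    (hm : Perm.sign (rot (2 * h)) = -1) : NonHom (Perm.sumCongr (rot (2 * h)) τ) := by
  intro V _ _ _ _ R
  by_cases hB : R.Basic
  · exact hB.nonHomog_sumCongr (by rw [Perm.sign_sumCongr, hm, hs, mul_one])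
  have hne {i j : ℕ} (hi : i < 2 * h) (hj : j < 2 * h) (hij : i ≠ j) :
      (i : ZMod (2 * h)) ≠ j := fun h1 => hij (by
    have h3 := (ZMod.natCast_eq_natCast_iff' _ _ _).1 h1
    rwa [Nat.mod_eq_of_lt hi, Nat.mod_eq_of_lt hj] at h3)
  have h01 := hne (i := 0) (j := 1) (by omega) (by omega) (by decide)
  have h12 := hne (i := 1) (j := 2) (by omega) (by omega) (by decide)
  have h02 := hne (i := 0) (j := 2) (by omega) (by omega) (by decide)
  let e : ZMod (2 * h) ↪ ZMod (2 * h) ⊕ γ := Function.Embedding.inl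
  let f : γ ↪ ZMod (2 * h) ⊕ γ := Function.Embedding.inr
  have hef : ∀ b c, e b ≠ f c := by simp [e, f]
  have hfe : ∀ b c, f b ≠ e c := by simp [e, f]
  refine NonHomog.signEq ?_ (R.op_sumCongr _ τ)
  have hcomm (ρ : Perm (ZMod (2 * h))) := R.op_disjoint_commute f e hfe ρ hs
  refine NonHomog.mul_of_commute (hcomm _).symm (R.op_injective _) fun b m l w hw hbw hmw => ?_
  set B := R.op (τ.viaEmbedding f) with hBdef
  change B w = _ at hbw
  have hst (ρ : Perm (ZMod (2 * h))) :
      ∀ v ∈ B.eigenspace b, (R.comap e).op ρ v ∈ B.eigenspace b := fun v hv =>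
    End.eigenspace_stable (hcomm ρ).symm b v hv
  have hnb : ¬((R.comap e).restrict _ hst).Basic := by
    intro hbas
    obtain ⟨u, hu, hu1⟩ := SpinRep.exists_fixed_of_not_basic hB (a := e (0 : ℕ))
      (b := e (1 : ℕ)) (c := e (2 : ℕ)) (e.injective.ne h01) (e.injective.ne h12)
      (e.injective.ne h02)
    rw [← Perm.viaEmbedding_swap, ← Perm.viaEmbedding_swap, ← Perm.viaEmbedding_mul] at hu1
    obtain ⟨v, hv1, hv0, hv⟩ := hτ.exists_mem_of_eigen R f (End.eigenspace (R.op
        ((swap ((0 : ℕ) : ZMod (2 * h)) (1 : ℕ) * swap ((1 : ℕ) : ZMod (2 * h)) (2 : ℕ)).viaEmbedding e)) 1)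
      (End.eigenspace_ne_bot hu (by rw [hu1, one_smul]))
      (fun ρ v hv => End.eigenspace_stable (R.op_disjoint_commute e f hef ρ (by
        rw [Perm.sign_mul, Perm.sign_swap h01, Perm.sign_swap h12]; rfl)).symm 1 v hv)
      hw hbw
    have h3 := hbas _ _ _ h01 h12 h02 (⟨v, End.mem_eigenspace_iff.2 hv⟩ : B.eigenspace b) (by
      rw [End.mem_eigenspace_iff, one_smul] at hv1
      exact Subtype.ext hv1)
    exact hv0 (congrArg Subtype.val h3)
  obtain ⟨U, hU, hUB, hUI⟩ := SpinRep.exists_irred_of_not_basic hnb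
  have hUn : Nontrivial U := by
    by_contra hsub
    rw [not_nontrivial_iff_subsingleton] at hsub
    exact hUB fun _ _ _ _ _ _ v _ => Subsingleton.elim _ _
  have ha : R.op ((rot (2 * h)).viaEmbedding e) ^ (2 * h) = m ^ h • 1 := by
    obtain ⟨s, -, h1⟩ := (R.op_pow ((rot (2 * h)).viaEmbedding e) (2 * h)).symm
    rw [← Perm.viaEmbedding_pow, rot_pow_self, Perm.viaEmbedding_one, R.op_one] at h1
    have h3 := End.pow_apply_of_eigen
      (A := R.op ((rot (2 * h)).viaEmbedding e) * R.op ((rot (2 * h)).viaEmbedding e)) hmw h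
    rw [← pow_two, ← pow_mul, h1, LinearMap.smul_apply, End.one_apply] at h3
    rw [h1, smul_left_injective ℂ hw h3]
  obtain ⟨v, hv1, hv2⟩ := hirr hUI hUB (a := m) (by
    ext v
    have h1 (j : ℕ) : (((((R.comap e).restrict _ hst).restrict U hU).op (rot (2 * h)) ^ j) v).1.1 =
        (R.op ((rot (2 * h)).viaEmbedding e) ^ j) v.1.1 := by
      induction j with
      | zero => rfl
      | succ j ih =>
        rw [pow_succ', pow_succ', End.mul_apply, End.mul_apply, ← ih]
        rfl
    rw [h1, ha]
    rfl) l
  refine ⟨v.1.1, End.mem_eigenspace_iff.1 v.1.2, ?_, fun hl => hv2 ?_⟩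
  · exact congrArg (fun x => x.1.1) hv1
  · exact Subtype.ext (Subtype.ext hl)

theorem nonHom_sumCongr_rot_four [Nonempty γ] {τ : Perm γ} (hτ : Good τ)
    (hs : Perm.sign τ = 1) : NonHom (Perm.sumCongr (rot 4) τ) :=
  nonHom_sumCongr_rot_of_irred (h := 2) le_rfl (fun hR hB _ ha => hR.exists_apply_ne_four hB ha)
    hτ hs (by decide)

theorem nonHom_sumCongr_rot_eight [Nonempty γ] {τ : Perm γ} (hτ : Good τ)
    (hs : Perm.sign τ = 1) : NonHom (Perm.sumCongr (rot 8) τ) :=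
  nonHom_sumCongr_rot_of_irred (h := 4) (by decide)
    (fun hR hB _ ha => hR.exists_apply_ne_eight hB ha) hτ hs (by decide)

theorem SpinRep.op_ne_zero_of_anti {α : Type} [DecidableEq α] [Fintype α] {V : Type}
    [AddCommGroup V] [Module ℂ V] (R : SpinRep α V) {T : End ℂ V} (hT : Function.Injective T)
    {f : Perm α} (hf : T * R.op f = -(R.op f * T)) {v : V} (hv : v ≠ 0) {l : ℂ}
    (h1 : T v = l • v) (h2 : T (R.op f v) = l • R.op f v) : False := by
  have h3 := congrArg (· v) hf
  simp only [End.mul_apply, LinearMap.neg_apply, h1, h2, map_smul] at h3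
  have h4 : l • R.op f v = 0 := by
    have : (2 : ℂ) • (l • R.op f v) = 0 := by rw [two_smul]; nth_rewrite 1 [h3]; simp
    exact (smul_eq_zero.1 this).resolve_left two_ne_zero
  rcases smul_eq_zero.1 h4 with rfl | h5
  · rw [zero_smul] at h1
    exact hv (hT (by rw [h1, map_zero]))
  · exact hv (R.op_injective f (by rw [h5, map_zero]))

/-- To see that the product of a transposition and an even permutation `τ` of odd order is
nowhere homogeneous, it suffices to look at the eigenspaces of the second factor. -/
theorem nonHom_sumCongr_rot_two {γ : Type} [DecidableEq γ] [Fintype γ] [Nonempty γ] {τ : Perm γ}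
    (hs : Perm.sign τ = 1)
    (h : ∀ {V : Type} [AddCommGroup V] [Module ℂ V] [FiniteDimensional ℂ V] [Nontrivial V]
      (R : SpinRep (ZMod 2 ⊕ γ) V), ¬R.Basic → ∀ {b : ℂ} {w : V}, w ≠ 0 →
      R.op (τ.viaEmbedding Function.Embedding.inr) w = b • w → ∀ l : ℂ,
      ∃ v, R.op (τ.viaEmbedding Function.Embedding.inr) v = b • v ∧
        R.op ((rot 2).viaEmbedding Function.Embedding.inl) v ≠ l • v) :
    NonHom (Perm.sumCongr (rot 2) τ) := by
  intro V _ _ _ _ R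
  by_cases hR : R.Basic
  · exact hR.nonHomog_sumCongr (by rw [Perm.sign_sumCongr, hs]; decide)
  refine NonHomog.signEq ?_ (R.op_sumCongr _ τ)
  refine NonHomog.mul_of_commute (R.op_disjoint_commute _ _ (by simp) _ hs).symm
    (R.op_injective _) fun b m l w hw hbw hmw => ?_
  obtain ⟨v, hv, hv2⟩ := h R hR hw hbw l
  refine ⟨v, hv, ?_, hv2⟩
  obtain ⟨s, -, h1⟩ := R.op_mul' ((rot 2).viaEmbedding (Function.Embedding.inl (β := γ)))
    ((rot 2).viaEmbedding Function.Embedding.inl)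
  rw [← Perm.viaEmbedding_mul, (show rot 2 * rot 2 = 1 by decide), Perm.viaEmbedding_one, R.op_one] at h1
  rw [← End.mul_apply, h1] at hmw ⊢
  rw [← smul_left_injective ℂ hw hmw]
  rfl

theorem shift_pow_self {d e : ℕ} [NeZero e] [NeZero d] (i : ZMod e) : shift e d i ^ d = 1 := by
  rw [shift, ← Perm.viaEmbedding_pow, rot_pow_self, Perm.viaEmbedding_one]

/-- An operator that acts as the scalar `l` on an eigenspace of a wheel also acts as `l` on the
weight spaces that the eigenspace projection does not annihilate. -/
theorem SpinRep.HasWeight.apply_eq_smul {d e : ℕ} [NeZero e] [NeZero d] {V : Type}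
    [AddCommGroup V] [Module ℂ V] {R : SpinRep (ZMod e × ZMod d) V} {T : End ℂ V}
    (hT : ∀ {σ}, Perm.sign σ = 1 → Commute (R.op σ) T) (he : 2 ≤ e) (heo : Odd e) (hd : Odd d)
    {b l : ℂ} (hb : b ^ (e * d) = 1) (h : ∀ v, R.op (wheel e d) v = b • v → T v = l • v)
    {w : ZMod e → ℂ} (hw0 : ∀ i, i ≠ 0 → w i ≠ w 0) (hprod : ∏ i, w i = b ^ e) {v : V}
    (hv : R.HasWeight 1 w v) : T v = l • v := by
  by_contra hne
  have hv0 : v ≠ 0 := by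
    rintro rfl
    simp at hne
  have ho : orderOf (wheel e d) = e * d := orderOf_wheel e d he
  have hsw : Perm.sign (wheel e d) = 1 := Perm.sign_eq_one_of_odd (by rw [ho]; exact heo.mul hd)
  have hC : R.op (wheel e d) ^ (e * d) = 1 := by
    rw [← ho]
    exact R.op_pow_orderOf _ (by rw [ho]; exact heo.mul hd)
  have hb0 : b ≠ 0 := by
    rintro rfl
    rw [zero_pow (mul_ne_zero (NeZero.ne e) (NeZero.ne d))] at hb
    exact zero_ne_one hb
  obtain ⟨s, hs, hpow⟩ := R.op_wheel_pow 1
  rw [mul_one] at hpow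
  have h1 := hpow w v hv
  rw [hprod] at h1
  have hs1 : s = 1 := by
    have hsd : s ^ d = s := by
      obtain ⟨k, rfl⟩ := hd
      rw [pow_succ, pow_mul, pow_two, hs, one_pow, one_mul]
    have h2 := End.pow_apply_of_eigen h1 d
    rw [← pow_mul, hC, mul_pow, hsd, ← pow_mul, hb, mul_one] at h2
    exact (smul_left_injective ℂ hv0 (by simpa using h2)).symm
  have hsub : R.HasWeight 1 w (T v - l • v) := fun i => by
    have hc : Commute (R.op (shift e d i) ^ 1) T := by
      rw [pow_one]
      exact hT (Perm.sign_eq_one_of_odd (hd.of_dvd_nat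
        (orderOf_dvd_of_pow_eq_one (shift_pow_self i))))
    rw [map_sub, map_smul, ← End.mul_apply, hc.eq, End.mul_apply, hv i, map_smul, smul_sub,
      smul_comm l]
  refine hsub.exists_wheel_eigenvector R (fun i => by simpa using R.op_wheel_mul_shift hd i)
    (sub_ne_zero.2 hne) hw0 (a := b) ?_
  rw [hs1, one_mul] at h1
  have h2 := h _ (apply_cyclicSum hb0 h1)
  rw [← End.mul_apply, ← (cyclicSum_commute (hT hsw) b e).eq, End.mul_apply] at h2
  rw [map_sub, map_smul, h2, sub_self]

theorem Lettered.nonHom_rot_two_wheel {d e : ℕ} [NeZero e] [NeZero d] (h : Lettered d)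
    (he : 3 ≤ e) (heo : Odd e) (hd : Odd d) (hd5 : 5 ≤ d) :
    NonHom (Perm.sumCongr (rot 2) (wheel e d)) := by
  have ho : orderOf (wheel e d) = e * d := orderOf_wheel e d (by omega)
  have hsw : Perm.sign (wheel e d) = 1 := Perm.sign_eq_one_of_odd (by rw [ho]; exact heo.mul hd)
  refine nonHom_sumCongr_rot_two hsw fun {V} _ _ _ _ R _ b w₀ hw₀ hb l => ?_
  let R' := R.comap (Function.Embedding.inr : ZMod e × ZMod d ↪ ZMod 2 ⊕ (ZMod e × ZMod d))
  set T := R.op ((rot 2).viaEmbedding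
    (Function.Embedding.inl : ZMod 2 ↪ ZMod 2 ⊕ (ZMod e × ZMod d))) with hT
  have hTR {σ : Perm (ZMod e × ZMod d)} (hσ : Perm.sign σ = 1) : Commute (R'.op σ) T :=
    R.op_disjoint_commute _ _ (by simp) _ hσ
  have hTa {σ : Perm (ZMod e × ZMod d)} (hσ : Perm.sign σ = -1) : T * R'.op σ = -(R'.op σ * T) :=
    R.op_disjoint_anti _ _ (by simp) (by decide) hσ
  change R'.op (wheel e d) w₀ = b • w₀ at hb
  change ∃ v, R'.op (wheel e d) v = b • v ∧ T v ≠ l • v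
  by_contra! hcon
  have hC : R'.op (wheel e d) ^ (e * d) = 1 := by
    rw [← ho]
    exact R'.op_pow_orderOf _ (by rw [ho]; exact heo.mul hd)
  have hbp : b ^ (e * d) = 1 := End.pow_eq_one_of_eigen hC hw₀ hb
  have hsign : Perm.sign (rot d ^ 1) = 1 := by rw [pow_one, sign_rot_of_odd hd]
  have hscalar {w : ZMod e → ℂ} (hw0 : ∀ i, i ≠ 0 → w i ≠ w 0) (hprod : ∏ i, w i = b ^ e) {v : V}
      (hv : R'.HasWeight 1 w v) : T v = l • v :=
    hv.apply_eq_smul hTR (by omega) heo hd hbp hcon hw0 hprod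
  obtain ⟨w, hw, hw0, hprod⟩ := exists_word (z := b ^ e) (by omega : 2 ≤ e) hd hd5 (by
    rw [← pow_mul, hbp])
  obtain ⟨v, hv, hvw⟩ := R'.exists_hasWeight hsign fun i => h _ (hw i).1 (hw i).2
  have hne : (1 : ZMod e) ≠ 2 ∧ (1 : ZMod e) ≠ 0 ∧ (2 : ZMod e) ≠ 0 := by
    have hn {i j : ℕ} (hi : i < e) (hj : j < e) (hij : i ≠ j) : (i : ZMod e) ≠ j := fun h => by
      rw [ZMod.natCast_eq_natCast_iff', Nat.mod_eq_of_lt hi, Nat.mod_eq_of_lt hj] at h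
      exact hij h
    exact ⟨by simpa using hn (i := 1) (j := 2) (by omega) (by omega) (by decide),
      by simpa using hn (i := 1) (j := 0) (by omega) (by omega) (by decide),
      by simpa using hn (i := 2) (j := 0) (by omega) (by omega) (by decide)⟩
  refine R'.op_ne_zero_of_anti (R.op_injective _) (f := blockSwap e d 1 2)
    (hTa (by rw [sign_blockSwap e d hne.1, hd.neg_one_pow])) hv (hscalar hw0 hprod hvw) ?_
  refine hscalar (w := w ∘ swap 1 2) (fun i hi => ?_) ?_ fun i => ?_
  · simp only [Function.comp_apply]
    rw [swap_apply_of_ne_of_ne hne.2.1.symm hne.2.2.symm]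
    refine hw0 _ fun h1 => hi ?_
    rw [← swap_apply_of_ne_of_ne hne.2.1.symm hne.2.2.symm] at h1
    exact (swap _ _).injective h1
  · rw [← hprod]
    exact Equiv.prod_comp (swap 1 2) w
  · have h1 := hvw (swap 1 2 i)
    rw [pow_one] at h1 ⊢
    exact R'.apply_conj hd (shift_pow_self _) (blockSwap e d 1 2) (by
      rw [blockSwap_mul_shift, swap_apply_self, mul_inv_cancel_right]) h1

theorem nonHom_rot_two_wheel_three : NonHom (Perm.sumCongr (rot 2) (wheel 3 3)) := by
  have ho : orderOf (wheel 3 3) = 3 * 3 := orderOf_wheel 3 3 (by omega)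
  refine nonHom_sumCongr_rot_two (Perm.sign_eq_one_of_odd (by rw [ho]; decide))
    fun {V} _ _ _ _ R hR b w₀ hw₀ hb l => ?_
  let R' := R.comap (Function.Embedding.inr : ZMod 3 × ZMod 3 ↪ ZMod 2 ⊕ (ZMod 3 × ZMod 3))
  set T := R.op ((rot 2).viaEmbedding
    (Function.Embedding.inl : ZMod 2 ↪ ZMod 2 ⊕ (ZMod 3 × ZMod 3))) with hT
  have hTR {σ : Perm (ZMod 3 × ZMod 3)} (hσ : Perm.sign σ = 1) : Commute (R'.op σ) T :=
    R.op_disjoint_commute _ _ (by simp) _ hσ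
  have hTa {σ : Perm (ZMod 3 × ZMod 3)} (hσ : Perm.sign σ = -1) : T * R'.op σ = -(R'.op σ * T) :=
    R.op_disjoint_anti _ _ (by simp) (by decide) hσ
  change R'.op (wheel 3 3) w₀ = b • w₀ at hb
  change ∃ v, R'.op (wheel 3 3) v = b • v ∧ T v ≠ l • v
  by_contra! hcon
  have hC : R'.op (wheel 3 3) ^ (3 * 3) = 1 := by
    rw [← ho]
    exact R'.op_pow_orderOf _ (by rw [ho]; decide)
  have hbp : b ^ (3 * 3) = 1 := End.pow_eq_one_of_eigen hC hw₀ hb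
  obtain ⟨r, s, hr, hr1, hs, hs1, hrs⟩ := exists_mul_of_pow_three (b := b ^ 3) (by
    rw [← pow_mul, hbp])
  obtain ⟨v, hv, h0, h1, h2⟩ : ∃ v, v ≠ 0 ∧ R'.op (shift 3 3 0) v = (1 : ℂ) • v ∧
      R'.op (shift 3 3 1) v = r • v ∧ R'.op (shift 3 3 2) v = s • v := by
    obtain ⟨u, hu, hu1⟩ := SpinRep.exists_fixed_of_not_basic hR (a := Sum.inr (0, 0))
      (b := Sum.inr (0, 1)) (c := Sum.inr (0, 2)) (by decide) (by decide) (by decide)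
    let e₃ : Fin 3 ↪ ZMod 2 ⊕ (ZMod 3 × ZMod 3) :=
      ⟨![Sum.inr (0, 0), Sum.inr (0, 1), Sum.inr (0, 2)], by decide⟩
    let e₇ : Fin 7 ↪ ZMod 2 ⊕ (ZMod 3 × ZMod 3) :=
      ⟨![Sum.inr (1, 0), Sum.inr (1, 1), Sum.inr (1, 2), Sum.inr (2, 0), Sum.inr (2, 1),
        Sum.inr (2, 2), Sum.inl 0], by decide⟩
    set X := R.op ((swap 0 1 * swap 1 2 : Perm (Fin 3)).viaEmbedding e₃) with hX
    have hst (ρ : Perm (Fin 7)) : ∀ v ∈ X.eigenspace 1, (R.comap e₇).op ρ v ∈ X.eigenspace 1 :=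
      fun v hv => End.eigenspace_stable
        (R.op_disjoint_commute e₃ e₇ (by decide) ρ (by decide)).symm 1 v hv
    have : Nontrivial (X.eigenspace 1) :=
      Submodule.nontrivial_iff_ne_bot.2 (End.eigenspace_ne_bot hu (by
        rw [one_smul, hX, Perm.viaEmbedding_mul, Perm.viaEmbedding_swap, Perm.viaEmbedding_swap]
        exact hu1))
    obtain ⟨v, hv, h1, h2⟩ := ((R.comap e₇).restrict _ hst).exists_eigenvector_two_threeCycles
      hr hr1 hs hs1
    have h0 := End.mem_eigenspace_iff.1 v.2
    replace h1 := congrArg (Submodule.subtype _) h1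
    replace h2 := congrArg (Submodule.subtype _) h2
    simp only [hX, SpinRep.restrict_op, SpinRep.comap_op, Perm.viaEmbedding_mul,
      Perm.viaEmbedding_swap] at h0 h1 h2
    refine ⟨v, by simpa using hv, ?_, ?_, ?_⟩
    all_goals
      rw [SpinRep.comap_op, shift_three, Perm.viaEmbedding_mul, Perm.viaEmbedding_swap,
        Perm.viaEmbedding_swap]
    exacts [h0, h1, h2]
  have hscalar {u : V} (hu0 : R'.op (shift 3 3 0) u = (1 : ℂ) • u)
      (hu1 : R'.op (shift 3 3 1) u = r • u) (hu2 : R'.op (shift 3 3 2) u = s • u) :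
      T u = l • u := by
    refine SpinRep.HasWeight.apply_eq_smul (R := R') (w := ![1, r, s]) hTR (by norm_num)
      (by decide) (by decide) hbp hcon ?_ ?_ ?_
    · intro i hi
      fin_cases i
      exacts [absurd rfl hi, hr1, hs1]
    · rw [hrs]
      exact (Fin.prod_univ_three _).trans (by simp)
    · intro i
      rw [pow_one]
      fin_cases i
      exacts [hu0, hu1, hu2]
  have hconj {i : ZMod 3} {σ : Perm (ZMod 3 × ZMod 3)} {z : ℂ} {u : V}
      (hu : R'.op (shift 3 3 i) u = z • u)
      (h : swap (0, 1) (0, 2) * shift 3 3 i * (swap (0, 1) (0, 2))⁻¹ = σ) :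
      R'.op σ (R'.op (swap (0, 1) (0, 2)) u) = z • R'.op (swap (0, 1) (0, 2)) u :=
    R'.apply_conj (k := 3) (by decide) (shift_pow_self i) _ h hu
  refine R'.op_ne_zero_of_anti (R.op_injective _) (f := swap (0, 1) (0, 2))
    (hTa (by decide)) hv (hscalar h0 h1 h2) (hscalar ?_ (hconj h1 ?_) (hconj h2 ?_))
  · have h3 := hconj (σ := shift 3 3 0 ^ 2) h0 (by rw [shift_three]; decide)
    rw [R'.op_pow_of_odd (by decide) (shift_pow_self 0)] at h3
    have h4 := End.pow_apply_of_eigen h3 2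
    rw [← pow_mul, pow_succ _ 3, R'.op_pow_eq_one (by decide) (shift_pow_self 0), one_mul] at h4
    rw [h4, one_pow]
  · rw [shift_three]; decide
  · rw [shift_three]; decide

section prime

variable {p : ℕ} [Fact p.Prime]

/-- The sign of multiplication by a unit, as a multiplicative character. -/
noncomputable def dilSign (p : ℕ) [Fact p.Prime] : MulChar (ZMod p) ℂ :=
  MulChar.ofUnitHom ((Units.map (Int.castRingHom ℂ).toMonoidHom).comp
    (Perm.sign.comp (MulAction.toPermHom (ZMod p)ˣ (ZMod p))))

theorem dilSign_coe (u : (ZMod p)ˣ) : dilSign p u = ((Perm.sign (dil u) : ℤ) : ℂ) := by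
  have : MulAction.toPermHom (ZMod p)ˣ (ZMod p) u = dil u := by ext; rfl
  rw [dilSign, MulChar.ofUnitHom_coe, ← this]
  rfl

theorem isQuadratic_dilSign : (dilSign p).IsQuadratic := fun a => by
  by_cases ha : IsUnit a
  · obtain ⟨u, rfl⟩ := ha
    rw [dilSign_coe]
    rcases Int.units_eq_one_or (Perm.sign (dil u)) with h | h <;> simp [h]
  · exact Or.inl (MulChar.map_nonunit _ ha)

theorem exists_sign_dil (hp : p ≠ 2) : ∃ u : (ZMod p)ˣ, Perm.sign (dil u) = -1 := by
  obtain ⟨u, hu⟩ := IsCyclic.exists_generator (α := (ZMod p)ˣ)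
  have hpow (k : ℤ) (x : ZMod p) : (dil u ^ k) x = (u ^ k : (ZMod p)ˣ) * x := by
    have h1 (v : (ZMod p)ˣ) : MulAction.toPermHom (ZMod p)ˣ (ZMod p) v = dil v := by ext; rfl
    rw [← h1, ← map_zpow, h1, dil_apply]
  have hp1 : 2 < p := lt_of_le_of_ne (Fact.out : p.Prime).two_le hp.symm
  have hu1 : u ≠ 1 := by
    rintro rfl
    have h1 := orderOf_eq_card_of_forall_mem_zpowers hu
    rw [orderOf_one, Nat.card_eq_fintype_card, ZMod.card_units] at h1
    omega
  have hfix (x : ZMod p) : dil u x ≠ x ↔ x ≠ 0 := by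
    rw [dil_apply]
    refine ⟨?_, fun hx h => hu1 (Units.ext (mul_right_cancel₀ hx (by rw [h, Units.val_one, one_mul])))⟩
    rintro h rfl
    exact h (mul_zero _)
  have hc : (dil u).IsCycle := by
    refine ⟨1, (hfix 1).2 one_ne_zero, fun y hy => ?_⟩
    obtain ⟨k, hk⟩ := Subgroup.mem_zpowers_iff.1 (hu (Units.mk0 y ((hfix y).1 hy)))
    exact ⟨k, by rw [hpow, hk, mul_one, Units.val_mk0]⟩
  refine ⟨u, ?_⟩
  have hs : (dil u).support = Finset.univ.erase 0 := by
    ext x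
    rw [Perm.mem_support, hfix]
    simp
  rw [hc.sign, hs, Finset.card_erase_of_mem (Finset.mem_univ _), Finset.card_univ, ZMod.card,
    ((Fact.out : p.Prime).even_sub_one hp).neg_one_pow]

theorem dilSign_ne_one (hp : p ≠ 2) : dilSign p ≠ 1 := by
  obtain ⟨u, hu⟩ := exists_sign_dil hp
  intro h
  have h1 := dilSign_coe u
  rw [h, MulChar.one_apply_coe, hu] at h1
  norm_num at h1

theorem norm_gaussSum_dilSign (hp : p ≠ 2) {z : ℂ} (hz : z ^ p = 1) (hz1 : z ≠ 1) :
    ‖gaussSum (dilSign p) (AddChar.zmodChar p hz)‖ ^ 2 = p := by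
  have h1 : IsPrimitiveRoot z p := by
    rw [← orderOf_eq_prime hz hz1]
    exact IsPrimitiveRoot.orderOf z
  rw [← norm_pow, gaussSum_sq (dilSign_ne_one hp) isQuadratic_dilSign
    (AddChar.zmodChar_primitive_of_primitive_root p h1), norm_mul, ZMod.card, Complex.norm_natCast]
  have h2 : dilSign p (-1) = ((Perm.sign (dil (-1 : (ZMod p)ˣ)) : ℤ) : ℂ) := by
    rw [← dilSign_coe]; simp
  rw [h2]
  rcases Int.units_eq_one_or (Perm.sign (dil (-1 : (ZMod p)ˣ))) with h | h <;> simp [h]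

variable {V : Type} [AddCommGroup V] [Module ℂ V] [FiniteDimensional ℂ V]

/-- Conjugating by multiplications compares the traces of the powers of a `p`-cycle, twisted by a
disjoint transposition. -/
theorem SpinRep.trace_rot_two_mul_pow (hp : Odd p) (R : SpinRep (ZMod 2 ⊕ ZMod p) V)
    (u : (ZMod p)ˣ) :
    LinearMap.trace ℂ V (R.op ((rot 2).viaEmbedding Function.Embedding.inl) *
        R.op ((rot p).viaEmbedding Function.Embedding.inr) ^ (u : ZMod p).val) =
      dilSign p u * LinearMap.trace ℂ V (R.op ((rot 2).viaEmbedding Function.Embedding.inl) *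
        R.op ((rot p).viaEmbedding Function.Embedding.inr)) := by
  let R' := R.comap (Function.Embedding.inr : ZMod p ↪ ZMod 2 ⊕ ZMod p)
  set T := R.op ((rot 2).viaEmbedding (Function.Embedding.inl : ZMod 2 ↪ ZMod 2 ⊕ ZMod p)) with hT
  change LinearMap.trace ℂ V (T * R'.op (rot p) ^ (u : ZMod p).val) =
    _ * LinearMap.trace ℂ V (T * R'.op (rot p))
  have h1 := R'.op_conj hp (σ := rot p ^ (u : ZMod p).val)
    (by rw [← pow_mul, mul_comm, pow_mul, rot_pow_self, one_pow]) (dil u⁻¹)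
  rw [dil_inv_mul_rot u (ZMod.natCast_zmod_val _).symm, R'.op_pow_of_odd hp (rot_pow_self p)] at h1
  have hs : Perm.sign (dil u⁻¹) = Perm.sign (dil u) := by
    have : dil u⁻¹ = (dil u)⁻¹ := rfl
    rw [this, Perm.sign_inv]
  have h2 : R'.op (dil u⁻¹) * T = dilSign p u • (T * R'.op (dil u⁻¹)) := by
    rw [dilSign_coe, ← hs]
    rcases Int.units_eq_one_or (Perm.sign (dil u⁻¹)) with h | h
    · have h5 : R'.op (dil u⁻¹) * T = T * R'.op (dil u⁻¹) :=
        R.op_disjoint_commute Function.Embedding.inr Function.Embedding.inl (by simp) (rot 2) h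
      rw [h, h5]
      simp
    · have h5 : R'.op (dil u⁻¹) * T = -(T * R'.op (dil u⁻¹)) :=
        R.op_disjoint_anti Function.Embedding.inr Function.Embedding.inl (by simp) h (by decide)
      rw [h, h5]
      simp
  have h3 := R'.trace_eq_of_mul_eq (dil u⁻¹) (A := T * R'.op (rot p) ^ (u : ZMod p).val)
    (B := dilSign p u • (T * R'.op (rot p))) (by
      rw [← mul_assoc, h2, smul_mul_assoc, mul_assoc, h1, smul_mul_assoc, mul_assoc])
  rw [← h3, map_smul, smul_eq_mul]

theorem not_dimension_bounds {p m d : ℕ} (hp : 7 ≤ p) (hodd : Odd p) (hm : m ≠ 0)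
    (hle : (p : ℝ) * m ^ 2 + ((d : ℝ) - m) ^ 2 ≤ 2 * p) (h4 : 2 ^ 2 ∣ d + (p - 1) * m)
    (h9 : 9 * 2 ^ (p - 4) ≤ (d + (p - 1) * m) ^ 2) : False := by
  replace hle : (p : ℤ) * m ^ 2 + ((d : ℤ) - m) ^ 2 ≤ 2 * p := by exact_mod_cast hle
  obtain rfl : m = 1 := by
    by_contra hm1
    have h1 : (4 : ℤ) ≤ m ^ 2 := by
      have : 2 ≤ m := by omega
      exact_mod_cast Nat.pow_le_pow_left this 2
    have h2 : (p : ℤ) * 4 ≤ p * m ^ 2 := by gcongr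
    have := sq_nonneg ((d : ℤ) - m)
    omega
  have h1 : ((d : ℤ) - 1) ^ 2 ≤ p := by push_cast at hle; linarith
  obtain ⟨D, hD⟩ : ∃ D, d + (p - 1) * 1 = D := ⟨_, rfl⟩
  rw [hD] at h4 h9
  obtain rfl | hp8 := hp.eq_or_lt
  · have h2 : d ≤ 3 := by
      by_contra! h
      have : (4 : ℤ) ≤ d := by exact_mod_cast h
      push_cast at h1
      nlinarith
    norm_num at h9 h4
    have : 9 ≤ D := by
      by_contra! h
      interval_cases D <;> omega
    omega
  · have hp9 : 9 ≤ p := by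
      obtain ⟨k, rfl⟩ := hodd
      omega
    have h5 (q : ℕ) (hq : 9 ≤ q) : 2 * q + 2 * q ^ 2 < 9 * 2 ^ (q - 4) := by
      induction q, hq using Nat.le_induction with
      | base => norm_num
      | succ q hq ih =>
        rw [show q + 1 - 4 = q - 4 + 1 by omega, pow_succ 2 (q - 4)]
        nlinarith
    have h6 := h5 p hp9
    have h7 : (D : ℤ) = d - 1 + p := by omega
    have h8 : (D : ℤ) ^ 2 ≤ 2 * p + 2 * p ^ 2 := by
      rw [h7]
      nlinarith [sq_nonneg ((d : ℤ) - 1 - p)]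
    have h10 : D ^ 2 ≤ 2 * p + 2 * p ^ 2 := by exact_mod_cast h8
    omega

variable [Nontrivial V]

theorem SpinRep.Irred.exists_ne_of_rot_two_rot_prime (hp : 7 ≤ p)
    {R : SpinRep (ZMod 2 ⊕ ZMod p) V} (hR : R.Irred) (hB : ¬R.Basic) {b : ℂ} (hb : b ^ p = 1)
    (hb1 : b ≠ 1) (l : ℂ) :
    ∃ v, R.op ((rot p).viaEmbedding Function.Embedding.inr) v = b • v ∧
      R.op ((rot 2).viaEmbedding Function.Embedding.inl) v ≠ l • v := by
  by_contra! hcon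
  have hpp : p.Prime := Fact.out
  have hodd : Odd p := hpp.odd_of_ne_two (by omega)
  have hp0 : (p : ℂ) ≠ 0 := Nat.cast_ne_zero.2 hpp.ne_zero
  let R' := R.comap (Function.Embedding.inr : ZMod p ↪ ZMod 2 ⊕ ZMod p)
  have htr := R.trace_rot_two_mul_pow hodd
  set T := R.op ((rot 2).viaEmbedding (Function.Embedding.inl : ZMod 2 ↪ ZMod 2 ⊕ ZMod p)) with hT
  set C := R.op ((rot p).viaEmbedding (Function.Embedding.inr : ZMod p ↪ ZMod 2 ⊕ ZMod p)) with hC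
  have hCp : C ^ p = 1 := R'.op_pow_eq_one hodd (rot_pow_self p)
  have hb0 : b ≠ 0 := by
    rintro rfl
    rw [zero_pow hpp.ne_zero] at hb
    exact zero_ne_one hb
  obtain ⟨m, hm, hdim, htrC⟩ := R'.exists_finrank_eigenspace hpp hodd (rot_pow_self p)
    fun k hk => SpinRep.isConj_rot_pow hk
  change LinearMap.trace ℂ V C = _ at htrC
  have hCP (v : V) : C (cyclicSum C b p v) = b • cyclicSum C b p v :=
    apply_cyclicSum hb0 (by rw [hCp, hb, one_smul]; rfl)
  have hTP : T * cyclicSum C b p = l • cyclicSum C b p := by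
    ext v
    exact hcon _ (hCP v)
  have hsum (f : ℕ → ℂ) (F : ZMod p → ℂ) (h : ∀ x, f x.val = F x) :
      ∑ j ∈ Finset.range p, f j = ∑ x, F x := by
    refine Finset.sum_nbij' (fun j => (j : ZMod p)) ZMod.val (by simp)
      (fun x _ => Finset.mem_range.2 x.val_lt)
      (fun j hj => ZMod.val_cast_of_lt (Finset.mem_range.1 hj)) (fun x _ => x.natCast_zmod_val)
      fun j hj => ?_
    rw [← h, ZMod.val_cast_of_lt (Finset.mem_range.1 hj)]
  have htP : LinearMap.trace ℂ V (cyclicSum C b p) = p * m := by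
    have hpow (j : ℕ) (hj : j ∈ Finset.range p) : b⁻¹ ^ j * LinearMap.trace ℂ V (C ^ j) =
        b⁻¹ ^ j * LinearMap.trace ℂ V C +
          if j = 0 then (finrank ℂ V : ℂ) - LinearMap.trace ℂ V C else 0 := by
      split_ifs with h0
      · simp [h0]
      · have h1 : (j : ZMod p) ≠ 0 := fun h => Nat.not_dvd_of_pos_of_lt (Nat.pos_of_ne_zero h0)
          (Finset.mem_range.1 hj) ((ZMod.natCast_eq_zero_iff _ _).1 h)
        have h2 := R'.op_conj hodd (σ := rot p ^ j)
          (by rw [← pow_mul, mul_comm, pow_mul, rot_pow_self, one_pow]) (dil (Units.mk0 _ h1)⁻¹)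
        rw [dil_inv_mul_rot (Units.mk0 _ h1) rfl, R'.op_pow_of_odd hodd (rot_pow_self p)] at h2
        rw [add_zero]
        congr 1
        exact (R'.trace_eq_of_mul_eq _ h2).symm
    have hgeom : ∑ j ∈ Finset.range p, b⁻¹ ^ j = 0 := by
      rw [geom_sum_eq (by simpa using hb1), inv_pow, hb]
      simp
    rw [cyclicSum, map_sum]
    simp only [map_smul, smul_eq_mul]
    rw [Finset.sum_congr rfl hpow, Finset.sum_add_distrib, ← Finset.sum_mul, hgeom,
      Finset.sum_ite_eq' , if_pos (Finset.mem_range.2 hpp.pos), htrC, hdim]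
    push_cast [Nat.cast_sub hpp.one_le]
    ring
  have htTP : LinearMap.trace ℂ V (T * cyclicSum C b p) =
      LinearMap.trace ℂ V (T * C) * gaussSum (dilSign p)
        (AddChar.zmodChar p (ζ := b⁻¹) (by rw [inv_pow, hb, inv_one])) := by
    have htT : LinearMap.trace ℂ V T = 0 := by
      obtain ⟨u, hu⟩ := exists_sign_dil (p := p) (by omega)
      have h5 : R'.op (dil u) * T = -(T * R'.op (dil u)) :=
        R.op_disjoint_anti Function.Embedding.inr Function.Embedding.inl (by simp) hu (by decide)
      have h6 := R'.trace_eq_of_mul_eq (dil u) (A := T) (B := -T) (by rw [h5, neg_mul])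
      rw [map_neg] at h6
      linear_combination -(1 / 2 : ℂ) * h6
    rw [cyclicSum, Finset.mul_sum, map_sum, gaussSum, Finset.mul_sum]
    refine hsum _ _ fun x => ?_
    rw [mul_smul_comm, map_smul, smul_eq_mul, AddChar.zmodChar_apply]
    by_cases hx : x = 0
    · subst hx
      rw [ZMod.val_zero, pow_zero C, mul_one, htT, MulChar.map_zero]
      ring
    · have h1 := htr (Units.mk0 x hx)
      rw [Units.val_mk0] at h1
      rw [h1]
      ring
  have hm0 : m ≠ 0 := by
    rintro rfl
    have h1 := hm b hb hb1
    rw [Submodule.finrank_eq_zero] at h1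
    have ho : orderOf (rot p) = p := by
      rw [Perm.orderOf_eq_lcm_parts, parts_rot, Multiset.lcm_singleton, normalize_eq]
    have h2 := good_rot_prime hp V R' b (by
      rw [ho, hb, one_smul]
      exact hCp)
    exact h2 h1
  have hl : ‖l‖ = 1 := by
    obtain ⟨s, hs, h1⟩ : SignEq (T * T) 1 := by
      have := R.op_mul' ((rot 2).viaEmbedding (Function.Embedding.inl (β := ZMod p)))
        ((rot 2).viaEmbedding Function.Embedding.inl)
      rwa [← Perm.viaEmbedding_mul, (show rot 2 * rot 2 = 1 by decide), Perm.viaEmbedding_one,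
        R.op_one] at this
    have h2 : T * T * cyclicSum C b p = (l * l) • cyclicSum C b p := by
      rw [mul_assoc, hTP, mul_smul_comm, hTP, smul_smul]
    rw [h1, smul_mul_assoc, one_mul] at h2
    have h3 := congrArg (LinearMap.trace ℂ V) h2
    rw [map_smul, map_smul, htP, smul_eq_mul, smul_eq_mul] at h3
    have h4 := mul_right_cancel₀ (mul_ne_zero hp0 (Nat.cast_ne_zero.2 hm0)) h3
    refine Complex.norm_eq_one_of_pow_eq_one (n := 4) ?_ (by decide)
    rw [← hs, h4]
    ring
  have hchi : R.chiSq (Perm.sumCongr (rot 2) (rot p)) = p * m ^ 2 := by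
    obtain ⟨s, hs, h1⟩ := R.op_sumCongr (rot 2) (rot p)
    have hs1 : ‖s‖ = 1 :=
      Complex.norm_eq_one_of_pow_eq_one (n := 2) (by rw [pow_two, hs]) (by decide)
    rw [SpinRep.chiSq, h1, map_smul, Complex.normSq_eq_norm_sq, norm_smul, hs1, one_mul]
    have h2 := congrArg (‖·‖ ^ 2) htTP
    rw [hTP, map_smul, htP, norm_smul, hl, one_mul, norm_mul, norm_mul, mul_pow, mul_pow,
      norm_gaussSum_dilSign (by omega) _ (by simpa using hb1), Complex.norm_natCast,
      Complex.norm_natCast] at h2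
    have hp0' : (p : ℝ) ≠ 0 := Nat.cast_ne_zero.2 hpp.ne_zero
    exact mul_right_cancel₀ hp0' (h2.symm.trans (by ring))
  have hchi' : R.chiSq ((rot p).viaEmbedding Function.Embedding.inr) =
      ((finrank ℂ ((R'.op (rot p)).eigenspace 1) : ℝ) - m) ^ 2 := by
    rw [SpinRep.chiSq, htrC, ← Complex.ofReal_natCast, ← Complex.ofReal_natCast,
      ← Complex.ofReal_sub, Complex.normSq_ofReal, pow_two]
  have hz : Perm.zee (Perm.sumCongr (rot 2) (rot p)) = 2 * p := by
    have h1 : (Perm.sumCongr (rot 2) (rot p)).cycleType = {2, p} := by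
      rw [Perm.cycleType_eq_filter, Perm.parts_sumCongr, parts_rot, parts_rot, Multiset.filter_add,
        Multiset.filter_singleton, Multiset.filter_singleton, if_pos le_rfl, if_pos (by omega)]
      rfl
    have h2 : p ≠ 2 := by omega
    simp [Perm.zee, h1, ZMod.card, Finset.prod_pair h2.symm, h2, h2.symm]
  have hz' : Perm.zee ((rot p).viaEmbedding
      (Function.Embedding.inr : ZMod p ↪ ZMod 2 ⊕ ZMod p)) = 2 * p := by
    simp [Perm.zee, Perm.cycleType_viaEmbedding, SpinRep.cycleType_rot, ZMod.card]
  have hnc : ¬IsConj (Perm.sumCongr (rot 2) (rot p)) ((rot p).viaEmbedding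
      (Function.Embedding.inr : ZMod p ↪ ZMod 2 ⊕ ZMod p)) := by
    intro h
    obtain ⟨c, hc⟩ := isConj_iff.1 h
    have h3 := congrArg Perm.sign hc
    rw [map_mul, map_mul, Perm.sign_inv, mul_right_comm, Int.units_mul_self, one_mul,
      Perm.sign_sumCongr, Perm.sign_viaEmbedding, sign_rot_of_odd hodd] at h3
    exact absurd h3 (by decide)
  have hle := hR.chiSq_div_add_le hnc
  rw [hchi, hchi', hz, hz', ← add_div, div_le_one (by positivity)] at hle
  set d₁ := finrank ℂ ((R'.op (rot p)).eigenspace 1)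
  push_cast at hle
  refine not_dimension_bounds hp hodd hm0 hle ?_ ?_
  · rw [← hdim]
    exact SpinRep.two_pow_dvd_finrank 2 R (by simp [ZMod.card]; omega)
  · rw [← hdim]
    exact SpinRep.two_pow_le_of_not_basic hB (n := p - 4) (by simp [ZMod.card]; omega) (by omega)

end prime

theorem nonHom_rot_two_rot_prime {p : ℕ} [Fact p.Prime] (hp : 7 ≤ p) :
    NonHom (Perm.sumCongr (rot 2) (rot p)) := by
  have hpp : p.Prime := Fact.out
  have hodd : Odd p := hpp.odd_of_ne_two (by omega)
  refine nonHom_sumCongr_rot_two (sign_rot_of_odd hodd) fun {V} _ _ _ _ R hR b w hw hb l => ?_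
  let R' := R.comap (Function.Embedding.inr : ZMod p ↪ ZMod 2 ⊕ ZMod p)
  by_cases hb1 : b = 1
  · subst hb1
    set T := R.op ((rot 2).viaEmbedding (Function.Embedding.inl : ZMod 2 ↪ ZMod 2 ⊕ ZMod p)) with hT
    change R'.op (rot p) w = (1 : ℂ) • w at hb
    change ∃ v, R'.op (rot p) v = (1 : ℂ) • v ∧ T v ≠ l • v
    by_contra! hcon
    obtain ⟨u, hu⟩ := exists_sign_dil (p := p) (by omega)
    have hs : Perm.sign (dil u⁻¹) = -1 := by
      have : dil u⁻¹ = (dil u)⁻¹ := rfl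
      rw [this, Perm.sign_inv, hu]
    refine R'.op_ne_zero_of_anti (R.op_injective _) (f := dil u⁻¹) (R.op_disjoint_anti
      Function.Embedding.inl Function.Embedding.inr (by simp) (by decide) hs) hw (hcon w hb) ?_
    refine hcon _ (R'.apply_conj hodd (σ := rot p ^ (u : ZMod p).val)
      (by rw [← pow_mul, mul_comm, pow_mul, rot_pow_self, one_pow]) _
      (dil_inv_mul_rot u (ZMod.natCast_zmod_val _).symm) ?_)
    rw [R'.op_pow_of_odd hodd (rot_pow_self p), End.pow_apply_of_eigen hb, one_pow]
  · obtain ⟨U, hU, hB, hirr⟩ := R.exists_irred_of_not_basic hR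
    have hbp : b ^ p = 1 :=
      End.pow_eq_one_of_eigen (R'.op_pow_eq_one hodd (rot_pow_self p)) hw hb
    have : Nontrivial U := by
      rw [SpinRep.Basic] at hB
      push Not at hB
      obtain ⟨_, _, _, _, _, _, v, -, hv⟩ := hB
      exact nontrivial_of_ne v 0 hv
    obtain ⟨v, hv, hne⟩ := hirr.exists_ne_of_rot_two_rot_prime hp hB hbp hb1 l
    exact ⟨v, congrArg U.subtype hv, fun h => hne (Subtype.ext h)⟩

theorem nonHom_rot_two_rot {q : ℕ} [NeZero q] (hq : Odd q) (hq7 : 7 ≤ q) :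
    NonHom (Perm.sumCongr (rot 2) (rot q)) := by
  obtain ⟨d, _, hd, hd5, ⟨e, he⟩, hd', h⟩ := exists_lettered_dvd hq (by omega)
  have hnz : e ≠ 0 := by rintro rfl; omega
  have : NeZero e := ⟨hnz⟩
  by_cases he1 : e = 1
  · obtain rfl : q = d := by rw [he, he1, mul_one]
    rcases hd' with hp | rfl
    · have : Fact q.Prime := ⟨hp⟩
      exact nonHom_rot_two_rot_prime hq7
    · exact nonHom_rot_two_wheel_three.of_parts (by
        simp only [Perm.parts_sumCongr, parts_rot, parts_wheel 3 3 (by norm_num)])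
  · have heo : Odd e := hq.of_dvd_nat ⟨d, by rw [he, mul_comm]⟩
    have he3 : 3 ≤ e := by
      obtain ⟨k, rfl⟩ := heo
      omega
    exact (h.nonHom_rot_two_wheel he3 heo hd hd5).of_parts (by
      rw [Perm.parts_sumCongr, Perm.parts_sumCongr, parts_rot, parts_rot, parts_wheel e d (by omega),
        he, mul_comm])

variable {α β : Type} [DecidableEq α] [Fintype α] [DecidableEq β] [Fintype β]

theorem Perm.exists_cons_parts {σ : Perm α} {m : ℕ} (hm : m ∈ Perm.parts σ) :
    ∃ (l : ℕ) (τ : Perm (Fin l)), m ::ₘ Perm.parts τ = Perm.parts σ := by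
  obtain ⟨l, τ, hτ⟩ := Perm.exists_parts_eq ((Perm.parts σ).erase m) fun k hk =>
    Perm.pos_of_mem_parts (Multiset.mem_of_mem_erase hk)
  exact ⟨l, τ, by rw [hτ, Multiset.cons_erase hm]⟩

theorem Perm.sign_of_cons_parts {σ : Perm α} {τ : Perm β} {m : ℕ}
    (h : m ::ₘ Perm.parts τ = Perm.parts σ) : Perm.sign σ = (-1) ^ (m + 1) * Perm.sign τ := by
  rw [Perm.sign_eq_parts, Perm.sign_eq_parts, ← h, Multiset.sum_cons, Multiset.card_cons, ← pow_add]
  congr 1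
  ring

theorem Perm.filter_dvd_of_cons_parts {σ : Perm α} {τ : Perm β} {m d : ℕ}
    (h : m ::ₘ Perm.parts τ = Perm.parts σ) (hd : ¬d ∣ m) :
    (Perm.parts τ).filter (d ∣ ·) = (Perm.parts σ).filter (d ∣ ·) := by
  rw [← h, Multiset.filter_cons_of_neg _ hd]

theorem NonHom.of_cons_parts {σ : Perm α} {τ : Perm β} {m : ℕ} [NeZero m]
    (h : m ::ₘ Perm.parts τ = Perm.parts σ) (hn : NonHom (Perm.sumCongr (rot m) τ)) : NonHom σ :=
  hn.of_parts (by rw [← h, Perm.parts_sumCongr, parts_rot, Multiset.singleton_add])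

theorem exists_mem_filter_ne {M : Multiset ℕ} (hM : M.Nodup) {d : ℕ} (hd : d ∈ M)
    (h : M.filter (d ∣ ·) ≠ {d}) : ∃ x ∈ M, d ∣ x ∧ x ≠ d := by
  by_contra! hc
  refine h ((Multiset.Nodup.ext (hM.filter _) (Multiset.nodup_singleton d)).2 fun x => ?_)
  rw [Multiset.mem_filter, Multiset.mem_singleton]
  refine ⟨fun hx => hc x hx.1 hx.2, ?_⟩
  rintro rfl
  exact ⟨hd, dvd_rfl⟩

section distinct

variable {σ : Perm α} (hs : Perm.sign σ = -1) (h3 : (Perm.parts σ).filter (3 ∣ ·) ≠ {3})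
  (h5 : (Perm.parts σ).filter (5 ∣ ·) ≠ {5}) (h9 : 9 ≤ Fintype.card α)
  (hev : ∀ m ∈ Perm.parts σ, Even m → m < 10) (hnd : (Perm.parts σ).Nodup)

include hs h5 h9 hev hnd

theorem nonHom_of_six_mem (h6 : 6 ∈ Perm.parts σ) : NonHom σ := by
  obtain ⟨l, τ, hτ⟩ := Perm.exists_cons_parts h6
  have hsτ : Perm.sign τ = 1 := by
    have := Perm.sign_of_cons_parts hτ
    rw [hs, (by decide : ((-1 : ℤˣ) ^ (6 + 1)) = -1)] at this
    simpa using this.symm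
  by_cases hm3 : 3 ∈ Perm.parts τ
  · obtain ⟨k, τ', hτ'⟩ := Perm.exists_cons_parts hm3
    obtain ⟨j, ρ, hρ⟩ := Perm.exists_parts_eq {6, 3} (by simp)
    refine ((nonHom_of_parts_six_three hρ).sumCongr (τ := τ') ?_).of_parts ?_
    · have := Perm.sign_of_cons_parts hτ'
      rw [hsτ, (by decide : ((-1 : ℤˣ) ^ (3 + 1)) = 1)] at this
      simpa using this.symm
    · rw [Perm.parts_sumCongr, hρ, ← hτ, ← hτ']
      rfl
  · have hl : 9 ≤ 6 + l := by
      have h1 := Perm.sum_parts σ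
      rw [← hτ, Multiset.sum_cons, Perm.sum_parts, Fintype.card_fin] at h1
      omega
    have : Nonempty (Fin l) := ⟨⟨0, by omega⟩⟩
    have hgood : Good τ := by
      refine good_of_sign_eq_one hsτ (fun h => hm3 ?_) ?_ (Or.inl fun b hb => ?_)
      · exact (Multiset.mem_filter.1 (h ▸ Multiset.mem_singleton_self 3)).1
      · rwa [Perm.filter_dvd_of_cons_parts hτ (by decide)]
      · rcases b with _ | _ | b
        · exact hm3 hb
        · rw [← hτ] at hnd
          exact (Multiset.nodup_cons.1 hnd).1 hb
        · have h1 := hev _ (hτ ▸ Multiset.mem_cons_of_mem hb)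
            ⟨3 * 2 ^ (b + 1), by ring⟩
          have h2 : 1 ≤ 2 ^ b := Nat.one_le_two_pow
          rw [pow_succ, pow_succ] at h1
          omega
    have : NonHom (Perm.sumCongr (wheel 2 3) τ) := fun V _ _ _ _ R => by
      by_cases hB : R.Basic
      · refine hB.nonHomog_sumCongr ?_
        rw [Perm.sign_sumCongr, hsτ, Perm.sign_eq_parts, parts_wheel 2 3 le_rfl]
        rfl
      · exact R.nonHomog_six hB hgood hsτ
    exact this.of_parts (by
      rw [← hτ, Perm.parts_sumCongr, parts_wheel 2 3 le_rfl]
      rfl)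

include h3

theorem good_of_cons_parts {m : ℕ} (h6 : 6 ∉ Perm.parts σ) (hm3 : ¬3 ∣ m) (hm5 : ¬5 ∣ m)
    {l : ℕ} {τ : Perm (Fin l)} (hτ : m ::ₘ Perm.parts τ = Perm.parts σ) (hsτ : Perm.sign τ = 1) :
    Good τ := by
  have hf3 := Perm.filter_dvd_of_cons_parts hτ hm3
  refine good_of_sign_eq_one hsτ (by rwa [hf3])
    (by rwa [Perm.filter_dvd_of_cons_parts hτ hm5]) (or_iff_not_imp_left.2 fun h => ?_)
  push Not at h
  obtain ⟨b, hb⟩ := h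
  have hmem {x : ℕ} (hx : x ∈ Perm.parts τ) : x ∈ Perm.parts σ :=
    hτ ▸ Multiset.mem_cons_of_mem hx
  rcases b with _ | _ | b
  · obtain ⟨x, hx, hx3, hne⟩ := exists_mem_filter_ne (hτ ▸ hnd : (m ::ₘ Perm.parts τ).Nodup).of_cons
      hb (by rwa [pow_zero, mul_one, hf3])
    have h1 := Multiset.le_sum_of_mem hx
    rw [Perm.sum_parts] at h1
    have h2 := Perm.pos_of_mem_parts hx
    have h4 : x ≠ 6 := by rintro rfl; exact h6 (hmem hx)
    omega
  · exact absurd (hmem hb) h6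
  · have h1 := hev _ (hmem hb) ⟨3 * 2 ^ (b + 1), by ring⟩
    have h2 : 1 ≤ 2 ^ b := Nat.one_le_two_pow
    rw [pow_succ, pow_succ] at h1
    omega

theorem nonHom_of_even_parts_eq_two (h2 : ∀ m ∈ Perm.parts σ, Even m → m = 2) : NonHom σ := by
  obtain ⟨l, τ, hτ⟩ : ∃ (l : ℕ) (τ : Perm (Fin l)), 2 ::ₘ Perm.parts τ = Perm.parts σ := by
    refine Perm.exists_cons_parts ?_
    by_contra h
    have h1 : Odd (orderOf σ) := by
      rw [Perm.orderOf_eq_lcm_parts]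
      refine odd_lcm fun m hm => Nat.not_even_iff_odd.1 fun he => h ?_
      rwa [← h2 m hm he]
    rw [Perm.sign_eq_one_of_odd h1] at hs
    exact absurd hs (by decide)
  have hsτ : Perm.sign τ = 1 := by
    have := Perm.sign_of_cons_parts hτ
    rw [hs, (by decide : ((-1 : ℤˣ) ^ (2 + 1)) = -1)] at this
    simpa using this.symm
  have hnd' := hτ ▸ hnd
  rw [Multiset.nodup_cons] at hnd'
  have hmem {x : ℕ} (hx : x ∈ Perm.parts τ) : x ∈ Perm.parts σ :=
    hτ ▸ Multiset.mem_cons_of_mem hx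
  have hodd (m : ℕ) (hm : m ∈ Perm.parts τ) : Odd m :=
    Nat.not_even_iff_odd.1 fun he => hnd'.1 (h2 m (hmem hm) he ▸ hm)
  obtain ⟨q, hq, hq7⟩ : ∃ q ∈ Perm.parts τ, 7 ≤ q := by
    by_contra! hc
    have hno {d : ℕ} (hd : ¬d ∣ 2) (hd1 : 3 ≤ d) (h : (Perm.parts σ).filter (d ∣ ·) ≠ {d}) :
        d ∉ Perm.parts τ := fun hdm => by
      rw [← Perm.filter_dvd_of_cons_parts hτ hd] at h
      obtain ⟨x, hx, ⟨c, rfl⟩, hne⟩ := exists_mem_filter_ne hnd'.2 hdm h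
      have h1 := hc _ hx
      have h4 := hodd _ hx
      have h6 : c ≠ 0 := by rintro rfl; simp at h4
      have h7 : c ≠ 1 := by rintro rfl; simp at hne
      have h8 : c ≠ 2 := by rintro rfl; exact absurd h4 (by simp)
      have h10 : 3 * 3 ≤ d * c := Nat.mul_le_mul hd1 (by omega)
      omega
    have h31 := hno (by decide) le_rfl h3
    have h51 := hno (by decide) (by decide) h5
    have h1 : ∀ x ∈ Perm.parts τ, x = 1 := fun x hx => by
      have h4 := hc x hx
      have h6 := hodd x hx
      interval_cases x
      · exact absurd h6 (by decide)
      · rfl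
      · exact absurd h6 (by decide)
      · exact absurd hx h31
      · exact absurd h6 (by decide)
      · exact absurd hx h51
      · exact absurd h6 (by decide)
    have h4 := Multiset.eq_replicate_card.2 h1
    have h6 := Multiset.nodup_iff_count_le_one.1 hnd'.2 1
    have h7 := Perm.sum_parts σ
    rw [← hτ, Multiset.sum_cons, h4, Multiset.sum_replicate] at h7
    rw [h4, Multiset.count_replicate_self] at h6
    simp only [smul_eq_mul, mul_one] at h7
    omega
  have : NeZero q := ⟨by omega⟩
  obtain ⟨k, τ', hτ'⟩ := Perm.exists_cons_parts hq
  refine ((nonHom_rot_two_rot (hodd q hq) hq7).sumCongr (τ := τ') ?_).of_parts ?_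
  · have := Perm.sign_of_cons_parts hτ'
    rw [hsτ, (hodd q hq).add_one.neg_one_pow, one_mul] at this
    exact this.symm
  · rw [Perm.parts_sumCongr, Perm.parts_sumCongr, parts_rot, parts_rot, ← hτ, ← hτ']
    rfl

end distinct

theorem nonHom_of_sign_eq_neg_one {σ : Perm α} (hs : Perm.sign σ = -1)
    (h3 : (Perm.parts σ).filter (3 ∣ ·) ≠ {3}) (h5 : (Perm.parts σ).filter (5 ∣ ·) ≠ {5})
    (h9 : 9 ≤ Fintype.card α) : NonHom σ := by
  have hsign {m : ℕ} (hm : Even m) {l : ℕ} {τ : Perm (Fin l)}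
      (h : m ::ₘ Perm.parts τ = Perm.parts σ) : Perm.sign τ = 1 := by
    have := Perm.sign_of_cons_parts h
    rw [hs, hm.add_one.neg_one_pow] at this
    simpa using this.symm
  by_cases hev : ∀ m ∈ Perm.parts σ, Even m → m < 10
  swap
  · push Not at hev
    obtain ⟨m, hm, he, hm10⟩ := hev
    have : NeZero m := ⟨by omega⟩
    obtain ⟨l, τ, hτ⟩ := Perm.exists_cons_parts hm
    exact NonHom.of_cons_parts hτ ((nonHom_rot_of_even he hm10).sumCongr (hsign he hτ))
  by_cases hnd : (Perm.parts σ).Nodup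
  swap
  · rw [Multiset.nodup_iff_count_le_one] at hnd
    push Not at hnd
    obtain ⟨m, hm⟩ := hnd
    exact nonHom_of_two_le_count hm hs
  by_cases h6 : 6 ∈ Perm.parts σ
  · exact nonHom_of_six_mem hs h5 h9 hev hnd h6
  have hne {m : ℕ} (hm : m < 9) {l : ℕ} {τ : Perm (Fin l)}
      (h : m ::ₘ Perm.parts τ = Perm.parts σ) : Nonempty (Fin l) := by
    have h1 := Perm.sum_parts σ
    rw [← h, Multiset.sum_cons, Perm.sum_parts, Fintype.card_fin] at h1
    exact ⟨⟨0, by omega⟩⟩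
  by_cases h4 : 4 ∈ Perm.parts σ
  · obtain ⟨l, τ, hτ⟩ := Perm.exists_cons_parts h4
    have := hne (by decide) hτ
    have hsτ := hsign (by decide) hτ
    exact NonHom.of_cons_parts hτ (nonHom_sumCongr_rot_four (good_of_cons_parts hs h3 h5 h9 hev hnd
      h6 (by decide) (by decide) hτ hsτ) hsτ)
  by_cases h8 : 8 ∈ Perm.parts σ
  · obtain ⟨l, τ, hτ⟩ := Perm.exists_cons_parts h8
    have := hne (by decide) hτ
    have hsτ := hsign (by decide) hτ
    exact NonHom.of_cons_parts hτ (nonHom_sumCongr_rot_eight (good_of_cons_parts hs h3 h5 h9 hev hnd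
      h6 (by decide) (by decide) hτ hsτ) hsτ)
  refine nonHom_of_even_parts_eq_two hs h3 h5 h9 hev hnd fun m hm he => ?_
  have h1 := hev m hm he
  have h2 := Perm.pos_of_mem_parts hm
  interval_cases m
  all_goals first
    | rfl
    | exact absurd he (by decide)
    | contradiction

theorem good_of_nine_le_card {σ : Perm α} (h3 : (Perm.parts σ).filter (3 ∣ ·) ≠ {3})
    (h5 : (Perm.parts σ).filter (5 ∣ ·) ≠ {5}) (h9 : 9 ≤ Fintype.card α) : Good σ := by
  rcases Int.units_eq_one_or (Perm.sign σ) with hs | hs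
  · exact good_of_sign_eq_one hs h3 h5 (Or.inr (by omega))
  · exact (nonHom_of_sign_eq_neg_one hs h3 h5 h9).good hs h3 h5 (by omega)

section coxeter

variable {G : Type*} [Group G] {n : ℕ} {t : ℕ → G}

/-- The product `t m * t (m - 1) * ⋯` of `d` factors. -/
def descProd (t : ℕ → G) (m : ℕ) : ℕ → G
  | 0 => 1
  | d + 1 => descProd t m d * t (m - d)

theorem descProd_mul_comm (hc : ∀ i j, i + 2 ≤ j → j + 1 < n → t i * t j = t j * t i) {m : ℕ}
    (hm : m + 1 < n) {d j : ℕ} (h : j + d < m) : descProd t m d * t j = t j * descProd t m d := by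
  induction d with
  | zero => simp [descProd]
  | succ d ih =>
    rw [descProd, mul_assoc, ← hc j (m - d) (by omega) (by omega), ← mul_assoc, ih (by omega),
      mul_assoc]

theorem descProd_mul_braid (hc : ∀ i j, i + 2 ≤ j → j + 1 < n → t i * t j = t j * t i)
    (hb : ∀ i, i + 2 < n → t (i + 1) * t i * t (i + 1) = t i * t (i + 1) * t i) {m : ℕ}
    (hm : m + 1 < n) {d i : ℕ} (hd : d ≤ m + 1) (hi : i < m) (h : m + 1 ≤ i + d) :
    descProd t m d * t (i + 1) = t i * descProd t m d := by
  induction d with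
  | zero => omega
  | succ d ih =>
    rcases eq_or_ne (i + d) m with h1 | h1
    · obtain ⟨d, rfl⟩ : ∃ e, d = e + 1 := ⟨d - 1, by omega⟩
      rw [descProd, descProd, show m - (d + 1) = i by omega, show m - d = i + 1 by omega,
        mul_assoc, mul_assoc, ← mul_assoc (t (i + 1)), hb i (by omega), mul_assoc, ← mul_assoc,
        descProd_mul_comm hc hm (by omega)]
      simp only [mul_assoc]
    · rw [descProd, mul_assoc, hc (m - d) (i + 1) (by omega) (by omega), ← mul_assoc,
        ih (by omega) (by omega), mul_assoc]

theorem exists_mul_descProd (hs : ∀ i, i + 1 < n → t i * t i = 1)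
    (hc : ∀ i j, i + 2 ≤ j → j + 1 < n → t i * t j = t j * t i)
    (hb : ∀ i, i + 2 < n → t (i + 1) * t i * t (i + 1) = t i * t (i + 1) * t i) {m : ℕ}
    (hm : m + 1 < n) {g : G} (hg : g ∈ Subgroup.closure (t '' Set.Iio (m + 1))) :
    ∃ h ∈ Subgroup.closure (t '' Set.Iio m), ∃ d ≤ m + 1, g = h * descProd t m d := by
  have key : ∀ x ∈ t '' Set.Iio (m + 1), ∀ y, (∃ h ∈ Subgroup.closure (t '' Set.Iio m),
      ∃ d ≤ m + 1, y = h * descProd t m d) → ∃ h ∈ Subgroup.closure (t '' Set.Iio m),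
      ∃ d ≤ m + 1, y * x = h * descProd t m d := by
    rintro _ ⟨i, hi, rfl⟩ _ ⟨h, hh, d, hd, rfl⟩
    rw [Set.mem_Iio] at hi
    have hmem {j : ℕ} (hj : j < m) : t j ∈ Subgroup.closure (t '' Set.Iio m) :=
      Subgroup.subset_closure ⟨j, hj, rfl⟩
    rcases lt_trichotomy (i + d) m with h1 | h1 | h1
    · exact ⟨h * t i, mul_mem hh (hmem (by omega)), d, hd, by
        rw [mul_assoc, descProd_mul_comm hc hm h1, mul_assoc]⟩
    · exact ⟨h, hh, d + 1, by omega, by rw [descProd, mul_assoc, show m - d = i by omega]⟩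
    · rcases eq_or_ne (i + d) (m + 1) with h2 | h2
      · obtain ⟨d, rfl⟩ : ∃ e, d = e + 1 := ⟨d - 1, by omega⟩
        exact ⟨h, hh, d, by omega, by
          rw [descProd, show m - d = i by omega, mul_assoc, mul_assoc, hs i (by omega), mul_one]⟩
      · obtain ⟨i, rfl⟩ : ∃ e, i = e + 1 := ⟨i - 1, by omega⟩
        exact ⟨h * t i, mul_mem hh (hmem (by omega)), d, hd, by
          rw [mul_assoc, descProd_mul_braid hc hb hm hd (by omega) (by omega), mul_assoc]⟩
  have hinv : ∀ x ∈ t '' Set.Iio (m + 1), x⁻¹ = x := by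
    rintro _ ⟨i, hi, rfl⟩
    rw [Set.mem_Iio] at hi
    exact inv_eq_of_mul_eq_one_left (hs i (by omega))
  induction hg using Subgroup.closure_induction_right with
  | one => exact ⟨1, one_mem _, 0, by omega, by simp [descProd]⟩
  | mul_right x hx y hy ih => exact key _ hy _ ih
  | mul_inv_cancel x hx y hy ih => rw [hinv y hy]; exact key _ hy _ ih

variable {f : G →* Perm (Fin n)}

theorem apply_descProd (hf : ∀ i (h : i + 1 < n), f (t i) = swap ⟨i, by omega⟩ ⟨i + 1, h⟩) {m : ℕ}
    (hm : m + 1 < n) {d : ℕ} (hd : d ≤ m + 1) :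
    f (descProd t m d) ⟨m + 1 - d, by omega⟩ = ⟨m + 1, hm⟩ := by
  induction d with
  | zero => simp [descProd]
  | succ d ih =>
    rw [descProd, map_mul, Perm.mul_apply, hf (m - d) (by omega)]
    convert ih (by omega) using 2
    convert swap_apply_left _ _ using 2
    · simp
    · omega

theorem apply_of_mem_closure (hf : ∀ i (h : i + 1 < n), f (t i) = swap ⟨i, by omega⟩ ⟨i + 1, h⟩)
    {m : ℕ} (hm : m + 1 < n) {g : G} (hg : g ∈ Subgroup.closure (t '' Set.Iio m)) :
    f g ⟨m + 1, hm⟩ = ⟨m + 1, hm⟩ := by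
  have : Subgroup.closure (t '' Set.Iio m) ≤
      (MulAction.stabilizer (Perm (Fin n)) (⟨m + 1, hm⟩ : Fin n)).comap f := by
    rw [Subgroup.closure_le]
    rintro _ ⟨i, hi, rfl⟩
    rw [Set.mem_Iio] at hi
    change f (t i) _ = _
    rw [hf i (by omega)]
    exact swap_apply_of_ne_of_ne (by simp; omega) (by simp; omega)
  exact this hg

/-- The Coxeter presentation of the symmetric group. -/
theorem eq_one_of_mem_closure (hs : ∀ i, i + 1 < n → t i * t i = 1)
    (hc : ∀ i j, i + 2 ≤ j → j + 1 < n → t i * t j = t j * t i)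
    (hb : ∀ i, i + 2 < n → t (i + 1) * t i * t (i + 1) = t i * t (i + 1) * t i)
    (hf : ∀ i (h : i + 1 < n), f (t i) = swap ⟨i, by omega⟩ ⟨i + 1, h⟩) {m : ℕ}
    (hm : m ≤ n - 1) {g : G} (hg : g ∈ Subgroup.closure (t '' Set.Iio m)) (h1 : f g = 1) : g = 1 := by
  induction m generalizing g with
  | zero => simpa using hg
  | succ m ih =>
    have hm' : m + 1 < n := by omega
    obtain ⟨h, hh, d, hd, rfl⟩ := exists_mul_descProd hs hc hb hm' hg
    have h2 := congrArg (fun σ : Perm (Fin n) => σ ⟨m + 1 - d, by omega⟩) h1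
    simp only [map_mul, Perm.mul_apply, apply_descProd hf hm' hd,
      apply_of_mem_closure hf hm' hh, Perm.one_apply, Fin.mk.injEq] at h2
    obtain rfl : d = 0 := by omega
    rw [descProd, mul_one] at h1 ⊢
    exact ih (by omega) hh h1

end coxeter

namespace Schur

variable {n : ℕ}

theorem z_mul_z : z n * z n = 1 := by
  have := PresentedGroup.one_of_mem (rels := rels n) (x := zf n ^ 2) (Or.inl rfl)
  rw [map_pow, pow_two] at this
  exact this

theorem t_mul_t (i : Fin (n - 1)) : t n i * t n i = z n := by
  have := PresentedGroup.one_of_mem (rels := rels n) (x := tf n i ^ 2 * (zf n)⁻¹)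
    (Or.inr (Or.inl ⟨i, rfl⟩))
  rw [map_mul, map_inv, mul_inv_eq_one, map_pow, pow_two] at this
  exact this

theorem t_mul_t_pow_three {i j : Fin (n - 1)} (h : (i : ℕ) + 1 = j) :
    (t n i * t n j) ^ 3 = z n := by
  have := PresentedGroup.one_of_mem (rels := rels n) (x := (tf n i * tf n j) ^ 3 * (zf n)⁻¹)
    (Or.inr (Or.inr (Or.inl ⟨i, j, h, rfl⟩)))
  rw [map_mul, map_inv, mul_inv_eq_one, map_pow, map_mul] at this
  exact this

theorem t_mul_t_sq {i j : Fin (n - 1)} (h : (i : ℕ) + 2 ≤ j) : (t n i * t n j) ^ 2 = z n := by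
  have := PresentedGroup.one_of_mem (rels := rels n) (x := (tf n i * tf n j) ^ 2 * (zf n)⁻¹)
    (Or.inr (Or.inr (Or.inr ⟨i, j, Or.inl h, rfl⟩)))
  rw [map_mul, map_inv, mul_inv_eq_one, map_pow, map_mul] at this
  exact this

theorem z_commute (g : Cover n) : Commute (z n) g := by
  have hg : g ∈ Subgroup.closure (Set.range (PresentedGroup.of (rels := rels n))) := by
    rw [PresentedGroup.closure_range_of]; trivial
  induction hg using Subgroup.closure_induction with
  | mem x hx =>
    obtain ⟨_ | i, rfl⟩ := hx
    · exact Commute.refl _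
    · change Commute _ (t n i)
      rw [← t_mul_t i]
      exact (Commute.refl _).mul_left (Commute.refl _)
  | one => exact Commute.one_right _
  | mul x y _ _ hx hy => exact hx.mul_right hy
  | inv x _ hx => exact hx.inv_right

theorem mem_zpowers_z {g : Cover n} : g ∈ Subgroup.zpowers (z n) ↔ g = 1 ∨ g = z n := by
  constructor
  · rintro ⟨m, rfl⟩
    rcases Int.even_or_odd' m with ⟨l, rfl | rfl⟩
    · left; simp [zpow_mul, pow_two, z_mul_z]
    · right; simp [zpow_add, zpow_mul, pow_two, z_mul_z]
  · rintro (rfl | rfl)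
    exacts [one_mem _, Subgroup.mem_zpowers _]

instance : (Subgroup.zpowers (z n)).Normal where
  conj_mem x hx g := by
    rcases mem_zpowers_z.1 hx with rfl | rfl
    · simp
    · rw [← (z_commute g).eq, mul_inv_cancel_right]
      exact hx

theorem t_mul_t_comm {i j : Fin (n - 1)} (h : (i : ℕ) + 2 ≤ j) :
    t n i * t n j = z n * (t n j * t n i) := by
  have h1 : t n i * t n j * (t n i * t n j) = z n := by rw [← pow_two, t_mul_t_sq h]
  have h2 : t n i * t n j * (t n j * t n i) = 1 := by
    rw [mul_assoc, ← mul_assoc (t n j), t_mul_t, (z_commute _).eq, ← mul_assoc, t_mul_t, z_mul_z]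
  rw [← mul_right_inj (t n i * t n j), h1, ← mul_assoc, ← (z_commute _).eq, mul_assoc, h2, mul_one]

theorem T_succ {i : ℕ} (h : i < n - 1) : T n (i + 1) = t n ⟨i, h⟩ := by
  simp [T, h]

variable {π : Cover n →* Perm (Fin n)} (hπt : ∀ i : Fin (n - 1), π (t n i) = adj n i)
  (hπz : π (z n) = 1)

include hπt hπz

theorem eq_one_or_eq_z {g : Cover n} (hg : π g = 1) : g = 1 ∨ g = z n := by
  have hz : ((z n : Cover n) : Cover n ⧸ Subgroup.zpowers (z n)) = 1 :=
    (QuotientGroup.eq_one_iff _).2 (Subgroup.mem_zpowers _)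
  let f : Cover n ⧸ Subgroup.zpowers (z n) →* Perm (Fin n) :=
    QuotientGroup.lift _ π (by rw [Subgroup.zpowers_le]; exact hπz)
  let s : ℕ → Cover n ⧸ Subgroup.zpowers (z n) := fun i => (T n (i + 1) : Cover n)
  have hs' {i : ℕ} (h : i + 1 < n) : s i = (t n ⟨i, by omega⟩ : Cover n) := by
    simp only [s]; rw [T_succ]
  have hs : ∀ i, i + 1 < n → s i * s i = 1 := fun i h => by
    rw [hs' h, ← QuotientGroup.mk_mul, t_mul_t, hz]
  rw [← mem_zpowers_z, ← QuotientGroup.eq_one_iff]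
  refine eq_one_of_mem_closure (n := n) (t := s) (f := f) (m := n - 1) hs ?_ ?_ ?_ le_rfl ?_ ?_
  · intro i j h hj
    have : (s i * s j) ^ 2 = 1 := by
      rw [hs' (by omega), hs' hj, ← QuotientGroup.mk_mul, ← QuotientGroup.mk_pow, t_mul_t_sq h, hz]
    rw [pow_two] at this
    rw [← mul_inv_eq_one, mul_inv_rev, inv_eq_of_mul_eq_one_left (hs i (by omega)),
      inv_eq_of_mul_eq_one_left (hs j hj), this]
  · intro i hi
    have : (s i * s (i + 1)) ^ 3 = 1 := by
      rw [hs' (by omega), hs' hi, ← QuotientGroup.mk_mul, ← QuotientGroup.mk_pow,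
        t_mul_t_pow_three rfl, hz]
    symm
    rw [← mul_inv_eq_one, mul_inv_rev, mul_inv_rev, inv_eq_of_mul_eq_one_left (hs i (by omega)),
      inv_eq_of_mul_eq_one_left (hs (i + 1) hi), ← this]
    simp only [pow_succ, pow_zero, one_mul, mul_assoc]
  · intro i hi
    rw [hs' hi]
    exact hπt _
  · have hle : (⊤ : Subgroup (Cover n)) ≤
        (Subgroup.closure (s '' Set.Iio (n - 1))).comap (QuotientGroup.mk' _) := by
      rw [← PresentedGroup.closure_range_of, Subgroup.closure_le]
      rintro _ ⟨_ | i, rfl⟩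
      · change ((z n : Cover n) : Cover n ⧸ Subgroup.zpowers (z n)) ∈
          Subgroup.closure (s '' Set.Iio (n - 1))
        rw [hz]
        exact one_mem _
      · exact Subgroup.subset_closure ⟨i, i.2, hs' (by omega)⟩
    exact hle trivial
  · exact hg

theorem eq_or_eq_z_mul {g h : Cover n} (hgh : π g = π h) : g = h ∨ g = z n * h := by
  have := eq_one_or_eq_z hπt hπz (g := g * h⁻¹) (by rw [map_mul, map_inv, hgh, mul_inv_cancel])
  rwa [mul_inv_eq_one, mul_inv_eq_iff_eq_mul] at this

omit hπz in
theorem surjective_of_apply_t : Function.Surjective π := by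
  rw [← MonoidHom.mrange_eq_top]
  rcases n with _ | m
  · exact Subsingleton.elim _ _
  rw [eq_top_iff, ← Perm.mclosure_swap_castSucc_succ, Submonoid.closure_le]
  rintro _ ⟨i, rfl⟩
  exact ⟨t _ i, hπt i⟩

theorem exists_lift (σ : Perm (Fin n)) :
    ∃ g, π g = σ ∧ (Odd (orderOf σ) → g ^ orderOf σ = 1) := by
  obtain ⟨g, rfl⟩ := surjective_of_apply_t hπt σ
  rcases eq_one_or_eq_z hπt hπz (g := g ^ orderOf (π g)) (by rw [map_pow, pow_orderOf_eq_one])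
    with h | h
  · exact ⟨g, rfl, fun _ => h⟩
  · refine ⟨z n * g, by rw [map_mul, hπz, one_mul], fun ⟨l, hl⟩ => ?_⟩
    rw [(z_commute g).mul_pow, h, ← pow_succ, hl, show 2 * l + 1 + 1 = 2 * (l + 1) by ring,
      pow_mul, pow_two, z_mul_z, one_pow]

variable {V : Type} [AddCommGroup V] [Module ℂ V] {ρ : Cover n →* End ℂ V}
  (hspin : ρ (z n) = -1)

include hspin

theorem signEq_of_apply_eq {g h : Cover n} (hgh : π g = π h) : SignEq (ρ g) (ρ h) := by
  rcases eq_or_eq_z_mul hπt hπz hgh with rfl | rfl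
  · exact SignEq.refl _
  · rw [map_mul, hspin, neg_one_mul]
    exact SignEq.neg _

omit hπz hspin in
theorem exists_mul_apply_t_mul_inv (hn : 8 < n) (x : Fin 4 ↪ Fin n) :
    ∃ g, π (g * t n ⟨0, by omega⟩ * g⁻¹) = swap (x 0) (x 1) ∧
      π (g * t n ⟨2, by omega⟩ * g⁻¹) = swap (x 2) (x 3) := by
  have := Perm.isMultiplyPretransitive (Fin n) 4
  obtain ⟨σ, hσ⟩ := MulAction.exists_smul_eq (Perm (Fin n)) (Fin.castLEEmb (by omega : 4 ≤ n)) x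
  obtain ⟨g, rfl⟩ := surjective_of_apply_t hπt σ
  refine ⟨g, ?_, ?_⟩
  · rw [map_mul, map_mul, map_inv, hπt, ← hσ, adj, ← swap_apply_apply]
    rfl
  · rw [map_mul, map_mul, map_inv, hπt, ← hσ, adj, ← swap_apply_apply]
    rfl

omit hπz in
theorem exists_apply_eq_swap (hn : 8 < n) {a b : Fin n} (h : a ≠ b) :
    ∃ g, π g = swap a b ∧ ρ g * ρ g = -1 := by
  obtain ⟨σ, hσ⟩ := isConj_iff.1 (Perm.isConj_swap (w := (⟨0, by omega⟩ : Fin n))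
    (x := ⟨0 + 1, by omega⟩) (by simp) h)
  obtain ⟨g, rfl⟩ := surjective_of_apply_t hπt σ
  refine ⟨g * t n ⟨0, by omega⟩ * g⁻¹, ?_, ?_⟩
  · rw [map_mul, map_mul, map_inv, hπt, adj, hσ]
  · rw [← map_mul, ← hspin, conj_mul, t_mul_t, ← (z_commute g).eq, mul_inv_cancel_right]

omit hπz in
theorem exists_apply_eq_swap_pair (hn : 8 < n) {a b c d : Fin n} (hab : a ≠ b) (hcd : c ≠ d)
    (hac : a ≠ c) (had : a ≠ d) (hbc : b ≠ c) (hbd : b ≠ d) :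
    ∃ g h, π g = swap a b ∧ π h = swap c d ∧ ρ g * ρ h = -(ρ h * ρ g) := by
  let x : Fin 4 ↪ Fin n := ⟨![a, b, c, d], by
    intro i j
    fin_cases i <;> fin_cases j <;> simp [*, Ne.symm]⟩
  obtain ⟨g, h1, h2⟩ := exists_mul_apply_t_mul_inv hπt hn x
  refine ⟨_, _, h1, h2, ?_⟩
  rw [← map_mul, ← map_mul, ← neg_one_mul, ← hspin, ← map_mul, conj_mul, conj_mul,
    t_mul_t_comm (by simp), ← mul_assoc g (z n), ← (z_commute g).eq]
  simp only [mul_assoc]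

omit hspin in
/-- The normalised operators of a spin representation. -/
noncomputable def liftOp (ρ : Cover n →* End ℂ V) (σ : Perm (Fin n)) : End ℂ V :=
  ρ (exists_lift hπt hπz σ).choose

theorem signEq_liftOp (g : Cover n) : SignEq (liftOp hπt hπz ρ (π g)) (ρ g) :=
  signEq_of_apply_eq hπt hπz hspin (exists_lift hπt hπz (π g)).choose_spec.1

/-- A spin representation of Schur's double cover, as a projective representation of the symmetric
group. -/
noncomputable def spinRep (hn : 8 < n) : SpinRep (Fin n) V where
  op := liftOp hπt hπz ρ
  op_one := by
    have h : ∀ x : Cover n, x ^ orderOf (1 : Perm (Fin n)) = 1 → x = 1 := by simp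
    rw [liftOp, h _ ((exists_lift hπt hπz 1).choose_spec.2 (by simp)), map_one]
  op_mul σ τ := by
    obtain ⟨g, rfl⟩ := surjective_of_apply_t hπt σ
    obtain ⟨h, rfl⟩ := surjective_of_apply_t hπt τ
    rw [← map_mul]
    refine (signEq_liftOp hπt hπz hspin _).trans ?_
    rw [map_mul]
    exact ((signEq_liftOp hπt hπz hspin _).mul (signEq_liftOp hπt hπz hspin _)).symm
  op_pow_orderOf σ h := by
    rw [liftOp, ← map_pow, (exists_lift hπt hπz σ).choose_spec.2 h, map_one]
  op_swap_sq a b h := by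
    obtain ⟨g, hg, hg'⟩ := exists_apply_eq_swap hπt hspin hn h
    rw [← hg]
    rcases (signEq_liftOp hπt hπz hspin g).or with h | h <;> rw [h] <;> simpa using hg'
  op_swap_anti a b c d hab hcd hac had hbc hbd := by
    obtain ⟨g, h, hg, hh, hgh⟩ := exists_apply_eq_swap_pair hπt hspin hn hab hcd hac had hbc hbd
    rw [← hg, ← hh]
    rcases (signEq_liftOp hπt hπz hspin g).or with h1 | h1 <;>
      rcases (signEq_liftOp hπt hπz hspin h).or with h2 | h2 <;> rw [h1, h2] <;> simp [hgh]

end Schur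

open Polynomial in
/-- An operator whose `k`-th power is a nonzero scalar `a` and which has all `k`-th roots of `a` as
eigenvalues has minimal polynomial `X ^ k - a`. -/
theorem minpoly_eq_of_hasEigenvalue {V : Type*} [AddCommGroup V] [Module ℂ V]
    [FiniteDimensional ℂ V] [Nontrivial V] {A : End ℂ V} {k : ℕ} (hk : k ≠ 0) {a : ℂ} (ha : a ≠ 0)
    (hA : A ^ k = a • (1 : End ℂ V)) (h : ∀ b : ℂ, b ^ k = a → A.HasEigenvalue b) :
    minpoly ℂ A = X ^ k - C a ∧ (spectrum ℂ A).ncard = k := by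
  have hsep : (X ^ k - C a : ℂ[X]).Separable := separable_X_pow_sub_C a (by exact_mod_cast hk) ha
  have hsplit : (X ^ k - C a : ℂ[X]).Splits := IsAlgClosed.splits _
  have hmon : (X ^ k - C a : ℂ[X]).Monic := monic_X_pow_sub_C a hk
  have hroot {b : ℂ} : b ∈ (X ^ k - C a : ℂ[X]).roots ↔ b ^ k = a := by
    simp [mem_roots hmon.ne_zero, sub_eq_zero]
  have hAint : IsIntegral ℂ A := Algebra.IsIntegral.isIntegral A
  have h1 : minpoly ℂ A ∣ X ^ k - C a := by
    refine minpoly.dvd _ _ ?_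
    simp [hA, Algebra.algebraMap_eq_smul_one]
  have h2 : X ^ k - C a ∣ minpoly ℂ A := by
    rw [hsplit.dvd_iff_roots_le_roots hmon.ne_zero (minpoly.ne_zero hAint),
      Multiset.le_iff_subset (nodup_roots hsep)]
    intro b hb
    rw [mem_roots (minpoly.ne_zero hAint)]
    exact End.isRoot_of_hasEigenvalue (h b (hroot.1 hb))
  have heq := eq_of_monic_of_associated (minpoly.monic hAint) hmon (associated_of_dvd_dvd h1 h2)
  refine ⟨heq, ?_⟩
  have h3 : spectrum ℂ A = ((X ^ k - C a : ℂ[X]).roots.toFinset : Set ℂ) := by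
    ext b
    rw [← End.hasEigenvalue_iff_mem_spectrum, End.hasEigenvalue_iff_isRoot, heq, Finset.mem_coe,
      Multiset.mem_toFinset, mem_roots hmon.ne_zero]
  rw [h3, Set.ncard_coe_finset, Multiset.toFinset_card_of_nodup (nodup_roots hsep),
    ← hsplit.natDegree_eq_card_roots, natDegree_X_pow_sub_C]

open Schur Polynomial in
/-- Theorem (main theorem for `S̃_n`, generic case): for `n > 8` and `g ∈ S̃_n` such that
neither 3 nor 5 is a solitary part of the cycle type of `π(g)`, the minimal polynomial of
`ρ(g)` in every irreducible spin representation `(ρ, V)` of `S̃_n` is `X^k − ε_g`, where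
`k` is the order of `π(g)`; in particular `ρ(g)` has exactly `k` distinct eigenvalues. -/
theorem schur_minpoly_generic (n : ℕ) (hn : 8 < n)
    (π : Cover n →* Equiv.Perm (Fin n))
    (hπt : ∀ i : Fin (n - 1), π (t n i) = adj n i)
    (hπz : π (z n) = 1)
    (g : Cover n) (k : ℕ) (hk : k = orderOf (π g))
    (h3 : ¬ SolitaryPart 3 (π g)) (h5 : ¬ SolitaryPart 5 (π g))
    (V : Type) [AddCommGroup V] [Module ℂ V] [FiniteDimensional ℂ V] [Nontrivial V]
    (ρ : Cover n →* Module.End ℂ V)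
    (hirr : ∀ U : Submodule ℂ V, (∀ h : Cover n, U.map (ρ h) ≤ U) → U = ⊥ ∨ U = ⊤)
    (hspin : ρ (z n) = -1)
    (ε : ℂ) (hε : (g ^ k = 1 ∧ ε = 1) ∨ (g ^ k = z n ∧ ε = -1)) :
    minpoly ℂ (ρ g) = X ^ k - C ε ∧ (spectrum ℂ (ρ g)).ncard = k := by
  rw [SolitaryPart, Perm.filter_dvd_parts _ (by norm_num)] at h3 h5
  have hA : ρ g ^ k = ε • (1 : End ℂ V) := by
    rw [← map_pow]
    rcases hε with ⟨h, rfl⟩ | ⟨h, rfl⟩ <;> simp [h, hspin]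
  have hspec : FullSpec (ρ g) k := by
    rw [hk]
    exact (good_of_nine_le_card h3 h5 (by rwa [Fintype.card_fin]) V (spinRep hπt hπz hspin hn)).signEq
      (signEq_liftOp hπt hπz hspin g).symm
  refine minpoly_eq_of_hasEigenvalue ?_ ?_ hA fun b hb => hspec b (by rw [hA, hb])
  · rw [hk]
    exact (orderOf_pos _).ne'
  · rcases hε with ⟨_, rfl⟩ | ⟨_, rfl⟩ <;> simp
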